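/- Let p > 5 be a prime with p ≡ 3 (mod 4), F = ℚ(√p), and H the totally definite quaternion F-algebra that is unramified at all finite places of F (i.e. H ⊗_F F_v ≅ M₂(F_v) for every finite place v). Then t(H, D₃) = t(H, D₄) = t(H, S₄) = 1, and t(H, G) = 0 for every finite group G not belonging to {S₄, D₄, D₃, C₄, C₃, C₂, C₁}. -/

import Mathlib

open NumberField Quaternion

noncomputable section

namespace QuatPaper

variable (F : Type) [Field F] [NumberField F]

def scalarSet (H : Type) [Ring H] [Algebra F H] : Set H :=
  Set.range fun r : 𝓞 F => algebraMap F H (algebraMap (𝓞 F) F r)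

def IsOrder {H : Type} [Ring H] [Algebra F H] (O : Subring H) : Prop :=
  scalarSet F H ⊆ ↑O ∧ O.toAddSubgroup.FG ∧ Submodule.span F (O : Set H) = ⊤

def IsMaximalOrder {H : Type} [Ring H] [Algebra F H] (O : Subring H) : Prop :=
  IsOrder F O ∧ ∀ O' : Subring H, IsOrder F O' → O ≤ O' → O' = O

def IsScalarUnit {H : Type} [Ring H] [Algebra F H] {O : Subring H} (u : (↥O)ˣ) : Prop :=
  ∃ r : (𝓞 F)ˣ, ((u : ↥O) : H) = algebraMap F H (algebraMap (𝓞 F) F ↑r)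

def RedUnitIso {H : Type} [Ring H] [Algebra F H] (O : Subring H) (G : Type*) [Group G] : Prop :=
  ∃ φ : (↥O)ˣ →* G, Function.Surjective φ ∧ ∀ u, φ u = 1 ↔ IsScalarUnit F u

def IsConjugate {H : Type} [Ring H] (x : Hˣ) (O O' : Subring H) : Prop :=
  ∀ y : H, y ∈ O ↔ (x : H) * y * ((x⁻¹ : Hˣ) : H) ∈ O'

def ConjRel {H : Type} [Ring H] (O O' : Subring H) : Prop :=
  ∃ x : Hˣ, IsConjugate x O O'

def typeNum (H : Type) [Ring H] [Algebra F H] (G : Type*) [Group G] : ℕ :=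
  Nat.card (Quot fun O O' : {O : Subring H // IsMaximalOrder F O ∧ RedUnitIso F O G} =>
    ConjRel O.1 O'.1)

def IsQuatAlg (H : Type) [Ring H] [Algebra F H] : Prop :=
  ∃ a b : F, a ≠ 0 ∧ b ≠ 0 ∧ Nonempty (H ≃ₐ[F] ℍ[F, a, b])

def TotallyDefinite (H : Type) [Ring H] [Algebra F H] : Prop :=
  ∀ σ : F →+* ℝ,
    letI : Algebra F ℝ := σ.toAlgebra
    ∀ x : TensorProduct F ℝ H, x ≠ 0 → IsUnit x

section Metabolic

variable {K : Type} [Field K] {ι κ : Type} [Fintype ι] [Fintype κ]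

/-- The diagonal bilinear form with coefficients `a`. -/
def diagForm (a : ι → K) : LinearMap.BilinForm K (ι → K) :=
  LinearMap.mk₂ K (fun x y => ∑ i, a i * x i * y i)
    (fun x y z => by simp only [Pi.add_apply, mul_add, add_mul, Finset.sum_add_distrib])
    (fun c x y => by
      simp only [Pi.smul_apply, smul_eq_mul, Finset.mul_sum]
      exact Finset.sum_congr rfl fun i _ => by ring)
    (fun x y z => by simp only [Pi.add_apply, mul_add, Finset.sum_add_distrib])
    (fun c x y => by
      simp only [Pi.smul_apply, smul_eq_mul, Finset.mul_sum]
      exact Finset.sum_congr rfl fun i _ => by ring)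

lemma diagForm_apply (a : ι → K) (x y : ι → K) : diagForm a x y = ∑ i, a i * x i * y i := rfl

lemma diagForm_isRefl (a : ι → K) : (diagForm a).IsRefl := fun x y h => by
  rw [diagForm_apply] at h ⊢; rw [← h]; exact Finset.sum_congr rfl fun i _ => by ring

lemma diagForm_nondegenerate [DecidableEq ι] (a : ι → K) (ha : ∀ i, a i ≠ 0) :
    (diagForm a).Nondegenerate := by
  refine (diagForm_isRefl a).nondegenerate_iff_separatingLeft.mpr fun x hx => ?_
  ext i
  have := hx (Pi.single i 1)
  rw [diagForm_apply, Finset.sum_eq_single i] at this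
  · simpa [ha i] using this
  · intro j _ hj; simp [hj]
  · simp

/-- The diagonal form `a` has a totally isotropic subspace of at least half the dimension. -/
def Met (a : ι → K) : Prop :=
  ∃ N : Submodule K (ι → K), (∀ x ∈ N, ∀ y ∈ N, diagForm a x y = 0) ∧
    Fintype.card ι ≤ 2 * Module.finrank K N

lemma Met.of_injective {V : Type} [AddCommGroup V] [Module K V] (a : ι → K)
    (f : V →ₗ[K] (ι → K)) (hf : Function.Injective f)
    (h : ∀ x y, diagForm a (f x) (f y) = 0) (hc : Fintype.card ι ≤ 2 * Module.finrank K V) :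
    Met a := by
  refine ⟨LinearMap.range f, ?_, ?_⟩
  · rintro _ ⟨x, rfl⟩ _ ⟨y, rfl⟩; exact h x y
  · rwa [LinearMap.finrank_range_of_inj hf]

lemma Met.reindex {a : ι → K} (h : Met a) (e : κ ≃ ι) : Met (a ∘ e) := by
  obtain ⟨N, hN, hc⟩ := h
  refine Met.of_injective (V := N) _ ((LinearMap.funLeft K K e).comp N.subtype) ?_ ?_ ?_
  · rw [LinearMap.coe_comp]
    exact (LinearMap.funLeft_injective_of_surjective K K e e.surjective).comp N.subtype_injective
  · intro x y
    rw [← hN x x.2 y y.2, diagForm_apply, diagForm_apply]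
    exact Equiv.sum_comp e (fun i => a i * x.1 i * y.1 i)
  · rwa [Fintype.card_congr e]

lemma Met.add {a : ι → K} {b : κ → K} (ha : Met a) (hb : Met b) : Met (Sum.elim a b) := by
  obtain ⟨N, hN, hc⟩ := ha
  obtain ⟨M, hM, hd⟩ := hb
  refine Met.of_injective (V := N × M) _
    ((LinearEquiv.sumArrowLequivProdArrow ι κ K K).symm.toLinearMap.comp
      (N.subtype.prodMap M.subtype)) ?_ ?_ ?_
  · rw [LinearMap.coe_comp]
    exact (LinearEquiv.injective _).comp
      (Function.Injective.prodMap N.subtype_injective M.subtype_injective)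
  · rintro ⟨x, x'⟩ ⟨y, y'⟩
    have h1 := hN x x.2 y y.2
    have h2 := hM x' x'.2 y' y'.2
    rw [diagForm_apply] at h1 h2 ⊢
    rw [Fintype.sum_sum_type]
    simpa [h1] using h2
  · rw [Module.finrank_prod, Fintype.card_sum]; omega

lemma Met.self_neg (a : ι → K) : Met (Sum.elim a (-a)) := by
  refine Met.of_injective (V := ι → K) _
    ((LinearEquiv.sumArrowLequivProdArrow ι ι K K).symm.toLinearMap.comp
      (LinearMap.id.prod LinearMap.id)) ?_ ?_ ?_
  · rw [LinearMap.coe_comp]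
    exact (LinearEquiv.injective _).comp fun x y h => (Prod.ext_iff.mp h).1
  · intro x y
    rw [diagForm_apply, Fintype.sum_sum_type]
    simp
  · rw [Module.finrank_fintype_fun_eq_card, Fintype.card_sum]; omega

lemma Met.cancel {a : ι → K} {b : κ → K} (ha0 : ∀ i, a i ≠ 0) (hb0 : ∀ i, b i ≠ 0)
    (ha : Met a) (hab : Met (Sum.elim a b)) : Met b := by
  classical
  obtain ⟨L, hL, hLc⟩ := ha
  obtain ⟨N, hN, hNc⟩ := hab
  have nda := diagForm_nondegenerate a ha0
  have ndab := diagForm_nondegenerate (Sum.elim a b) (by rintro (i | i); exacts [ha0 i, hb0 i])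
  set Φ := LinearEquiv.sumArrowLequivProdArrow ι κ K K with hΦ
  let L' : Submodule K (ι ⊕ κ → K) :=
    L.map (Φ.symm.toLinearMap.comp (LinearMap.inl K (ι → K) (κ → K)))
  let π : (ι ⊕ κ → K) →ₗ[K] (ι → K) := (LinearMap.fst K _ _).comp Φ.toLinearMap
  let ρ : (ι ⊕ κ → K) →ₗ[K] (κ → K) := (LinearMap.snd K _ _).comp Φ.toLinearMap
  have split : ∀ x y, diagForm (Sum.elim a b) x y = diagForm a (π x) (π y) + diagForm b (ρ x) (ρ y) := by
    intro x y
    rw [diagForm_apply, Fintype.sum_sum_type]; rfl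
  have hLd : Module.finrank K L' = Module.finrank K L := by
    apply LinearEquiv.finrank_eq
    exact (Submodule.equivMapOfInjective _ (by
      rw [LinearMap.coe_comp]
      exact (LinearEquiv.injective _).comp LinearMap.inl_injective) L).symm
  have hNN : N = (diagForm (Sum.elim a b)).orthogonal N := by
    apply Submodule.eq_of_le_of_finrank_le
    · intro x hx y hy; exact hN y hy x hx
    · rw [LinearMap.BilinForm.finrank_orthogonal ndab,
        Module.finrank_fintype_fun_eq_card]
      omega
  have hLL : L = (diagForm a).orthogonal L := by
    apply Submodule.eq_of_le_of_finrank_le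
    · intro x hx y hy; exact hL y hy x hx
    · rw [LinearMap.BilinForm.finrank_orthogonal nda,
        Module.finrank_fintype_fun_eq_card]
      omega
  set P := (diagForm (Sum.elim a b)).orthogonal (N ⊔ L') with hP
  have hPN : ∀ x ∈ P, x ∈ N := by
    intro x hx
    rw [hNN]
    intro y hy
    exact hx y (Submodule.mem_sup_left hy)
  have hPL : ∀ x ∈ P, π x ∈ L := by
    intro x hx
    rw [hLL]
    intro y hy
    have : diagForm (Sum.elim a b) (Φ.symm (y, 0)) x = 0 := hx (Φ.symm (y, 0)) (Submodule.mem_sup_right ⟨y, hy, rfl⟩)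
    rw [split] at this
    change diagForm a y (π x) = 0
    simpa [π, ρ] using this
  have hPd : Module.finrank K P = Fintype.card ι + Fintype.card κ -
      Module.finrank K (N ⊔ L' : Submodule K _) := by
    rw [hP, LinearMap.BilinForm.finrank_orthogonal ndab,
        Module.finrank_fintype_fun_eq_card, Fintype.card_sum]
  have hsum := Submodule.finrank_sup_add_finrank_inf_eq N L'
  have hrn := LinearMap.finrank_range_add_finrank_ker (ρ.domRestrict P)
  have hker : Module.finrank K (LinearMap.ker (ρ.domRestrict P)) ≤
      Module.finrank K (N ⊓ L' : Submodule K _) := by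
    rw [LinearEquiv.finrank_eq (Submodule.equivMapOfInjective _ P.subtype_injective _)]
    apply Submodule.finrank_mono
    rintro _ ⟨⟨x, hx⟩, hx', rfl⟩
    refine ⟨hPN x hx, π x, hPL x hx, ?_⟩
    have : ρ x = 0 := by simpa using hx'
    apply Φ.injective
    simp only [LinearMap.comp_apply, LinearEquiv.coe_coe, LinearEquiv.apply_symm_apply]
    exact Prod.ext rfl this.symm
  refine ⟨LinearMap.range (ρ.domRestrict P), ?_, ?_⟩
  · rintro _ ⟨⟨x, hx⟩, rfl⟩ _ ⟨⟨y, hy⟩, rfl⟩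
    have h1 := hN x (hPN x hx) y (hPN y hy)
    rw [split, hL _ (hPL x hx) _ (hPL y hy), zero_add] at h1
    exact h1
  · have : Module.finrank K L + Module.finrank K L ≤ Fintype.card ι := by
      have : Module.finrank K L = Module.finrank K ((diagForm a).orthogonal L) := by
        rw [← hLL]
      rw [LinearMap.BilinForm.finrank_orthogonal nda,
        Module.finrank_fintype_fun_eq_card] at this
      have h3 : Module.finrank K L ≤ Fintype.card ι := by grind
      omega
    have : Module.finrank K N + Module.finrank K N ≤ Fintype.card (ι ⊕ κ) := by
      have := congrArg (fun S : Submodule K (ι ⊕ κ → K) => Module.finrank K S) hNN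
      simp only [LinearMap.BilinForm.finrank_orthogonal ndab,
        Module.finrank_fintype_fun_eq_card] at this
      have h3 : Module.finrank K N ≤ Fintype.card (ι ⊕ κ) := by grind
      omega
    rw [Fintype.card_sum] at hNc this
    omega

end Metabolic

section WittPresentation

/-- Functions on a field satisfying the defining relations of the Witt group (extended by zero). -/
structure IsWitt {K M : Type} [Field K] [AddCommGroup M] (g : K → M) : Prop where
  zero : g 0 = 0
  sq : ∀ a b, b ≠ 0 → g (a * b ^ 2) = g a
  add : ∀ a b, g a + g b = g (a + b) + g (a * b * (a + b))

/-- The relations of the Witt group in the free abelian group on `K`. -/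
def wittRel (K : Type) [Field K] : Set (K →₀ ℤ) :=
  {f | f = Finsupp.single 0 1 ∨
    (∃ a b : K, b ≠ 0 ∧ f = Finsupp.single (a * b ^ 2) 1 - Finsupp.single a 1) ∨
    ∃ a b : K, f = Finsupp.single a 1 + Finsupp.single b 1 -
      (Finsupp.single (a + b) 1 + Finsupp.single (a * b * (a + b)) 1)}

/-- The Witt group of `K`, given by generators and relations. -/
abbrev WP (K : Type) [Field K] : Type := (K →₀ ℤ) ⧸ AddSubgroup.closure (wittRel K)

variable {K L M : Type} [Field K] [Field L] [AddCommGroup M]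

/-- The class of the one-dimensional form `a x ^ 2`. -/
def wp (a : K) : WP K := QuotientAddGroup.mk (Finsupp.single a 1)

lemma wp_isWitt : IsWitt (wp : K → WP K) where
  zero := (QuotientAddGroup.eq_zero_iff _).mpr (AddSubgroup.subset_closure (Or.inl rfl))
  sq a b hb := by
    rw [← sub_eq_zero]
    exact (QuotientAddGroup.eq_zero_iff _).mpr
      (AddSubgroup.subset_closure (Or.inr (Or.inl ⟨a, b, hb, rfl⟩)))
  add a b := by
    rw [← sub_eq_zero]
    exact (QuotientAddGroup.eq_zero_iff _).mpr
      (AddSubgroup.subset_closure (Or.inr (Or.inr ⟨a, b, rfl⟩)))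

lemma IsWitt.neg {g : K → M} (hg : IsWitt g) (a : K) : g (-a) = -g a := by
  have := hg.add a (-a)
  simp only [add_neg_cancel, mul_zero, hg.zero, add_zero] at this
  grind

/-- The homomorphism on the Witt group induced by a function satisfying its relations. -/
def wlift (g : K → M) (hg : IsWitt g) : WP K →+ M :=
  QuotientAddGroup.lift _ (Finsupp.liftAddHom fun a => (zmultiplesHom M) (g a)) <| by
    rw [AddSubgroup.closure_le]
    rintro f (rfl | ⟨a, b, hb, rfl⟩ | ⟨a, b, rfl⟩)
    · simp [hg.zero]
    · rw [SetLike.mem_coe, AddMonoidHom.mem_ker, map_sub]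
      simp [hg.sq a b hb]
    · rw [SetLike.mem_coe, AddMonoidHom.mem_ker, map_sub, map_add, map_add]
      simp [hg.add a b]

@[simp] lemma wlift_wp (g : K → M) (hg : IsWitt g) (a : K) : wlift g hg (wp a) = g a := by
  simp [wlift, wp]

lemma closure_range_wp : AddSubgroup.closure (Set.range (wp : K → WP K)) = ⊤ := by
  rw [eq_top_iff]
  rintro ⟨f⟩ -
  change QuotientAddGroup.mk f ∈ _
  induction f using Finsupp.induction_linear with
  | zero => exact AddSubgroup.zero_mem _
  | add f g hf hg => exact AddSubgroup.add_mem _ hf hg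
  | single a n =>
    have : (QuotientAddGroup.mk (Finsupp.single a n) : WP K) = n • wp a := by
      rw [wp, ← QuotientAddGroup.mk_zsmul, Finsupp.smul_single, smul_eq_mul, mul_one]
    rw [this]
    exact AddSubgroup.zsmul_mem _ (AddSubgroup.subset_closure (Set.mem_range_self a)) n

lemma IsWitt.scale {g : K → M} (hg : IsWitt g) {c : K} (hc : c ≠ 0) :
    IsWitt (fun a => g (c * a)) where
  zero := by rw [mul_zero, hg.zero]
  sq a b hb := by rw [← mul_assoc, hg.sq _ b hb]
  add a b := by
    rw [hg.add, ← hg.sq (c * (a * b * (a + b))) c hc]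
    congr 2 <;> ring

lemma IsWitt.map {g : L → M} (hg : IsWitt g) (φ : K →+* L) : IsWitt (fun a => g (φ a)) where
  zero := by rw [map_zero, hg.zero]
  sq a b hb := by
    rw [map_mul, map_pow, hg.sq _ _ ((map_ne_zero φ).mpr hb)]
  add a b := by rw [hg.add, map_mul, map_mul, map_add]

section
variable {ι κ : Type} [Fintype ι] [Fintype κ]

lemma Met.neg {a : ι → K} (h : Met a) : Met (-a) := by
  obtain ⟨N, hN, hc⟩ := h
  refine ⟨N, fun x hx y hy => ?_, hc⟩
  have := hN x hx y hy
  rw [diagForm_apply] at this ⊢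
  simp [this]

lemma Met.of_isEmpty [IsEmpty ι] (a : ι → K) : Met a :=
  ⟨⊥, fun x hx y _ => by simp [(Submodule.mem_bot K).mp hx], by simp⟩

end

/-- The combinations of generators that are visibly differences of forms that become
isometric after adding a metabolic form. -/
def IsMetabolicDiff (f : K →₀ ℤ) : Prop :=
  ∃ (n : ℤ) (ι κ : Type) (_ : Fintype ι) (_ : Fintype κ) (a : ι → K) (b : κ → K),
    (∀ i, a i ≠ 0) ∧ (∀ i, b i ≠ 0) ∧
    f = Finsupp.single 0 n + ∑ i, Finsupp.single (a i) 1 - ∑ i, Finsupp.single (b i) 1 ∧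
    Met (Sum.elim a (-b))

lemma met_pair (a b : K) :
    Met (Sum.elim (fun _ : Unit => a * b ^ 2) (-fun _ : Unit => a)) := by
  refine Met.of_injective (V := K) _
    (LinearMap.pi (Sum.elim (fun _ => LinearMap.id) fun _ => LinearMap.lsmul K K b)) ?_ ?_ ?_
  · intro x y h; simpa using congrFun h (Sum.inl ())
  · intro x y
    rw [diagForm_apply]
    simp only [Fintype.sum_sum_type, Finset.univ_unique, Finset.sum_singleton, Sum.elim_inl,
      Sum.elim_inr, LinearMap.pi_apply, LinearMap.id_apply, Pi.neg_apply, LinearMap.lsmul_apply,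
      smul_eq_mul]
    ring
  · simp

lemma met_quad {a b : K} :
    Met (Sum.elim ![a, b] (-![a + b, a * b * (a + b)])) := by
  refine Met.of_injective (V := K × K) _
    (LinearMap.pi (Sum.elim
      ![LinearMap.fst K K K + LinearMap.lsmul K _ b (LinearMap.snd K K K),
        LinearMap.fst K K K - LinearMap.lsmul K _ a (LinearMap.snd K K K)]
      ![LinearMap.fst K K K, LinearMap.snd K K K])) ?_ ?_ ?_
  · intro x y h
    have h1 := congrFun h (Sum.inr 0)
    have h2 := congrFun h (Sum.inr 1)
    exact Prod.ext (by simpa using h1) (by simpa using h2)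
  · intro x y
    rw [diagForm_apply]
    simp [Fintype.sum_sum_type, Fin.sum_univ_two]
    ring
  · simp

lemma IsMetabolicDiff.neg {f : K →₀ ℤ} (hf : IsMetabolicDiff f) : IsMetabolicDiff (-f) := by
  obtain ⟨n, ι, κ, _, _, a, b, ha, hb, rfl, h⟩ := hf
  refine ⟨-n, κ, ι, inferInstance, inferInstance, b, a, hb, ha, ?_, ?_⟩
  · rw [Finsupp.single_neg]; abel
  · convert h.neg.reindex (Equiv.sumComm κ ι) using 1
    ext (i | i) <;> simp

lemma IsMetabolicDiff.add {f g : K →₀ ℤ} (hf : IsMetabolicDiff f) (hg : IsMetabolicDiff g) :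
    IsMetabolicDiff (f + g) := by
  obtain ⟨n, ι, κ, _, _, a, b, ha, hb, rfl, h⟩ := hf
  obtain ⟨n', ι', κ', _, _, a', b', ha', hb', rfl, h'⟩ := hg
  refine ⟨n + n', ι ⊕ ι', κ ⊕ κ', inferInstance, inferInstance, Sum.elim a a', Sum.elim b b',
    ?_, ?_, ?_, ?_⟩
  · grind
  · grind
  · simp only [Finsupp.single_add, Fintype.sum_sum_type, Sum.elim_inl, Sum.elim_inr]; abel
  · convert (h.add h').reindex (Equiv.sumSumSumComm ι ι' κ κ') using 1
    ext ((i | i) | (i | i)) <;> simp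

lemma isMetabolicDiff_of_mem_closure {f : K →₀ ℤ} (hf : f ∈ AddSubgroup.closure (wittRel K)) :
    IsMetabolicDiff f := by
  have h0 : ∀ n : ℤ, IsMetabolicDiff (Finsupp.single (0 : K) n) := fun n =>
    ⟨n, Empty, Empty, inferInstance, inferInstance, Empty.elim, Empty.elim, fun i => i.elim,
      fun i => i.elim, by simp, Met.of_isEmpty _⟩
  induction hf using AddSubgroup.closure_induction with
  | zero => simpa using h0 0
  | add f g _ _ hf hg => exact hf.add hg
  | neg f _ hf => exact hf.neg
  | mem f hf =>
    rcases hf with rfl | ⟨a, b, hb, rfl⟩ | ⟨a, b, rfl⟩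
    · exact h0 1
    · by_cases ha : a = 0
      · simpa [ha] using h0 0
      · exact ⟨0, Unit, Unit, inferInstance, inferInstance, fun _ => a * b ^ 2, fun _ => a,
          fun _ => mul_ne_zero ha (pow_ne_zero 2 hb), fun _ => ha, by simp, met_pair a b⟩
    · by_cases ha : a = 0
      · convert h0 0 using 1
        rw [ha, zero_mul, zero_mul, zero_add, Finsupp.single_zero, add_comm, sub_self]
      by_cases hb : b = 0
      · convert h0 0 using 1
        rw [hb, mul_zero, zero_mul, add_zero, Finsupp.single_zero, sub_self]
      by_cases hab : a + b = 0
      · obtain rfl : b = -a := by linear_combination hab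
        have : IsMetabolicDiff (Finsupp.single a 1 + Finsupp.single (-a) 1 : K →₀ ℤ) := by
          refine ⟨0, Unit ⊕ Unit, Empty, inferInstance, inferInstance,
            Sum.elim (fun _ => a) (-fun _ => a), Empty.elim, ?_, fun i => i.elim, ?_, ?_⟩
          · rintro (i | i) <;> simpa
          · simp
          · exact (Met.self_neg _).add (Met.of_isEmpty _)
        convert this.add (h0 (-2)) using 1
        rw [hab, mul_zero, sub_eq_add_neg, ← Finsupp.single_add, ← Finsupp.single_neg]
        norm_num
      · refine ⟨0, Fin 2, Fin 2, inferInstance, inferInstance, ![a, b],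
          ![a + b, a * b * (a + b)], ?_, ?_, ?_, met_quad⟩
        · rw [Fin.forall_fin_two]; exact ⟨ha, hb⟩
        · rw [Fin.forall_fin_two]; exact ⟨hab, mul_ne_zero (mul_ne_zero ha hb) hab⟩
        · simp [Fin.sum_univ_two]

omit [Field K] in
lemma sum_single_apply {ι : Type} [Fintype ι] (a : ι → K) (u : K) :
    (∑ i, Finsupp.single (a i) (1 : ℤ)) u = Nat.card {i // a i = u} := by
  classical
  rw [Finsupp.finsetSum_apply, Nat.card_eq_fintype_card, Fintype.card_subtype,
    Finset.card_eq_sum_ones, Finset.sum_filter]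
  push_cast
  grind

/-- A diagonal form whose class in the Witt group vanishes is metabolic. -/
theorem met_of_sum_wp_eq_zero {ι : Type} [Fintype ι] (a : ι → K) (ha : ∀ i, a i ≠ 0)
    (h : ∑ i, wp (a i) = 0) : Met a := by
  have h1 : (∑ i, Finsupp.single (a i) 1 : K →₀ ℤ) ∈ AddSubgroup.closure (wittRel K) := by
    rw [← QuotientAddGroup.eq_zero_iff, ← h]
    exact map_sum (QuotientAddGroup.mk' _) _ _
  obtain ⟨n, κ, μ, _, _, b, c, hb, hc, he, hm⟩ := isMetabolicDiff_of_mem_closure h1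
  classical
  have key : ∀ u : K, Nonempty ({i // Sum.elim a c i = u} ≃ {i // b i = u}) := by
    intro u
    have h2 := DFunLike.congr_fun he u
    rw [Finsupp.sub_apply, Finsupp.add_apply, sum_single_apply, sum_single_apply,
      sum_single_apply] at h2
    apply Finite.card_eq.mp
    rw [Nat.card_congr (Equiv.subtypeSum), Nat.card_sum]
    by_cases hu : u = 0
    · subst hu
      simp [ha, hb, hc]
    · rw [Finsupp.single_apply, if_neg (Ne.symm hu)] at h2
      simp only [Sum.elim_inl, Sum.elim_inr]
      omega
  let e : ι ⊕ μ ≃ κ := Equiv.ofFiberEquiv fun u => (key u).some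
  have hbe : ∀ x, b (e x) = Sum.elim a c x := Equiv.ofFiberEquiv_map _
  have hm2 : Met (Sum.elim (Sum.elim c (-c)) a) := by
    have h3 := hm.reindex (((Equiv.sumComm (μ ⊕ μ) ι).trans
      (Equiv.sumAssoc ι μ μ).symm).trans (Equiv.sumCongr e (Equiv.refl μ)))
    convert h3 using 1
    ext ((i | i) | i) <;> simp [hbe]
  exact Met.cancel (by rintro (i | i) <;> simp [hc]) ha (Met.self_neg c) hm2

end WittPresentation

section Residue

variable (l : ℕ) [hl : Fact l.Prime]

lemma toZMod_ne_zero_iff (u : ℤ_[l]) : PadicInt.toZMod u ≠ 0 ↔ ‖u‖ = 1 := by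
  rw [← PadicInt.isUnit_iff, ← not_iff_not, not_not, ← RingHom.mem_ker, PadicInt.ker_toZMod,
    IsLocalRing.mem_maximalIdeal, mem_nonunits_iff]

lemma norm_mul_zpow_neg_valuation {x : ℚ_[l]} (hx : x ≠ 0) :
    ‖x * (l : ℚ_[l]) ^ (-x.valuation)‖ = 1 := by
  have : (l : ℝ) ≠ 0 := mod_cast hl.out.ne_zero
  rw [norm_mul, norm_zpow, Padic.norm_p, Padic.norm_eq_zpow_neg_valuation hx, inv_zpow, zpow_neg,
    inv_inv, inv_mul_cancel₀ (zpow_ne_zero _ this)]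

/-- The residue of the unit part of a nonzero `l`-adic number. -/
def lead (x : ℚ_[l]) : ZMod l :=
  PadicInt.toZMod ⟨x * (l : ℚ_[l]) ^ (-x.valuation), by
    by_cases hx : x = 0
    · simp [hx]
    · exact (norm_mul_zpow_neg_valuation l hx).le⟩

lemma lead_zero : lead l 0 = 0 := by
  rw [lead, ← map_zero PadicInt.toZMod]
  congr 1
  exact Subtype.ext (by simp)

variable {l}

lemma exists_eq_zpow_mul {x : ℚ_[l]} (hx : x ≠ 0) :
    ∃ u : ℤ_[l], x = (l : ℚ_[l]) ^ x.valuation * u ∧ PadicInt.toZMod u ≠ 0 ∧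
      lead l x = PadicInt.toZMod u := by
  have h0 : (l : ℚ_[l]) ≠ 0 := mod_cast hl.out.ne_zero
  have := norm_mul_zpow_neg_valuation l hx
  refine ⟨(⟨_, this.le⟩ : ℤ_[l]), ?_, ?_, rfl⟩
  · rw [mul_comm, mul_assoc, ← zpow_add₀ h0]; simp
  · exact (toZMod_ne_zero_iff l _).mpr this

lemma valuation_lead_of_eq (n : ℤ) (u : ℤ_[l]) (hu : PadicInt.toZMod u ≠ 0) :
    ((l : ℚ_[l]) ^ n * u).valuation = n ∧ lead l ((l : ℚ_[l]) ^ n * u) = PadicInt.toZMod u := by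
  have h0 : (l : ℚ_[l]) ≠ 0 := mod_cast hl.out.ne_zero
  rw [toZMod_ne_zero_iff] at hu
  have hu0 : (u : ℚ_[l]) ≠ 0 := by
    rintro h; rw [PadicInt.norm_def, h, norm_zero] at hu; exact zero_ne_one hu
  have hv : (u : ℚ_[l]).valuation = 0 := by
    have h1 := Padic.norm_eq_zpow_neg_valuation hu0
    rw [← PadicInt.norm_def, hu] at h1
    have h2 : (1 : ℝ) < l := mod_cast hl.out.one_lt
    have := (zpow_eq_one_iff_right₀ (by positivity) h2.ne').mp h1.symm
    omega
  have hv' : ((l : ℚ_[l]) ^ n * u).valuation = n := by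
    rw [Padic.valuation_mul (zpow_ne_zero _ h0) hu0, Padic.valuation_zpow, Padic.valuation_p, hv]
    simp
  refine ⟨hv', ?_⟩
  rw [lead]
  congr 1
  apply Subtype.ext
  simp only [hv']
  rw [mul_right_comm, ← zpow_add₀ h0]; simp

lemma lead_mul (x y : ℚ_[l]) : lead l (x * y) = lead l x * lead l y := by
  by_cases hx : x = 0
  · simp [hx, lead_zero]
  by_cases hy : y = 0
  · simp [hy, lead_zero]
  have h0 : (l : ℚ_[l]) ≠ 0 := mod_cast hl.out.ne_zero
  obtain ⟨u, hu, hu0, hu'⟩ := exists_eq_zpow_mul hx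
  obtain ⟨w, hw, hw0, hw'⟩ := exists_eq_zpow_mul hy
  have : x * y = (l : ℚ_[l]) ^ (x.valuation + y.valuation) * (u * w : ℤ_[l]) := by
    conv_lhs => rw [hu, hw]
    rw [zpow_add₀ h0]; push_cast; ring
  rw [this, (valuation_lead_of_eq _ _ (by rw [map_mul]; exact mul_ne_zero hu0 hw0)).2, map_mul,
    hu', hw']

lemma lead_ne_zero {x : ℚ_[l]} (hx : x ≠ 0) : lead l x ≠ 0 := by
  obtain ⟨u, -, hu0, hu'⟩ := exists_eq_zpow_mul hx
  rwa [hu']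

lemma add_of_valuation_lt {a b : ℚ_[l]} (ha : a ≠ 0) (hb : b ≠ 0)
    (h : a.valuation < b.valuation) :
    (a + b).valuation = a.valuation ∧ lead l (a + b) = lead l a := by
  have h0 : (l : ℚ_[l]) ≠ 0 := mod_cast hl.out.ne_zero
  obtain ⟨u, hu, hu0, hu'⟩ := exists_eq_zpow_mul ha
  obtain ⟨w, hw, hw0, hw'⟩ := exists_eq_zpow_mul hb
  obtain ⟨k, hk⟩ : ∃ k : ℕ, b.valuation = a.valuation + (k + 1) :=
    ⟨(b.valuation - a.valuation - 1).toNat, by omega⟩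
  have hz : PadicInt.toZMod (u + (l : ℤ_[l]) ^ (k + 1) * w) = PadicInt.toZMod u := by simp
  have : a + b = (l : ℚ_[l]) ^ a.valuation * (u + (l : ℤ_[l]) ^ (k + 1) * w : ℤ_[l]) := by
    conv_lhs => rw [hu, hw, hk]
    rw [zpow_add₀ h0]; push_cast; rw [← zpow_natCast]; push_cast; ring
  rw [this, hu', ← hz]
  have h2 := valuation_lead_of_eq a.valuation (u + (l : ℤ_[l]) ^ (k + 1) * w) (by rwa [hz])
  grind

lemma add_of_valuation_eq {a b : ℚ_[l]} (ha : a ≠ 0) (hb : b ≠ 0)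
    (h : a.valuation = b.valuation) (hs : lead l a + lead l b ≠ 0) :
    (a + b).valuation = a.valuation ∧ lead l (a + b) = lead l a + lead l b := by
  obtain ⟨u, hu, hu0, hu'⟩ := exists_eq_zpow_mul ha
  obtain ⟨w, hw, hw0, hw'⟩ := exists_eq_zpow_mul hb
  rw [hu', hw', ← map_add] at hs ⊢
  have : a + b = (l : ℚ_[l]) ^ a.valuation * (u + w : ℤ_[l]) := by
    conv_lhs => rw [hu, hw, ← h]
    push_cast; ring
  rw [this]
  have h2 := valuation_lead_of_eq a.valuation (u + w) hs
  grind

/-- The second residue of a one-dimensional form over the `l`-adic numbers. -/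
def residue (l : ℕ) [Fact l.Prime] (x : ℚ_[l]) : WP (ZMod l) :=
  if Even x.valuation then 0 else wp (lead l x)

lemma residue_congr {x y : ℚ_[l]} (h : Even x.valuation ↔ Even y.valuation)
    (h' : lead l x = lead l y) : residue l x = residue l y := by
  unfold residue; simp only [h, h']

lemma residue_zero : residue l 0 = 0 := by simp [residue]

lemma residue_mul_sq (a b : ℚ_[l]) (hb : b ≠ 0) : residue l (a * b ^ 2) = residue l a := by
  by_cases ha : a = 0
  · simp [ha]
  unfold residue
  rw [Padic.valuation_mul ha (pow_ne_zero 2 hb), Padic.valuation_pow, lead_mul, pow_two,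
    lead_mul, ← pow_two, wp_isWitt.sq _ _ (lead_ne_zero hb)]
  grind

lemma valuation_lead_neg (a : ℚ_[l]) :
    (-a).valuation = a.valuation ∧ lead l (-a) = -lead l a := by
  by_cases ha : a = 0
  · simp [ha, lead_zero]
  have := valuation_lead_of_eq 0 (-1 : ℤ_[l]) (by simp)
  simp only [zpow_zero, PadicInt.coe_neg, PadicInt.coe_one, one_mul] at this
  rw [← neg_one_mul, Padic.valuation_mul (by simp) ha, this.1, zero_add, lead_mul, this.2, map_neg,
    map_one, neg_one_mul]
  exact ⟨rfl, rfl⟩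

lemma residue_neg (a : ℚ_[l]) : residue l (-a) = -residue l a := by
  unfold residue
  rw [(valuation_lead_neg a).1, (valuation_lead_neg a).2, wp_isWitt.neg]
  grind

lemma residue_add_of_lt {a b : ℚ_[l]} (ha : a ≠ 0) (hb : b ≠ 0)
    (h : a.valuation < b.valuation) :
    residue l a + residue l b = residue l (a + b) + residue l (a * b * (a + b)) := by
  obtain ⟨h1, h2⟩ := add_of_valuation_lt ha hb h
  have hab : a + b ≠ 0 := by
    intro h3; rw [h3, lead_zero] at h2; exact lead_ne_zero ha h2.symm
  rw [residue_congr (x := a + b) (y := a) (by rw [h1]) h2]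
  congr 1
  rw [← residue_mul_sq b a ha]
  apply residue_congr
  · rw [Padic.valuation_mul hb (pow_ne_zero 2 ha), Padic.valuation_mul (mul_ne_zero ha hb) hab,
      Padic.valuation_mul ha hb, Padic.valuation_pow, h1]
    grind
  · rw [lead_mul, lead_mul, lead_mul, h2, pow_two, lead_mul]; ring

lemma residue_isWitt (l : ℕ) [Fact l.Prime] : IsWitt (residue l) where
  zero := residue_zero
  sq := residue_mul_sq
  add a b := by
    by_cases ha : a = 0
    · simp [ha, residue_zero]
    by_cases hb : b = 0
    · simp [hb, residue_zero]
    rcases lt_trichotomy a.valuation b.valuation with h | h | h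
    · exact residue_add_of_lt ha hb h
    · by_cases hs : lead l a + lead l b = 0
      · have e1 : residue l b = -residue l a := by
          rw [← residue_neg]
          exact residue_congr (by rw [(valuation_lead_neg a).1, h])
            (by rw [(valuation_lead_neg a).2]; linear_combination hs)
        by_cases hab : a + b = 0
        · simp [hab, e1, residue_zero]
        rw [e1, add_neg_cancel, eq_comm, add_eq_zero_iff_eq_neg', ← residue_neg,
          ← residue_mul_sq (-(a + b)) a ha]
        apply residue_congr
        · rw [Padic.valuation_mul (neg_ne_zero.mpr hab) (pow_ne_zero 2 ha),
            Padic.valuation_mul (mul_ne_zero ha hb) hab, Padic.valuation_mul ha hb,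
            Padic.valuation_pow, h, (valuation_lead_neg _).1]
          grind
        · rw [lead_mul, lead_mul, lead_mul, (valuation_lead_neg _).2, pow_two, lead_mul]
          grind
      · obtain ⟨h1, h2⟩ := add_of_valuation_eq ha hb h hs
        have hab : a + b ≠ 0 := by
          intro h3; rw [h3, lead_zero] at h2; exact hs h2.symm
        have h4 : (a * b * (a + b)).valuation = 3 * a.valuation := by
          rw [Padic.valuation_mul (mul_ne_zero ha hb) hab, Padic.valuation_mul ha hb, h1, ← h]; ring
        unfold residue
        rw [h4, h1, ← h, lead_mul, lead_mul, h2]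
        have : Even (3 * a.valuation) ↔ Even a.valuation := by grind
        simp only [this]
        split_ifs
        · rfl
        · exact wp_isWitt.add _ _
    · have := residue_add_of_lt hb ha h
      grind

end Residue

section FiniteField

variable {l : ℕ} [hl : Fact l.Prime]

lemma wp_sq_mul {K : Type} [Field K] (a : K) {b c : K} (hb : b ≠ 0) (h : c = a * b ^ 2) :
    wp c = wp a := by rw [h, wp_isWitt.sq a b hb]

lemma wp_add_wp_zmod (hl2 : l ≠ 2) {u w : ZMod l} (hu : u ≠ 0) (hw : w ≠ 0) :
    wp u + wp w = wp 1 + wp (u * w) := by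
  obtain ⟨x, y, hxy⟩ : ∃ x y : ZMod l, u * x ^ 2 + w * y ^ 2 = 1 := by
    have h1 : Polynomial.degree (Polynomial.C u * Polynomial.X ^ 2 : Polynomial (ZMod l)) = 2 :=
      Polynomial.degree_C_mul_X_pow 2 hu
    have h2 : Polynomial.degree (Polynomial.C w * Polynomial.X ^ 2 - Polynomial.C 1) = 2 := by
      rw [Polynomial.degree_sub_eq_left_of_degree_lt] <;>
        rw [Polynomial.degree_C_mul_X_pow 2 hw]
      · rfl
      · exact Polynomial.degree_C_le.trans_lt (by norm_num)
    obtain ⟨x, y, h⟩ := FiniteField.exists_root_sum_quadratic h1 h2 (by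
      rw [ZMod.card]
      exact Nat.odd_iff.mp (hl.out.odd_of_ne_two hl2))
    exact ⟨x, y, by simp at h; linear_combination h⟩
  by_cases hx : x = 0
  · subst hx
    have hy : y ≠ 0 := by rintro rfl; simp at hxy
    have h1 : wp 1 = wp w := wp_sq_mul w hy (by linear_combination -hxy)
    have h2 : wp u = wp (u * w) := wp_sq_mul (u * w) hy (by linear_combination -u * hxy)
    rw [h1, h2, add_comm]
  by_cases hy : y = 0
  · subst hy
    have h1 : wp 1 = wp u := wp_sq_mul u hx (by linear_combination -hxy)
    have h2 : wp w = wp (u * w) := wp_sq_mul (u * w) hx (by linear_combination -w * hxy)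
    rw [h1, h2]
  rw [← wp_isWitt.sq u x hx, ← wp_isWitt.sq w y hy, wp_isWitt.add, hxy]
  congr 1
  exact wp_sq_mul (u * w) (mul_ne_zero hx hy) (by ring)

lemma wp_add_wp_of_isSquare {u w : ZMod l} (hu : u ≠ 0) (hw : w ≠ 0)
    (h : IsSquare (-(u * w))) : wp u + wp w = 0 := by
  obtain ⟨z, hz⟩ := h
  have hz0 : z ≠ 0 := by
    rintro rfl
    exact mul_ne_zero hu hw (by linear_combination -hz)
  have h1 : wp w = wp (-u) := wp_sq_mul (-u) (div_ne_zero hz0 hu) (by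
    field_simp
    linear_combination -hz)
  rw [h1, wp_isWitt.neg, add_neg_cancel]

/-- Two binary forms with the same discriminant class are equal. -/
lemma wp_add_wp_eq_of_isSquare (hl2 : l ≠ 2) {u w u' w' : ZMod l} (hu : u ≠ 0) (hw : w ≠ 0)
    (hu' : u' ≠ 0) (hw' : w' ≠ 0) (h : IsSquare (u * w * (u' * w'))) :
    wp u + wp w = wp u' + wp w' := by
  obtain ⟨z, hz⟩ := h
  have hz0 : z ≠ 0 := by
    rintro rfl
    exact mul_ne_zero (mul_ne_zero hu hw) (mul_ne_zero hu' hw') (by linear_combination hz)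
  rw [wp_add_wp_zmod hl2 hu hw, wp_add_wp_zmod hl2 hu' hw']
  congr 1
  refine wp_sq_mul _ (div_ne_zero hz0 (mul_ne_zero hu' hw')) ?_
  field_simp
  linear_combination hz

lemma isSquare_mul_of_not_isSquare {u w : ZMod l} (hu : ¬ IsSquare u) (hw : ¬ IsSquare w) :
    IsSquare (u * w) := by
  by_cases hl2 : l = 2
  · subst hl2
    exact (hu (FiniteField.isSquare_of_char_two (ZMod.ringChar_zmod_n 2) u)).elim
  have h {a : ZMod l} (ha : a ≠ 0) := FiniteField.isSquare_iff (F := ZMod l) (by rwa [ZMod.ringChar_zmod_n]) ha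
  have hd {a : ZMod l} (ha : a ≠ 0) :=
    FiniteField.pow_dichotomy (F := ZMod l) (by rwa [ZMod.ringChar_zmod_n]) ha
  have hu0 : u ≠ 0 := by rintro rfl; exact hu (IsSquare.zero)
  have hw0 : w ≠ 0 := by rintro rfl; exact hw (IsSquare.zero)
  rw [h (mul_ne_zero hu0 hw0), mul_pow, (hd hu0).resolve_left (mt (h hu0).mpr hu),
    (hd hw0).resolve_left (mt (h hw0).mpr hw)]
  ring

end FiniteField

section Smooth

/-- A nonzero integer all of whose prime factors are smaller than `m`. -/
def Smooth (m : ℕ) (u : ℤ) : Prop := u ≠ 0 ∧ ∀ q : ℕ, q.Prime → (q : ℤ) ∣ u → q < m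

lemma Smooth.mul {m : ℕ} {u w : ℤ} (hu : Smooth m u) (hw : Smooth m w) : Smooth m (u * w) :=
  ⟨mul_ne_zero hu.1 hw.1, fun q hq h =>
    ((Nat.prime_iff_prime_int.mp hq).dvd_or_dvd h).elim (hu.2 q hq) (hw.2 q hq)⟩

lemma Smooth.neg {m : ℕ} {u : ℤ} (hu : Smooth m u) : Smooth m (-u) :=
  ⟨neg_ne_zero.mpr hu.1, fun q hq h => hu.2 q hq (dvd_neg.mp h)⟩

lemma Smooth.of_abs_lt {m : ℕ} {u : ℤ} (h0 : u ≠ 0) (h : |u| < m) : Smooth m u :=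
  ⟨h0, fun q _ hd => by
    have := Int.le_of_dvd (abs_pos.mpr h0) ((dvd_abs _ _).mpr hd)
    omega⟩

lemma Smooth.of_nat_lt {m n : ℕ} (h0 : n ≠ 0) (h : n < m) : Smooth m n :=
  Smooth.of_abs_lt (mod_cast h0) (by rw [Nat.abs_cast]; exact_mod_cast h)

/-- The subgroup of the Witt group of `ℚ` generated by the smooth integers. -/
def smoothWP (m : ℕ) : AddSubgroup (WP ℚ) :=
  AddSubgroup.closure {x | ∃ u : ℤ, Smooth m u ∧ x = wp (u : ℚ)}

lemma wp_mem_smoothWP {m : ℕ} {u : ℤ} (hu : Smooth m u) : wp (u : ℚ) ∈ smoothWP m :=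
  AddSubgroup.subset_closure ⟨u, hu, rfl⟩

/-- Scaling of forms. -/
def wscale {K : Type} [Field K] {c : K} (hc : c ≠ 0) : WP K →+ WP K :=
  wlift (fun a => wp (c * a)) (wp_isWitt.scale hc)

@[simp] lemma wscale_wp {K : Type} [Field K] {c : K} (hc : c ≠ 0) (a : K) :
    wscale hc (wp a) = wp (c * a) := wlift_wp _ _ _

lemma wscale_mem_smoothWP {m : ℕ} {c : ℤ} (hc : Smooth m c) (hc0 : (c : ℚ) ≠ 0) {x : WP ℚ}
    (hx : x ∈ smoothWP m) : wscale hc0 x ∈ smoothWP m := by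
  induction hx using AddSubgroup.closure_induction with
  | mem x hx =>
    obtain ⟨u, hu, rfl⟩ := hx
    rw [wscale_wp, ← Int.cast_mul]
    exact wp_mem_smoothWP (hc.mul hu)
  | zero => rw [map_zero]; exact AddSubgroup.zero_mem _
  | add x y _ _ hx hy => rw [map_add]; exact AddSubgroup.add_mem _ hx hy
  | neg x _ hx => rw [map_neg]; exact AddSubgroup.neg_mem _ hx

variable {l : ℕ} [hl : Fact l.Prime]

/-- The Witt group of `ℚ` modulo the classes of smooth integers. -/
def WPQuot (m : ℕ) : Type := WP ℚ ⧸ smoothWP m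

instance (m : ℕ) : AddCommGroup (WPQuot m) :=
  inferInstanceAs (AddCommGroup (WP ℚ ⧸ smoothWP m))

/-- The class of a form modulo the classes of smooth integers. -/
def modSmooth (l : ℕ) : WP ℚ →+ WPQuot l := QuotientAddGroup.mk' _

omit hl in
lemma modSmooth_eq_zero {m : ℕ} {x : WP ℚ} : modSmooth m x = 0 ↔ x ∈ smoothWP m :=
  QuotientAddGroup.eq_zero_iff x

omit hl in
lemma modSmooth_wp {u : ℤ} (hu : Smooth l u) : modSmooth l (wp (u : ℚ)) = 0 :=
  modSmooth_eq_zero.mpr (wp_mem_smoothWP hu)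

omit hl in
lemma modSmooth_wp_of_eq {u : ℤ} {a b : ℚ} (hu : Smooth l u) (hb : b ≠ 0) (h : a = u * b ^ 2) :
    modSmooth l (wp a) = 0 := by
  rw [wp_sq_mul _ hb h, modSmooth_wp hu]

/-- Class of the form `l u`. -/
abbrev primeClass (l : ℕ) (u : ℤ) : WPQuot l := modSmooth l (wp ((l : ℚ) * u))

lemma primeClass_add (u w : ℤ) :
    primeClass l u + primeClass l w = primeClass l (u + w) + primeClass l (u * w * (u + w)) := by
  have h0 : (l : ℚ) ≠ 0 := mod_cast hl.out.ne_zero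
  unfold primeClass
  rw [← map_add, wp_isWitt.add, map_add]
  congr 2
  · push_cast; ring_nf
  · exact wp_sq_mul _ h0 (by push_cast; ring)

lemma primeClass_mul_mod {r t : ℕ} (hr : r ≠ 0) (hrl : r < l) (ht : t ≠ 0) (htl : t < l) :
    primeClass l (r * t) = primeClass l ((r * t % l : ℕ) : ℤ) := by
  have h0 : (l : ℚ) ≠ 0 := mod_cast hl.out.ne_zero
  set z := r * t % l with hz
  set k := r * t / l with hk
  have hd : r * t = l * k + z := (Nat.div_add_mod (r * t) l).symm
  have hdq : (r * t : ℚ) = l * k + z := mod_cast hd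
  have hzl : z < l := Nat.mod_lt _ hl.out.pos
  have hz0 : z ≠ 0 := by
    intro h
    have : l ∣ r * t := Nat.dvd_of_mod_eq_zero h
    rcases (Nat.Prime.dvd_mul hl.out).mp this with h | h
    · exact absurd (Nat.le_of_dvd (by omega) h) (by omega)
    · exact absurd (Nat.le_of_dvd (by omega) h) (by omega)
  by_cases hk0 : k = 0
  · rw [hk0] at hd
    congr 3
    exact_mod_cast (by omega : r * t = z)
  have hkl : k < l := by
    rw [hk, Nat.div_lt_iff_lt_mul hl.out.pos]
    exact Nat.mul_lt_mul_of_lt_of_lt hrl htl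
  have hK : Smooth l k := Smooth.of_nat_lt hk0 hkl
  have hZ : Smooth l z := Smooth.of_nat_lt hz0 hzl
  have hR : Smooth l r := Smooth.of_nat_lt hr hrl
  have hT : Smooth l t := Smooth.of_nat_lt ht htl
  have := congrArg (modSmooth l) (wp_isWitt.add ((l : ℚ) * (l * k)) (l * z))
  rw [map_add, map_add, modSmooth_wp_of_eq (a := (l : ℚ) * (l * k)) hK h0 (by push_cast; ring),
    modSmooth_wp_of_eq (a := (l : ℚ) * (l * k) * (l * z) * (l * (l * k) + l * z)) (((hK.mul hZ).mul hR).mul hT) (pow_ne_zero 2 h0)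
      (by push_cast; rw [← mul_add, ← hdq]; ring), zero_add, add_zero, ← mul_add, ← hdq] at this
  unfold primeClass
  push_cast
  exact this.symm

lemma primeClass_neg {r : ℕ} (hr : r ≠ 0) (hrl : r < l) :
    primeClass l (-r) = primeClass l ((l - r : ℕ) : ℤ) := by
  have h0 : (l : ℚ) ≠ 0 := mod_cast hl.out.ne_zero
  have hR : Smooth l r := Smooth.of_nat_lt hr hrl
  have hR' : Smooth l ((l - r : ℕ) : ℤ) := Smooth.of_nat_lt (by omega) (by omega)
  have h1 : Smooth l 1 := Smooth.of_nat_lt one_ne_zero hl.out.one_lt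
  have hc : (((l - r : ℕ) : ℤ) : ℚ) = l - r := by push_cast [hrl.le]; ring
  have := congrArg (modSmooth l) (wp_isWitt.add ((l : ℚ) * l) (l * (-r)))
  rw [map_add, map_add, modSmooth_wp_of_eq (a := (l : ℚ) * l) h1 h0 (by push_cast; ring),
    modSmooth_wp_of_eq (a := (l : ℚ) * l * (l * (-r)) * (l * l + l * (-r))) (hR.neg.mul hR') (pow_ne_zero 2 h0) (by rw [Int.cast_mul, hc]; push_cast; ring),
    zero_add, add_zero, ← mul_add] at this
  unfold primeClass
  rw [hc]; push_cast
  rw [this]; ring_nf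

lemma primeClass_natCast {n : ℕ} (hn : Smooth l n) :
    primeClass l n = primeClass l ((n : ZMod l).val : ℤ) := by
  induction n using Nat.recOnMul with
  | zero => exact absurd rfl hn.1
  | one => rw [ZMod.val_natCast, Nat.mod_eq_of_lt hl.out.one_lt]
  | prime q hq => rw [ZMod.val_natCast, Nat.mod_eq_of_lt (hn.2 q hq dvd_rfl)]
  | mul a b ha hb =>
    push_cast at hn
    have hA : Smooth l a := ⟨left_ne_zero_of_mul hn.1, fun q hq h => hn.2 q hq (h.mul_right _)⟩
    have hB : Smooth l b := ⟨right_ne_zero_of_mul hn.1, fun q hq h => hn.2 q hq (h.mul_left _)⟩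
    have key : ∀ {c m : ℕ}, Smooth l c → Smooth l m →
        primeClass l m = primeClass l ((m : ZMod l).val : ℤ) →
        primeClass l (c * m) = primeClass l (c * ((m : ZMod l).val : ℤ)) := by
      intro c m hc _ h
      have hc0 : ((c : ℤ) : ℚ) ≠ 0 := mod_cast hc.1
      have h1 : wp ((l : ℚ) * (m : ℤ)) - wp ((l : ℚ) * (((m : ZMod l).val : ℤ))) ∈ smoothWP l := by
        rw [← modSmooth_eq_zero]
        exact (map_sub (modSmooth l) _ _).trans (sub_eq_zero.mpr h)
      have h2 := wscale_mem_smoothWP hc hc0 h1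
      rw [map_sub, wscale_wp, wscale_wp, ← modSmooth_eq_zero] at h2
      have h3 := sub_eq_zero.mp ((map_sub (modSmooth l) _ _).symm.trans h2)
      unfold primeClass
      push_cast at h3 ⊢
      rw [mul_left_comm, h3, mul_left_comm]
    have ndvd : ∀ {m : ℕ}, Smooth l m → (m : ZMod l).val ≠ 0 := by
      intro m hm h
      rw [ZMod.val_eq_zero, ZMod.natCast_eq_zero_iff] at h
      exact lt_irrefl _ (hm.2 l hl.out (mod_cast h))
    have hval : Smooth l ((b : ZMod l).val : ℤ) := Smooth.of_nat_lt (ndvd hB) (ZMod.val_lt _)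
    rw [Nat.cast_mul, key hA hB (hb hB), mul_comm, key hval hA (ha hA), mul_comm,
      primeClass_mul_mod (ndvd hA) (ZMod.val_lt _) (ndvd hB) (ZMod.val_lt _), ← ZMod.val_mul,
      Nat.cast_mul]

lemma primeClass_eq {u : ℤ} (hu : Smooth l u) :
    primeClass l u = primeClass l ((u : ZMod l).val : ℤ) := by
  obtain ⟨n, rfl | rfl⟩ := u.eq_nat_or_neg
  · simpa using primeClass_natCast hu
  · have hn : Smooth l n := by simpa using hu.neg
    have h0 : (n : ZMod l) ≠ 0 := by
      intro h
      rw [ZMod.natCast_eq_zero_iff] at h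
      exact lt_irrefl _ (hn.2 l hl.out (mod_cast h))
    have hneg : ∀ w : ℤ, primeClass l (-w) = - primeClass l w := by
      intro w
      unfold primeClass
      rw [← map_neg, ← wp_isWitt.neg]; push_cast; ring_nf
    rw [hneg, primeClass_natCast hn, ← hneg,
      primeClass_neg ((ZMod.val_ne_zero _).mpr h0) (ZMod.val_lt _)]
    push_cast
    have : NeZero (n : ZMod l) := ⟨h0⟩
    rw [ZMod.val_neg_of_ne_zero]

lemma primeClass_isWitt : IsWitt fun n : ZMod l => primeClass l (n.val : ℤ) where
  zero := by unfold primeClass; simp [wp_isWitt.zero]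
  sq a b hb := by
    by_cases ha : a = 0
    · simp [ha]
    have h0 : ((b.val : ℤ) : ℚ) ≠ 0 := mod_cast (ZMod.val_ne_zero b).mpr hb
    have hA : Smooth l a.val := Smooth.of_nat_lt ((ZMod.val_ne_zero a).mpr ha) (ZMod.val_lt _)
    have hB : Smooth l b.val := Smooth.of_nat_lt ((ZMod.val_ne_zero b).mpr hb) (ZMod.val_lt _)
    have h1 := primeClass_eq (hA.mul (hB.mul hB))
    have h2 : (((a.val : ℤ) * (b.val * b.val) : ℤ) : ZMod l) = a * b ^ 2 := by
      push_cast; rw [ZMod.natCast_zmod_val, ZMod.natCast_zmod_val]; ring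
    rw [h2] at h1
    rw [← h1]
    unfold primeClass
    congr 1
    exact wp_sq_mul _ h0 (by push_cast; ring)
  add a b := by
    by_cases ha : a = 0
    · unfold primeClass; simp [ha, wp_isWitt.zero, add_comm]
    by_cases hb : b = 0
    · unfold primeClass; simp [hb, wp_isWitt.zero, add_comm]
    have hA : Smooth l a.val := Smooth.of_nat_lt ((ZMod.val_ne_zero a).mpr ha) (ZMod.val_lt _)
    have hB : Smooth l b.val := Smooth.of_nat_lt ((ZMod.val_ne_zero b).mpr hb) (ZMod.val_lt _)
    have key : ∀ t : ℤ, Smooth l t → (t : ZMod l) = b → 0 ≤ a.val + t → a.val + t < l →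
        primeClass l (a.val : ℤ) + primeClass l t =
        primeClass l ((a + b).val : ℤ) + primeClass l ((a * b * (a + b)).val : ℤ) := by
      intro t ht htb h1 h2
      have e1 : (((a.val + t : ℤ)) : ZMod l) = a + b := by
        push_cast; rw [ZMod.natCast_zmod_val, htb]
      by_cases h3 : a.val + t = 0
      · have e2 : a + b = 0 := by rw [← e1, h3]; simp
        rw [primeClass_add, h3, e2]
        simp
      · have hs : Smooth l (a.val + t) := Smooth.of_abs_lt h3 (by rw [abs_of_nonneg h1]; exact h2)
        rw [primeClass_add, primeClass_eq hs,
          primeClass_eq ((hA.mul ht).mul hs), e1]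
        have e3 : (((a.val * t * (a.val + t) : ℤ)) : ZMod l) = a * b * (a + b) := by
          push_cast; rw [ZMod.natCast_zmod_val, htb]
        rw [e3]
    have la := ZMod.val_lt a
    have lb := ZMod.val_lt b
    by_cases h : a.val + b.val < l
    · exact key b.val hB (by simp) (by positivity) (mod_cast h)
    · have ht : Smooth l ((b.val : ℤ) - l) :=
        Smooth.of_abs_lt (by omega) (by rw [abs_lt]; constructor <;> have := (ZMod.val_ne_zero b).mpr hb <;> omega)
      have := primeClass_eq ht
      have e : (((b.val : ℤ) - l : ℤ) : ZMod l) = b := by push_cast; simp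
      rw [e] at this
      rw [← this]
      exact key _ ht e (by omega) (by omega)

end Smooth

section Milnor

/-- Residue of a rational form at `l`. -/
def ratResidue (l : ℕ) [Fact l.Prime] : WP ℚ →+ WP (ZMod l) :=
  wlift _ ((residue_isWitt l).map (Rat.castHom ℚ_[l]))

@[simp] lemma ratResidue_wp (l : ℕ) [Fact l.Prime] (a : ℚ) :
    ratResidue l (wp a) = residue l (a : ℚ_[l]) := wlift_wp _ _ _

lemma sign_isWitt : IsWitt fun a : ℚ => (SignType.sign a : ℤ) where
  zero := by simp
  sq a b hb := by simp only [sign_mul, sign_pos (a := b ^ 2) (by positivity)]; simp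
  add a b := by
    rcases lt_trichotomy a 0 with ha | ha | ha <;> rcases lt_trichotomy b 0 with hb | hb | hb <;>
      rcases lt_trichotomy (a + b) 0 with h | h | h <;>
      simp [sign_mul, ha, hb, h, sign_pos, sign_neg] <;> linarith

/-- The signature of a rational form. -/
def signature : WP ℚ →+ ℤ := wlift _ sign_isWitt

@[simp] lemma signature_wp (a : ℚ) : signature (wp a) = SignType.sign a := wlift_wp _ _ _

lemma dyadic_isWitt : IsWitt fun a : ℚ => (padicValRat 2 a : ZMod 2) where
  zero := by simp
  sq a b hb := by
    by_cases ha : a = 0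
    · simp [ha]
    simp only [padicValRat.mul ha (pow_ne_zero 2 hb), padicValRat.pow]
    grind
  add a b := by
    by_cases ha : a = 0
    · simp [ha]
    by_cases hb : b = 0
    · simp [hb]
    by_cases hab : a + b = 0
    · rw [hab, eq_neg_of_add_eq_zero_left hab]
      simp [CharTwo.add_self_eq_zero]
    simp only [padicValRat.mul (mul_ne_zero ha hb) hab, padicValRat.mul ha hb]
    push_cast
    grind

/-- Parity of the dyadic valuation of the discriminant of a rational form. -/
def dyadic : WP ℚ →+ ZMod 2 := wlift _ dyadic_isWitt

@[simp] lemma dyadic_wp (a : ℚ) : dyadic (wp a) = (padicValRat 2 a : ZMod 2) := wlift_wp _ _ _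

lemma modSmooth_eq_of_mem {l : ℕ} [hl : Fact l.Prime] {x : WP ℚ} (hx : x ∈ smoothWP (l + 1)) :
    wlift _ primeClass_isWitt (ratResidue l x) = modSmooth l x := by
  have h0 : (l : ℚ) ≠ 0 := mod_cast hl.out.ne_zero
  induction hx using AddSubgroup.closure_induction with
  | zero => simp
  | add x y _ _ hx hy => simp only [map_add, hx, hy]
  | neg x _ hx => simp only [map_neg, hx]
  | mem x hx =>
    obtain ⟨u, hu, rfl⟩ := hx
    obtain ⟨k, w, hw, rfl⟩ : ∃ (k : ℕ) (w : ℤ), ¬ (l : ℤ) ∣ w ∧ u = l ^ k * w := by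
      have hf : FiniteMultiplicity (l : ℤ) u :=
        Int.finiteMultiplicity_iff.mpr ⟨by simpa using hl.out.ne_one, hu.1⟩
      obtain ⟨w, h1, h2⟩ := hf.exists_eq_pow_mul_and_not_dvd
      grind
    have hw' : Smooth l w := ⟨fun h => hw (h ▸ dvd_zero _), fun q hq hd => by
      have h1 := hu.2 q hq (hd.mul_left _)
      have h2 : q ≠ l := by rintro rfl; exact hw hd
      omega⟩
    have hz : PadicInt.toZMod (w : ℤ_[l]) ≠ 0 := by
      rw [map_intCast]
      exact mt (ZMod.intCast_zmod_eq_zero_iff_dvd w l).mp hw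
    obtain ⟨h1, h2⟩ := valuation_lead_of_eq (l := l) k (w : ℤ_[l]) hz
    have e : (((l ^ k * w : ℤ) : ℚ) : ℚ_[l]) = (l : ℚ_[l]) ^ (k : ℤ) * ((w : ℤ_[l]) : ℚ_[l]) := by
      push_cast; rw [zpow_natCast]
    rw [ratResidue_wp, e, residue, h1, h2, map_intCast]
    rcases Nat.even_or_odd' k with ⟨m, rfl | rfl⟩
    · rw [if_pos (by simp), map_zero]
      exact (modSmooth_wp_of_eq hw' (pow_ne_zero m h0) (by push_cast; ring)).symm
    · rw [if_neg (by simp), wlift_wp, ← primeClass_eq hw']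
      unfold primeClass
      congr 1
      exact (wp_sq_mul _ (pow_ne_zero m h0) (by push_cast; ring)).symm

lemma mem_smoothWP_of_succ {m : ℕ} (hm : ¬ m.Prime) {x : WP ℚ} (hx : x ∈ smoothWP (m + 1)) :
    x ∈ smoothWP m := by
  refine AddSubgroup.closure_mono ?_ hx
  rintro x ⟨u, hu, rfl⟩
  refine ⟨u, ⟨hu.1, fun q hq hd => ?_⟩, rfl⟩
  have h1 := hu.2 q hq hd
  grind

lemma smoothWP_mono {m n : ℕ} (h : m ≤ n) : smoothWP m ≤ smoothWP n := by
  refine AddSubgroup.closure_mono ?_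
  rintro x ⟨u, hu, rfl⟩
  exact ⟨u, ⟨hu.1, fun q hq hd => (hu.2 q hq hd).trans_le h⟩, rfl⟩

lemma exists_mem_smoothWP (x : WP ℚ) : ∃ m, x ∈ smoothWP m := by
  have hx : x ∈ AddSubgroup.closure (Set.range (wp : ℚ → WP ℚ)) := by
    rw [closure_range_wp]; trivial
  induction hx using AddSubgroup.closure_induction with
  | zero => exact ⟨0, AddSubgroup.zero_mem _⟩
  | add x y _ _ hx hy =>
    obtain ⟨m, hm⟩ := hx
    obtain ⟨n, hn⟩ := hy
    exact ⟨max m n, AddSubgroup.add_mem _ (smoothWP_mono (le_max_left _ _) hm)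
      (smoothWP_mono (le_max_right _ _) hn)⟩
  | neg x _ hx => exact hx.imp fun m hm => AddSubgroup.neg_mem _ hm
  | mem x hx =>
    obtain ⟨q, rfl⟩ := hx
    by_cases hq : q = 0
    · exact ⟨0, by rw [hq, wp_isWitt.zero]; exact AddSubgroup.zero_mem _⟩
    have hd : (q.den : ℚ) ≠ 0 := mod_cast q.den_ne_zero
    have h0 : q.num * q.den ≠ 0 :=
      mul_ne_zero (Rat.num_ne_zero.mpr hq) (mod_cast q.den_ne_zero)
    refine ⟨(q.num * q.den).natAbs + 1, ?_⟩
    have e : wp ((q.num * q.den : ℤ) : ℚ) = wp q := wp_sq_mul q hd (by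
      push_cast
      nth_rewrite 3 [← Rat.num_div_den q]
      field_simp)
    rw [← e]
    exact wp_mem_smoothWP (Smooth.of_abs_lt h0 (by push_cast; omega))

lemma eq_zsmul_of_mem_smoothWP_three {x : WP ℚ} (hx : x ∈ smoothWP 3) :
    ∃ m n : ℤ, x = m • wp 1 + n • wp 2 := by
  induction hx using AddSubgroup.closure_induction with
  | zero => exact ⟨0, 0, by simp⟩
  | add x y _ _ hx hy =>
    obtain ⟨m, n, rfl⟩ := hx
    obtain ⟨m', n', rfl⟩ := hy
    exact ⟨m + m', n + n', by rw [add_zsmul, add_zsmul]; abel⟩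
  | neg x _ hx =>
    obtain ⟨m, n, rfl⟩ := hx
    exact ⟨-m, -n, by rw [neg_zsmul, neg_zsmul]; abel⟩
  | mem x hx =>
    obtain ⟨u, hu, rfl⟩ := hx
    obtain ⟨k, hk⟩ : ∃ k, u.natAbs = 2 ^ k := by
      refine ⟨_, Nat.eq_prime_pow_of_unique_prime_dvd (Int.natAbs_ne_zero.mpr hu.1) ?_⟩
      intro d hd hdu
      have := hu.2 d hd (Int.natCast_dvd.mpr hdu)
      have := hd.two_le
      omega
    have key : ∀ k : ℕ, ∃ m n : ℤ, wp ((2 : ℚ) ^ k) = m • wp 1 + n • wp 2 := by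
      intro k
      rcases Nat.even_or_odd' k with ⟨m, rfl | rfl⟩
      · exact ⟨1, 0, by rw [wp_sq_mul 1 (pow_ne_zero m two_ne_zero) (by ring)]; simp⟩
      · exact ⟨0, 1, by rw [wp_sq_mul 2 (pow_ne_zero m two_ne_zero) (by ring)]; simp⟩
    obtain ⟨m, n, h⟩ := key k
    rcases Int.natAbs_eq u with h' | h' <;> rw [h', hk] <;> push_cast
    · exact ⟨m, n, h⟩
    · exact ⟨-m, -n, by rw [wp_isWitt.neg, h, neg_zsmul, neg_zsmul]; abel⟩

theorem eq_zero_of_ratResidue {x : WP ℚ}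
    (hres : ∀ (l : ℕ) [Fact l.Prime], l ≠ 2 → ratResidue l x = 0)
    (hsig : signature x = 0) (hdy : dyadic x = 0) : x = 0 := by
  have h3 : x ∈ smoothWP 3 := by
    obtain ⟨m, hm⟩ := exists_mem_smoothWP x
    have : ∀ n, x ∈ smoothWP (3 + n) → x ∈ smoothWP 3 := by
      intro n
      induction n with
      | zero => exact id
      | succ n ih =>
        intro h
        refine ih ?_
        by_cases hp : (3 + n).Prime
        · have : Fact (3 + n).Prime := ⟨hp⟩
          exact modSmooth_eq_zero.mp (by rw [← modSmooth_eq_of_mem (l := 3 + n) h, hres _ (by omega), map_zero])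
        · exact mem_smoothWP_of_succ hp h
    exact this m (smoothWP_mono (by omega) hm)
  obtain ⟨m, n, rfl⟩ := eq_zsmul_of_mem_smoothWP_three h3
  have h1 : m + n = 0 := by simpa using hsig
  have h2 : (n : ZMod 2) = 0 := by
    have := padicValRat.self (p := 2) one_lt_two
    push_cast at this
    simpa [this] using hdy
  obtain ⟨k, rfl⟩ := (ZMod.intCast_zmod_eq_zero_iff_dvd n 2).mp h2
  have h11 : wp (1 : ℚ) + wp 1 = wp 2 + wp 2 := by
    rw [wp_isWitt.add (1 : ℚ) 1]; norm_num
  have hm : m = -(k * 2) := by grind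
  rw [hm]; push_cast
  rw [neg_zsmul, mul_comm 2 k, mul_comm k 2, mul_zsmul, mul_zsmul, two_zsmul, two_zsmul,
    ← zsmul_add, ← zsmul_add, h11, neg_add_cancel]

end Milnor

lemma sq_ne_prime {p : ℕ} (hp : p.Prime) (q : ℚ) : q ^ 2 ≠ p := by
  intro h
  have := hp.irrational_sqrt
  rw [irrational_sqrt_natCast_iff] at this
  refine this ?_
  rw [← Rat.isSquare_natCast_iff]
  exact ⟨q, by rw [← h, pow_two]⟩

section RealQuadratic

/-- `F = ℚ(√p)` with `p ≡ 3 (mod 4)` prime, `p > 5`, and `θ = √p`. -/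
structure IsSqrtGen (p : ℕ) (θ : F) : Prop where
  prime : p.Prime
  gt : 5 < p
  mod : p % 4 = 3
  sq : θ ^ 2 = p
  gen : Algebra.adjoin ℚ {θ} = ⊤

variable {F} {p : ℕ} {θ : F}

namespace IsSqrtGen

lemma exists_coord (h : IsSqrtGen F p θ) (x : F) : ∃ a b : ℚ, x = a + b * θ := by
  have hx : x ∈ Algebra.adjoin ℚ {θ} := by rw [h.gen]; trivial
  induction hx using Algebra.adjoin_induction with
  | mem x hx => exact ⟨0, 1, by rw [Set.mem_singleton_iff.mp hx]; simp⟩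
  | algebraMap r => exact ⟨r, 0, by simp⟩
  | add x y _ _ hx hy =>
    obtain ⟨a, b, rfl⟩ := hx
    obtain ⟨c, d, rfl⟩ := hy
    exact ⟨a + c, b + d, by push_cast; ring⟩
  | mul x y _ _ hx hy =>
    obtain ⟨a, b, rfl⟩ := hx
    obtain ⟨c, d, rfl⟩ := hy
    exact ⟨a * c + p * b * d, a * d + b * c, by push_cast; linear_combination (b * d : F) * h.sq⟩

lemma norm_eq_zero (h : IsSqrtGen F p θ) {a b : ℚ} (hab : a ^ 2 - p * b ^ 2 = 0) :
    a = 0 ∧ b = 0 := by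
  have hb : b = 0 := by
    by_contra hb
    refine sq_ne_prime h.prime (a / b) ?_
    grind
  subst hb
  grind

lemma coord_eq_zero (h : IsSqrtGen F p θ) {a b : ℚ} (hab : (a : F) + b * θ = 0) :
    a = 0 ∧ b = 0 := by
  refine h.norm_eq_zero ?_
  have : ((a ^ 2 - p * b ^ 2 : ℚ) : F) = 0 := by
    push_cast
    linear_combination (a - b * θ : F) * hab + (b : F) ^ 2 * h.sq
  exact_mod_cast this

lemma coord_inj (h : IsSqrtGen F p θ) {a b c d : ℚ} (hab : (a : F) + b * θ = c + d * θ) :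
    a = c ∧ b = d := by
  have := h.coord_eq_zero (a := a - c) (b := b - d) (by push_cast; linear_combination hab)
  grind

/-- Rational part. -/
def re (h : IsSqrtGen F p θ) (x : F) : ℚ := (h.exists_coord x).choose

/-- Irrational part. -/
def im (h : IsSqrtGen F p θ) (x : F) : ℚ := (h.exists_coord x).choose_spec.choose

lemma eq_coord (h : IsSqrtGen F p θ) (x : F) : x = h.re x + h.im x * θ :=
  (h.exists_coord x).choose_spec.choose_spec

lemma re_im_of_eq (h : IsSqrtGen F p θ) {x : F} {a b : ℚ} (hx : x = a + b * θ) :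
    h.re x = a ∧ h.im x = b :=
  h.coord_inj ((h.eq_coord x).symm.trans hx)

lemma re_im_add (h : IsSqrtGen F p θ) (x y : F) :
    h.re (x + y) = h.re x + h.re y ∧ h.im (x + y) = h.im x + h.im y :=
  h.re_im_of_eq (by push_cast; linear_combination h.eq_coord x + h.eq_coord y)

lemma re_im_mul (h : IsSqrtGen F p θ) (x y : F) :
    h.re (x * y) = h.re x * h.re y + p * (h.im x * h.im y) ∧
      h.im (x * y) = h.re x * h.im y + h.im x * h.re y :=
  h.re_im_of_eq (by
    conv_lhs => rw [h.eq_coord x, h.eq_coord y]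
    push_cast
    linear_combination (h.im x * h.im y : F) * h.sq)

lemma re_im_ratCast (h : IsSqrtGen F p θ) (q : ℚ) : h.re (q : F) = q ∧ h.im (q : F) = 0 :=
  h.re_im_of_eq (by simp)

/-- The ring homomorphism determined by a square root of `p`. -/
def lift (h : IsSqrtGen F p θ) {L : Type} [Field L] [CharZero L] (r : L) (hr : r ^ 2 = p) :
    F →+* L where
  toFun x := h.re x + h.im x * r
  map_zero' := by
    have := h.re_im_ratCast 0
    rw [Rat.cast_zero] at this
    simp [this]
  map_one' := by
    have := h.re_im_ratCast 1
    rw [Rat.cast_one] at this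
    simp [this]
  map_add' x y := by
    rw [(h.re_im_add x y).1, (h.re_im_add x y).2]; push_cast; ring
  map_mul' x y := by
    rw [(h.re_im_mul x y).1, (h.re_im_mul x y).2]; push_cast
    grind

lemma lift_apply (h : IsSqrtGen F p θ) {L : Type} [Field L] [CharZero L] (r : L)
    (hr : r ^ 2 = p) (x : F) : h.lift r hr x = h.re x + h.im x * r := rfl

/-- Conjugation. -/
def conj (h : IsSqrtGen F p θ) : F →+* F := h.lift (-θ) (by rw [neg_sq, h.sq])

lemma conj_apply (h : IsSqrtGen F p θ) (x : F) : h.conj x = h.re x - h.im x * θ := by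
  rw [conj, lift_apply]; ring

lemma re_im_conj (h : IsSqrtGen F p θ) (x : F) : h.re (h.conj x) = h.re x ∧
    h.im (h.conj x) = - h.im x :=
  h.re_im_of_eq (by rw [h.conj_apply]; push_cast; ring)

/-- The norm to `ℚ`. -/
def nm (h : IsSqrtGen F p θ) (x : F) : ℚ := h.re x ^ 2 - p * h.im x ^ 2

lemma mul_conj (h : IsSqrtGen F p θ) (x : F) : x * h.conj x = h.nm x := by
  rw [h.conj_apply, nm]
  nth_rewrite 1 [h.eq_coord x]
  push_cast
  linear_combination -(h.im x : F) ^ 2 * h.sq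

lemma nm_mul (h : IsSqrtGen F p θ) (x y : F) : h.nm (x * y) = h.nm x * h.nm y := by
  rw [nm, (h.re_im_mul x y).1, (h.re_im_mul x y).2, nm, nm]; ring

lemma nm_ne_zero (h : IsSqrtGen F p θ) {x : F} (hx : x ≠ 0) : h.nm x ≠ 0 := by
  intro h0
  obtain ⟨h1, h2⟩ := h.norm_eq_zero h0
  exact hx (by rw [h.eq_coord x, h1, h2]; simp)

lemma nm_ratCast (h : IsSqrtGen F p θ) (q : ℚ) : h.nm (q : F) = q ^ 2 := by
  rw [nm, (h.re_im_ratCast q).1, (h.re_im_ratCast q).2]; ring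

lemma nm_neg (h : IsSqrtGen F p θ) (x : F) : h.nm (-x) = h.nm x := by
  have := h.nm_mul (-1) x
  have h2 := h.nm_ratCast (-1)
  push_cast at h2
  rw [h2] at this
  simpa using this

/-- An element is positive under both real embeddings iff its coordinates say so. -/
lemma nm_pos (h : IsSqrtGen F p θ) {x : F} (hx : ∀ σ : F →+* ℝ, σ x < 0) : 0 < h.nm x := by
  have hr : (Real.sqrt p) ^ 2 = p := Real.sq_sqrt (Nat.cast_nonneg p)
  have h1 := hx (h.lift (Real.sqrt p) hr)
  have h2 := hx (h.lift (-Real.sqrt p) (by rw [neg_sq, hr]))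
  rw [lift_apply] at h1 h2
  have : (0 : ℝ) < h.nm x := by
    rw [nm]; push_cast
    nlinarith
  exact_mod_cast this

lemma exists_real (h : IsSqrtGen F p θ) : Nonempty (F →+* ℝ) :=
  ⟨h.lift (Real.sqrt p) (Real.sq_sqrt (Nat.cast_nonneg p))⟩

end IsSqrtGen

/-- Elements of `ℤ[θ]`. -/
def IsInt (θ x : F) : Prop := ∃ m n : ℤ, x = m + n * θ

namespace IsSqrtGen

lemma rat_isInt_of_isIntegral {q : ℚ} (hq : IsIntegral ℤ (q : F)) : ∃ m : ℤ, q = m := by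
  have : IsIntegral ℤ q := by
    rw [← isIntegral_algebraMap_iff (B := F) (algebraMap ℚ F).injective]
    simpa using hq
  obtain ⟨m, hm⟩ := IsIntegrallyClosed.isIntegral_iff.mp this
  exact ⟨m, by simpa using hm.symm⟩

lemma isIntegral_theta (h : IsSqrtGen F p θ) : IsIntegral ℤ θ :=
  IsIntegral.of_pow two_pos (by rw [h.sq]; simpa using isIntegral_algebraMap (R := ℤ) (A := F) (x := (p : ℤ)))

lemma isIntegral_of_isInt (h : IsSqrtGen F p θ) {x : F} (hx : IsInt θ x) : IsIntegral ℤ x := by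
  obtain ⟨m, n, rfl⟩ := hx
  exact (isIntegral_intCast m).add ((isIntegral_intCast n).mul h.isIntegral_theta)

lemma isInt_of_isIntegral (h : IsSqrtGen F p θ) {x : F} (hx : IsIntegral ℤ x) : IsInt θ x := by
  have hc : IsIntegral ℤ (h.conj x) := hx.map (h.conj.toIntAlgHom)
  have ht : x + h.conj x = ((2 * h.re x : ℚ) : F) := by
    rw [h.conj_apply]
    nth_rewrite 1 [h.eq_coord x]
    push_cast; ring
  obtain ⟨u, hu⟩ := rat_isInt_of_isIntegral (ht ▸ hx.add hc)
  obtain ⟨n, hn⟩ := rat_isInt_of_isIntegral (h.mul_conj x ▸ hx.mul hc)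
  have h4 : (p : ℚ) * (2 * h.im x) ^ 2 = (u ^ 2 - 4 * n : ℤ) := by
    push_cast
    rw [← hu, ← hn, nm]; ring
  obtain ⟨w, hw⟩ : ∃ w : ℤ, 2 * h.im x = w := by
    have h5 : (p * (2 * h.im x)) ^ 2 = ((p * (u ^ 2 - 4 * n) : ℤ) : ℚ) := by
      push_cast at h4 ⊢
      grind
    obtain ⟨z, hz⟩ : ∃ z : ℤ, p * (2 * h.im x) = z := by
      have : IsIntegral ℤ (p * (2 * h.im x)) :=
        IsIntegral.of_pow two_pos (by rw [h5]; exact isIntegral_intCast _)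
      obtain ⟨z, hz⟩ := IsIntegrallyClosed.isIntegral_iff.mp this
      exact ⟨z, by simpa using hz.symm⟩
    have h6 : z ^ 2 = p * (u ^ 2 - 4 * n) := by
      rw [hz] at h5
      exact_mod_cast h5
    have h7 : (p : ℤ) ∣ z := (Nat.prime_iff_prime_int.mp h.prime).dvd_of_dvd_pow ⟨_, h6⟩
    obtain ⟨w, rfl⟩ := h7
    refine ⟨w, ?_⟩
    have : (p : ℚ) ≠ 0 := mod_cast h.prime.ne_zero
    exact mul_left_cancel₀ this (by rw [hz]; push_cast; ring)
  have h8 : (p : ℤ) * w ^ 2 = u ^ 2 - 4 * n := by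
    rw [hw] at h4
    exact_mod_cast h4
  have hp4 : (p : ℤ) % 4 = 3 := mod_cast h.mod
  have h9 : u % 2 = 0 ∧ w % 2 = 0 := by
    have h10 : (u ^ 2 + w ^ 2) % 4 = 0 := by
      have : u ^ 2 + w ^ 2 = 4 * (n + (p / 4 + 1) * w ^ 2) := by grind
      omega
    clear hu hw h4 h8
    obtain ⟨a, rfl | rfl⟩ := Int.even_or_odd' u <;> obtain ⟨b, rfl | rfl⟩ := Int.even_or_odd' w <;>
      grind
  obtain ⟨a, rfl⟩ := Int.dvd_of_emod_eq_zero h9.1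
  obtain ⟨b, rfl⟩ := Int.dvd_of_emod_eq_zero h9.2
  refine ⟨a, b, ?_⟩
  rw [h.eq_coord x]
  push_cast at hu hw
  have e1 : h.re x = a := by linarith
  have e2 : h.im x = b := by linarith
  rw [e1, e2]; simp

lemma isInt_iff (h : IsSqrtGen F p θ) {x : F} :
    IsInt θ x ↔ ∃ r : 𝓞 F, algebraMap (𝓞 F) F r = x :=
  ⟨fun hx => ⟨⟨x, h.isIntegral_of_isInt hx⟩, rfl⟩, by
    rintro ⟨r, rfl⟩
    exact h.isInt_of_isIntegral r.2⟩

end IsSqrtGen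

end RealQuadratic

section Split

/-- Anticommuting elements with prescribed squares. -/
structure Anti {K H : Type} [Field K] [Ring H] [Algebra K H] (a b : K) (X Y : H) : Prop where
  sqX : X * X = algebraMap K H a
  sqY : Y * Y = algebraMap K H b
  anti : X * Y = -(Y * X)

lemma exists_norm_of_matrix {L : Type} [Field L] [CharZero L] {a b : L} (ha : a ≠ 0)
    (hb : b ≠ 0) {X Y : Matrix (Fin 2) (Fin 2) L} (hX : X * X = algebraMap L _ a)
    (hY : Y * Y = algebraMap L _ b) (hXY : X * Y = -(Y * X)) :
    ∃ x y : L, x ^ 2 - a * y ^ 2 = b⁻¹ := by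
  have h1 := congrFun (congrFun hX 0) 0
  have h2 := congrFun (congrFun hY 0) 0
  have h3 := congrFun (congrFun hXY 0) 0
  simp [Matrix.mul_apply, Fin.sum_univ_two, Matrix.algebraMap_matrix_apply] at h1 h2 h3
  by_cases h : X 1 0 = 0
  · have hr : X 0 0 ≠ 0 := by grind
    refine ⟨(1 + b⁻¹) / 2, (1 - b⁻¹) / (2 * X 0 0), ?_⟩
    rw [h] at h1
    have : a = X 0 0 ^ 2 := by linear_combination -h1
    rw [this]
    grind
  · refine ⟨(X 1 0 * Y 0 0 - Y 1 0 * X 0 0) / (X 1 0 * b), Y 1 0 / (X 1 0 * b), ?_⟩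
    grind

lemma isOpen_val_lt {R Γ : Type} [Ring R] [LinearOrderedCommGroupWithZero Γ] [Valued R Γ]
    (c : R) : IsOpen {z : R | Valued.v z < Valued.v c} := by
  have := Valued.isOpen_ball R (Valued.v.restrict c)
  simpa only [Valuation.restrict_lt_iff] using this

variable {F}

open IsDedekindDomain

/-- `H` splits at the finite place `v`. -/
def SplitAt (v : HeightOneSpectrum (𝓞 F)) (H : Type) [Ring H] [Algebra F H] : Prop :=
  Nonempty (H →ₐ[F] Matrix (Fin 2) (Fin 2) (v.adicCompletion F))

lemma SplitAt.exists_norm {v : HeightOneSpectrum (𝓞 F)} {H : Type} [Ring H] [Algebra F H]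
    (hs : SplitAt v H) {a b : F} {X Y : H} (h : Anti a b X Y) (ha : a ≠ 0) (hb : b ≠ 0) :
    ∃ x y : v.adicCompletion F, x ^ 2 - algebraMap F _ a * y ^ 2 = (algebraMap F _ b)⁻¹ := by
  obtain ⟨f⟩ := hs
  have : CharZero (v.adicCompletion F) :=
    charZero_of_injective_algebraMap (algebraMap F (v.adicCompletion F)).injective
  have key : ∀ c : F, f (algebraMap F H c) = algebraMap (v.adicCompletion F) _
      (algebraMap F (v.adicCompletion F) c) := by
    intro c
    rw [AlgHom.commutes]
    ext i j
    simp [Matrix.algebraMap_matrix_apply]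
  refine exists_norm_of_matrix (X := f X) (Y := f Y) (by simpa using ha) (by simpa using hb) ?_ ?_ ?_
  · rw [← map_mul, h.sqX, key]
  · rw [← map_mul, h.sqY, key]
  · rw [← map_mul, ← map_mul, ← map_neg, h.anti]

/-- `a` and `b` define a split quaternion algebra at `v`, approximated by global elements. -/
def ApproxNorm {K Γ : Type} [Field K] [LinearOrderedCommGroupWithZero Γ] (val : Valuation K Γ)
    (a b : K) : Prop :=
  ∀ γ : Γ, γ ≠ 0 → ∃ x y : K, val (x ^ 2 - a * y ^ 2 - b⁻¹) < γ

lemma SplitAt.approxNorm {v : HeightOneSpectrum (𝓞 F)} {H : Type} [Ring H] [Algebra F H]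
    (hs : SplitAt v H) {a b : F} {X Y : H} (h : Anti a b X Y) (ha : a ≠ 0) (hb : b ≠ 0) :
    ApproxNorm (v.valuation F) a b := by
  intro γ hγ
  obtain ⟨x, y, hxy⟩ := hs.exists_norm h ha hb
  let g : v.adicCompletion F × v.adicCompletion F → v.adicCompletion F := fun z =>
    z.1 ^ 2 - algebraMap F _ a * z.2 ^ 2 - (algebraMap F _ b)⁻¹
  have hg : Continuous g := by fun_prop
  obtain ⟨c, rfl⟩ := v.valuation_surjective F γ
  rw [← v.valuedAdicCompletion_eq_valuation'] at hγ
  have hopen : IsOpen (g ⁻¹' {z | Valued.v z < Valued.v (c : v.adicCompletion F)}) :=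
    (isOpen_val_lt _).preimage hg
  have hdense := (v.denseRange_algebraMap (K := F)).prodMap (v.denseRange_algebraMap (K := F))
  obtain ⟨z, hz1, ⟨w, hw⟩⟩ := hdense.inter_open_nonempty _ hopen ⟨(x, y), by
    simp only [Set.mem_preimage, Set.mem_ofPred_eq, g, hxy, sub_self, map_zero]
    exact zero_lt_iff.mpr hγ⟩
  refine ⟨w.1, w.2, ?_⟩
  rw [← hw] at hz1
  have : g (Prod.map (algebraMap F (v.adicCompletion F)) (algebraMap F (v.adicCompletion F)) w) =
      algebraMap F (v.adicCompletion F) (w.1 ^ 2 - a * w.2 ^ 2 - b⁻¹) := by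
    simp [g]
  rw [Set.mem_preimage, this] at hz1
  rw [← v.valuedAdicCompletion_eq_valuation', ← v.valuedAdicCompletion_eq_valuation']
  exact hz1

/-- Common denominators. -/
lemma exists_common_denominator {ι : Type} (s : Finset ι) (x : ι → F) :
    ∃ d : 𝓞 F, d ≠ 0 ∧ ∀ i ∈ s, ∃ n : 𝓞 F, algebraMap (𝓞 F) F d * x i = algebraMap (𝓞 F) F n := by
  classical
  obtain ⟨⟨d, hd⟩, h⟩ := IsLocalization.exist_integer_multiples (nonZeroDivisors (𝓞 F)) s x
  refine ⟨d, nonZeroDivisors.ne_zero hd, fun i hi => ?_⟩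
  obtain ⟨n, hn⟩ := h i hi
  exact ⟨n, by rw [hn, Algebra.smul_def]⟩

lemma exists_approx (s : Finset (HeightOneSpectrum (𝓞 F))) (x : HeightOneSpectrum (𝓞 F) → F)
    (γ : HeightOneSpectrum (𝓞 F) → WithZero (Multiplicative ℤ)) (hγ : ∀ v, γ v ≠ 0) :
    ∃ y : F, ∀ v ∈ s, v.valuation F (y - x v) < γ v := by
  classical
  obtain ⟨d, hd0, hd⟩ := exists_common_denominator s x
  choose! n hn using hd
  have hdF : algebraMap (𝓞 F) F d ≠ 0 := by simpa using hd0
  have he : ∀ v : HeightOneSpectrum (𝓞 F), ∃ e : ℕ,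
      WithZero.exp (-(e : ℤ)) < γ v * v.valuation F (algebraMap (𝓞 F) F d) := by
    intro v
    have h0 : γ v * v.valuation F (algebraMap (𝓞 F) F d) ≠ 0 :=
      mul_ne_zero (hγ v) ((Valuation.ne_zero_iff _).mpr hdF)
    obtain ⟨k, hk⟩ : ∃ k : ℤ, γ v * v.valuation F (algebraMap (𝓞 F) F d) = WithZero.exp k :=
      ⟨_, (WithZero.exp_log h0).symm⟩
    refine ⟨(1 - k).toNat, ?_⟩
    rw [hk, WithZero.exp_lt_exp]
    omega
  choose e he using he
  obtain ⟨m, hm⟩ := IsDedekindDomain.exists_forall_sub_mem_ideal (s := s)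
    (fun v => v.asIdeal) e (fun v _ => v.prime)
    (fun v _ w _ hvw h => hvw (HeightOneSpectrum.ext h)) (fun v => n v.1)
  refine ⟨algebraMap (𝓞 F) F m / algebraMap (𝓞 F) F d, fun v hv => ?_⟩
  have h1 : algebraMap (𝓞 F) F m / algebraMap (𝓞 F) F d - x v =
      algebraMap (𝓞 F) F (m - n v) / algebraMap (𝓞 F) F d := by
    grind
  rw [h1, map_div₀, div_lt_iff₀ (zero_lt_iff.mpr ((Valuation.ne_zero_iff _).mpr hdF))]
  refine lt_of_le_of_lt ?_ (he v)
  rw [HeightOneSpectrum.valuation_of_algebraMap, HeightOneSpectrum.intValuation_le_pow_iff_mem]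
  exact hm v hv

/-- A square-class dichotomy: if the second entry has odd valuation, the first is a square
modulo the maximal ideal. -/
lemma ApproxNorm.exists_sq {K Γ : Type} [Field K] [LinearOrderedCommGroupWithZero Γ]
    {val : Valuation K Γ} {a b : K} (h : ApproxNorm val a b) (ha : val a = 1) (hb0 : b ≠ 0)
    (hb : ∀ z, val (z ^ 2) ≠ val b) : ∃ t, val t ≤ 1 ∧ val (t ^ 2 - a) < 1 := by
  have hb0' : val b⁻¹ ≠ 0 := (Valuation.ne_zero_iff _).mpr (inv_ne_zero hb0)
  have hb1 : ∀ z, val (z ^ 2) ≠ val b⁻¹ := by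
    intro z hz
    refine hb z⁻¹ ?_
    rw [inv_pow, map_inv₀, hz, map_inv₀, inv_inv]
  obtain ⟨x, y, hxy⟩ := h _ hb0'
  have hn : val (x ^ 2 - a * y ^ 2) = val b⁻¹ := by
    rw [← Valuation.map_add_eq_of_lt_left _ hxy, add_sub_cancel]
  have hay : val (a * y ^ 2) = val (y ^ 2) := by grind
  have hxy' : val (x ^ 2) = val (y ^ 2) := by
    by_contra hne
    rcases lt_or_gt_of_ne hne with hlt | hlt
    · rw [Valuation.map_sub_eq_of_lt_right _ (by rwa [hay]), hay] at hn
      exact hb1 y hn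
    · rw [Valuation.map_sub_eq_of_lt_left _ (by rwa [hay])] at hn
      exact hb1 x hn
  have hy : y ≠ 0 := by grind
  have hvy : val (y ^ 2) ≠ 0 := (Valuation.ne_zero_iff _).mpr (pow_ne_zero 2 hy)
  have hle : val b⁻¹ < val (y ^ 2) := by
    refine lt_of_le_of_ne ?_ (hb1 y).symm
    rw [← hn]
    exact (Valuation.map_sub _ _ _).trans (by rw [hay, hxy', max_self])
  have e1 : val ((x / y) ^ 2) = 1 := by
    rw [div_pow, map_div₀, hxy', div_self hvy]
  refine ⟨x / y, ?_, ?_⟩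
  · rw [map_pow] at e1
    exact (pow_eq_one_iff_of_nonneg zero_le (by norm_num) |>.mp e1).le
  · have e2 : (x / y) ^ 2 - a = (x ^ 2 - a * y ^ 2) / y ^ 2 := by field_simp
    rw [e2, map_div₀, hn, div_lt_one₀ (zero_lt_iff.mpr hvy)]
    exact hle

end Split

section Transfer

open IsDedekindDomain

variable {F} {p : ℕ} {θ : F} {l : ℕ} [hl : Fact l.Prime]

lemma valuation_lead_add {x y : ℚ_[l]} (hx : x ≠ 0) (h : y = 0 ∨ x.valuation < y.valuation) :
    (x + y).valuation = x.valuation ∧ lead l (x + y) = lead l x := by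
  by_cases hy : y = 0
  · simp [hy]
  · exact add_of_valuation_lt hx hy (h.resolve_left hy)

lemma ne_zero_of_norm_eq_one {x : ℚ_[l]} (hx : ‖x‖ = 1) : x ≠ 0 := by
  rintro rfl
  simp at hx

lemma valuation_eq_zero_of_norm {x : ℚ_[l]} (hx : ‖x‖ = 1) : x.valuation = 0 := by
  have h1 := (Padic.norm_le_one_iff_val_nonneg x).mp hx.le
  have h2 := (Padic.norm_le_one_iff_val_nonneg x⁻¹).mp (by rw [norm_inv, hx, inv_one])
  rw [Padic.valuation_inv] at h2
  omega

lemma residue_mul_of_isSquare (x : ℚ_[l]) {u : ℚ_[l]} (hu : u ≠ 0) (he : Even u.valuation)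
    (hs : IsSquare (lead l u)) : residue l (x * u) = residue l x := by
  by_cases hx : x = 0
  · simp [hx]
  obtain ⟨z, hz⟩ := hs
  have hz0 : z ≠ 0 := by
    rintro rfl
    exact lead_ne_zero hu (by rw [hz, zero_mul])
  unfold residue
  rw [Padic.valuation_mul hx hu, lead_mul, hz, ← pow_two, wp_isWitt.sq _ _ hz0]
  grind

lemma isSquare_lead_sub {a b N : ℚ_[l]} (hN : ‖N‖ = 1) (h : N = a ^ 2 - b)
    (hb : b = 0 ∨ 0 < b.valuation) : IsSquare (lead l N) := by
  have := (valuation_lead_add (y := b) (ne_zero_of_norm_eq_one hN)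
    (by rwa [valuation_eq_zero_of_norm hN])).2
  rw [← this, h, sub_add_cancel, pow_two, lead_mul]
  exact ⟨_, rfl⟩

lemma valuation_pos_or {m : ℕ} {b : ℚ_[l]} (hb : b = 0 ∨ 0 < b.valuation) :
    (m : ℚ_[l]) * b ^ 2 = 0 ∨ 0 < ((m : ℚ_[l]) * b ^ 2).valuation := by
  rcases hb with rfl | hb
  · simp
  by_cases hm : (m : ℚ_[l]) = 0
  · simp [hm]
  by_cases hb0 : b = 0
  · simp [hb0]
  right
  rw [Padic.valuation_mul hm (pow_ne_zero 2 hb0), Padic.valuation_pow]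
  have : 0 ≤ (m : ℚ_[l]).valuation := by simp
  grind

/-- The binary form `z ↦ θ-coefficient of α z²`. -/
def IsSqrtGen.tr (h : IsSqrtGen F p θ) (α : F) : WP ℚ := wp (h.im α) - wp (h.im α * h.nm α)

namespace IsSqrtGen

lemma nm_cast (h : IsSqrtGen F p θ) (α : F) :
    ((h.nm α : ℚ) : ℚ_[l]) = (h.re α : ℚ_[l]) ^ 2 - p * (h.im α : ℚ_[l]) ^ 2 := by
  rw [nm]; push_cast; ring

/-- `α` is integral at `l` with norm a unit at `l`. -/
structure UnitAt (h : IsSqrtGen F p θ) (l : ℕ) [Fact l.Prime] (α : F) : Prop where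
  re : ‖(h.re α : ℚ_[l])‖ ≤ 1
  im : ‖(h.im α : ℚ_[l])‖ ≤ 1
  nm : ‖((h.nm α : ℚ) : ℚ_[l])‖ = 1

lemma padic_add_le {x y : ℚ_[l]} (hx : ‖x‖ ≤ 1) (hy : ‖y‖ ≤ 1) : ‖x + y‖ ≤ 1 :=
  (IsUltrametricDist.norm_add_le_max x y).trans (max_le hx hy)

lemma padic_mul_le {x y : ℚ_[l]} (hx : ‖x‖ ≤ 1) (hy : ‖y‖ ≤ 1) : ‖x * y‖ ≤ 1 := by
  rw [norm_mul]
  exact mul_le_one₀ hx (norm_nonneg _) hy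

lemma padic_natCast_le (n : ℕ) : ‖(n : ℚ_[l])‖ ≤ 1 := by
  exact_mod_cast Padic.norm_int_le_one (p := l) n

lemma mul_integral (h : IsSqrtGen F p θ) {α β : F}
    (hα : ‖(h.re α : ℚ_[l])‖ ≤ 1 ∧ ‖(h.im α : ℚ_[l])‖ ≤ 1)
    (hβ : ‖(h.re β : ℚ_[l])‖ ≤ 1 ∧ ‖(h.im β : ℚ_[l])‖ ≤ 1) :
    ‖(h.re (α * β) : ℚ_[l])‖ ≤ 1 ∧ ‖(h.im (α * β) : ℚ_[l])‖ ≤ 1 := by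
  rw [(h.re_im_mul α β).1, (h.re_im_mul α β).2]
  push_cast
  exact ⟨padic_add_le (padic_mul_le hα.1 hβ.1)
      (padic_mul_le (padic_natCast_le p) (padic_mul_le hα.2 hβ.2)),
    padic_add_le (padic_mul_le hα.1 hβ.2) (padic_mul_le hα.2 hβ.1)⟩

lemma UnitAt.mul {h : IsSqrtGen F p θ} {α β : F} (hα : h.UnitAt l α) (hβ : h.UnitAt l β) :
    h.UnitAt l (α * β) :=
  have := h.mul_integral ⟨hα.1, hα.2⟩ ⟨hβ.1, hβ.2⟩
  ⟨this.1, this.2, by rw [h.nm_mul]; push_cast; rw [norm_mul, hα.3, hβ.3, one_mul]⟩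

lemma re_im_neg (h : IsSqrtGen F p θ) (x : F) : h.re (-x) = -h.re x ∧ h.im (-x) = -h.im x :=
  h.re_im_of_eq (by nth_rewrite 1 [h.eq_coord x]; push_cast; ring)

lemma UnitAt.neg {h : IsSqrtGen F p θ} {α : F} (hα : h.UnitAt l α) : h.UnitAt l (-α) :=
  ⟨by rw [(h.re_im_neg α).1]; push_cast; rw [norm_neg]; exact hα.1,
    by rw [(h.re_im_neg α).2]; push_cast; rw [norm_neg]; exact hα.2,
    by rw [h.nm_neg]; exact hα.3⟩

lemma UnitAt.isSquare_or {h : IsSqrtGen F p θ} {α : F} (hα : h.UnitAt l α) :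
    IsSquare (lead l ((h.nm α : ℚ) : ℚ_[l])) ∨
      ((h.im α : ℚ_[l]) ≠ 0 ∧ (h.im α : ℚ_[l]).valuation = 0) := by
  by_cases h0 : (h.im α : ℚ_[l]) ≠ 0 ∧ (h.im α : ℚ_[l]).valuation = 0
  · exact Or.inr h0
  · refine Or.inl (isSquare_lead_sub hα.3 (h.nm_cast α) (valuation_pos_or ?_))
    have := (Padic.norm_le_one_iff_val_nonneg _).mp hα.2
    grind

lemma ratResidue_tr (h : IsSqrtGen F p θ) (α : F) : ratResidue l (h.tr α) =
    residue l (h.im α : ℚ_[l]) - residue l ((h.im α : ℚ_[l]) * ((h.nm α : ℚ) : ℚ_[l])) := by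
  rw [tr, map_sub, ratResidue_wp, ratResidue_wp]; push_cast; rfl

lemma UnitAt.residue_tr {h : IsSqrtGen F p θ} {α : F} (hα : h.UnitAt l α) :
    ratResidue l (h.tr α) = 0 := by
  have h0 := ne_zero_of_norm_eq_one hα.3
  have hv := valuation_eq_zero_of_norm hα.3
  rw [ratResidue_tr]
  rcases hα.isSquare_or with hs | ⟨h1, h2⟩
  · rw [residue_mul_of_isSquare _ h0 (by simp [hv]) hs, sub_self]
  · rw [residue, residue, if_pos (by simp [h2]), Padic.valuation_mul h1 h0,
      if_pos (by simp [h2, hv]), sub_self]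

lemma tr_mul_sq (h : IsSqrtGen F p θ) (α : F) {c : ℚ} (hc : c ≠ 0) :
    h.tr (α * (c : F) ^ 2) = h.tr α := by
  have e : h.im (α * (c : F) ^ 2) = h.im α * c ^ 2 := by
    rw [← Rat.cast_pow, (h.re_im_mul _ _).2, (h.re_im_ratCast _).1, (h.re_im_ratCast _).2]; ring
  have e2 : h.nm (α * (c : F) ^ 2) = h.nm α * (c ^ 2) ^ 2 := by
    rw [h.nm_mul, ← Rat.cast_pow, h.nm_ratCast]
  rw [tr, tr, e, e2, wp_isWitt.sq _ _ hc]
  congr 1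
  exact wp_sq_mul _ (pow_ne_zero 3 hc) (by ring)

lemma UnitAt.residue_tr_mul {h : IsSqrtGen F p θ} {α : F} (hα : h.UnitAt l α) :
    ∃ u : ZMod l, u ≠ 0 ∧ ratResidue l (h.tr (α * (l : ℚ))) =
      wp u - wp (u * lead l ((h.nm α : ℚ) : ℚ_[l])) := by
  have h0 := ne_zero_of_norm_eq_one hα.3
  have hv := valuation_eq_zero_of_norm hα.3
  have hl0 : (l : ℚ_[l]) ≠ 0 := mod_cast hl.out.ne_zero
  have e : h.im (α * (l : ℚ)) = h.im α * l := by
    rw [(h.re_im_mul _ _).2, (h.re_im_ratCast _).1, (h.re_im_ratCast _).2]; ring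
  have e2 : h.nm (α * (l : ℚ)) = h.nm α * l ^ 2 := by
    rw [h.nm_mul, h.nm_ratCast]
  rw [ratResidue_tr, e, e2]
  push_cast
  rw [← mul_assoc _ _ ((l : ℚ_[l]) ^ 2), residue_mul_sq _ _ hl0]
  rcases hα.isSquare_or with hs | ⟨h1, h2⟩
  · refine ⟨1, one_ne_zero, ?_⟩
    rw [residue_mul_of_isSquare _ h0 (by simp [hv]) hs, sub_self]
    obtain ⟨z, hz⟩ := hs
    have hz0 : z ≠ 0 := by
      rintro rfl
      exact lead_ne_zero h0 (by rw [hz, zero_mul])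
    rw [hz, ← pow_two, wp_isWitt.sq _ _ hz0, sub_self]
  · have v1 : ((h.im α : ℚ_[l]) * l).valuation = 1 := by
      rw [Padic.valuation_mul h1 hl0, h2, Padic.valuation_p]; norm_num
    refine ⟨lead l ((h.im α : ℚ_[l]) * l), lead_ne_zero (mul_ne_zero h1 hl0), ?_⟩
    rw [residue, residue, if_neg (by simp [v1]),
      Padic.valuation_mul (mul_ne_zero h1 hl0) h0, v1, hv, if_neg (by simp), lead_mul _ (h.nm α : ℚ_[l])]

lemma signature_tr (h : IsSqrtGen F p θ) {α : F} (hα : 0 < h.nm α) : signature (h.tr α) = 0 := by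
  rw [tr, map_sub, signature_wp, signature_wp, sign_mul, sign_pos hα, mul_one, sub_self]

lemma dyadic_tr (h : IsSqrtGen F p θ) {α : F} (hα : α ≠ 0) :
    dyadic (h.tr α) = (padicValRat 2 (h.nm α) : ZMod 2) := by
  rw [tr, map_sub, dyadic_wp, dyadic_wp]
  by_cases h0 : h.im α = 0
  · have h1 : h.re α ≠ 0 := by
      intro h1
      exact hα (by rw [h.eq_coord α, h0, h1]; simp)
    have : h.nm α = h.re α * h.re α := by rw [nm, h0]; ring
    rw [this, padicValRat.mul h1 h1, h0]
    grind
  · rw [padicValRat.mul h0 (h.nm_ne_zero hα)]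
    grind

/-- Coefficientwise reduction for elements close to `1`. -/
lemma residue_tr_of_close (h : IsSqrtGen F p θ) {A B : F} {N : ℕ} (hA : A ≠ 0)
    (hA0 : ‖(h.re A : ℚ_[l])‖ ≤ 1 ∧ ‖(h.im A : ℚ_[l])‖ ≤ 1)
    (hN : 0 < N) (hN' : (h.im A : ℚ_[l]).valuation < N) {β : F}
    (hβ : ‖(h.re β : ℚ_[l])‖ ≤ 1 ∧ ‖(h.im β : ℚ_[l])‖ ≤ 1) (hB : B = 1 + (l : F) ^ N * β) :
    ratResidue l (h.tr (-A) + h.tr (-B) + h.tr (A * B)) = 0 := by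
  have hl0 : (l : ℚ_[l]) ≠ 0 := mod_cast hl.out.ne_zero
  have hBc : h.re B = 1 + l ^ N * h.re β ∧ h.im B = l ^ N * h.im β :=
    h.re_im_of_eq (by
      rw [hB]
      nth_rewrite 1 [h.eq_coord β]
      push_cast; ring)
  have hsmall : ∀ {x : ℚ_[l]}, ‖x‖ ≤ 1 → (l : ℚ_[l]) ^ N * x = 0 ∨
      (N : ℤ) ≤ ((l : ℚ_[l]) ^ N * x).valuation := by
    intro x hx
    by_cases hx0 : x = 0
    · simp [hx0]
    · right
      have := (Padic.norm_le_one_iff_val_nonneg _).mp hx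
      rw [Padic.valuation_mul (pow_ne_zero N hl0) hx0, Padic.valuation_pow, Padic.valuation_p]
      omega
  have hone : ∀ {x : ℚ_[l]}, ‖x‖ ≤ 1 →
      (1 + (l : ℚ_[l]) ^ N * x).valuation = 0 ∧ lead l (1 + (l : ℚ_[l]) ^ N * x) = lead l 1 := by
    intro x hx
    have := valuation_lead_add (l := l) (x := 1) (y := (l : ℚ_[l]) ^ N * x) one_ne_zero (by
      rw [Padic.valuation_one]
      exact (hsmall hx).imp_right fun h => by omega)
    rwa [Padic.valuation_one] at this
  have hne : ∀ {x : ℚ_[l]}, ‖x‖ ≤ 1 → 1 + (l : ℚ_[l]) ^ N * x ≠ 0 := by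
    intro x hx h0
    have := (hone hx).2
    rw [h0, lead_zero] at this
    exact lead_ne_zero (l := l) one_ne_zero this.symm
  have hlN : ‖(l : ℚ_[l]) ^ N‖ ≤ 1 := by
    rw [norm_pow]
    exact pow_le_one₀ (norm_nonneg _) (padic_natCast_le l)
  have hneg {x : ℚ_[l]} (hx : ‖x‖ ≤ 1) : ‖-x‖ ≤ 1 := by rwa [norm_neg]
  obtain ⟨ν, hν, hνe⟩ : ∃ ν : ℚ_[l], ‖ν‖ ≤ 1 ∧ ((h.nm B : ℚ) : ℚ_[l]) = 1 + (l : ℚ_[l]) ^ N * ν := by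
    refine ⟨2 * (h.re β : ℚ_[l]) + (l : ℚ_[l]) ^ N * (h.re β : ℚ_[l]) ^ 2 +
      -(p * ((l : ℚ_[l]) ^ N * (h.im β : ℚ_[l]) ^ 2)), ?_, ?_⟩
    · have h2 : ‖(2 : ℚ_[l])‖ ≤ 1 := mod_cast padic_natCast_le (l := l) 2
      simp only [pow_two (_ : ℚ_[l])]
      exact padic_add_le (padic_add_le (padic_mul_le h2 hβ.1)
        (padic_mul_le hlN (padic_mul_le hβ.1 hβ.1)))
        (hneg (padic_mul_le (padic_natCast_le p) (padic_mul_le hlN (padic_mul_le hβ.2 hβ.2))))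
    · rw [h.nm_cast, hBc.1, hBc.2]; push_cast; ring
  have hsq1 : IsSquare (lead l (1 : ℚ_[l])) :=
    ⟨lead l 1, by rw [← lead_mul, one_mul]⟩
  have hBu : ∀ x : ℚ_[l], residue l (x * ((h.nm B : ℚ) : ℚ_[l])) = residue l x := by
    intro x
    rw [hνe]
    exact residue_mul_of_isSquare x (hne hν) (by rw [(hone hν).1]; simp)
      (by rw [(hone hν).2]; exact hsq1)
  have hB0 : ratResidue l (h.tr (-B)) = 0 := by
    rw [ratResidue_tr, h.nm_neg, hBu, sub_self]
  rw [map_add, map_add, hB0, add_zero, ratResidue_tr, ratResidue_tr, h.nm_neg, h.nm_mul,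
    (h.re_im_neg A).2]
  push_cast
  rw [← mul_assoc ((h.im (A * B) : ℚ) : ℚ_[l]), hBu, neg_mul, residue_neg, residue_neg]
  by_cases hA1 : h.im A = 0
  · have e : h.nm A = h.re A ^ 2 := by rw [nm, hA1]; ring
    have h1 : (h.re A : ℚ_[l]) ≠ 0 := by
      intro h1
      exact hA (by rw [h.eq_coord A, hA1, Rat.cast_eq_zero.mp h1]; simp)
    rw [hA1, e]
    push_cast
    rw [residue_mul_sq ((h.im (A * B) : ℚ) : ℚ_[l]) _ h1]
    simp
  · have hA1' : (h.im A : ℚ_[l]) ≠ 0 := mod_cast hA1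
    have key : ((h.im (A * B) : ℚ) : ℚ_[l]).valuation = (h.im A : ℚ_[l]).valuation ∧
        lead l ((h.im (A * B) : ℚ) : ℚ_[l]) = lead l (h.im A : ℚ_[l]) := by
      have e : ((h.im (A * B) : ℚ) : ℚ_[l]) = h.im A +
          (l : ℚ_[l]) ^ N * (h.im A * h.re β + h.re A * h.im β) := by
        rw [(h.re_im_mul A B).2, hBc.1, hBc.2]; push_cast; ring
      rw [e]
      refine valuation_lead_add hA1' ?_
      exact (hsmall (padic_add_le (padic_mul_le hA0.2 hβ.1) (padic_mul_le hA0.1 hβ.2))).imp_right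
        fun h => by omega
    have e1 : residue l ((h.im (A * B) : ℚ) : ℚ_[l]) = residue l (h.im A : ℚ_[l]) :=
      residue_congr (by rw [key.1]) key.2
    have hAB : ((h.im (A * B) : ℚ) : ℚ_[l]) ≠ 0 := by
      intro h0
      rw [h0, lead_zero] at key
      exact lead_ne_zero hA1' key.2.symm
    have hn : ((h.nm A : ℚ) : ℚ_[l]) ≠ 0 := mod_cast h.nm_ne_zero hA
    have e2 : residue l (((h.im (A * B) : ℚ) : ℚ_[l]) * ((h.nm A : ℚ) : ℚ_[l])) =
        residue l ((h.im A : ℚ_[l]) * ((h.nm A : ℚ) : ℚ_[l])) :=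
      residue_congr (by rw [Padic.valuation_mul hAB hn, Padic.valuation_mul hA1' hn, key.1])
        (by rw [lead_mul, lead_mul, key.2])
    grind

end IsSqrtGen

end Transfer

section Local

open IsDedekindDomain

variable {F} {p : ℕ} {θ : F} {l : ℕ} [hl : Fact l.Prime]

namespace IsSqrtGen

/-- Integrality at `l` of the coordinates. -/
def IntAt (h : IsSqrtGen F p θ) (l : ℕ) [Fact l.Prime] (α : F) : Prop :=
  ‖(h.re α : ℚ_[l])‖ ≤ 1 ∧ ‖(h.im α : ℚ_[l])‖ ≤ 1

lemma IntAt.of_int (h : IsSqrtGen F p θ) (r : 𝓞 F) : h.IntAt l (algebraMap (𝓞 F) F r) := by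
  obtain ⟨m, n, hr⟩ := h.isInt_iff.mpr ⟨r, rfl⟩
  obtain ⟨h1, h2⟩ := h.re_im_of_eq (x := algebraMap (𝓞 F) F r) (a := m) (b := n) (by simpa using hr)
  rw [IntAt, h1, h2]
  exact ⟨by simpa using Padic.norm_int_le_one m, by simpa using Padic.norm_int_le_one n⟩

lemma IntAt.mul {h : IsSqrtGen F p θ} {α β : F} (hα : h.IntAt l α) (hβ : h.IntAt l β) :
    h.IntAt l (α * β) := h.mul_integral hα hβ

lemma IntAt.neg {h : IsSqrtGen F p θ} {α : F} (hα : h.IntAt l α) : h.IntAt l (-α) := by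
  rw [IntAt, (h.re_im_neg α).1, (h.re_im_neg α).2]
  push_cast
  rwa [norm_neg, norm_neg]

lemma IntAt.conj {h : IsSqrtGen F p θ} {α : F} (hα : h.IntAt l α) : h.IntAt l (h.conj α) := by
  rw [IntAt, (h.re_im_conj α).1, (h.re_im_conj α).2]
  push_cast
  rwa [norm_neg]

lemma re_im_mul_rat (h : IsSqrtGen F p θ) (α : F) (c : ℚ) :
    h.re (α * c) = h.re α * c ∧ h.im (α * c) = h.im α * c := by
  rw [(h.re_im_mul _ _).1, (h.re_im_mul _ _).2, (h.re_im_ratCast c).1, (h.re_im_ratCast c).2]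
  grind

lemma IntAt.of_rat_mul {h : IsSqrtGen F p θ} {α : F} {c : ℚ} (hc : ‖(c : ℚ_[l])‖ = 1)
    (hα : h.IntAt l (α * c)) : h.IntAt l α := by
  rw [IntAt, (h.re_im_mul_rat α c).1, (h.re_im_mul_rat α c).2] at hα
  push_cast at hα
  rwa [norm_mul, norm_mul, hc, mul_one, mul_one] at hα

lemma intAt_of_valuation (h : IsSqrtGen F p θ) {β : F}
    (hβ : ∀ v : HeightOneSpectrum (𝓞 F), (l : 𝓞 F) ∈ v.asIdeal → v.valuation F β ≤ 1) :
    h.IntAt l β := by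
  have hl0 : (l : 𝓞 F) ≠ 0 := mod_cast hl.out.ne_zero
  let I : Ideal (𝓞 F) :=
    { carrier := {d | ∃ r : 𝓞 F, algebraMap (𝓞 F) F d * β = algebraMap (𝓞 F) F r}
      zero_mem' := ⟨0, by simp⟩
      add_mem' := by
        rintro a b ⟨r, hr⟩ ⟨t, ht⟩
        exact ⟨r + t, by rw [map_add, map_add, add_mul, hr, ht]⟩
      smul_mem' := by
        rintro c a ⟨r, hr⟩
        exact ⟨c * r, by rw [smul_eq_mul, map_mul, map_mul, mul_assoc, hr]⟩ }
  have htop : I ⊔ Ideal.span {(l : 𝓞 F)} = ⊤ := by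
    by_contra hne
    obtain ⟨P, hP, hle⟩ := Ideal.exists_le_maximal _ hne
    have hlP : (l : 𝓞 F) ∈ P := hle (Ideal.mem_sup_right (Ideal.mem_span_singleton_self _))
    let v : HeightOneSpectrum (𝓞 F) := ⟨P, hP.isPrime, by
      rintro rfl
      exact hl0 (by simpa using hlP)⟩
    obtain ⟨n, d, hd⟩ := v.exists_primeCompl_mul_eq_of_integer β (hβ v hlP)
    have : (d : 𝓞 F) ∈ I := ⟨n, by rw [mul_comm]; exact hd⟩
    exact d.2 (hle (Ideal.mem_sup_left this))
  obtain ⟨d, ⟨r, hr⟩, y, hy, hdy⟩ := Submodule.mem_sup.mp (htop ▸ Submodule.mem_top : (1 : 𝓞 F) ∈ _)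
  obtain ⟨e, rfl⟩ := Ideal.mem_span_singleton'.mp hy
  set D := algebraMap (𝓞 F) F d with hD
  have hDe : D = 1 - algebraMap (𝓞 F) F e * (l : ℚ) := by
    have := congrArg (algebraMap (𝓞 F) F) hdy
    simp only [map_add, map_mul, map_natCast, map_one] at this
    push_cast
    linear_combination this
  have hnm : ‖((h.nm D : ℚ) : ℚ_[l])‖ = 1 := by
    have he := IntAt.of_int (l := l) h e
    obtain ⟨h1, h2⟩ := h.re_im_of_eq (x := D) (a := 1 - h.re (algebraMap (𝓞 F) F e) * l)
      (b := -h.im (algebraMap (𝓞 F) F e) * l) (by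
        rw [hDe]
        nth_rewrite 1 [h.eq_coord (algebraMap (𝓞 F) F e)]
        push_cast; ring)
    set a := (h.re (algebraMap (𝓞 F) F e) : ℚ_[l])
    set b := (h.im (algebraMap (𝓞 F) F e) : ℚ_[l])
    have e1 : ((h.nm D : ℚ) : ℚ_[l]) = 1 + l * (-((2 : ℕ) * a) + l * (a * a) + -(p * (l * (b * b)))) := by
      rw [h.nm_cast, h1, h2]; push_cast; ring
    have hneg {x : ℚ_[l]} (hx : ‖x‖ ≤ 1) : ‖-x‖ ≤ 1 := by rwa [norm_neg]
    have hlt : ‖(l : ℚ_[l]) * (-((2 : ℕ) * a) + l * (a * a) + -(p * (l * (b * b))))‖ < 1 := by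
      rw [norm_mul]
      refine mul_lt_one_of_nonneg_of_lt_one_left (norm_nonneg _) Padic.norm_p_lt_one ?_
      exact padic_add_le (padic_add_le (hneg (padic_mul_le (padic_natCast_le 2) he.1))
        (padic_mul_le (padic_natCast_le l) (padic_mul_le he.1 he.1)))
        (hneg (padic_mul_le (padic_natCast_le p) (padic_mul_le (padic_natCast_le l)
          (padic_mul_le he.2 he.2))))
    rw [e1, IsUltrametricDist.norm_add_eq_max_of_norm_ne_norm (by rw [norm_one]; exact hlt.ne'),
      norm_one, max_eq_left hlt.le]
  refine IntAt.of_rat_mul hnm ?_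
  rw [← h.mul_conj, show β * (D * h.conj D) = (D * β) * h.conj D by ring, hr]
  exact (IntAt.of_int h r).mul (IntAt.of_int h d).conj

lemma valuation_rat_le {v : HeightOneSpectrum (𝓞 F)} (hv : (l : 𝓞 F) ∈ v.asIdeal) {q : ℚ}
    (hq : ‖(q : ℚ_[l])‖ ≤ 1) : v.valuation F (q : F) ≤ 1 := by
  have hden : ¬ l ∣ q.den := by
    simpa [Nat.Prime.coprime_iff_not_dvd hl.out] using
      PadicInt.isUnit_iff.mp (PadicInt.isUnit_den _ hq)
  have hd : (q.den : 𝓞 F) ∉ v.asIdeal := by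
    intro hmem
    have hc : IsCoprime (l : ℤ) q.den :=
      Nat.isCoprime_iff_coprime.mpr ((Nat.Prime.coprime_iff_not_dvd hl.out).mpr hden)
    obtain ⟨a, b, hab⟩ := hc
    refine v.isPrime.ne_top ((Ideal.eq_top_iff_one _).mpr ?_)
    have : (1 : 𝓞 F) = a * l + b * q.den := mod_cast congrArg (Int.cast (R := 𝓞 F)) hab.symm
    rw [this]
    exact Ideal.add_mem _ (Ideal.mul_mem_left _ _ hv) (Ideal.mul_mem_left _ _ hmem)
  have h1 : v.valuation F (q.den : F) = 1 := by
    have := (v.valuation_eq_one_iff_notMem (K := F) (r := (q.den : 𝓞 F))).mpr hd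
    simpa using this
  have h2 : v.valuation F (q.num : F) ≤ 1 := by
    have := v.valuation_le_one (K := F) (q.num : 𝓞 F)
    simpa using this
  rw [Rat.cast_def, map_div₀, h1, div_one]
  exact h2

lemma IntAt.valuation_le {h : IsSqrtGen F p θ} {α : F} (hα : h.IntAt l α)
    {v : HeightOneSpectrum (𝓞 F)} (hv : (l : 𝓞 F) ∈ v.asIdeal) : v.valuation F α ≤ 1 := by
  have hθ : v.valuation F θ ≤ 1 := by
    obtain ⟨r, hr⟩ := (h.isInt_iff (x := θ)).mp ⟨0, 1, by simp⟩
    rw [← hr]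
    exact v.valuation_le_one r
  rw [h.eq_coord α]
  refine (Valuation.map_add _ _ _).trans (max_le (valuation_rat_le hv hα.1) ?_)
  rw [map_mul]
  exact mul_le_one' (valuation_rat_le hv hα.2) hθ

lemma UnitAt.valuation_eq {h : IsSqrtGen F p θ} {α : F} (hα : h.UnitAt l α)
    {v : HeightOneSpectrum (𝓞 F)} (hv : (l : 𝓞 F) ∈ v.asIdeal) : v.valuation F α = 1 := by
  have hi : h.IntAt l α := ⟨hα.1, hα.2⟩
  have h1 := hi.valuation_le hv
  have h2 := hi.conj.valuation_le hv
  have h3 : ‖(((h.nm α)⁻¹ : ℚ) : ℚ_[l])‖ ≤ 1 := by push_cast; rw [norm_inv, hα.3, inv_one]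
  have h4 := valuation_rat_le hv h3
  have hn : h.nm α ≠ 0 := by
    intro h0
    have := hα.3
    rw [h0] at this; simp at this
  have e : (1 : F) = α * (h.conj α * ((h.nm α)⁻¹ : ℚ)) := by
    rw [← mul_assoc, h.mul_conj]; push_cast
    rw [mul_inv_cancel₀ (mod_cast hn)]
  refine le_antisymm h1 ?_
  have := congrArg (v.valuation F) e
  rw [map_one, map_mul, map_mul] at this
  calc (1 : WithZero (Multiplicative ℤ)) = _ := this
    _ ≤ v.valuation F α * 1 := mul_le_mul_right (mul_le_one' h2 h4) _
    _ = _ := mul_one _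

lemma norm_nm_of_inert (h : IsSqrtGen F p θ) (hin : ¬ IsSquare (p : ZMod l)) {α : F}
    (hα : h.IntAt l α) (hα1 : ‖(h.re α : ℚ_[l])‖ = 1 ∨ ‖(h.im α : ℚ_[l])‖ = 1) :
    ‖((h.nm α : ℚ) : ℚ_[l])‖ = 1 := by
  let a : ℤ_[l] := ⟨_, hα.1⟩
  let b : ℤ_[l] := ⟨_, hα.2⟩
  have e : ((h.nm α : ℚ) : ℚ_[l]) = ((a ^ 2 - p * b ^ 2 : ℤ_[l]) : ℚ_[l]) := by
    rw [h.nm_cast]; push_cast; rfl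
  rw [e]
  refine (toZMod_ne_zero_iff l (a ^ 2 - p * b ^ 2)).mp fun h0 => ?_
  rw [map_sub, map_mul, map_pow, map_pow, map_natCast, sub_eq_zero] at h0
  have hb : PadicInt.toZMod b = 0 := by
    by_contra hb
    refine hin ⟨PadicInt.toZMod a / PadicInt.toZMod b, ?_⟩
    grind
  have ha : PadicInt.toZMod a = 0 := by simpa [hb] using h0
  rcases hα1 with h1 | h1
  · exact (toZMod_ne_zero_iff l a).mpr h1 ha
  · exact (toZMod_ne_zero_iff l b).mpr h1 hb

lemma exists_primitive (h : IsSqrtGen F p θ) (hin : ¬ IsSquare (p : ZMod l)) {B : F}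
    (hB : B ≠ 0) : ∃ (m : ℤ) (B' : F), h.UnitAt l B' ∧ B = B' * (((l : ℚ) ^ m : ℚ) : F) := by
  have hl0 : (l : ℚ) ≠ 0 := mod_cast hl.out.ne_zero
  have hl0' : (l : ℚ_[l]) ≠ 0 := mod_cast hl.out.ne_zero
  have key : ∀ x : ℚ_[l], x ≠ 0 → ‖(h.re B : ℚ_[l])‖ ≤ ‖x‖ → ‖(h.im B : ℚ_[l])‖ ≤ ‖x‖ →
      (x = h.re B ∨ x = h.im B) →
      ∃ (m : ℤ) (B' : F), h.UnitAt l B' ∧ B = B' * (((l : ℚ) ^ m : ℚ) : F) := by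
    intro x hx h1 h2 h3
    have hx' := norm_mul_zpow_neg_valuation l hx
    set c := (l : ℚ_[l]) ^ (-x.valuation) with hc
    have hc0 : 0 < ‖c‖ := norm_pos_iff.mpr (zpow_ne_zero _ hl0')
    have e1 := h.re_im_mul_rat B ((l : ℚ) ^ (-x.valuation))
    have hi : h.IntAt l (B * (((l : ℚ) ^ (-x.valuation) : ℚ) : F)) := by
      rw [IntAt, e1.1, e1.2, Rat.cast_mul, Rat.cast_mul, Rat.cast_zpow, Rat.cast_natCast, ← hc,
        norm_mul, norm_mul]
      rw [norm_mul] at hx'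
      exact ⟨hx' ▸ mul_le_mul_of_nonneg_right h1 hc0.le, hx' ▸ mul_le_mul_of_nonneg_right h2 hc0.le⟩
    refine ⟨x.valuation, B * (((l : ℚ) ^ (-x.valuation) : ℚ) : F),
      ⟨hi.1, hi.2, h.norm_nm_of_inert hin hi ?_⟩, ?_⟩
    · rw [e1.1, e1.2, Rat.cast_mul, Rat.cast_mul, Rat.cast_zpow, Rat.cast_natCast, ← hc]
      rcases h3 with h3 | h3
      · exact Or.inl (h3 ▸ hx')
      · exact Or.inr (h3 ▸ hx')
    · rw [mul_assoc, ← Rat.cast_mul, ← zpow_add₀ hl0, neg_add_cancel, zpow_zero, Rat.cast_one, mul_one]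
  by_cases hle : ‖(h.re B : ℚ_[l])‖ ≤ ‖(h.im B : ℚ_[l])‖
  · refine key (h.im B) ?_ hle le_rfl (Or.inr rfl)
    intro h0
    rw [h0, norm_zero, norm_le_zero_iff] at hle
    exact hB (by rw [h.eq_coord B, Rat.cast_eq_zero.mp hle, Rat.cast_eq_zero.mp h0]; simp)
  · refine key (h.re B) ?_ le_rfl (not_le.mp hle).le (Or.inl rfl)
    intro h0
    rw [h0, norm_zero, not_le] at hle
    exact absurd hle (norm_nonneg _).not_gt

omit hl in
lemma exists_place (h : IsSqrtGen F p θ) [hl : Fact l.Prime] :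
    ∃ v : HeightOneSpectrum (𝓞 F), (l : 𝓞 F) ∈ v.asIdeal := by
  by_contra! hc
  have h1 := h.intAt_of_valuation (l := l) (β := ((l : ℚ)⁻¹ : ℚ)) (fun v hv => absurd hv (hc v))
  have h2 := h1.1
  rw [(h.re_im_ratCast _).1] at h2
  push_cast at h2
  rw [norm_inv, Padic.norm_p, inv_inv] at h2
  have := hl.out.one_lt
  have : (1 : ℝ) < l := mod_cast this
  linarith

/-- Local reciprocity for unit entries at an inert prime. -/
lemma residue_of_inert (h : IsSqrtGen F p θ) (hl2 : l ≠ 2) (hin : ¬ IsSquare (p : ZMod l))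
    {A B : F} (hA : h.UnitAt l A) (hB : B ≠ 0)
    (hap : ∀ v : HeightOneSpectrum (𝓞 F), (l : 𝓞 F) ∈ v.asIdeal →
      ApproxNorm (v.valuation F) A B) :
    ratResidue l (h.tr (-A) + h.tr (-B) + h.tr (A * B)) = 0 := by
  have hl0 : (l : ℚ) ≠ 0 := mod_cast hl.out.ne_zero
  have hlF : (l : F) ≠ 0 := mod_cast hl.out.ne_zero
  obtain ⟨m, B', hB', hBe⟩ := h.exists_primitive hin hB
  rw [map_add, map_add, hA.neg.residue_tr, zero_add]
  rcases Int.even_or_odd' m with ⟨k, hk | hk⟩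
  · have e : B = B' * (((l : ℚ) ^ k : ℚ) : F) ^ 2 := by
      rw [hBe, ← Rat.cast_pow, ← zpow_natCast, ← zpow_mul, hk, mul_comm k]; rfl
    have e1 : -B = -B' * (((l : ℚ) ^ k : ℚ) : F) ^ 2 := by rw [e, neg_mul]
    have e2 : A * B = A * B' * (((l : ℚ) ^ k : ℚ) : F) ^ 2 := by rw [e, mul_assoc]
    rw [e1, e2, h.tr_mul_sq _ (zpow_ne_zero k hl0), h.tr_mul_sq _ (zpow_ne_zero k hl0),
      hB'.neg.residue_tr, (hA.mul hB').residue_tr, add_zero]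
  · have e : B = B' * (l : ℚ) * (((l : ℚ) ^ k : ℚ) : F) ^ 2 := by
      rw [hBe, hk, ← Rat.cast_pow, ← zpow_natCast, ← zpow_mul, mul_assoc, ← Rat.cast_mul,
        ← zpow_one_add₀ hl0, add_comm, mul_comm k]; rfl
    have e1 : -B = -B' * (l : ℚ) * (((l : ℚ) ^ k : ℚ) : F) ^ 2 := by rw [e]; ring
    have e2 : A * B = A * B' * (l : ℚ) * (((l : ℚ) ^ k : ℚ) : F) ^ 2 := by rw [e]; ring
    rw [e1, e2, h.tr_mul_sq _ (zpow_ne_zero k hl0), h.tr_mul_sq _ (zpow_ne_zero k hl0)]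
    obtain ⟨v, hv⟩ := h.exists_place (l := l)
    have hvl : v.valuation F (l : F) < 1 := by
      have := (v.valuation_lt_one_iff_mem (K := F) (l : 𝓞 F)).mpr hv
      simpa using this
    have hvl0 : v.valuation F (l : F) ≠ 0 := (Valuation.ne_zero_iff _).mpr hlF
    have hval : ∀ (n : ℤ) (z : F), h.UnitAt l z →
        v.valuation F (z * (((l : ℚ) ^ n : ℚ) : F)) = v.valuation F (l : F) ^ n := by
      intro n z hz
      rw [map_mul, hz.valuation_eq hv, one_mul, Rat.cast_zpow, map_zpow₀, Rat.cast_natCast]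
    have hexp : ∀ n : ℤ, v.valuation F (l : F) ^ n ≤ 1 → 0 ≤ n := by
      intro n hn
      by_contra! hneg
      exact absurd hn (not_le.mpr (one_lt_zpow_of_neg₀ (zero_lt_iff.mpr hvl0) hvl hneg))
    have hintA : ∀ z : F, v.valuation F z ≤ 1 → h.IntAt l z := by
      intro z hz
      by_cases hz0 : z = 0
      · rw [hz0]
        simpa using IntAt.of_int (l := l) h 0
      obtain ⟨n, z', hz', rfl⟩ := h.exists_primitive hin hz0
      rw [hval n z' hz'] at hz
      obtain ⟨n, rfl⟩ := Int.eq_ofNat_of_zero_le (hexp n hz)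
      refine IntAt.mul ⟨hz'.1, hz'.2⟩ ?_
      have := IntAt.of_int (l := l) h ((l : 𝓞 F) ^ n)
      simpa using this
    obtain ⟨t, ht, htA⟩ := (hap v hv).exists_sq (hA.valuation_eq hv) hB (by
      intro z hz
      by_cases hz0 : z = 0
      · rw [hz0, zero_pow two_ne_zero, map_zero, eq_comm, Valuation.zero_iff] at hz
        exact hB hz
      obtain ⟨n, z', hz', rfl⟩ := h.exists_primitive hin hz0
      rw [map_pow, hval n z' hz', hBe, hval m B' hB', ← zpow_natCast, ← zpow_mul] at hz
      have hinj := zpow_right_injective₀ (zero_lt_iff.mpr hvl0) hvl.ne hz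
      push_cast at hinj
      omega)
    have hγ : h.IntAt l ((t ^ 2 - A) * ((l : ℚ)⁻¹ : ℚ)) := by
      by_cases hz0 : t ^ 2 - A = 0
      · grind
      obtain ⟨n, z', hz', hze⟩ := h.exists_primitive hin hz0
      rw [hze, hval n z' hz'] at htA
      have hn := hexp n htA.le
      have hn0 : n ≠ 0 := by rintro rfl; simp at htA
      obtain ⟨n, rfl⟩ : ∃ k : ℕ, n = k + 1 := ⟨(n - 1).toNat, by omega⟩
      rw [hze, mul_assoc, ← Rat.cast_mul, zpow_add_one₀ hl0, mul_inv_cancel_right₀ hl0]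
      refine IntAt.mul ⟨hz'.1, hz'.2⟩ ?_
      have := IntAt.of_int (l := l) h ((l : 𝓞 F) ^ n)
      simpa using this
    set γ := (t ^ 2 - A) * (((l : ℚ)⁻¹ : ℚ) : F) with hγd
    have hAe : A = t ^ 2 + -γ * (l : ℚ) := by
      rw [hγd]; push_cast; field_simp; ring
    have ht' := hintA t ht
    have hsq : IsSquare (lead l ((h.nm A : ℚ) : ℚ_[l])) := by
      have ht2 := ht'.mul ht'
      have e4 := h.re_im_mul_rat (-γ) l
      have e5 := h.re_im_add (t ^ 2) (-γ * (l : ℚ))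
      set g1 := h.re (-γ)
      set g2 := h.im (-γ)
      have hg1 : ‖(g1 : ℚ_[l])‖ ≤ 1 := hγ.neg.1
      have hg2 : ‖(g2 : ℚ_[l])‖ ≤ 1 := hγ.neg.2
      rw [← pow_two] at ht2
      have hneg {x : ℚ_[l]} (hx : ‖x‖ ≤ 1) : ‖-x‖ ≤ 1 := by rwa [norm_neg]
      set r1 := h.re (t ^ 2) with hr1
      set r2 := h.im (t ^ 2) with hr2
      set δ : ℚ_[l] := -((2 : ℕ) * (r1 * g1) + l * (g1 * g1) +
        -(p * ((2 : ℕ) * (r2 * g2) + l * (g2 * g2)))) with hδ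
      have hδ1 : ‖δ‖ ≤ 1 := hneg (padic_add_le (padic_add_le
        (padic_mul_le (padic_natCast_le 2) (padic_mul_le ht2.1 hg1))
        (padic_mul_le (padic_natCast_le l) (padic_mul_le hg1 hg1)))
        (hneg (padic_mul_le (padic_natCast_le p) (padic_add_le
          (padic_mul_le (padic_natCast_le 2) (padic_mul_le ht2.2 hg2))
          (padic_mul_le (padic_natCast_le l) (padic_mul_le hg2 hg2))))))
      refine isSquare_lead_sub (a := (h.nm t : ℚ)) (b := (l : ℚ_[l]) * δ) hA.3 ?_ ?_
      · have hn2 : h.nm (t ^ 2) = h.nm t ^ 2 := by rw [pow_two, h.nm_mul, pow_two]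
        have : h.nm A = h.nm t ^ 2 - l * -((2 : ℕ) * (r1 * g1) + l * (g1 * g1) +
            -(p * ((2 : ℕ) * (r2 * g2) + l * (g2 * g2)))) := by
          rw [← hn2, nm, nm, hAe, e5.1, e5.2, e4.1, e4.2, ← hr1, ← hr2]
          push_cast; ring
        rw [this, hδ]; push_cast; ring
      · by_cases hδ0 : δ = 0
        · simp [hδ0]
        · right
          have := (Padic.norm_le_one_iff_val_nonneg _).mp hδ1
          rw [Padic.valuation_mul (mod_cast hl0) hδ0, Padic.valuation_p]
          omega
    obtain ⟨u, hu, hu'⟩ := hB'.neg.residue_tr_mul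
    obtain ⟨w, hw, hw'⟩ := (hA.mul hB').residue_tr_mul
    rw [hu', hw', h.nm_neg, h.nm_mul, Rat.cast_mul, lead_mul]
    obtain ⟨z, hz⟩ := hsq
    have hz0 : z ≠ 0 := by
      rintro rfl
      exact lead_ne_zero (ne_zero_of_norm_eq_one hA.3) (by rw [hz, zero_mul])
    have hD : lead l ((h.nm B' : ℚ) : ℚ_[l]) ≠ 0 := lead_ne_zero (ne_zero_of_norm_eq_one hB'.3)
    set D := lead l ((h.nm B' : ℚ) : ℚ_[l])
    have e6 : wp (w * (lead l ((h.nm A : ℚ) : ℚ_[l]) * D)) = wp (w * D) :=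
      wp_sq_mul _ hz0 (by rw [hz]; ring)
    have key := wp_add_wp_eq_of_isSquare (l := l) hl2 hu (neg_ne_zero.mpr (mul_ne_zero hu hD))
      (neg_ne_zero.mpr hw) (mul_ne_zero hw hD) ⟨u * w * D, by ring⟩
    rw [wp_isWitt.neg, wp_isWitt.neg] at key
    grind

end IsSqrtGen

end Local

section Split

open IsDedekindDomain

variable {F} {p : ℕ} {θ : F} {l : ℕ} [hl : Fact l.Prime]

lemma exists_padic_sqrt {n : ℕ} (hl2 : l ≠ 2) (hn : (n : ZMod l) ≠ 0) (hs : IsSquare (n : ZMod l)) :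
    ∃ r : ℚ_[l], r ^ 2 = n := by
  obtain ⟨c, hc⟩ := hs
  obtain ⟨a, rfl⟩ : ∃ a : ℕ, (a : ZMod l) = c := ⟨c.val, by simp⟩
  have h1 : PadicInt.toZMod ((a : ℤ_[l]) ^ 2 - (n : ℤ_[l])) = 0 := by
    rw [map_sub, map_pow, map_natCast, map_natCast, hc]; ring
  have h2 : PadicInt.toZMod (2 * (a : ℤ_[l])) ≠ 0 := by
    have ha : (a : ZMod l) ≠ 0 := by grind
    rw [map_mul, map_natCast, map_ofNat]
    refine mul_ne_zero ?_ ha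
    intro h0
    have : l ∣ 2 := by
      rw [← ZMod.natCast_eq_zero_iff]; exact_mod_cast h0
    exact hl2 ((Nat.prime_dvd_prime_iff_eq hl.out Nat.prime_two).mp this)
  let f : Polynomial ℤ_[l] := Polynomial.X ^ 2 - Polynomial.C (n : ℤ_[l])
  obtain ⟨z, hz, -⟩ := hensels_lemma (p := l) (F := f)
    (a := (a : ℤ_[l])) (by
      have e1 : Polynomial.aeval (a : ℤ_[l]) f = (a : ℤ_[l]) ^ 2 - (n : ℤ_[l]) := by simp [f]
      have e2 : Polynomial.aeval (a : ℤ_[l]) (Polynomial.derivative f) = 2 * (a : ℤ_[l]) := by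
        simp [f, one_add_one_eq_two]
      rw [e1, e2, (toZMod_ne_zero_iff l _).mp h2, one_pow]
      refine lt_of_le_of_ne (PadicInt.norm_le_one _) fun h => ?_
      exact (toZMod_ne_zero_iff l _).mpr h h1)
  refine ⟨z, ?_⟩
  have e : z ^ 2 = (n : ℤ_[l]) := sub_eq_zero.mp (by simpa [f] using hz)
  exact_mod_cast congrArg (fun t : ℤ_[l] => (t : ℚ_[l])) e

lemma isSquare_lead_of_approx {a b : ℚ_[l]} (ha0 : a ≠ 0) (hb0 : b ≠ 0) (ha : Even a.valuation)
    (hb : ¬ Even b.valuation)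
    (h : ∀ ε : ℝ, 0 < ε → ∃ x y : ℚ_[l], ‖x ^ 2 - a * y ^ 2 - b⁻¹‖ < ε) :
    IsSquare (lead l a) := by
  obtain ⟨x, y, hxy⟩ := h ‖b⁻¹‖ (norm_pos_iff.mpr (inv_ne_zero hb0))
  set δ := x ^ 2 - a * y ^ 2 with hδ
  have hn : ‖δ‖ = ‖b⁻¹‖ := by
    have := IsUltrametricDist.norm_add_eq_max_of_norm_ne_norm (x := δ - b⁻¹) (y := b⁻¹) hxy.ne
    grind
  have hδ0 : δ ≠ 0 := by
    rw [← norm_ne_zero_iff, hn, norm_ne_zero_iff]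
    grind
  have hδv : ¬ Even δ.valuation := by
    rw [Padic.norm_eq_zpow_neg_valuation hδ0, Padic.norm_eq_zpow_neg_valuation (inv_ne_zero hb0),
      Padic.valuation_inv] at hn
    have hl1 : (1 : ℝ) < l := mod_cast hl.out.one_lt
    have := zpow_right_injective₀ (by linarith) hl1.ne' hn
    grind
  have hx : x ^ 2 = a * y ^ 2 + δ := by rw [hδ]; ring
  have hx2 : Even (x ^ 2).valuation := by rw [Padic.valuation_pow]; simp
  have hy : y ≠ 0 := by grind
  have hay : a * y ^ 2 ≠ 0 := mul_ne_zero ha0 (pow_ne_zero 2 hy)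
  have hayv : Even (a * y ^ 2).valuation := by
    rw [Padic.valuation_mul ha0 (pow_ne_zero 2 hy), Padic.valuation_pow]
    grind
  have hlt : (a * y ^ 2).valuation < δ.valuation := by
    by_contra! hle
    rcases hle.lt_or_eq with hlt | heq
    · have := (add_of_valuation_lt hδ0 hay hlt).1
      grind
    · exact hδv (heq ▸ hayv)
  have := (add_of_valuation_lt hay hδ0 hlt).2
  rw [← hx, pow_two, pow_two, lead_mul, lead_mul, lead_mul] at this
  have hy' := lead_ne_zero hy
  refine ⟨lead l x / lead l y, ?_⟩
  grind

namespace IsSqrtGen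

variable {r : ℚ_[l]}

lemma lift_mul_lift_neg (h : IsSqrtGen F p θ) (hr : r ^ 2 = p) (hr' : (-r) ^ 2 = p) (α : F) :
    h.lift r hr α * h.lift (-r) hr' α = (h.nm α : ℚ) := by
  rw [lift_apply, lift_apply, nm_cast]
  grind

lemma norm_sqrt_le (hr : r ^ 2 = p) : ‖r‖ ≤ 1 := by
  have : ‖r‖ ^ 2 ≤ 1 := by rw [← norm_pow, hr]; exact padic_natCast_le p
  exact (pow_le_one_iff_of_nonneg (norm_nonneg r) two_ne_zero).mp this

lemma IntAt.lift_le {h : IsSqrtGen F p θ} {α : F} (hα : h.IntAt l α) (hr : r ^ 2 = p) :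
    ‖h.lift r hr α‖ ≤ 1 :=
  padic_add_le hα.1 (padic_mul_le hα.2 (norm_sqrt_le hr))

lemma UnitAt.lift_eq {h : IsSqrtGen F p θ} {α : F} (hα : h.UnitAt l α) (hr : r ^ 2 = p) :
    ‖h.lift r hr α‖ = 1 := by
  have hi : h.IntAt l α := ⟨hα.1, hα.2⟩
  have hr' : (-r) ^ 2 = p := by rw [neg_sq, hr]
  have h1 := hi.lift_le hr
  have h2 := hi.lift_le hr'
  have h3 := congrArg norm (h.lift_mul_lift_neg hr hr' α)
  rw [norm_mul, hα.3] at h3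
  nlinarith [norm_nonneg (h.lift r hr α), norm_nonneg (h.lift (-r) hr' α)]

lemma exists_split_place (h : IsSqrtGen F p θ) (hr : r ^ 2 = p) :
    ∃ v : HeightOneSpectrum (𝓞 F), (l : 𝓞 F) ∈ v.asIdeal ∧
      ∀ z, v.valuation F z ≤ 1 → ‖h.lift r hr z‖ ≤ 1 := by
  set φ := h.lift r hr with hφ
  have hle : ∀ x : 𝓞 F, ‖φ (algebraMap (𝓞 F) F x)‖ ≤ 1 := fun x => (IntAt.of_int h x).lift_le hr
  let I : Ideal (𝓞 F) :=
    { carrier := {x | ‖φ (algebraMap (𝓞 F) F x)‖ < 1}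
      zero_mem' := by simp
      add_mem' := by
        intro a b ha hb
        simp only [Set.mem_ofPred_eq, map_add] at *
        exact (IsUltrametricDist.norm_add_le_max _ _).trans_lt (max_lt ha hb)
      smul_mem' := by
        intro c a ha
        simp only [Set.mem_ofPred_eq, smul_eq_mul, map_mul, norm_mul] at *
        exact mul_lt_one_of_nonneg_of_lt_one_right (hle c) (norm_nonneg _) ha }
  have hmem : ∀ x, x ∈ I ↔ ‖φ (algebraMap (𝓞 F) F x)‖ < 1 := fun x => Iff.rfl
  have hlI : (l : 𝓞 F) ∈ I := by
    rw [hmem, map_natCast, map_natCast]; exact Padic.norm_p_lt_one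
  have hprime : I.IsPrime := by
    refine Ideal.isPrime_iff.mpr ⟨fun htop => ?_, fun {x y} hxy => ?_⟩
    · have : (1 : 𝓞 F) ∈ I := htop ▸ Submodule.mem_top
      rw [hmem] at this
      simp at this
    · rw [hmem, map_mul, map_mul, norm_mul] at hxy
      rw [hmem, hmem]
      by_contra! hc
      have h1 := le_antisymm (hle x) hc.1
      have h2 := le_antisymm (hle y) hc.2
      rw [h1, h2] at hxy
      norm_num at hxy
  refine ⟨⟨I, hprime, fun hbot => ?_⟩, hlI, fun z hz => ?_⟩
  · rw [hbot] at hlI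
    have : (l : 𝓞 F) = 0 := hlI
    exact hl.out.ne_zero (mod_cast this)
  · obtain ⟨n, d, hd⟩ := HeightOneSpectrum.exists_primeCompl_mul_eq_of_integer _ z hz
    have hd1 : ‖φ (algebraMap (𝓞 F) F d)‖ = 1 :=
      le_antisymm (hle d) (not_lt.mp fun hlt => d.2 ((hmem _).mpr hlt))
    have := congrArg (fun z => ‖φ z‖) hd
    simp only [map_mul, norm_mul, hd1, mul_one] at this
    grind

lemma split_approx (h : IsSqrtGen F p θ) (hr : r ^ 2 = p) {A B : F}
    (hap : ∀ v : HeightOneSpectrum (𝓞 F), (l : 𝓞 F) ∈ v.asIdeal →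
      ApproxNorm (v.valuation F) A B) (ε : ℝ) (hε : 0 < ε) :
    ∃ x y : ℚ_[l], ‖x ^ 2 - h.lift r hr A * y ^ 2 - (h.lift r hr B)⁻¹‖ < ε := by
  obtain ⟨v, hv, hvle⟩ := h.exists_split_place hr
  have hlF : (l : F) ≠ 0 := mod_cast hl.out.ne_zero
  obtain ⟨N, hN⟩ := exists_pow_lt_of_lt_one hε (Padic.norm_p_lt_one (p := l))
  obtain ⟨x, y, hxy⟩ := hap v hv (v.valuation F ((l : F) ^ N))
    ((Valuation.ne_zero_iff _).mpr (pow_ne_zero N hlF))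
  refine ⟨h.lift r hr x, h.lift r hr y, ?_⟩
  set z := x ^ 2 - A * y ^ 2 - B⁻¹ with hz
  have e : h.lift r hr x ^ 2 - h.lift r hr A * h.lift r hr y ^ 2 - (h.lift r hr B)⁻¹ =
      h.lift r hr (z / (l : F) ^ N) * (l : ℚ_[l]) ^ N := by
    rw [← map_pow, ← map_pow, ← map_mul, ← map_inv₀, ← map_sub, ← map_sub, ← hz,
      ← map_natCast (h.lift r hr) l, ← map_pow, ← map_mul, div_mul_cancel₀ _ (pow_ne_zero N hlF)]
  rw [e, norm_mul, norm_pow]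
  refine lt_of_le_of_lt (mul_le_of_le_one_left (by positivity) (hvle _ ?_)) hN
  rw [map_div₀]
  exact div_le_one_of_le₀ hxy.le zero_le

lemma isSquare_lead_lift (h : IsSqrtGen F p θ) (hr : r ^ 2 = p) {A B : F} (hA : A ≠ 0)
    (hB : B ≠ 0) (hap : ∀ v : HeightOneSpectrum (𝓞 F), (l : 𝓞 F) ∈ v.asIdeal →
      ApproxNorm (v.valuation F) A B) (he : Even (h.lift r hr A).valuation)
    (ho : ¬ Even (h.lift r hr B).valuation) : IsSquare (lead l (h.lift r hr A)) :=
  isSquare_lead_of_approx ((map_ne_zero _).mpr hA) ((map_ne_zero _).mpr hB) he ho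
    (h.split_approx hr hap)

lemma residue_tr_split (h : IsSqrtGen F p θ) (hr : r ^ 2 = p) (hr' : (-r) ^ 2 = p) (α : F) :
    ratResidue l (h.tr α) = residue l (2 * r * h.lift r hr α) +
      residue l (2 * -r * h.lift (-r) hr' α) := by
  have hp0 : (p : ℚ_[l]) ≠ 0 := mod_cast h.prime.ne_zero
  have hr0 : r ≠ 0 := by grind
  have h2r : 2 * r ≠ 0 := mul_ne_zero two_ne_zero hr0
  rw [(residue_isWitt l).add, ratResidue_tr, sub_eq_add_neg, ← residue_neg]
  have e1 : 2 * r * h.lift r hr α + 2 * -r * h.lift (-r) hr' α = (h.im α : ℚ_[l]) * (2 * r) ^ 2 := by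
    rw [lift_apply, lift_apply]; ring
  have e2 : 2 * r * h.lift r hr α * (2 * -r * h.lift (-r) hr' α) *
      ((h.im α : ℚ_[l]) * (2 * r) ^ 2) =
      -((h.im α : ℚ_[l]) * (h.nm α : ℚ)) * ((2 * r) ^ 2) ^ 2 := by
    rw [← h.lift_mul_lift_neg hr hr']; ring
  rw [e1, e2, residue_mul_sq _ _ h2r, residue_mul_sq _ _ (pow_ne_zero 2 h2r)]

/-- Local reciprocity for unit entries at a split prime. -/
lemma residue_of_split (h : IsSqrtGen F p θ) (hl2 : l ≠ 2) (hp : (p : ZMod l) ≠ 0)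
    (hs : IsSquare (p : ZMod l)) {A B : F} (hA : h.UnitAt l A) (hB : B ≠ 0)
    (hap : ∀ v : HeightOneSpectrum (𝓞 F), (l : 𝓞 F) ∈ v.asIdeal →
      ApproxNorm (v.valuation F) A B) :
    ratResidue l (h.tr (-A) + h.tr (-B) + h.tr (A * B)) = 0 := by
  obtain ⟨r, hr⟩ := exists_padic_sqrt hl2 hp hs
  have hr' : (-r) ^ 2 = p := by rw [neg_sq, hr]
  have hA0 : A ≠ 0 := by
    rintro rfl
    have := ne_zero_of_norm_eq_one hA.3
    simp [nm, (h.re_im_of_eq (x := 0) (a := 0) (b := 0) (by simp)).1,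
      (h.re_im_of_eq (x := 0) (a := 0) (b := 0) (by simp)).2] at this
  rw [map_add, map_add, hA.neg.residue_tr, zero_add, h.residue_tr_split hr hr',
    h.residue_tr_split hr hr']
  have key : ∀ (c : ℚ_[l]) (hc : c ^ 2 = p),
      residue l (2 * c * h.lift c hc (-B)) + residue l (2 * c * h.lift c hc (A * B)) = 0 := by
    intro c hc
    have hnA := hA.lift_eq hc
    have hvA := valuation_eq_zero_of_norm hnA
    have hc1 : ‖c‖ = 1 := by
      have : ‖(p : ℚ_[l])‖ = 1 := by
        have h1 : PadicInt.toZMod (p : ℤ_[l]) ≠ 0 := by rwa [map_natCast]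
        have := (toZMod_ne_zero_iff l _).mp h1
        rw [PadicInt.norm_def] at this
        exact_mod_cast this
      rw [← hc, norm_pow] at this
      exact (pow_eq_one_iff_of_nonneg (norm_nonneg c) two_ne_zero).mp this
    have hB' : h.lift c hc B ≠ 0 := (map_ne_zero _).mpr hB
    have h21 : ‖(2 : ℚ_[l])‖ = 1 := by
      have h1 : PadicInt.toZMod (2 : ℤ_[l]) ≠ 0 := by
        rw [map_ofNat]
        intro h0
        have : l ∣ 2 := by
          rw [← ZMod.natCast_eq_zero_iff]; exact_mod_cast h0
        exact hl2 ((Nat.prime_dvd_prime_iff_eq hl.out Nat.prime_two).mp this)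
      have := (toZMod_ne_zero_iff l _).mp h1
      rw [PadicInt.norm_def] at this
      exact_mod_cast this
    have h2c1 : ‖2 * c‖ = 1 := by rw [norm_mul, h21, hc1, one_mul]
    have h2c := ne_zero_of_norm_eq_one h2c1
    have h2v := valuation_eq_zero_of_norm h2c1
    have e1 : 2 * c * h.lift c hc (-B) = -(2 * c * h.lift c hc B) := by rw [map_neg]; ring
    have e2 : 2 * c * h.lift c hc (A * B) = 2 * c * h.lift c hc B * h.lift c hc A := by
      grind
    rw [e1, e2, residue_neg]
    have hvB : (2 * c * h.lift c hc B).valuation = (h.lift c hc B).valuation := by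
      rw [Padic.valuation_mul h2c hB', h2v, zero_add]
    by_cases hev : Even (h.lift c hc B).valuation
    · rw [residue, residue, if_pos (hvB ▸ hev), Padic.valuation_mul (mul_ne_zero h2c hB')
        (ne_zero_of_norm_eq_one hnA), hvA, add_zero, if_pos (hvB ▸ hev)]
      simp
    · rw [residue_mul_of_isSquare _ (ne_zero_of_norm_eq_one hnA) (by simp [hvA])
        (h.isSquare_lead_lift hc hA0 hB hap (by simp [hvA]) hev)]
      simp
  grind

end IsSqrtGen

end Split

section Descent

open IsDedekindDomain

variable {F} {p : ℕ} {θ : F}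

/-- The homomorphism from the quaternion algebra given by an anticommuting pair. -/
def Anti.hom {K H : Type} [Field K] [Ring H] [Algebra K H] {a b : K} {X Y : H}
    (h : Anti a b X Y) : ℍ[K,a,b] →ₐ[K] H :=
  QuaternionAlgebra.Basis.liftHom
    { i := X, j := Y, k := X * Y
      i_mul_i := by rw [h.sqX, Algebra.algebraMap_eq_smul_one]; simp
      j_mul_j := by rw [h.sqY, Algebra.algebraMap_eq_smul_one]
      i_mul_j := rfl
      j_mul_i := by rw [h.anti]; simp }

lemma Anti.hom_apply {K H : Type} [Field K] [Ring H] [Algebra K H] {a b : K} {X Y : H}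
    (h : Anti a b X Y) (q : ℍ[K,a,b]) : h.hom q =
      algebraMap K H q.re + q.imI • X + q.imJ • Y + q.imK • (X * Y) := rfl

lemma Anti.map {K H H' : Type} [Field K] [Ring H] [Algebra K H] [Ring H'] [Algebra K H']
    {a b : K} {X Y : H} (h : Anti a b X Y) (f : H →ₐ[K] H') : Anti a b (f X) (f Y) :=
  ⟨by rw [← map_mul, h.sqX, AlgHom.commutes], by rw [← map_mul, h.sqY, AlgHom.commutes],
    by rw [← map_mul, h.anti, map_neg, map_mul]⟩

lemma algebraMap_quat {K : Type} [Field K] {a b : K} (c : K) :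
    algebraMap K ℍ[K,a,b] c = ⟨c, 0, 0, 0⟩ := rfl

namespace IsSqrtGen

lemma tr_entries (h : IsSqrtGen F p θ) {α : F} (hα : α ≠ 0) :
    ∃ (c d : ℚ) (g k : F), c ≠ 0 ∧ d ≠ 0 ∧ h.tr α = wp c + wp d ∧
      (∀ u w : ℚ, u * g + w * k = 0 → u = 0 ∧ w = 0) ∧
      ∀ u w u' w' : ℚ, h.im (α * ((u * g + w * k) * (u' * g + w' * k))) = c * (u * u') + d * (w * w') := by
  have hα' := h.eq_coord α
  set a := h.re α with ha
  set b := h.im α with hb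
  have hsq := h.sq
  by_cases hb0 : b = 0
  · have ha0 : a ≠ 0 := by
      intro h0
      exact hα (by rw [hα', h0, hb0]; simp)
    have ha0' : (a : F) ≠ 0 := mod_cast ha0
    refine ⟨1, -1, ((2 * a)⁻¹ : ℚ) + θ, ((2 * a)⁻¹ : ℚ) - θ, one_ne_zero, by norm_num, ?_, ?_, ?_⟩
    · rw [tr, ← hb, hb0, zero_mul, sub_self, wp_isWitt.neg, add_neg_cancel]
    · intro u w huw
      have := h.coord_eq_zero (a := (u + w) * (2 * a)⁻¹) (b := u - w)
        (by push_cast at huw ⊢; linear_combination huw)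
      grind
    · intro u w u' w'
      refine (h.re_im_of_eq (a := a * ((u + w) * (u' + w') * ((2 * a)⁻¹) ^ 2 + p * ((u - w) * (u' - w')))) ?_).2
      rw [hα', hb0]
      push_cast
      grind
  · refine ⟨b, -(b * h.nm α), 1, b * θ - a, hb0, neg_ne_zero.mpr (mul_ne_zero hb0 (h.nm_ne_zero hα)),
      ?_, ?_, ?_⟩
    · rw [tr, ← hb, wp_isWitt.neg, sub_eq_add_neg]
    · intro u w huw
      have := h.coord_eq_zero (a := u - w * a) (b := w * b)
        (by push_cast; linear_combination huw)
      have hw : w = 0 := (mul_eq_zero.mp this.2).resolve_right hb0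
      have := this.1
      grind
    · intro u w u' w'
      refine (h.re_im_of_eq (a := a * (u * u') - h.nm α * (u * w' + u' * w) + h.nm α * a * (w * w')) ?_).2
      rw [nm, ← ha, ← hb]
      nth_rewrite 1 [hα']
      push_cast
      grind

/-- Vanishing of the transferred form yields an orthogonal pair of pure quaternions with
rational squares. -/
lemma exists_rational_pair (h : IsSqrtGen F p θ) {A B : F}
    (htot : ∀ σ : F →+* ℝ, σ A < 0 ∧ σ B < 0)
    (hx : h.tr (-A) + h.tr (-B) + h.tr (A * B) = 0) :
    ∃ (a c : ℚ) (V W : ℍ[F,A,B]), 0 < a ∧ 0 < c ∧ Anti (-(a : F)) (-(c : F)) V W := by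
  classical
  obtain ⟨σ⟩ := h.exists_real
  have hA : A ≠ 0 := by rintro rfl; simpa using (htot σ).1
  have hB : B ≠ 0 := by rintro rfl; simpa using (htot σ).2
  let α : Fin 3 → F := ![-A, -B, A * B]
  have hα : ∀ i, α i ≠ 0 := by
    intro i
    fin_cases i
    · exact neg_ne_zero.mpr hA
    · exact neg_ne_zero.mpr hB
    · exact mul_ne_zero hA hB
  have hσα : ∀ i, 0 < σ (α i) := by
    intro i
    fin_cases i
    · change 0 < σ (-A); rw [map_neg]; linarith [(htot σ).1]
    · change 0 < σ (-B); rw [map_neg]; linarith [(htot σ).2]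
    · change 0 < σ (A * B); rw [map_mul]; nlinarith [(htot σ).1, (htot σ).2]
  choose c d g k hc hd htr hinj him using fun i => h.tr_entries (hα i)
  let e : Fin 3 × Fin 2 → ℚ := fun i => if i.2 = 0 then c i.1 else d i.1
  have hmet : Met e := by
    refine met_of_sum_wp_eq_zero e (fun i => ?_) ?_
    · grind
    · rw [Fintype.sum_prod_type]
      simp only [e, Fin.sum_univ_two]
      simp only [if_true, one_ne_zero, if_false, ← htr]
      rw [Fin.sum_univ_three]
      exact hx
  obtain ⟨N, hN, hdim⟩ := hmet
  let z : (Fin 3 × Fin 2 → ℚ) → Fin 3 → F := fun x i => x (i, 0) * g i + x (i, 1) * k i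
  have hz0 : ∀ x, z x = 0 → x = 0 := by
    intro x hx
    ext ⟨i, j⟩
    have := hinj i _ _ (congrFun hx i)
    fin_cases j
    · exact this.1
    · exact this.2
  have hzlin : ∀ (s t : ℚ) x y, z (s • x - t • y) = fun i => s * z x i - t * z y i := by
    intro s t x y
    ext i
    simp only [z, Pi.sub_apply, Pi.smul_apply, smul_eq_mul]
    push_cast; ring
  let b : (Fin 3 × Fin 2 → ℚ) → (Fin 3 × Fin 2 → ℚ) → F := fun x y => ∑ i, α i * (z x i * z y i)
  have hb : ∀ x ∈ N, ∀ y ∈ N, b x y = (h.re (b x y) : F) := by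
    intro x hx y hy
    have hadd : ∀ f : Fin 3 → F, h.im (∑ i, f i) = ∑ i, h.im (f i) := by
      intro f
      rw [Fin.sum_univ_three, Fin.sum_univ_three, (h.re_im_add _ _).2, (h.re_im_add _ _).2]
    have h0 : h.im (b x y) = 0 := by
      rw [hadd, ← hN x hx y hy, diagForm_apply, Fintype.sum_prod_type]
      refine Finset.sum_congr rfl fun i _ => ?_
      rw [him, Fin.sum_univ_two]
      grind
    nth_rewrite 1 [h.eq_coord (b x y)]
    rw [h0]; simp
  have hbpos : ∀ x ∈ N, x ≠ 0 → 0 < h.re (b x x) := by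
    intro x hx hx0
    have h1 : 0 < σ (b x x) := by
      dsimp only [b]
      rw [map_sum]
      obtain ⟨i, hi⟩ := Function.ne_iff.mp (fun h0 => hx0 (hz0 x h0))
      refine Finset.sum_pos' (fun j _ => ?_) ⟨i, Finset.mem_univ _, ?_⟩
      · rw [map_mul, map_mul]
        exact mul_nonneg (hσα j).le (mul_self_nonneg _)
      · rw [map_mul, map_mul]
        exact mul_pos (hσα i) (mul_self_pos.mpr ((map_ne_zero σ).mpr hi))
    rw [hb x hx x hx] at h1
    simpa using h1
  have hdim' : 3 ≤ Module.finrank ℚ N := by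
    simp only [Fintype.card_prod, Fintype.card_fin] at hdim
    omega
  obtain ⟨x, hxN, hx0⟩ : ∃ x ∈ N, x ≠ 0 := by
    by_contra! hc
    have : N = ⊥ := (Submodule.eq_bot_iff N).mpr hc
    rw [this, finrank_bot] at hdim'
    omega
  obtain ⟨y, hyN, hyx⟩ : ∃ y ∈ N, y ∉ Submodule.span ℚ {x} := by
    by_contra! hc
    have h1 := Submodule.finrank_mono (R := ℚ) (s := N) (t := Submodule.span ℚ {x}) hc
    rw [finrank_span_singleton hx0] at h1
    omega
  let V : (Fin 3 → F) → ℍ[F,A,B] := fun z => ⟨0, z 0, z 1, z 2⟩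
  have hV : ∀ z w : Fin 3 → F, V z * V w + V w * V z =
      algebraMap F _ (-(2 * ∑ i, α i * (z i * w i))) := by
    intro z w
    rw [algebraMap_quat, Fin.sum_univ_three]
    ext
    · simp [V, α]; ring
    · simp [V]; ring
    · simp [V]; ring
    · simp [V]; ring
  have hV2 : ∀ z : Fin 3 → F, V z * V z = algebraMap F _ (-(∑ i, α i * (z i * z i))) := by
    intro z
    rw [algebraMap_quat, Fin.sum_univ_three]
    ext
    · simp [V, α]; ring
    · simp [V]; ring
    · simp [V]; ring
    · simp [V]; ring
  set s := h.re (b x x) with hs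
  set t := h.re (b x y) with ht
  have hs0 := hbpos x hxN hx0
  let w := s • y - t • x
  have hwN : w ∈ N := N.sub_mem (N.smul_mem _ hyN) (N.smul_mem _ hxN)
  have hw0 : w ≠ 0 := by
    intro hw
    refine hyx (Submodule.mem_span_singleton.mpr ⟨s⁻¹ * t, ?_⟩)
    rw [mul_smul, ← sub_eq_zero.mp hw, smul_smul, inv_mul_cancel₀ hs0.ne', one_smul]
  refine ⟨s, h.re (b w w), V (z x), V (z w), hs0, hbpos w hwN hw0, ?_, ?_, ?_⟩
  · rw [hV2, ← hb x hxN x hxN]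
  · rw [hV2, ← hb w hwN w hwN]
  · rw [eq_neg_iff_add_eq_zero, hV]
    have : ∑ i, α i * (z x i * z w i) = s * b x y - t * b x x := by
      dsimp only [b, w]
      rw [hzlin, Finset.mul_sum, Finset.mul_sum, ← Finset.sum_sub_distrib]
      grind
    grind

end IsSqrtGen

end Descent

section Rational

open IsDedekindDomain

variable {F} {p : ℕ} {θ : F}

lemma ApproxNorm.exists_nhds {K Γ : Type} [Field K] [LinearOrderedCommGroupWithZero Γ]
    {val : Valuation K Γ} {a b : K} (h : ApproxNorm val a b) (ha : val a ≤ 1) {γ : Γ}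
    (hγ : γ ≠ 0) : ∃ (x y : K) (δ : Γ), δ ≠ 0 ∧ ∀ x' y', val (x' - x) < δ → val (y' - y) < δ →
      val (x' ^ 2 - a * y' ^ 2 - b⁻¹) < γ := by
  obtain ⟨x, y, hxy⟩ := h γ hγ
  set m := max 1 (max (val (2 * x)) (val (2 * y))) with hm
  have hm1 : 1 ≤ m := le_max_left _ _
  have hm0 : 0 < m := zero_lt_one.trans_le hm1
  refine ⟨x, y, min 1 (γ / m), ?_, fun x' y' hx hy => ?_⟩
  · exact (lt_min zero_lt_one (div_pos (zero_lt_iff.mpr hγ) hm0)).ne'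
  have key : ∀ z d : K, val (2 * z) ≤ m → val d < min 1 (γ / m) →
      val (d * (d + 2 * z)) < γ := by
    intro z d hz hd
    have h1 : val (d + 2 * z) ≤ m := by
      refine (val.map_add _ _).trans (max_le ?_ hz)
      grind
    rw [map_mul]
    calc val d * val (d + 2 * z) ≤ val d * m := by gcongr
      _ < γ / m * m := by
        refine mul_lt_mul_of_pos_right (hd.trans_le (min_le_right _ _)) hm0
      _ = γ := div_mul_cancel₀ _ hm0.ne'
  have e : x' ^ 2 - a * y' ^ 2 - b⁻¹ = (x ^ 2 - a * y ^ 2 - b⁻¹) +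
      ((x' - x) * ((x' - x) + 2 * x) - a * ((y' - y) * ((y' - y) + 2 * y))) := by ring
  rw [e]
  refine val.map_add_lt hxy (val.map_sub_lt ?_ ?_)
  · exact key x _ ((le_max_left _ _).trans (le_max_right _ _)) hx
  · rw [map_mul]
    refine lt_of_le_of_lt (mul_le_of_le_one_left zero_le ha) ?_
    grind

lemma exists_norm_close {A B : F} (hA : ∃ r : 𝓞 F, algebraMap (𝓞 F) F r = A) (hB : B ≠ 0)
    (hap : ∀ v : HeightOneSpectrum (𝓞 F), ApproxNorm (v.valuation F) A B) {M : ℕ} (hM : M ≠ 0)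
    (N : ℕ) : ∃ x y : F, ∀ v : HeightOneSpectrum (𝓞 F), (M : 𝓞 F) ∈ v.asIdeal →
      v.valuation F (B * (x ^ 2 - A * y ^ 2) - 1) < v.valuation F ((M : F) ^ N) := by
  have hMF : (M : F) ≠ 0 := mod_cast hM
  have hMO : (M : 𝓞 F) ≠ 0 := mod_cast hM
  have hloc := fun v => (hap v).exists_nhds (γ := v.valuation F ((M : F) ^ N * B⁻¹))
    (by obtain ⟨r, rfl⟩ := hA; exact v.valuation_le_one r)
    ((Valuation.ne_zero_iff _).mpr (mul_ne_zero (pow_ne_zero _ hMF) (inv_ne_zero hB)))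
  choose x y δ hδ hxy using hloc
  have hfin : {v : HeightOneSpectrum (𝓞 F) | (M : 𝓞 F) ∈ v.asIdeal}.Finite := by
    refine (Ideal.finite_factors (I := Ideal.span {(M : 𝓞 F)}) (by simpa using hMO)).subset ?_
    intro v hv
    exact Ideal.dvd_iff_le.mpr ((Ideal.span_singleton_le_iff_mem _).mpr hv)
  obtain ⟨x0, hx0⟩ := exists_approx hfin.toFinset x δ hδ
  obtain ⟨y0, hy0⟩ := exists_approx hfin.toFinset y δ hδ
  refine ⟨x0, y0, fun v hv => ?_⟩
  have hv' : v ∈ hfin.toFinset := hfin.mem_toFinset.mpr hv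
  have h1 := hxy v x0 y0 (hx0 v hv') (hy0 v hv')
  have h2 : B * (x0 ^ 2 - A * y0 ^ 2) - 1 = (x0 ^ 2 - A * y0 ^ 2 - B⁻¹) * B := by
    field_simp
  have h3 : (M : F) ^ N = (M : F) ^ N * B⁻¹ * B := by field_simp
  rw [h2, h3, map_mul, map_mul _ _ B]
  exact mul_lt_mul_of_pos_right h1 (zero_lt_iff.mpr ((Valuation.ne_zero_iff _).mpr hB))

namespace IsSqrtGen

/-- A totally definite quaternion algebra split at all finite places is generated by an
anticommuting pair with rational squares. -/
theorem exists_rational (h : IsSqrtGen F p θ) {A B : F}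
    (htot : ∀ σ : F →+* ℝ, σ A < 0 ∧ σ B < 0)
    (hs : ∀ v : HeightOneSpectrum (𝓞 F), SplitAt v ℍ[F,A,B]) :
    ∃ (a c : ℚ) (V W : ℍ[F,A,B]), 0 < a ∧ 0 < c ∧ Anti (-(a : F)) (-(c : F)) V W := by
  obtain ⟨σ0⟩ := h.exists_real
  have hA : A ≠ 0 := by rintro rfl; simpa using (htot σ0).1
  have hB : B ≠ 0 := by rintro rfl; simpa using (htot σ0).2
  obtain ⟨d, hd0, hd⟩ := exists_common_denominator {()} (fun _ : Unit => A)
  obtain ⟨a, ha⟩ := hd () (Finset.mem_singleton_self _)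
  set D := algebraMap (𝓞 F) F d with hD
  have hD0 : D ≠ 0 := by simpa [hD] using hd0
  obtain ⟨A', hA'⟩ : ∃ A', A' = D ^ 2 * A := ⟨_, rfl⟩
  have hint : ∃ r : 𝓞 F, algebraMap (𝓞 F) F r = A' :=
    ⟨d * a, by rw [map_mul, ← ha, hA']; ring⟩
  have hA'0 : A' ≠ 0 := by grind
  have hσA' : ∀ σ : F →+* ℝ, σ A' < 0 := by
    intro σ
    have : 0 < σ D ^ 2 := by
      have := (map_ne_zero σ).mpr hD0
      positivity
    rw [hA', map_mul, map_pow]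
    exact mul_neg_of_pos_of_neg this (htot σ).1
  obtain ⟨m, n, hmn⟩ := h.isInt_iff.mpr hint
  obtain ⟨hre, him⟩ := h.re_im_of_eq (x := A') (a := m) (b := n) (by simpa using hmn)
  have hnm : h.nm A' = ((m ^ 2 - p * n ^ 2 : ℤ) : ℚ) := by
    rw [nm, hre, him]; push_cast; ring
  set nn := m ^ 2 - p * n ^ 2 with hnn
  have hnn0 : nn ≠ 0 := by
    intro h0
    exact h.nm_ne_zero hA'0 (by rw [hnm, h0]; simp)
  obtain ⟨M, hM⟩ : ∃ M, M = p * nn.natAbs := ⟨_, rfl⟩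
  have hM0 : M ≠ 0 := by rw [hM]; exact mul_ne_zero h.prime.ne_zero (by simpa using hnn0)
  obtain ⟨N, hN⟩ : ∃ N, N = n.natAbs + 1 := ⟨_, rfl⟩
  -- the first anticommuting pair
  have hanti : Anti A' B (⟨0, D, 0, 0⟩ : ℍ[F,A,B]) ⟨0, 0, 1, 0⟩ := by
    refine ⟨?_, ?_, ?_⟩
    · rw [algebraMap_quat, hA']; ext <;> simp; ring
    · rw [algebraMap_quat]; ext <;> simp
    · ext <;> simp
  obtain ⟨x, y, hxy⟩ := exists_norm_close hint hB
    (fun v => (hs v).approxNorm hanti hA'0 hB) hM0 N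
  obtain ⟨B', hB'⟩ : ∃ B', B' = B * (x ^ 2 - A' * y ^ 2) := ⟨_, rfl⟩
  rw [← hB'] at hxy
  have hB'0 : B' ≠ 0 := by
    intro h0
    have : Fact p.Prime := ⟨h.prime⟩
    obtain ⟨v, hv⟩ := h.exists_place (l := p)
    have h1 := hxy v (by rw [hM]; push_cast; exact Ideal.mul_mem_right _ _ hv)
    rw [h0, zero_sub, Valuation.map_neg, map_one] at h1
    refine absurd h1 (not_lt.mpr ?_)
    have := v.valuation_le_one (K := F) ((M : 𝓞 F) ^ N)
    simpa using this
  have hσB' : ∀ σ : F →+* ℝ, σ B' < 0 := by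
    intro σ
    have h1 : 0 ≤ σ x ^ 2 - σ A' * σ y ^ 2 := by nlinarith [sq_nonneg (σ x), sq_nonneg (σ y), hσA' σ]
    have h2 : σ B' = σ B * (σ x ^ 2 - σ A' * σ y ^ 2) := by rw [hB']; simp
    have h3 : σ B' ≠ 0 := (map_ne_zero σ).mpr hB'0
    refine lt_of_le_of_ne ?_ h3
    rw [h2]
    exact mul_nonpos_of_nonpos_of_nonneg (htot σ).2.le h1
  have hanti' : Anti A' B' (⟨0, D, 0, 0⟩ : ℍ[F,A,B]) ⟨0, 0, x, y * D⟩ := by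
    refine ⟨hanti.sqX, ?_, ?_⟩
    · rw [algebraMap_quat, hB', hA']; ext <;> simp <;> ring
    · ext <;> simp <;> ring
  have hzero : h.tr (-A') + h.tr (-B') + h.tr (A' * B') = 0 := by
    refine eq_zero_of_ratResidue (fun l hl hl2 => ?_) ?_ ?_
    · have hIA : h.IntAt l A' := by
        obtain ⟨r, hr⟩ := hint
        rw [← hr]; exact IntAt.of_int h r
      by_cases hlM : l ∣ M
      · obtain ⟨M', hM'⟩ := hlM
        have hl0 : (l : F) ≠ 0 := mod_cast hl.out.ne_zero
        refine h.residue_tr_of_close (N := N) (β := (B' - 1) / (l : F) ^ N) hA'0 hIA (by omega) ?_ ?_ ?_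
        · rw [him, Rat.cast_intCast, Padic.valuation_intCast, hN, padicValInt]
          by_cases hn0 : n = 0
          · simp [hn0]
          have h1 : l ^ padicValNat l n.natAbs ≤ n.natAbs :=
            Nat.le_of_dvd (by omega) pow_padicValNat_dvd
          have h2 := Nat.lt_pow_self hl.out.one_lt (n := padicValNat l n.natAbs)
          grind
        · refine h.intAt_of_valuation fun v hv => ?_
          have h1 := hxy v (by rw [hM']; push_cast; exact Ideal.mul_mem_right _ _ hv)
          have h2 := v.valuation_le_one (K := F) ((M' : 𝓞 F) ^ N)
          have h3 : (M : F) ^ N = (l : F) ^ N * algebraMap (𝓞 F) F ((M' : 𝓞 F) ^ N) := by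
            rw [hM']; push_cast; rw [mul_pow]
          have h4 : 0 < v.valuation F ((l : F) ^ N) :=
            zero_lt_iff.mpr ((Valuation.ne_zero_iff _).mpr (pow_ne_zero _ hl0))
          rw [map_div₀]
          refine div_le_one_of_le₀ (h1.le.trans ?_) zero_le
          rw [h3, map_mul]
          exact mul_le_of_le_one_right zero_le h2
        · field_simp; ring
      · have hp0 : (p : ZMod l) ≠ 0 := by
          rw [Ne, ZMod.natCast_eq_zero_iff]
          grind
        have hUA : h.UnitAt l A' := by
          refine ⟨hIA.1, hIA.2, ?_⟩
          rw [hnm, Rat.cast_intCast]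
          refine le_antisymm (Padic.norm_int_le_one _) (not_lt.mp fun hlt => ?_)
          exact hlM (hM ▸ (Int.natCast_dvd.mp ((Padic.norm_intCast_lt_one_iff).mp hlt)).mul_left _)
        have hap := fun v (_ : (l : 𝓞 F) ∈ v.asIdeal) => (hs v).approxNorm hanti' hA'0 hB'0
        by_cases hsq : IsSquare (p : ZMod l)
        · exact h.residue_of_split hl2 hp0 hsq hUA hB'0 hap
        · exact h.residue_of_inert hl2 hsq hUA hB'0 hap
    · have h1 := h.nm_pos hσA'
      have h2 := h.nm_pos hσB'
      rw [map_add, map_add, h.signature_tr (by rwa [h.nm_neg]), h.signature_tr (by rwa [h.nm_neg]),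
        h.signature_tr (by rw [h.nm_mul]; positivity)]
      simp
    · rw [map_add, map_add, h.dyadic_tr (neg_ne_zero.mpr hA'0), h.dyadic_tr (neg_ne_zero.mpr hB'0),
        h.dyadic_tr (mul_ne_zero hA'0 hB'0), h.nm_neg, h.nm_neg, h.nm_mul,
        padicValRat.mul (h.nm_ne_zero hA'0) (h.nm_ne_zero hB'0)]
      grind
  obtain ⟨a, c, V, W, ha, hc, hVW⟩ := h.exists_rational_pair
    (fun σ => ⟨hσA' σ, hσB' σ⟩) hzero
  exact ⟨a, c, _, _, ha, hc, hVW.map hanti'.hom⟩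

end IsSqrtGen

end Rational

section NormClass

open IsDedekindDomain

/-- The Witt class of the norm form `⟨1, a, c, a c⟩`. -/
def normClass (a c : ℚ) : WP ℚ := wp 1 + wp a + wp c + wp (a * c)

section Local

variable {F} {p : ℕ} {θ : F} {l : ℕ} [hl : Fact l.Prime]

omit hl in
lemma Anti.symm {K H : Type} [Field K] [Ring H] [Algebra K H] {a b : K} {X Y : H}
    (h : Anti a b X Y) : Anti b a Y X :=
  ⟨h.sqY, h.sqX, by rw [h.anti, neg_neg]⟩

omit hl in
lemma Anti.mul {K H : Type} [Field K] [Ring H] [Algebra K H] {a b : K} {X Y : H}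
    (h : Anti a b X Y) : Anti (-(a * b)) a (X * Y) X := by
  refine ⟨?_, h.sqX, ?_⟩
  · have : X * Y * (X * Y) = -(X * X * (Y * Y)) := by
      rw [mul_assoc, ← mul_assoc Y X Y, h.symm.anti]; noncomm_ring
    rw [this, h.sqX, h.sqY, ← map_mul, map_neg]
  · rw [← mul_assoc X X Y, mul_assoc X Y X, show Y * X = -(X * Y) by rw [h.anti, neg_neg],
      mul_neg, mul_assoc]

lemma residue_eq_wp_lead {x : ℚ_[l]} (h : ¬ Even x.valuation) : residue l x = wp (lead l x) := by
  rw [residue, if_neg h]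

lemma residue_eq_zero {x : ℚ_[l]} (h : Even x.valuation) : residue l x = 0 := by
  rw [residue, if_pos h]

lemma residue_one : residue l (1 : ℚ_[l]) = 0 := residue_eq_zero (by simp)

namespace IsSqrtGen

lemma residue_normClass_of_even (h : IsSqrtGen F p θ) (hl2 : l ≠ 2) {H : Type} [Ring H]
    [Algebra F H] (hs : ∀ v : HeightOneSpectrum (𝓞 F), SplitAt v H) {a c : ℚ} {V W : H}
    (ha : 0 < a) (hc : 0 < c) (hVW : Anti (-(a : F)) (-(c : F)) V W)
    (he : Even (a : ℚ_[l]).valuation) :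
    ratResidue l (normClass a c) = 0 ∨ (l = p ∨ ¬ IsSquare (p : ZMod l)) ∧
      ∃ u w : ZMod l, u ≠ 0 ∧ w ≠ 0 ∧ ratResidue l (normClass a c) = wp u + wp w := by
  have ha0 : (a : ℚ_[l]) ≠ 0 := mod_cast ha.ne'
  have hc0 : (c : ℚ_[l]) ≠ 0 := mod_cast hc.ne'
  have haF : -(a : F) ≠ 0 := neg_ne_zero.mpr (mod_cast ha.ne')
  have hcF : -(c : F) ≠ 0 := neg_ne_zero.mpr (mod_cast hc.ne')
  have e0 : ratResidue l (normClass a c) = residue l (c : ℚ_[l]) + residue l ((a : ℚ_[l]) * c) := by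
    simp only [normClass, map_add, ratResidue_wp]
    push_cast
    rw [residue_one, residue_eq_zero he]
    abel
  have hval : ((a : ℚ_[l]) * c).valuation = (a : ℚ_[l]).valuation + (c : ℚ_[l]).valuation :=
    Padic.valuation_mul ha0 hc0
  by_cases ho : Even (c : ℚ_[l]).valuation
  · left
    rw [e0, residue_eq_zero ho, residue_eq_zero (by rw [hval]; exact he.add ho), add_zero]
  have ho' : ¬ Even ((a : ℚ_[l]) * c).valuation := by grind
  have e1 : ratResidue l (normClass a c) = wp (lead l (c : ℚ_[l])) +
      wp (lead l (a : ℚ_[l]) * lead l (c : ℚ_[l])) := by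
    rw [e0, residue_eq_wp_lead ho, residue_eq_wp_lead ho', lead_mul]
  have hla := lead_ne_zero ha0
  have hlc := lead_ne_zero hc0
  by_cases hpl : (l = p ∨ ¬ IsSquare (p : ZMod l))
  · exact Or.inr ⟨hpl, _, _, hlc, mul_ne_zero hla hlc, e1⟩
  push Not at hpl
  have hp0 : (p : ZMod l) ≠ 0 := by
    rw [Ne, ZMod.natCast_eq_zero_iff, Nat.prime_dvd_prime_iff_eq hl.out h.prime]
    exact hpl.1
  obtain ⟨r, hr⟩ := exists_padic_sqrt hl2 hp0 hpl.2
  have hlift : ∀ x : ℚ, h.lift r hr (-(x : F)) = -(x : ℚ_[l]) := by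
    intro x; rw [map_neg, map_ratCast]
  left
  rw [e1]
  refine wp_add_wp_of_isSquare hlc (mul_ne_zero hla hlc) ?_
  have h1 := h.isSquare_lead_lift hr haF hcF (fun v _ => (hs v).approxNorm hVW haF hcF)
    (by rwa [hlift, (valuation_lead_neg _).1]) (by rwa [hlift, (valuation_lead_neg _).1])
  rw [hlift, (valuation_lead_neg _).2] at h1
  obtain ⟨z, hz⟩ := h1
  exact ⟨z * lead l (c : ℚ_[l]), by linear_combination lead l (c : ℚ_[l]) ^ 2 * hz⟩

lemma residue_normClass (h : IsSqrtGen F p θ) (hl2 : l ≠ 2) {H : Type} [Ring H]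
    [Algebra F H] (hs : ∀ v : HeightOneSpectrum (𝓞 F), SplitAt v H) {a c : ℚ} {V W : H}
    (ha : 0 < a) (hc : 0 < c) (hVW : Anti (-(a : F)) (-(c : F)) V W) :
    ratResidue l (normClass a c) = 0 ∨ (l = p ∨ ¬ IsSquare (p : ZMod l)) ∧
      ∃ u w : ZMod l, u ≠ 0 ∧ w ≠ 0 ∧ ratResidue l (normClass a c) = wp u + wp w := by
  by_cases he : Even (a : ℚ_[l]).valuation
  · exact h.residue_normClass_of_even hl2 hs ha hc hVW he
  by_cases ho : Even (c : ℚ_[l]).valuation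
  · have e : normClass a c = normClass c a := by
      rw [normClass, normClass, mul_comm a c]; abel
    rw [e]
    exact h.residue_normClass_of_even hl2 hs hc ha hVW.symm ho
  · have e : normClass a c = normClass (a * c) a := by
      rw [normClass, normClass, wp_sq_mul c ha.ne' (show a * c * a = c * a ^ 2 by ring)]; abel
    rw [e]
    refine h.residue_normClass_of_even hl2 hs (mul_pos ha hc) ha (V := V * W) (W := V) ?_ ?_
    · have := hVW.mul
      push_cast
      grind
    · push_cast
      rw [Padic.valuation_mul (mod_cast ha.ne') (mod_cast hc.ne')]
      grind

end IsSqrtGen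

end Local

lemma ratResidue_intCast_of_not_dvd {l : ℕ} [Fact l.Prime] {n : ℤ} (h : ¬ (l : ℤ) ∣ n) :
    ratResidue l (wp (n : ℚ)) = 0 := by
  rw [ratResidue_wp, Rat.cast_intCast]
  refine residue_eq_zero ?_
  rw [valuation_eq_zero_of_norm]
  · exact Even.zero
  · refine le_antisymm (Padic.norm_int_le_one _) (not_lt.mp fun hlt => ?_)
    exact h (Padic.norm_intCast_lt_one_iff.mp hlt)


lemma ratResidue_ratCast_of_not_dvd {l : ℕ} [Fact l.Prime] {a : ℚ} (h0 : a ≠ 0)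
    (h : ¬ (l : ℤ) ∣ a.num * a.den) : ratResidue l (wp a) = 0 := by
  have hd : (a.den : ℚ) ≠ 0 := mod_cast a.den_nz
  have e : ((a.num * a.den : ℤ) : ℚ) = a * (a.den : ℚ) ^ 2 := by
    push_cast
    nth_rewrite 3 [← Rat.num_div_den a]
    field_simp
  rw [← wp_sq_mul a hd e]
  exact ratResidue_intCast_of_not_dvd h

lemma residue_mul_natCast_self {l : ℕ} [hl : Fact l.Prime] {n : ℤ} (h : ¬ (l : ℤ) ∣ n) :
    residue l ((l : ℚ_[l]) * (n : ℚ_[l])) = wp (n : ZMod l) := by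
  have h1 : PadicInt.toZMod (n : ℤ_[l]) ≠ 0 := by
    rw [map_intCast, Ne, ZMod.intCast_zmod_eq_zero_iff_dvd]; exact h
  have h2 := valuation_lead_of_eq 1 (n : ℤ_[l]) h1
  rw [zpow_one, PadicInt.coe_intCast, map_intCast] at h2
  rw [residue_eq_wp_lead (by rw [h2.1]; decide), h2.2]

namespace IsSqrtGen

variable {F} {p : ℕ} {θ : F}

/-- The norm form of a pair in an everywhere split algebra becomes trivial over `F`. -/
lemma exists_twist (h : IsSqrtGen F p θ) {H : Type} [Ring H] [Algebra F H]
    (hs : ∀ v : HeightOneSpectrum (𝓞 F), SplitAt v H) {a c : ℚ} {V W : H}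
    (ha : 0 < a) (hc : 0 < c) (hVW : Anti (-(a : F)) (-(c : F)) V W) :
    ∃ t : ℚ, t ≠ 0 ∧
      normClass a c - (wp 1 + wp 1 + wp 1 + wp 1) - wp 1 + wp (p : ℚ) + wp t - wp ((p : ℚ) * t) = 0 := by
  classical
  have : Fact p.Prime := ⟨h.prime⟩
  have hp2 : p ≠ 2 := by have := h.gt; omega
  let m : ℤ := (a.num * a.den) * (c.num * c.den)
  have hm0 : m ≠ 0 := by
    have := Rat.num_ne_zero.mpr ha.ne'
    have := Rat.num_ne_zero.mpr hc.ne'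
    have := a.den_nz
    have := c.den_nz
    simp [m, *]
  let T : Finset ℕ := m.natAbs.primeFactors.filter fun l =>
    l ≠ 2 ∧ l ≠ p ∧ ∃ _ : Fact l.Prime, ratResidue l (normClass a c) ≠ 0
  have hT : ∀ l [Fact l.Prime], l ≠ 2 → l ≠ p → l ∉ T → ratResidue l (normClass a c) = 0 := by
    intro l hl hl2 hlp hlT
    by_contra h0
    have hlm : ¬ (l : ℤ) ∣ m := by
      intro hd
      exact hlT (Finset.mem_filter.mpr ⟨Nat.mem_primeFactors.mpr
        ⟨hl.out, Int.natCast_dvd.mp hd, by simpa using hm0⟩, hl2, hlp, hl, h0⟩)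
    have h1 : ¬ (l : ℤ) ∣ a.num * a.den := fun hd => hlm (hd.mul_right _)
    have h2 : ¬ (l : ℤ) ∣ c.num * c.den := fun hd => hlm (hd.mul_left _)
    refine h0 ?_
    have e : wp (a * c) = wp (m : ℚ) := by
      refine (wp_sq_mul _ (b := (a.den * c.den : ℚ)) ?_ ?_).symm
      · have := a.den_nz
        have := c.den_nz
        positivity
      · simp only [m]; push_cast
        rw [← Rat.mul_den_eq_num a, ← Rat.mul_den_eq_num c]
        ring
    rw [normClass, map_add, map_add, map_add, ratResidue_ratCast_of_not_dvd ha.ne' h1,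
      ratResidue_ratCast_of_not_dvd hc.ne' h2, e, ratResidue_intCast_of_not_dvd hlm,
      ratResidue_wp, Rat.cast_one, residue_one]
    simp
  let P : ℤ := ((∏ l ∈ T, l : ℕ) : ℤ)
  have hPdvd : ∀ (l : ℕ) [Fact l.Prime], (l : ℤ) ∣ P → l ∈ T := by
    intro l hl hd
    obtain ⟨q, hq, hlq⟩ := (hl.out.prime.dvd_finsetProd_iff _).mp (Int.natCast_dvd_natCast.mp hd)
    have := Nat.prime_of_mem_primeFactors (Finset.mem_filter.mp hq).1
    rwa [(Nat.prime_dvd_prime_iff_eq hl.out this).mp hlq]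
  have hpT : p ∉ T := fun hp => (Finset.mem_filter.mp hp).2.2.1 rfl
  have h2T : 2 ∉ T := fun hp => (Finset.mem_filter.mp hp).2.1 rfl
  have hPp : (P : ZMod p) ≠ 0 := by
    rw [Ne, ZMod.intCast_zmod_eq_zero_iff_dvd]
    exact fun hd => hpT (hPdvd p hd)
  have hneg : ¬ IsSquare (-1 : ZMod p) := by
    rw [ZMod.exists_sq_eq_neg_one_iff, h.mod]; simp
  obtain ⟨t, htP, htsq⟩ : ∃ t : ℤ, (t = P ∨ t = -P) ∧
      (IsSquare (t : ZMod p) ↔ ratResidue p (normClass a c) = 0) := by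
    have hiff : IsSquare ((-P : ℤ) : ZMod p) ↔ ¬ IsSquare (P : ZMod p) := by
      push_cast
      constructor
      · rintro ⟨z, hz⟩ ⟨w, hw⟩
        have hw0 : w ≠ 0 := by grind
        refine hneg ⟨z / w, ?_⟩
        grind
      · intro hP
        have := isSquare_mul_of_not_isSquare hneg hP
        rwa [neg_one_mul] at this
    by_cases h1 : IsSquare (P : ZMod p) ↔ ratResidue p (normClass a c) = 0
    · exact ⟨P, Or.inl rfl, h1⟩
    · exact ⟨-P, Or.inr rfl, by rw [hiff]; tauto⟩
  have htdvd : ∀ l : ℕ, (l : ℤ) ∣ t ↔ (l : ℤ) ∣ P := by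
    rcases htP with rfl | rfl <;> simp
  have ht0 : (t : ℚ) ≠ 0 := by
    have : t ≠ 0 := by grind
    exact_mod_cast this
  have hp0 : (p : ℚ) ≠ 0 := mod_cast h.prime.ne_zero
  have htp : ¬ (p : ℤ) ∣ t := fun hd => hpT (hPdvd p ((htdvd p).mp hd))
  have hr1 : ∀ l [Fact l.Prime], ratResidue l (wp 1) = 0 := by
    intro l _
    rw [ratResidue_wp, Rat.cast_one, residue_one]
  refine ⟨t, ht0, eq_zero_of_ratResidue (fun l hl hl2 => ?_) ?_ ?_⟩
  · simp only [map_add, map_sub, hr1]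
    by_cases hlp : l = p
    · subst hlp
      have e1 : ratResidue l (wp (l : ℚ)) = wp 1 := by
        have := residue_mul_natCast_self (l := l) (n := 1) (by
          rw [Int.natCast_dvd]; simpa using hl.out.one_lt.ne')
        rw [ratResidue_wp]; push_cast
        simpa using this
      have e2 : ratResidue l (wp ((l : ℚ) * t)) = wp (t : ZMod l) := by
        rw [ratResidue_wp]; push_cast
        exact residue_mul_natCast_self htp
      have ht' : (t : ZMod l) ≠ 0 := by
        rwa [Ne, ZMod.intCast_zmod_eq_zero_iff_dvd]
      rw [e1, e2, ratResidue_intCast_of_not_dvd htp]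
      by_cases hq0 : ratResidue l (normClass a c) = 0
      · obtain ⟨z, hz⟩ := htsq.mpr hq0
        have hz0 : z ≠ 0 := by grind
        rw [hq0, wp_sq_mul (1 : ZMod l) hz0 (show (t : ZMod l) = 1 * z ^ 2 by rw [hz]; ring)]
        abel
      · obtain ⟨-, u, w, hu, hw, huw⟩ := (h.residue_normClass hl2 hs ha hc hVW).resolve_left hq0
        have h1 : ¬ IsSquare (-(u * w)) := fun hsq => hq0 (huw.trans (wp_add_wp_of_isSquare hu hw hsq))
        have h2 := isSquare_mul_of_not_isSquare hneg h1
        rw [neg_one_mul, neg_neg] at h2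
        have h3 : wp u + wp w = wp (-1) + wp (-1 : ZMod l) :=
          wp_add_wp_eq_of_isSquare hl2 hu hw (by simp) (by simp) (by simpa using h2)
        obtain ⟨z, hz⟩ := isSquare_mul_of_not_isSquare hneg (fun h4 => hq0 (htsq.mp h4))
        have hz0 : z ≠ 0 := by grind
        rw [huw, h3, wp_sq_mul (-1 : ZMod l) hz0
          (show (t : ZMod l) = -1 * z ^ 2 by rw [pow_two, ← hz]; ring), wp_isWitt.neg]
        abel
    · have hlp' : ¬ (l : ℤ) ∣ (p : ℤ) := by
        rw [Int.natCast_dvd_natCast, Nat.prime_dvd_prime_iff_eq hl.out h.prime]; exact hlp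
      have e1 : ratResidue l (wp (p : ℚ)) = 0 := by
        simpa using ratResidue_intCast_of_not_dvd hlp'
      by_cases hlT : l ∈ T
      · have hlP : (l : ℤ) ∣ t := by
          rw [htdvd]
          exact Int.natCast_dvd_natCast.mpr (Finset.dvd_prod_of_mem _ hlT)
        obtain ⟨k, hk⟩ := hlP
        have hq0 : ratResidue l (normClass a c) ≠ 0 := (Finset.mem_filter.mp hlT).2.2.2.2
        have hlk : ¬ (l : ℤ) ∣ k := by
          rintro ⟨k', rfl⟩
          have hsq : (l * l : ℕ) ∣ ∏ q ∈ T, q := by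
            rw [← Int.natCast_dvd_natCast]
            change _ ∣ P
            have : ((l * l : ℕ) : ℤ) ∣ t := ⟨k', by rw [hk]; push_cast; ring⟩
            rcases htP with rfl | rfl
            · exact this
            · exact (dvd_neg.mp this)
          rw [← Finset.mul_prod_erase _ _ hlT, Nat.mul_dvd_mul_iff_left hl.out.pos,
            hl.out.prime.dvd_finsetProd_iff] at hsq
          obtain ⟨q, hq, hlq⟩ := hsq
          have hqp := Nat.prime_of_mem_primeFactors
            (Finset.mem_filter.mp (Finset.mem_of_mem_erase hq)).1
          exact Finset.ne_of_mem_erase hq ((Nat.prime_dvd_prime_iff_eq hl.out hqp).mp hlq).symm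
        have hk' : (k : ZMod l) ≠ 0 := by rwa [Ne, ZMod.intCast_zmod_eq_zero_iff_dvd]
        have hp' : (p : ZMod l) ≠ 0 := by
          rw [Ne, ZMod.natCast_eq_zero_iff]; exact fun hd => hlp' (Int.natCast_dvd_natCast.mpr hd)
        have e2 : ratResidue l (wp (t : ℚ)) = wp (k : ZMod l) := by
          rw [ratResidue_wp, hk]; push_cast
          exact residue_mul_natCast_self hlk
        have e3 : ratResidue l (wp ((p : ℚ) * t)) = wp ((p : ZMod l) * k) := by
          have := residue_mul_natCast_self (l := l) (n := p * k)
            (fun hd => ((Nat.prime_iff_prime_int.mp hl.out).dvd_or_dvd hd).elim hlp' hlk)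
          rw [ratResidue_wp, hk]; push_cast at this ⊢
          rw [← this]; congr 1; ring
        obtain ⟨hpl, u, w, hu, hw, huw⟩ := (h.residue_normClass hl2 hs ha hc hVW).resolve_left hq0
        have hpsq := hpl.resolve_left hlp
        have h1 : ¬ IsSquare (-(u * w)) := fun hsq => hq0 (huw.trans (wp_add_wp_of_isSquare hu hw hsq))
        obtain ⟨z, hz⟩ := isSquare_mul_of_not_isSquare h1 hpsq
        have h3 : wp u + wp w = wp (-k : ZMod l) + wp ((p : ZMod l) * k) :=
          wp_add_wp_eq_of_isSquare hl2 hu hw (neg_ne_zero.mpr hk') (mul_ne_zero hp' hk')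
            ⟨z * k, by linear_combination (k : ZMod l) ^ 2 * hz⟩
        rw [e1, e2, e3, huw, h3, wp_isWitt.neg]
        abel
      · have hlt : ¬ (l : ℤ) ∣ t := fun hd => hlT (hPdvd l ((htdvd l).mp hd))
        have e2 : ratResidue l (wp ((p : ℚ) * t)) = 0 := by
          have := ratResidue_intCast_of_not_dvd (l := l) (n := p * t)
            (fun hd => ((Nat.prime_iff_prime_int.mp hl.out).dvd_or_dvd hd).elim hlp' hlt)
          push_cast at this
          exact this
        rw [e1, e2, ratResidue_intCast_of_not_dvd hlt, hT l hl2 hlp hlT]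
        abel
  · simp only [normClass, map_add, map_sub, signature_wp, sign_mul, sign_pos ha, sign_pos hc,
      sign_pos (mod_cast h.prime.pos : (0 : ℚ) < p), sign_one]
    simp
  · have hvp : padicValRat 2 (p : ℚ) = 0 := by
      rw [padicValRat.of_nat, padicValNat_primes (Ne.symm hp2)]; rfl
    simp only [normClass, map_add, map_sub, dyadic_wp,
      padicValRat.mul ha.ne' hc.ne', padicValRat.mul hp0 ht0, hvp]
    have h2 := fun x : ZMod 2 => CharTwo.add_self_eq_zero x
    push_cast
    have hone : padicValRat 2 1 = 0 := by simp
    rw [hone]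
    grind

end IsSqrtGen

end NormClass

section Splitting

open IsDedekindDomain

variable {F}

lemma Anti.hom_injective {H : Type} [Ring H] [Nontrivial H] [Algebra F H] {a b : F} {X Y : H}
    (h : Anti a b X Y) (σ : F →+* ℝ) (ha : σ a < 0) (hb : σ b < 0) :
    Function.Injective h.hom := by
  rw [injective_iff_map_eq_zero]
  intro q hq
  have e : q * star q = algebraMap F ℍ[F,a,b]
      (q.re ^ 2 - a * q.imI ^ 2 - b * q.imJ ^ 2 + a * b * q.imK ^ 2) := by
    rw [algebraMap_quat]
    ext <;> simp <;> ring
  have h1 : algebraMap F H (q.re ^ 2 - a * q.imI ^ 2 - b * q.imJ ^ 2 + a * b * q.imK ^ 2) = 0 := by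
    rw [← AlgHom.commutes h.hom, ← e, map_mul, hq, zero_mul]
  have h2 : σ (q.re ^ 2 - a * q.imI ^ 2 - b * q.imJ ^ 2 + a * b * q.imK ^ 2) = 0 := by
    rw [(map_eq_zero_iff _ (algebraMap F H).injective).mp h1, map_zero]
  simp only [map_add, map_sub, map_mul, map_pow] at h2
  have hab : 0 < σ a * σ b := mul_pos_of_neg_of_neg ha hb
  have n1 := sq_nonneg (σ q.re)
  have n2 := mul_nonneg (neg_pos.mpr ha).le (sq_nonneg (σ q.imI))
  have n3 := mul_nonneg (neg_pos.mpr hb).le (sq_nonneg (σ q.imJ))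
  have n4 := mul_nonneg hab.le (sq_nonneg (σ q.imK))
  have z1 : σ q.re ^ 2 = 0 := by linarith
  have z2 : -σ a * σ q.imI ^ 2 = 0 := by linarith
  have z3 : -σ b * σ q.imJ ^ 2 = 0 := by linarith
  have z4 : σ a * σ b * σ q.imK ^ 2 = 0 := by linarith
  have hz : ∀ {c : ℝ} {x : F}, c ≠ 0 → c * σ x ^ 2 = 0 → x = 0 := by
    intro c x hc hx
    exact (map_eq_zero σ).mp (pow_eq_zero_iff two_ne_zero |>.mp ((mul_eq_zero.mp hx).resolve_left hc))
  ext
  · exact hz one_ne_zero (by rw [one_mul]; exact z1)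
  · exact hz (neg_pos.mpr ha).ne' z2
  · exact hz (neg_pos.mpr hb).ne' z3
  · exact hz hab.ne' z4

lemma Anti.exists_algEquiv {a b c d : F} {X Y : ℍ[F,c,d]}
    (h : Anti a b X Y) (σ : F →+* ℝ) (ha : σ a < 0) (hb : σ b < 0) :
    ∃ e : ℍ[F,a,b] ≃ₐ[F] ℍ[F,c,d], ∀ x, e x = h.hom x := by
  have h1 := h.hom_injective σ ha hb
  have h2 : Function.Surjective h.hom.toLinearMap :=
    (LinearMap.injective_iff_surjective_of_finrank_eq_finrank
      (by rw [QuaternionAlgebra.finrank_eq_four, QuaternionAlgebra.finrank_eq_four])).mp h1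
  exact ⟨AlgEquiv.ofBijective h.hom ⟨h1, h2⟩, fun _ => rfl⟩

/-- The inclusion of `ℚ` into `F` on Witt groups. -/
def wpToField : WP ℚ →+ WP F := wlift _ (wp_isWitt.map (algebraMap ℚ F))

lemma wpToField_wp (a : ℚ) : wpToField (F := F) (wp a) = wp (a : F) := by
  rw [wpToField, wlift_wp]; simp

namespace IsSqrtGen

variable {p : ℕ} {θ : F}

lemma exists_hamilton_pair (h : IsSqrtGen F p θ) {a c t : ℚ} (ha : 0 < a) (hc : 0 < c)
    (ht : normClass a c - (wp 1 + wp 1 + wp 1 + wp 1) - wp 1 + wp (p : ℚ) + wp t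
      - wp ((p : ℚ) * t) = 0) :
    ∃ I J : ℍ[F,-1,-1], Anti (-(a : F)) (-(c : F)) I J := by
  obtain ⟨σ⟩ := h.exists_real
  have hθ0 : θ ≠ 0 := by
    rintro rfl
    have := h.sq
    have hp := h.prime.ne_zero
    rw [zero_pow two_ne_zero] at this
    exact hp (mod_cast this.symm)
  let φ : Fin 4 → F := ![1, a, c, a * c]
  let e : Fin 4 ⊕ Fin 4 → F := Sum.elim φ (fun _ => -1)
  have hφpos : ∀ i, 0 < σ (φ i) := by
    intro i
    have ha' : (0 : ℝ) < a := mod_cast ha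
    have hc' : (0 : ℝ) < c := mod_cast hc
    fin_cases i <;> simp [φ] <;> positivity
  have hmet : Met e := by
    refine met_of_sum_wp_eq_zero e ?_ ?_
    · rintro (i | i)
      · grind
      · simp [e]
    · have h1 := congrArg (wpToField (F := F)) ht
      simp only [normClass, map_add, map_sub, wpToField_wp, map_zero] at h1
      push_cast at h1
      rw [wp_sq_mul (1 : F) hθ0 (show (p : F) = 1 * θ ^ 2 by rw [h.sq, one_mul]),
        wp_sq_mul (t : F) hθ0 (show (p : F) * t = t * θ ^ 2 by rw [h.sq, mul_comm])] at h1
      rw [Fintype.sum_sum_type, ← h1]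
      simp only [e, Sum.elim_inl, Sum.elim_inr, Fin.sum_univ_four, wp_isWitt.neg]
      simp only [φ, Matrix.cons_val]
      abel
  obtain ⟨N, hN, hdim⟩ := hmet
  have hN' : ∀ x ∈ N, ∀ y ∈ N, ∑ i, φ i * x (Sum.inl i) * y (Sum.inl i) =
      ∑ i, x (Sum.inr i) * y (Sum.inr i) := by
    intro x hx y hy
    have := hN x hx y hy
    rw [diagForm_apply, Fintype.sum_sum_type] at this
    simp only [e, Sum.elim_inl, Sum.elim_inr, neg_mul, one_mul, Finset.sum_neg_distrib] at this
    exact add_neg_eq_zero.mp this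
  let π : N →ₗ[F] (Fin 4 → F) := (LinearMap.funLeft F F Sum.inl).comp N.subtype
  have hπ : Function.Injective π := by
    rw [injective_iff_map_eq_zero]
    rintro ⟨x, hx⟩ h0
    have h0' : ∀ i, x (Sum.inl i) = 0 := fun i => congrFun h0 i
    have h1 := congrArg σ (hN' x hx x hx)
    simp only [h0', mul_zero, Finset.sum_const_zero, map_zero, map_sum, map_mul] at h1
    have h2 := (Finset.sum_eq_zero_iff_of_nonneg (fun i _ => mul_self_nonneg _)).mp h1.symm
    ext i
    rcases i with i | i
    · exact h0' i
    · exact (map_eq_zero σ).mp (mul_self_eq_zero.mp (h2 i (Finset.mem_univ i)))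
  have hsurj : Function.Surjective π := by
    have h1 := LinearMap.finrank_range_of_inj hπ
    have h2 : Module.finrank F (Fin 4 → F) ≤ Module.finrank F (LinearMap.range π) := by
      rw [h1]
      simp only [Fintype.card_sum, Fintype.card_fin] at hdim
      simp only [Module.finrank_fintype_fun_eq_card, Fintype.card_fin]
      omega
    exact LinearMap.range_eq_top.mp (Submodule.eq_top_of_finrank_eq
      (le_antisymm (Submodule.finrank_le _) h2))
  choose g hg using fun i : Fin 4 => hsurj (Pi.single i 1)
  let f : Fin 4 → Fin 4 → F := fun i j => (g i).1 (Sum.inr j)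
  have hf : ∀ i j, ∑ k, f i k * f j k = if i = j then φ i else 0 := by
    intro i j
    rw [← hN' _ (g i).2 _ (g j).2]
    have hgi : ∀ i k, (g i).1 (Sum.inl k) = (Pi.single i 1 : Fin 4 → F) k := fun i k => congrFun (hg i) k
    simp only [hgi]
    rw [Finset.sum_eq_single i]
    · grind
    · intro k _ hk; simp [hk]
    · simp
  let q : Fin 4 → ℍ[F,-1,-1] := fun i => ⟨f i 0, f i 1, f i 2, f i 3⟩
  have hq : ∀ i j, q i * star (q j) + q j * star (q i) =
      algebraMap F _ (2 * if i = j then φ i else 0) := by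
    intro i j
    rw [← hf, algebraMap_quat, Fin.sum_univ_four]
    ext <;> simp [q] <;> ring
  have hq' : ∀ i j, star (q i) * q j + star (q j) * q i =
      algebraMap F _ (2 * if i = j then φ i else 0) := by
    intro i j
    rw [← hf, algebraMap_quat, Fin.sum_univ_four]
    ext <;> simp [q] <;> ring
  have hn : ∀ i, q i * star (q i) = algebraMap F _ (φ i) := by
    intro i
    have := hf i i
    rw [if_pos rfl] at this
    rw [← this, algebraMap_quat, Fin.sum_univ_four]
    ext <;> simp [q] <;> ring
  have hn' : star (q 0) * q 0 = 1 := by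
    have := hf 0 0
    rw [if_pos rfl, Fin.sum_univ_four] at this
    have h1 : φ 0 = 1 := rfl
    rw [h1] at this
    ext <;> simp [q]
    · linear_combination this
    all_goals ring
  have hoff : ∀ i j, i ≠ j → q i * star (q j) = -(q j * star (q i)) := by grind
  have hoff' : ∀ i j, i ≠ j → star (q i) * q j = -(star (q j) * q i) := by grind
  have key : ∀ i j, i ≠ 0 → j ≠ 0 → q i * star (q 0) * (q j * star (q 0)) = -(q i * star (q j)) := by
    intro i j hi hj
    calc q i * star (q 0) * (q j * star (q 0)) = q i * (star (q 0) * q j) * star (q 0) := by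
          simp only [mul_assoc]
      _ = -(q i * star (q j) * (q 0 * star (q 0))) := by
          rw [hoff' 0 j hj.symm]; noncomm_ring
      _ = -(q i * star (q j)) := by
          rw [hn 0]; simp [φ]
  refine ⟨q 1 * star (q 0), q 2 * star (q 0), ?_, ?_, ?_⟩
  · rw [key 1 1 (by decide) (by decide), hn, map_neg]; rfl
  · rw [key 2 2 (by decide) (by decide), hn, map_neg]; rfl
  · grind

/-- The totally definite quaternion algebra unramified at all finite places is the
Hamilton quaternion algebra. -/
theorem nonempty_algEquiv_hamilton (h : IsSqrtGen F p θ) {A B : F}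
    (htot : ∀ σ : F →+* ℝ, σ A < 0 ∧ σ B < 0)
    (hs : ∀ v : HeightOneSpectrum (𝓞 F), SplitAt v ℍ[F,A,B]) :
    Nonempty (ℍ[F,A,B] ≃ₐ[F] ℍ[F,-1,-1]) := by
  obtain ⟨σ⟩ := h.exists_real
  obtain ⟨a, c, V, W, ha, hc, hVW⟩ := h.exists_rational htot hs
  obtain ⟨t, -, ht⟩ := h.exists_twist hs ha hc hVW
  obtain ⟨I, J, hIJ⟩ := h.exists_hamilton_pair ha hc ht
  have ha' : σ (-(a : F)) < 0 := by simpa using ha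
  have hc' : σ (-(c : F)) < 0 := by simpa using hc
  obtain ⟨e1, -⟩ := hVW.exists_algEquiv σ ha' hc'
  obtain ⟨e2, -⟩ := hIJ.exists_algEquiv σ ha' hc'
  exact ⟨e1.symm.trans e2⟩

end IsSqrtGen

lemma anti_basis {K : Type} [Field K] (a b : K) :
    Anti a b (⟨0, 1, 0, 0⟩ : ℍ[K,a,b]) ⟨0, 0, 1, 0⟩ := by
  refine ⟨?_, ?_, ?_⟩
  · rw [algebraMap_quat]; ext <;> simp
  · rw [algebraMap_quat]; ext <;> simp
  · ext <;> simp

lemma splitAt_of_adic {v : HeightOneSpectrum (𝓞 F)} {A B : F}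
    (h : Nonempty (ℍ[v.adicCompletion F, algebraMap F (v.adicCompletion F) A,
      algebraMap F (v.adicCompletion F) B] ≃ₐ[v.adicCompletion F]
        Matrix (Fin 2) (Fin 2) (v.adicCompletion F))) : SplitAt v ℍ[F,A,B] := by
  obtain ⟨e⟩ := h
  set L := v.adicCompletion F
  have hb0 := anti_basis (algebraMap F L A) (algebraMap F L B)
  have hb : Anti A B (⟨0, 1, 0, 0⟩ : ℍ[L, algebraMap F L A, algebraMap F L B]) ⟨0, 0, 1, 0⟩ :=
    ⟨hb0.sqX, hb0.sqY, hb0.anti⟩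
  exact ⟨(e.toAlgHom.restrictScalars F).comp hb.hom⟩

end Splitting

section Units

variable {F} {p : ℕ} {θ : F}

lemma Int.exists_sq_of_pos {a b c : ℤ} (h : IsCoprime a b) (heq : a * b = c ^ 2) (ha : 0 < a) :
    ∃ d, a = d ^ 2 := by
  obtain ⟨d, hd | hd⟩ := Int.sq_of_isCoprime h heq
  · exact ⟨d, hd⟩
  · nlinarith [sq_nonneg d]

/-- For `p ≡ 3 (mod 4)` twice the fundamental unit is a square. -/
lemma pell_factor {p : ℕ} (hp : p.Prime) (hp4 : p % 4 = 3) {X Y : ℤ} (hX : 1 < X)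
    (hpell : X ^ 2 - p * Y ^ 2 = 1)
    (hmin : ∀ a b : ℤ, a ^ 2 - p * b ^ 2 = 1 → 1 < a → X ≤ a) :
    ∃ a b : ℤ, 2 * X = a ^ 2 + p * b ^ 2 ∧ Y = a * b ∧
      (a ^ 2 - p * b ^ 2 = 2 ∨ a ^ 2 - p * b ^ 2 = -2) ∧ X % 2 = 0 ∧ Y % 2 = 1 := by
  have hpZ : Prime (p : ℤ) := Nat.prime_iff_prime_int.mp hp
  have hp0 : (0 : ℤ) < p := mod_cast hp.pos
  have hp4' : (p : ℤ) % 4 = 3 := mod_cast hp4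
  obtain ⟨q, hq⟩ : ∃ q : ℤ, (p : ℤ) = 4 * q + 3 := ⟨p / 4, by omega⟩
  rcases Int.even_or_odd' X with ⟨m, hm | hm⟩
  · have hYodd : Y % 2 = 1 := by
      rcases Int.even_or_odd' Y with ⟨n, hn | hn⟩
      · exfalso
        have : 2 * (2 * m ^ 2 - 2 * p * n ^ 2) = 1 := by
          rw [hm, hn] at hpell; linear_combination hpell
        omega
      · omega
    have hab : (X - 1) * (X + 1) = p * Y ^ 2 := by linear_combination hpell
    have hcop : IsCoprime (X - 1) (X + 1) :=
      ⟨m, 1 - m, by rw [hm]; ring⟩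
    have hfin : ∀ a b : ℤ, Y ^ 2 = (a * b) ^ 2 → ∃ a' : ℤ, a' ^ 2 = a ^ 2 ∧ Y = a' * b := by
      intro a b hYab
      rcases sq_eq_sq_iff_eq_or_eq_neg.mp hYab with h | h
      · exact ⟨a, rfl, h⟩
      · exact ⟨-a, by ring, by rw [h]; ring⟩
    rcases hpZ.dvd_or_dvd ⟨Y ^ 2, hab⟩ with ⟨k, hk⟩ | ⟨k, hk⟩
    · have hk0 : 0 < k := by nlinarith
      have h1 : k * (X + 1) = Y ^ 2 := by
        apply mul_left_cancel₀ hp0.ne'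
        grind
      have hc : IsCoprime k (X + 1) := by
        rw [hk] at hcop; exact hcop.of_mul_left_right
      obtain ⟨b, hb⟩ := Int.exists_sq_of_pos hc h1 hk0
      obtain ⟨a, ha⟩ := Int.exists_sq_of_pos hc.symm (mul_comm k _ ▸ h1) (by linarith)
      obtain ⟨a', ha', hY'⟩ := hfin a b (by rw [← h1, hb, ha]; ring)
      refine ⟨a', b, ?_, hY', Or.inl ?_, by omega, hYodd⟩
      · grind
      · grind
    · have hk0 : 0 < k := by nlinarith
      have h1 : k * (X - 1) = Y ^ 2 := by
        apply mul_left_cancel₀ hp0.ne'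
        grind
      have hc : IsCoprime k (X - 1) := by
        rw [hk] at hcop; exact hcop.symm.of_mul_left_right
      obtain ⟨b, hb⟩ := Int.exists_sq_of_pos hc h1 hk0
      obtain ⟨a, ha⟩ := Int.exists_sq_of_pos hc.symm (mul_comm k _ ▸ h1) (by linarith)
      obtain ⟨a', ha', hY'⟩ := hfin a b (by rw [← h1, hb, ha]; ring)
      refine ⟨a', b, ?_, hY', Or.inr ?_, by omega, hYodd⟩
      · grind
      · grind
  · exfalso
    obtain ⟨n, hn⟩ : ∃ n, Y = 2 * n := by
      rcases Int.even_or_odd' Y with ⟨n, hn | hn⟩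
      · exact ⟨n, hn⟩
      · exfalso
        rw [hm, hn, hq] at hpell
        grind
    have hab : m * (m + 1) = p * n ^ 2 := by grind
    have hcop : IsCoprime m (m + 1) := ⟨-1, 1, by ring⟩
    have hm0 : 0 < m := by linarith
    rcases hpZ.dvd_or_dvd ⟨n ^ 2, hab⟩ with ⟨k, hk⟩ | ⟨k, hk⟩
    · have hk0 : 0 < k := by nlinarith
      have h1 : k * (m + 1) = n ^ 2 := by
        apply mul_left_cancel₀ hp0.ne'
        grind
      have hc : IsCoprime k (m + 1) :=
        IsCoprime.of_mul_left_right (x := (p : ℤ)) (by rw [← hk]; exact hcop)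
      obtain ⟨b, hb⟩ := Int.exists_sq_of_pos hc h1 hk0
      obtain ⟨a, ha⟩ := Int.exists_sq_of_pos hc.symm (mul_comm k _ ▸ h1) (by linarith)
      have h2 := hmin |a| b (by rw [sq_abs, ← ha, ← hb, ← hk]; ring) (by
        by_contra hlt
        nlinarith [sq_abs a, abs_nonneg a])
      nlinarith [sq_abs a, abs_nonneg a]
    · have hk0 : 0 < k := by nlinarith
      have h1 : k * m = n ^ 2 := by
        apply mul_left_cancel₀ hp0.ne'
        grind
      have hc : IsCoprime k m := by
        rw [hk] at hcop; exact hcop.symm.of_mul_left_right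
      obtain ⟨b, hb⟩ := Int.exists_sq_of_pos hc h1 hk0
      obtain ⟨a, ha⟩ := Int.exists_sq_of_pos hc.symm (mul_comm k _ ▸ h1) hm0
      rw [ha, hb, hq] at hk
      rcases Int.even_or_odd' a with ⟨x, rfl | rfl⟩ <;> rcases Int.even_or_odd' b with ⟨y, rfl | rfl⟩ <;>
        grind

/-- The ring of integers as a subring of `F`. -/
def intR (F : Type) [Field F] [NumberField F] : Subring F := (algebraMap (𝓞 F) F).range

lemma IsSqrtGen.mem_intR (h : IsSqrtGen F p θ) {x : F} :
    x ∈ intR F ↔ ∃ m n : ℤ, x = m + n * θ := by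
  rw [intR, RingHom.mem_range, ← h.isInt_iff]; rfl

/-- Arithmetic of `ℤ[√p]` at the prime above `2`: `s ^ 2 = 2 ε` with `ε` the fundamental unit. -/
structure DyadicData (θ s ε : F) : Prop where
  s_mem : s ∈ intR F
  eps_mem : ε ∈ intR F
  inv_mem : ε⁻¹ ∈ intR F
  sq : s ^ 2 = 2 * ε
  pos : ∀ σ : F →+* ℝ, 0 < σ ε
  coords : ∃ x y : ℤ, s = x + y * θ ∧ x % 2 = 1 ∧ y % 2 = 1
  eps_eq : ∃ z ∈ intR F, ε = 1 + s + 2 * z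
  units : ∀ u ∈ intR F, u⁻¹ ∈ intR F → u ≠ 0 → (∀ σ : F →+* ℝ, 0 < σ u) →
    ∃ v ∈ intR F, v⁻¹ ∈ intR F ∧ v ≠ 0 ∧ (u = v ^ 2 ∨ u = ε * v ^ 2)

namespace IsSqrtGen

lemma theta_mem (h : IsSqrtGen F p θ) : θ ∈ intR F := h.mem_intR.mpr ⟨0, 1, by simp⟩

/-- The two real embeddings. -/
lemma exists_real_pair (h : IsSqrtGen F p θ) : ∃ σ τ : F →+* ℝ, σ θ = √(p : ℝ) ∧ τ θ = -√(p : ℝ) := by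
  have hr : (√(p : ℝ)) ^ 2 = p := Real.sq_sqrt (Nat.cast_nonneg p)
  have e : θ = ((0 : ℚ) : F) + ((1 : ℚ) : F) * θ := by simp
  obtain ⟨e1, e2⟩ := h.re_im_of_eq e
  refine ⟨h.lift _ hr, h.lift (-√(p : ℝ)) (by rw [neg_sq, hr]), ?_, ?_⟩
  · rw [lift_apply, e1, e2]; simp
  · rw [lift_apply, e1, e2]; simp

lemma int_coord_inj (h : IsSqrtGen F p θ) {a b c d : ℤ} (hab : (a : F) + b * θ = c + d * θ) :
    a = c ∧ b = d := by
  have := h.coord_inj (a := a) (b := b) (c := c) (d := d) (by push_cast; exact hab)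
  exact_mod_cast this

/-- A totally positive unit comes from a solution of the Pell equation. -/
lemma pell_of_unit (h : IsSqrtGen F p θ) {u : F} (hu : u ∈ intR F) (hu' : u⁻¹ ∈ intR F) (hu0 : u ≠ 0)
    (hpos : ∀ σ : F →+* ℝ, 0 < σ u) :
    ∃ a : Pell.Solution₁ (p : ℤ), u = a.x + a.y * θ ∧ 0 < a.x := by
  obtain ⟨m, n, hmn⟩ := h.mem_intR.mp hu
  obtain ⟨k, l, hkl⟩ := h.mem_intR.mp hu'
  obtain ⟨σ, τ, hσ, hτ⟩ := h.exists_real_pair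
  have hr : (√(p : ℝ)) ^ 2 = p := Real.sq_sqrt (Nat.cast_nonneg p)
  have h1 : ((m * k + p * n * l : ℤ) : F) + ((m * l + n * k : ℤ) : F) * θ = (1 : ℤ) + (0 : ℤ) * θ := by
    have := mul_inv_cancel₀ hu0
    rw [hkl, hmn] at this
    push_cast
    linear_combination this - (n * l : F) * h.sq
  obtain ⟨h2, h3⟩ := h.int_coord_inj h1
  have hN : (m ^ 2 - p * n ^ 2) * (k ^ 2 - p * l ^ 2) = 1 := by grind
  have hs := hpos σ
  have ht := hpos τ
  rw [hmn] at hs ht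
  simp only [map_add, map_mul, map_intCast, hσ, hτ] at hs ht
  have hNpos : 0 < m ^ 2 - p * n ^ 2 := by
    have : (0 : ℝ) < m ^ 2 - p * n ^ 2 := by rw [← hr]; nlinarith
    exact_mod_cast this
  have hN1 : m ^ 2 - p * n ^ 2 = 1 := by
    rcases Int.eq_one_or_neg_one_of_mul_eq_one hN with h4 | h4
    · exact h4
    · omega
  refine ⟨Pell.Solution₁.mk m n hN1, by simpa using hmn, ?_⟩
  have : (0 : ℝ) < m := by linarith
  simpa using (mod_cast this : 0 < m)

/-- The value of a Pell solution in `F`. -/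
def pellHom (h : IsSqrtGen F p θ) : Pell.Solution₁ (p : ℤ) →* F where
  toFun a := a.x + a.y * θ
  map_one' := by simp
  map_mul' a b := by
    rw [Pell.Solution₁.x_mul, Pell.Solution₁.y_mul]
    push_cast
    linear_combination -(a.y * b.y : F) * h.sq

lemma pellHom_mem (h : IsSqrtGen F p θ) (a : Pell.Solution₁ (p : ℤ)) : h.pellHom a ∈ intR F :=
  h.mem_intR.mpr ⟨a.x, a.y, rfl⟩

lemma pellHom_inv (h : IsSqrtGen F p θ) (a : Pell.Solution₁ (p : ℤ)) :
    (h.pellHom a)⁻¹ = h.pellHom a⁻¹ := by grind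

lemma pellHom_ne_zero (h : IsSqrtGen F p θ) (a : Pell.Solution₁ (p : ℤ)) : h.pellHom a ≠ 0 :=
  (Group.isUnit a |>.map h.pellHom).ne_zero

theorem exists_dyadicData (h : IsSqrtGen F p θ) : ∃ s ε : F, DyadicData θ s ε := by
  have hp0 : (0 : ℤ) < p := mod_cast h.prime.pos
  obtain ⟨a, ha⟩ := Pell.IsFundamental.exists_of_not_isSquare hp0
    (fun hsq => (Nat.prime_iff_prime_int.mp h.prime).irreducible.not_isSquare hsq)
  obtain ⟨x, y, hX, hY, hxy, hX2, hY2⟩ := pell_factor h.prime h.mod ha.1 a.prop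
    (fun c d hcd hc => by
      have := ha.x_le_x (a := Pell.Solution₁.mk c d hcd) (by simpa using hc)
      simpa using this)
  have hodd : x % 2 = 1 ∧ y % 2 = 1 := by
    rw [hY] at hY2
    rcases Int.even_or_odd' x with ⟨x', rfl | rfl⟩ <;> rcases Int.even_or_odd' y with ⟨y', rfl | rfl⟩
    · ring_nf at hY2; omega
    · ring_nf at hY2; omega
    · ring_nf at hY2; omega
    · omega
  have hsmem : (x + y * θ : F) ∈ intR F := h.mem_intR.mpr ⟨x, y, rfl⟩
  refine ⟨x + y * θ, h.pellHom a, hsmem, h.pellHom_mem a, h.pellHom_inv a ▸ h.pellHom_mem _, ?_, ?_,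
    ⟨x, y, rfl, hodd⟩, ?_, ?_⟩
  · have e1 : (2 * a.x : F) = x ^ 2 + p * y ^ 2 := mod_cast congrArg (Int.cast (R := F)) hX
    have e2 : (a.y : F) = x * y := mod_cast congrArg (Int.cast (R := F)) hY
    show _ = 2 * ((a.x : F) + a.y * θ)
    linear_combination (y ^ 2 : F) * h.sq - e1 - 2 * θ * e2
  · obtain ⟨σ, τ, hσ, hτ⟩ := h.exists_real_pair
    intro ρ
    have hρ : (ρ θ) ^ 2 = p := by rw [← map_pow, h.sq, map_natCast]
    show 0 < ρ ((a.x : F) + a.y * θ)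
    have e : ρ ((a.x : F) + a.y * θ) * ((a.x : ℝ) - a.y * ρ θ) = 1 := by
      have := congrArg (Int.cast (R := ℝ)) a.prop
      push_cast at this
      simp only [map_add, map_mul, map_intCast]
      grind
    have hx1 : (0 : ℝ) < a.x := by
      have := ha.1
      exact_mod_cast (by linarith : 0 < a.x)
    by_contra hneg
    push Not at hneg
    have : ρ ((a.x : F) + a.y * θ) = a.x + a.y * ρ θ := by simp
    nlinarith
  · obtain ⟨k, hk⟩ : ∃ k, a.x = 1 + x + 2 * k := ⟨(a.x - 1 - x) / 2, by omega⟩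
    obtain ⟨l, hl⟩ : ∃ l, a.y = y + 2 * l := ⟨(a.y - y) / 2, by omega⟩
    refine ⟨k + l * θ, h.mem_intR.mpr ⟨k, l, rfl⟩, ?_⟩
    show (a.x : F) + a.y * θ = _
    rw [hk, hl]; push_cast; ring
  · intro u hu hu' hu0 hpos
    obtain ⟨b, hb, hb0⟩ := h.pell_of_unit hu hu' hu0 hpos
    have hub : u = h.pellHom b := hb
    obtain ⟨n, hn | hn⟩ := ha.eq_zpow_or_neg_zpow b
    · obtain ⟨k, hk | hk⟩ := Int.even_or_odd' n
      · refine ⟨h.pellHom (a ^ k), h.pellHom_mem _, h.pellHom_inv _ ▸ h.pellHom_mem _, h.pellHom_ne_zero _,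
          Or.inl ?_⟩
        rw [hub, ← map_pow, hn, hk, ← zpow_natCast, ← zpow_mul]; congr 2; push_cast; ring
      · refine ⟨h.pellHom (a ^ k), h.pellHom_mem _, h.pellHom_inv _ ▸ h.pellHom_mem _, h.pellHom_ne_zero _,
          Or.inr ?_⟩
        rw [hub, ← map_pow, ← map_mul, hn, hk, ← zpow_natCast, ← zpow_mul, ← zpow_one_add]
        grind
    · exfalso
      have h1 := Pell.Solution₁.x_zpow_pos ha.x_pos n
      rw [hn, Pell.Solution₁.x_neg] at hb0
      linarith

end IsSqrtGen

end Units

section Dyadic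

variable {F} {p : ℕ} {θ s ε : F}

lemma one_le_sq_of_ne_zero {n : ℤ} (hn : n ≠ 0) : 1 ≤ n ^ 2 := by
  have : 0 < n ^ 2 := by positivity
  omega

namespace IsSqrtGen

lemma int_div_mem (h : IsSqrtGen F p θ) {N : ℤ} (hN : N ≠ 0) {m n : ℤ} :
    ((m + n * θ : F) / N ∈ intR F) ↔ N ∣ m ∧ N ∣ n := by
  have hN' : (N : F) ≠ 0 := mod_cast hN
  rw [h.mem_intR]
  constructor
  · rintro ⟨k, l, hkl⟩
    rw [div_eq_iff hN'] at hkl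
    have := h.int_coord_inj (a := m) (b := n) (c := N * k) (d := N * l) (by
      rw [hkl]; push_cast; ring)
    exact ⟨⟨k, this.1⟩, ⟨l, this.2⟩⟩
  · rintro ⟨⟨k, rfl⟩, ⟨l, rfl⟩⟩
    grind

lemma sq_ne (h : IsSqrtGen F p θ) {n : ℕ} (hn : n < 7) (hsq : ¬ IsSquare n) (x : F) : x ^ 2 ≠ n := by
  intro hx
  obtain ⟨hp5, hp4, hpp⟩ := And.intro h.gt (And.intro h.mod h.prime)
  have hx' := h.eq_coord x
  set a := h.re x
  set b := h.im x
  have := h.coord_inj (a := a ^ 2 + p * b ^ 2) (b := 2 * a * b) (c := n) (d := 0) (by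
    push_cast
    rw [hx'] at hx
    linear_combination hx - (b : F) ^ 2 * h.sq)
  have h2 : a = 0 ∨ b = 0 := by simpa using this.2
  rcases h2 with h2 | h2
  · have h3 : ((p * n : ℕ) : ℚ) = (p * b) ^ 2 := by grind
    have h4 : IsSquare (p * n) := by
      rw [← Rat.isSquare_natCast_iff]; exact ⟨p * b, by rw [h3, pow_two]⟩
    obtain ⟨k, hk⟩ := h4
    have h5 : p ∣ k := by
      rcases hpp.dvd_mul.mp ⟨n, hk.symm⟩ with h5 | h5 <;> exact h5
    obtain ⟨l, rfl⟩ := h5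
    have h6 : n = p * l ^ 2 := by
      apply Nat.eq_of_mul_eq_mul_left hpp.pos; rw [hk]; ring
    have h7 : l = 0 := by
      by_contra hl
      have : 1 ≤ l ^ 2 := Nat.one_le_pow _ _ (Nat.pos_of_ne_zero hl)
      have : p ≤ p * l ^ 2 := Nat.le_mul_of_pos_right _ (by omega)
      omega
    rw [h7] at h6
    exact hsq ⟨0, by simpa using h6⟩
  · apply hsq
    rw [← Rat.isSquare_natCast_iff]
    refine ⟨a, ?_⟩
    have := this.1
    grind

/-- Small totally real integers are rational. -/
lemma eq_int_of_bounded (h : IsSqrtGen F p θ) {t : F} (ht : t ∈ intR F) {c : ℝ} (hc : c < 7)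
    (hb : ∀ σ : F →+* ℝ, (σ t) ^ 2 ≤ c) : ∃ m : ℤ, t = m ∧ (m : ℝ) ^ 2 ≤ c := by
  obtain ⟨m, n, rfl⟩ := h.mem_intR.mp ht
  obtain ⟨σ, τ, hσ, hτ⟩ := h.exists_real_pair
  have hr : (√(p : ℝ)) ^ 2 = p := Real.sq_sqrt (Nat.cast_nonneg p)
  have h1 := hb σ
  have h2 := hb τ
  simp only [map_add, map_mul, map_intCast, hσ, hτ] at h1 h2
  have hp7 : (7 : ℝ) ≤ p := by
    have := h.gt; have := h.mod
    exact_mod_cast (by omega : 7 ≤ p)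
  have h3 : (m : ℝ) ^ 2 + p * n ^ 2 ≤ c := by rw [← hr]; nlinarith
  have hn : n = 0 := by
    by_contra hn
    have : (1 : ℝ) ≤ (n : ℝ) ^ 2 := mod_cast one_le_sq_of_ne_zero hn
    nlinarith [sq_nonneg (m : ℝ)]
  subst hn
  grind

lemma two_ne_sq (h : IsSqrtGen F p θ) (x : F) : x ^ 2 ≠ 2 := by
  have := h.sq_ne (n := 2) (by norm_num) (by
    rintro ⟨k, hk⟩
    have : k < 2 := by nlinarith
    interval_cases k <;> omega) x
  grind

lemma eq_of_bounded_two (h : IsSqrtGen F p θ) {t : F} (ht : t ∈ intR F) (hb : ∀ σ : F →+* ℝ, (σ t) ^ 2 ≤ 4) :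
    t = 0 ∨ t = 1 ∨ t = -1 ∨ t = 2 ∨ t = -2 := by
  obtain ⟨m, rfl, hm⟩ := h.eq_int_of_bounded ht (by norm_num) hb
  have hm' : m ^ 2 ≤ 4 := mod_cast hm
  have h1 : m ≤ 2 := by nlinarith
  have h2 : -2 ≤ m := by nlinarith
  interval_cases m <;> simp

end IsSqrtGen

namespace DyadicData

lemma eps_ne (D : DyadicData θ s ε) : ε ≠ 0 := by
  intro h0
  obtain ⟨x, y, hs, hx, hy⟩ := D.coords
  have : s = 0 := by have := D.sq; rw [h0, mul_zero] at this; exact pow_eq_zero_iff two_ne_zero |>.mp this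
  obtain ⟨z, hz, he⟩ := D.eps_eq
  rw [h0, this] at he
  have h1 : IsIntegral ℤ z := by
    obtain ⟨r, rfl⟩ := hz; exact r.2
  have h2 : z = ((-1 / 2 : ℚ) : F) := by push_cast; linear_combination -he / 2
  rw [h2] at h1
  obtain ⟨m, hm⟩ := IsSqrtGen.rat_isInt_of_isIntegral h1
  have : (-1 : ℤ) = 2 * m := by
    have : (-1 : ℚ) = 2 * m := by rw [← hm]; norm_num
    exact_mod_cast this
  omega

lemma s_ne (D : DyadicData θ s ε) : s ≠ 0 := by
  intro h0
  have := D.sq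
  rw [h0] at this
  exact D.eps_ne (by simpa using this.symm)

lemma eps_def (D : DyadicData θ s ε) : ε = s ^ 2 / 2 := by rw [D.sq]; simp

lemma two_div_s_mem (D : DyadicData θ s ε) : 2 / s ∈ intR F := by
  have : 2 / s = s * ε⁻¹ := by
    have := D.s_ne; have := D.eps_ne
    field_simp; rw [← D.sq]
  rw [this]
  exact (intR F).mul_mem D.s_mem D.inv_mem

variable (h : IsSqrtGen F p θ) (D : DyadicData θ s ε)
include h D

lemma dvd_four {m n : ℤ} (hmn : (m + n * s : F) / 4 ∈ intR F) : 4 ∣ m ∧ 4 ∣ n := by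
  obtain ⟨x, y, hs, hx, hy⟩ := D.coords
  have h1 := (h.int_div_mem (N := 4) (m := m + n * x) (n := n * y) (by norm_num)).mp (by
    rw [hs] at hmn
    convert hmn using 2
    · push_cast; ring
    · norm_num)
  have h2 : (4 : ℤ) ∣ n := by
    have hc : IsCoprime (4 : ℤ) y := by
      rw [Int.isCoprime_iff_gcd_eq_one]
      have : Int.gcd 4 y ∣ 4 := mod_cast Int.gcd_dvd_left (a := 4) (b := y)
      have h3 : ((Int.gcd 4 y : ℕ) : ℤ) ∣ y := Int.gcd_dvd_right ..
      have h5 : Int.gcd 4 y ≤ 4 := Nat.le_of_dvd (by norm_num) this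
      interval_cases Int.gcd 4 y <;> omega
    exact hc.dvd_of_dvd_mul_right h1.2
  exact ⟨by
    obtain ⟨k, rfl⟩ := h2
    have := h1.1
    rw [mul_assoc] at this
    exact (Int.dvd_add_left ⟨k * x, rfl⟩).mp this, h2⟩

lemma dvd_two {m n : ℤ} (hmn : (m + n * s : F) / 2 ∈ intR F) : 2 ∣ m ∧ 2 ∣ n := by
  have := D.dvd_four h (m := 2 * m) (n := 2 * n) (by
    convert hmn using 1
    push_cast; ring)
  omega

lemma dvd_s {m n : ℤ} (hmn : (m + n * s : F) / s ∈ intR F) : 2 ∣ m := by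
  have hs := D.s_ne
  refine (D.dvd_two h (m := 0) (n := m) ?_).2
  have : ((0 : ℤ) + m * s : F) / 2 = ε * ((m + n * s : F) / s - n) := by
    rw [D.eps_def]; field_simp; push_cast; ring
  rw [this]
  exact (intR F).mul_mem D.eps_mem ((intR F).sub_mem hmn (intCast_mem _ n))

lemma exists_pattern {x : F} (hx : x ∈ intR F) :
    ∃ a b : Fin 2, ∃ z ∈ intR F, x = ((a : ℕ) : F) + ((b : ℕ) : F) * s + 2 * z := by
  obtain ⟨m, n, rfl⟩ := h.mem_intR.mp hx
  obtain ⟨x, y, hs, hx, hy⟩ := D.coords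
  have hfin : ∀ m : ℤ, ∃ a : Fin 2, ∃ k : ℤ, m = (a : ℕ) + 2 * k := fun m => by
    rcases Int.even_or_odd' m with ⟨k, hk | hk⟩
    · exact ⟨0, k, by simpa using hk⟩
    · exact ⟨1, k, by simp; omega⟩
  obtain ⟨b, k, hk⟩ := hfin n
  obtain ⟨a, l, hl⟩ := hfin (m - (b : ℕ) * x)
  obtain ⟨y', hy'⟩ : ∃ y', y = 1 + 2 * y' := ⟨y / 2, by omega⟩
  refine ⟨a, b, l + (k - (b : ℕ) * y') * θ, h.mem_intR.mpr ⟨l, k - (b : ℕ) * y', by push_cast; ring⟩, ?_⟩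
  have hm : m = (a : ℕ) + (b : ℕ) * x + 2 * l := by linarith
  rw [hm, hk, hs, hy']
  push_cast; ring

lemma eps_ne_sq (x : F) : x ^ 2 ≠ ε := by
  intro hx
  have hx0 : x ≠ 0 := by rintro rfl; exact D.eps_ne (by simpa using hx.symm)
  apply h.two_ne_sq (s / x)
  rw [div_pow, hx, D.sq]
  grind

lemma eq_of_bounded_eps {t : F} (ht : t ∈ intR F) (hb : ∀ σ : F →+* ℝ, (σ t) ^ 2 ≤ 4 * σ ε) :
    t = 0 ∨ t = s ∨ t = -s := by
  have hs := D.s_ne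
  have he := D.eps_ne
  have hte : t * ε⁻¹ ∈ intR F := (intR F).mul_mem ht D.inv_mem
  obtain ⟨k, l, hkl⟩ := h.mem_intR.mp hte
  obtain ⟨x, y, hxy, hx, hy⟩ := D.coords
  set m := x * k + p * y * l with hm
  set n := x * l + y * k with hn
  have ht' : s * (t * ε⁻¹) = m + n * θ := by
    rw [hkl, hxy, hm, hn]; push_cast
    linear_combination (y * l : F) * h.sq
  have hpodd : (p : ℤ) % 2 = 1 := by have := h.mod; omega
  have hpar : (m + n) % 2 = 0 := by
    obtain ⟨x', rfl⟩ : ∃ x', x = 1 + 2 * x' := ⟨x / 2, by omega⟩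
    obtain ⟨y', rfl⟩ : ∃ y', y = 1 + 2 * y' := ⟨y / 2, by omega⟩
    obtain ⟨q, hq⟩ : ∃ q, (p : ℤ) = 1 + 2 * q := ⟨p / 2, by omega⟩
    have : m + n = 2 * (k + l + x' * k + x' * l + y' * k + (q + y' + 2 * q * y') * l) := by grind
    omega
  have hb' : ∀ σ : F →+* ℝ, (σ (m + n * θ)) ^ 2 ≤ 8 := by
    intro σ
    have hpos := D.pos σ
    have h1 := hb σ
    have h2 : (σ s) ^ 2 = 2 * σ ε := by rw [← map_pow, D.sq, map_mul, map_ofNat]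
    rw [← ht', map_mul, map_mul, map_inv₀, mul_pow, mul_pow, h2, inv_pow]
    rw [show 2 * σ ε * ((σ t) ^ 2 * ((σ ε) ^ 2)⁻¹) = 2 * (σ t) ^ 2 / σ ε by field_simp,
      div_le_iff₀ hpos]
    linarith
  obtain ⟨σ, τ, hσ, hτ⟩ := h.exists_real_pair
  have hr : (√(p : ℝ)) ^ 2 = p := Real.sq_sqrt (Nat.cast_nonneg p)
  have hr0 : 0 < √(p : ℝ) := Real.sqrt_pos.mpr (mod_cast h.prime.pos)
  have h1 := hb' σ
  have h2 := hb' τ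
  simp only [map_add, map_mul, map_intCast, hσ, hτ] at h1 h2
  have hp7 : (7 : ℝ) ≤ p := by
    have := h.gt; have := h.mod
    exact_mod_cast (by omega : 7 ≤ p)
  have hmn : m = 0 ∨ n = 0 := by
    by_contra hmn
    push Not at hmn
    have a1 : (1 : ℝ) ≤ (n : ℝ) ^ 2 := mod_cast one_le_sq_of_ne_zero hmn.2
    have a2 : (1 : ℝ) ≤ (m : ℝ) ^ 2 := mod_cast one_le_sq_of_ne_zero hmn.1
    have a3 : (p : ℝ) ≤ p * (n : ℝ) ^ 2 := by nlinarith
    have a4 : (m : ℝ) * n ≠ 0 := by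
      exact_mod_cast mul_ne_zero hmn.1 hmn.2
    rcases lt_or_gt_of_ne a4 with a5 | a5
    · nlinarith [mul_pos (neg_pos.mpr a5) hr0]
    · nlinarith [mul_pos a5 hr0]
  have ht2 : t = (m + n * θ) * (s / 2) := by
    rw [← ht', D.eps_def]
    field_simp
  have hn0 : n = 0 := by
    rcases hmn with h0 | h0
    · by_contra hn0
      have hn2 : (2 : ℤ) ∣ n := by omega
      obtain ⟨n', hn'⟩ := hn2
      have : n' ≠ 0 := by grind
      have a1 : (1 : ℝ) ≤ (n' : ℝ) ^ 2 := mod_cast one_le_sq_of_ne_zero this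
      rw [h0, hn'] at h1
      push_cast at h1
      nlinarith
    · exact h0
  rw [hn0] at h1 ht2 hpar
  have hm8 : m ^ 2 ≤ 8 := by
    have : (m : ℝ) ^ 2 ≤ 8 := by simpa using h1
    exact_mod_cast this
  have b1 : m ≤ 2 := by nlinarith
  have b2 : -2 ≤ m := by nlinarith
  have hm3 : m = 0 ∨ m = 2 ∨ m = -2 := by omega
  rcases hm3 with h3 | h3 | h3 <;> rw [h3] at ht2
  · left; rw [ht2]; simp
  · grind
  · grind

end DyadicData

end Dyadic

section NormForm

variable {K : Type} [Field K] {a b : K}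

/-- The reduced norm of the quaternion algebra `(a, b)`. -/
def nrd (y : ℍ[K,a,b]) : K := y.re ^ 2 - a * y.imI ^ 2 - b * y.imJ ^ 2 + a * b * y.imK ^ 2

lemma nrd_mul (x y : ℍ[K,a,b]) : nrd (x * y) = nrd x * nrd y := by
  simp [nrd]; ring

lemma nrd_algebraMap (c : K) : nrd (algebraMap K ℍ[K,a,b] c) = c ^ 2 := by
  simp [nrd, algebraMap_quat]

lemma mul_star_eq (y : ℍ[K,a,b]) : y * star y = algebraMap K _ (nrd y) := by
  rw [algebraMap_quat]; ext <;> simp [nrd] <;> ring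

lemma star_eq_sub (y : ℍ[K,a,b]) : star y = algebraMap K _ (2 * y.re) - y := by
  rw [algebraMap_quat]; ext <;> simp; ring

lemma mul_self_eq (y : ℍ[K,a,b]) :
    y * y = algebraMap K _ (2 * y.re) * y - algebraMap K _ (nrd y) := by
  rw [algebraMap_quat, algebraMap_quat]; ext <;> simp [nrd] <;> ring

lemma re_mul_comm (x y : ℍ[K,a,b]) : (x * y).re = (y * x).re := by simp; ring

section Definite

variable {σ : K →+* ℝ} (hab : σ a < 0 ∧ σ b < 0)
include hab

lemma four_nrd_sub (y : ℍ[K,a,b]) : 0 ≤ 4 * σ (nrd y) - (σ (2 * y.re)) ^ 2 ∧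
    (4 * σ (nrd y) - (σ (2 * y.re)) ^ 2 = 0 → y = algebraMap K _ y.re) := by
  have e : 4 * σ (nrd y) - (σ (2 * y.re)) ^ 2 = 4 * ((-σ a) * (σ y.imI) ^ 2 + (-σ b) * (σ y.imJ) ^ 2
      + (σ a * σ b) * (σ y.imK) ^ 2) := by
    simp only [nrd, map_add, map_sub, map_mul, map_pow, map_ofNat]; ring
  have h1 : 0 ≤ (-σ a) * (σ y.imI) ^ 2 := mul_nonneg (by linarith) (sq_nonneg _)
  have h2 : 0 ≤ (-σ b) * (σ y.imJ) ^ 2 := mul_nonneg (by linarith) (sq_nonneg _)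
  have h3 : 0 < σ a * σ b := mul_pos_of_neg_of_neg hab.1 hab.2
  have h4 : 0 ≤ (σ a * σ b) * (σ y.imK) ^ 2 := mul_nonneg h3.le (sq_nonneg _)
  refine ⟨by rw [e]; linarith, fun h0 => ?_⟩
  rw [e] at h0
  have z1 : (-σ a) * (σ y.imI) ^ 2 = 0 := by linarith
  have z2 : (-σ b) * (σ y.imJ) ^ 2 = 0 := by linarith
  have z3 : (σ a * σ b) * (σ y.imK) ^ 2 = 0 := by linarith
  have w1 : y.imI = 0 := by simpa [hab.1.ne] using z1
  have w2 : y.imJ = 0 := by simpa [hab.2.ne] using z2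
  have w3 : y.imK = 0 := by simpa [hab.1.ne, hab.2.ne] using z3
  rw [algebraMap_quat]; ext <;> simp [w1, w2, w3]

lemma nrd_ne_zero {y : ℍ[K,a,b]} (hy : y ≠ 0) : nrd y ≠ 0 := by
  intro h0
  have h := four_nrd_sub hab y
  rw [h0, map_zero] at h
  have h1 : (σ (2 * y.re)) ^ 2 = 0 := le_antisymm (by linarith [h.1]) (sq_nonneg _)
  have h2 : y.re = 0 := by
    rw [map_mul, map_ofNat] at h1
    simpa using h1
  apply hy
  grind

lemma nrd_pos {y : ℍ[K,a,b]} (hy : y ≠ 0) : 0 < σ (nrd y) := by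
  have h := (four_nrd_sub hab y).1
  have h2 : σ (nrd y) ≠ 0 := by simpa using nrd_ne_zero hab hy
  have : 0 ≤ σ (nrd y) := by nlinarith [sq_nonneg (σ (2 * y.re))]
  grind

end Definite

end NormForm

section Orders

variable {F : Type} [Field F]

lemma IsOrder.isIntegral {H : Type} [Ring H] [Algebra F H] {O : Subring H} (hO : IsOrder F O)
    {y : H} (hy : y ∈ O) : IsIntegral ℤ y := by
  have hfg : O.toAddSubgroup.FG := hO.2.1
  have h1 : (AddSubgroup.toIntSubmodule O.toAddSubgroup).FG := by
    rw [Submodule.fg_iff_addSubgroup_fg]; exact hfg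
  have h2 : Module.Finite ℤ O := Module.Finite.iff_fg.mpr h1
  have h3 : IsIntegral ℤ (⟨y, hy⟩ : O) := IsIntegral.of_finite ℤ _
  exact h3.map O.subtype.toIntAlgHom

lemma star_isIntegral {a b : F} {y : ℍ[F,a,b]} (hy : IsIntegral ℤ y) : IsIntegral ℤ (star y) := by
  have := hy.map (starRingEquiv (R := ℍ[F,a,b])).toRingHom.toIntAlgHom
  obtain ⟨f, hf, h0⟩ := this
  refine ⟨f, hf, ?_⟩
  have h1 := congrArg MulOpposite.unop h0
  simp only [Polynomial.eval₂_eq_sum_range, Finset.unop_sum] at h1 ⊢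
  simpa [← Int.cast_comm] using h1

lemma isIntegral_add_mul_of_commute {H : Type} [Ring H] {x y : H} (hx : IsIntegral ℤ x)
    (hy : IsIntegral ℤ y) (hc : x * y = y * x) : IsIntegral ℤ (x + y) ∧ IsIntegral ℤ (x * y) := by
  let S := Algebra.adjoin ℤ ({x, y} : Set H)
  have hS : IsMulCommutative S := Algebra.isMulCommutative_adjoin ℤ (s := {x, y}) (by
    rintro u (rfl | rfl) v (rfl | rfl) <;> first | rfl | exact hc | exact hc.symm)
  let _ : CommRing S := { (inferInstance : Ring S) with mul_comm := hS.is_comm.comm }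
  have mx : x ∈ S := Algebra.subset_adjoin (by simp)
  have my : y ∈ S := Algebra.subset_adjoin (by simp)
  have ix : IsIntegral ℤ (⟨x, mx⟩ : S) :=
    (isIntegral_algHom_iff S.val Subtype.coe_injective).mp hx
  have iy : IsIntegral ℤ (⟨y, my⟩ : S) :=
    (isIntegral_algHom_iff S.val Subtype.coe_injective).mp hy
  exact ⟨(ix.add iy).map S.val, (ix.mul iy).map S.val⟩

variable [NumberField F]

lemma IsOrder.algebraMap_mem {H : Type} [Ring H] [Algebra F H] {O : Subring H} (hO : IsOrder F O)
    {x : F} (hx : x ∈ intR F) : algebraMap F H x ∈ O := by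
  obtain ⟨r, rfl⟩ := hx
  exact hO.1 ⟨r, rfl⟩

lemma mem_intR_of_isIntegral {x : F} (hx : IsIntegral ℤ x) : x ∈ intR F :=
  ⟨⟨x, hx⟩, rfl⟩

variable {a b : F}

lemma isIntegral_algebraMap_quat {x : F} (hx : IsIntegral ℤ (algebraMap F ℍ[F,a,b] x)) :
    x ∈ intR F := by
  refine mem_intR_of_isIntegral ?_
  exact (isIntegral_algHom_iff (algebraMap F ℍ[F,a,b]).toIntAlgHom
    (algebraMap F ℍ[F,a,b]).injective).mp hx

namespace IsOrder

variable {O : Subring ℍ[F,a,b]} (hO : IsOrder F O) {y : ℍ[F,a,b]} (hy : y ∈ O)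
include hO hy

lemma nrd_tr_mem : nrd y ∈ intR F ∧ 2 * y.re ∈ intR F := by
  have h1 := hO.isIntegral hy
  have h2 := star_isIntegral h1
  have hc : y * star y = star y * y := by
    rw [star_eq_sub, mul_sub, sub_mul, (Algebra.commutes _ _)]
  have h3 := isIntegral_add_mul_of_commute h1 h2 hc
  refine ⟨isIntegral_algebraMap_quat (a := a) (b := b) ?_, isIntegral_algebraMap_quat (a := a) (b := b) ?_⟩
  · rw [← mul_star_eq]; exact h3.2
  · have : algebraMap F ℍ[F,a,b] (2 * y.re) = y + star y := by rw [star_eq_sub]; abel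
    grind

lemma nrd_mem : nrd y ∈ intR F := (hO.nrd_tr_mem hy).1

lemma tr_mem : 2 * y.re ∈ intR F := (hO.nrd_tr_mem hy).2

lemma star_mem : star y ∈ O := by
  rw [star_eq_sub]; exact O.sub_mem (hO.algebraMap_mem (hO.tr_mem hy)) hy

end IsOrder

end Orders

section Units

variable {F : Type} [Field F] {ε a b : F}

/-- Square roots of `-1`. -/
def IsI (y : ℍ[F,a,b]) : Prop := y.re = 0 ∧ nrd y = 1

/-- Primitive cube roots of `1`. -/
def IsOmega (y : ℍ[F,a,b]) : Prop := 2 * y.re = -1 ∧ nrd y = 1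

/-- Square roots of `-ε`. -/
def IsW (ε : F) (y : ℍ[F,a,b]) : Prop := y.re = 0 ∧ nrd y = ε

lemma re_neg_nrd_neg (y : ℍ[F,a,b]) : (-y).re = -y.re ∧ nrd (-y) = nrd y := by
  simp [nrd]

lemma IsI.mul_self {y : ℍ[F,a,b]} (hy : IsI y) : y * y = -1 := by
  rw [mul_self_eq, hy.1, hy.2]; simp

lemma IsI.star {y : ℍ[F,a,b]} (hy : IsI y) : star y = -y := by
  rw [star_eq_sub, hy.1]; simp

lemma IsW.mul_self {y : ℍ[F,a,b]} (hy : IsW ε y) : y * y = -algebraMap F _ ε := by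
  rw [mul_self_eq, hy.1, hy.2]; simp

lemma IsOmega.mul_self {y : ℍ[F,a,b]} (hy : IsOmega y) : y * y = -y - 1 := by
  rw [mul_self_eq, hy.1, hy.2]; simp

lemma IsOmega.star {y : ℍ[F,a,b]} (hy : IsOmega y) : star y = -1 - y := by
  rw [star_eq_sub, hy.1]; simp

lemma commute_of_smul_sub_one {c : F} (hc : c ≠ 0) {x y : ℍ[F,a,b]}
    (h : Commute x (algebraMap F _ c * y - 1)) : Commute x y := by
  have h1 : Commute x (algebraMap F _ c * y) := by
    simpa using h.add_right (Commute.one_right x)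
  have h0 : Commute x (algebraMap F ℍ[F,a,b] c⁻¹) := (Algebra.commutes c⁻¹ x).symm
  have h2 := h0.mul_right h1
  rwa [← mul_assoc, ← map_mul, inv_mul_cancel₀ hc, map_one, one_mul] at h2

lemma commute_of_neg {x y : ℍ[F,a,b]} (h : Commute x (-y)) : Commute x y := by
  simpa using h.neg_right

variable [NumberField F] {p : ℕ} {θ s : F}

/-- The square root of `-1` attached to a unit of norm `ε` and trace `s`. -/
lemma isI_of_trace (D : DyadicData θ s ε) {y : ℍ[F,a,b]} (hn : nrd y = ε) (ht : 2 * y.re = s) :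
    IsI (algebraMap F _ (2 / s) * y - 1) := by
  have hs := D.s_ne
  constructor
  · simp [algebraMap_quat]; field_simp; linear_combination ht
  · have : nrd (algebraMap F _ (2 / s) * y - 1) = (2 / s) ^ 2 * nrd y - (2 / s) * (2 * y.re) + 1 := by
      simp [nrd, algebraMap_quat]; ring
    rw [this, hn, ht, D.eps_def]; field_simp; ring

section Order

variable (h : IsSqrtGen F p θ) (D : DyadicData θ s ε)
  (hab : ∀ σ : F →+* ℝ, σ a < 0 ∧ σ b < 0) {O : Subring ℍ[F,a,b]} (hO : IsOrder F O)
include hab hO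

include D in
lemma unit_decomp {u u' : ℍ[F,a,b]} (hu : u ∈ O) (hu' : u' ∈ O) (huu : u * u' = 1) :
    ∃ v ∈ intR F, v⁻¹ ∈ intR F ∧ v ≠ 0 ∧ ∃ y ∈ O, (nrd y = 1 ∨ nrd y = ε) ∧
      u = algebraMap F _ v * y := by
  have h1 : nrd u * nrd u' = 1 := by rw [← nrd_mul, huu]; simp [nrd]
  have h0 : nrd u ≠ 0 := left_ne_zero_of_mul_eq_one h1
  have hinv : (nrd u)⁻¹ = nrd u' := inv_eq_of_mul_eq_one_right h1
  have hu0 : u ≠ 0 := by rintro rfl; simp [nrd] at h0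
  obtain ⟨v, hv, hv', hv0, hval⟩ := D.units (nrd u) (hO.nrd_mem hu) (hinv ▸ hO.nrd_mem hu') h0
    fun σ => nrd_pos (hab σ) hu0
  refine ⟨v, hv, hv', hv0, algebraMap F _ v⁻¹ * u, O.mul_mem (hO.algebraMap_mem hv') hu, ?_, ?_⟩
  · rw [nrd_mul, nrd_algebraMap]
    grind
  · rw [← mul_assoc, ← map_mul, mul_inv_cancel₀ hv0, map_one, one_mul]

include h in
lemma trace_of_nrd_one {y : ℍ[F,a,b]} (hy : y ∈ O) (hn : nrd y = 1) :
    y = 1 ∨ y = -1 ∨ 2 * y.re = 0 ∨ 2 * y.re = 1 ∨ 2 * y.re = -1 := by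
  have hb : ∀ σ : F →+* ℝ, (σ (2 * y.re)) ^ 2 ≤ 4 := fun σ => by
    have := (four_nrd_sub (hab σ) y).1
    grind
  obtain ⟨σ, -, -, -⟩ := h.exists_real_pair
  have key : (2 * y.re) ^ 2 = 4 → y = algebraMap F _ y.re := fun h4 => by
    refine (four_nrd_sub (hab σ) y).2 ?_
    rw [hn, ← map_pow, h4, map_one, map_ofNat]; norm_num
  rcases h.eq_of_bounded_two (hO.tr_mem hy) hb with e | e | e | e | e
  · tauto
  · tauto
  · tauto
  · grind
  · grind

include h D

lemma trace_of_nrd_eps {y : ℍ[F,a,b]} (hy : y ∈ O) (hn : nrd y = ε) :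
    2 * y.re = 0 ∨ 2 * y.re = s ∨ 2 * y.re = -s := by
  refine D.eq_of_bounded_eps h (hO.tr_mem hy) fun σ => ?_
  have := (four_nrd_sub (hab σ) y).1
  grind

/-- Shapes of the elements of reduced norm `1` or `ε`. -/
lemma normUnit_cases {y : ℍ[F,a,b]} (hy : y ∈ O) (hn : nrd y = 1 ∨ nrd y = ε) :
    (y = 1 ∨ y = -1) ∨ (∃ g ∈ O, (IsI g ∨ IsOmega g ∨ IsW ε g) ∧ (y = g ∨ y = -g)) ∨
      ∃ i ∈ O, IsI i ∧ (y = algebraMap F _ (s / 2) * (1 + i) ∨ y = -(algebraMap F _ (s / 2) * (1 + i))) := by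
  have hs := D.s_ne
  have hneg := re_neg_nrd_neg y
  have z0 : 2 * y.re = 0 → y.re = 0 := fun e => by linear_combination e / 2
  have key : ∀ z : ℍ[F,a,b], algebraMap F _ (s / 2) * (1 + (algebraMap F _ (2 / s) * z - 1)) = z := by
    intro z
    rw [add_sub_cancel, ← mul_assoc, ← map_mul, show s / 2 * (2 / s) = 1 by field_simp, map_one, one_mul]
  have mem : ∀ z ∈ O, algebraMap F _ (2 / s) * z - 1 ∈ O := fun z hz =>
    O.sub_mem (O.mul_mem (hO.algebraMap_mem D.two_div_s_mem) hz) O.one_mem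
  rcases hn with hn | hn
  · rcases trace_of_nrd_one h hab hO hy hn with e | e | e | e | e
    · exact .inl (.inl e)
    · exact .inl (.inr e)
    · exact .inr (.inl ⟨y, hy, .inl ⟨z0 e, hn⟩, .inl rfl⟩)
    · exact .inr (.inl ⟨-y, O.neg_mem hy, .inr (.inl ⟨by rw [hneg.1]; linear_combination -e,
        by rw [hneg.2, hn]⟩), .inr (neg_neg y).symm⟩)
    · exact .inr (.inl ⟨y, hy, .inr (.inl ⟨e, hn⟩), .inl rfl⟩)
  · rcases trace_of_nrd_eps h D hab hO hy hn with e | e | e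
    · exact .inr (.inl ⟨y, hy, .inr (.inr ⟨z0 e, hn⟩), .inl rfl⟩)
    · exact .inr (.inr ⟨_, mem y hy, isI_of_trace D hn e, .inl (key y).symm⟩)
    · refine .inr (.inr ⟨_, mem _ (O.neg_mem hy), isI_of_trace D (hneg.2.trans hn)
        (by rw [hneg.1]; linear_combination -e), .inr ?_⟩)
      rw [key, neg_neg]

end Order

/-- Pairs of units generating the noncyclic configurations. -/
def HasPair (ε : F) (O : Subring ℍ[F,a,b]) : Prop :=
  (∃ i ∈ O, ∃ ω ∈ O, IsI i ∧ IsOmega ω ∧ 2 * (i * ω).re = -1) ∨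
  (∃ i ∈ O, ∃ g ∈ O, IsI i ∧ (IsI g ∨ IsW ε g) ∧ (i * g).re = 0) ∨
  (∃ ω ∈ O, ∃ g ∈ O, IsOmega ω ∧ (IsI g ∨ IsW ε g) ∧ (ω * g).re = 0)

section Pairs

variable (h : IsSqrtGen F p θ) (D : DyadicData θ s ε)
  (hab : ∀ σ : F →+* ℝ, σ a < 0 ∧ σ b < 0) {O : Subring ℍ[F,a,b]} (hO : IsOrder F O)
include h hab hO

lemma hasPair_I_I {i j : ℍ[F,a,b]} (hi : i ∈ O) (hj : j ∈ O) (Ii : IsI i) (Ij : IsI j)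
    (hc : ¬ Commute i j) : HasPair ε O := by
  have hz := O.mul_mem hi hj
  have hn : nrd (i * j) = 1 := by rw [nrd_mul, Ii.2, Ij.2, one_mul]
  have hneg := re_neg_nrd_neg (i * j)
  have hj' : j = -(i * (i * j)) := by rw [← mul_assoc, Ii.mul_self]; simp
  have hre : (i * j * i).re = 0 := by rw [re_mul_comm, ← mul_assoc, Ii.mul_self]; simp [Ij.1]
  rcases trace_of_nrd_one h hab hO hz hn with e | e | e | e | e
  · refine absurd ?_ hc; rw [hj', e]; simp
  · refine absurd ?_ hc; rw [hj', e]; simp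
  · exact .inr (.inl ⟨i, hi, j, hj, Ii, .inl Ij, by linear_combination e / 2⟩)
  · exact .inr (.inr ⟨-(i * j), O.neg_mem hz, i, hi, ⟨by rw [hneg.1]; linear_combination -e,
      by rw [hneg.2, hn]⟩, .inl Ii, by rw [neg_mul, (re_neg_nrd_neg _).1, hre, neg_zero]⟩)
  · exact .inr (.inr ⟨i * j, hz, i, hi, ⟨e, hn⟩, .inl Ii, hre⟩)

lemma hasPair_I_Omega {i ω : ℍ[F,a,b]} (hi : i ∈ O) (hω : ω ∈ O) (Ii : IsI i) (Iω : IsOmega ω)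
    (hc : ¬ Commute i ω) : HasPair ε O := by
  have hz := O.mul_mem hi hω
  have hn : nrd (i * ω) = 1 := by rw [nrd_mul, Ii.2, Iω.2, one_mul]
  have hω' : ω = -(i * (i * ω)) := by rw [← mul_assoc, Ii.mul_self]; simp
  have hneg := re_neg_nrd_neg i
  rcases trace_of_nrd_one h hab hO hz hn with e | e | e | e | e
  · refine absurd ?_ hc; rw [hω', e]; simp
  · refine absurd ?_ hc; rw [hω', e]; simp
  · exact .inr (.inr ⟨ω, hω, i, hi, Iω, .inl Ii, by rw [re_mul_comm]; linear_combination e / 2⟩)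
  · exact .inl ⟨-i, O.neg_mem hi, ω, hω, ⟨by rw [hneg.1, Ii.1, neg_zero], hneg.2.trans Ii.2⟩, Iω, by
      rw [neg_mul, (re_neg_nrd_neg _).1]; linear_combination -e⟩
  · exact .inl ⟨i, hi, ω, hω, Ii, Iω, e⟩

include D

lemma hasPair_I_W {i w : ℍ[F,a,b]} (hi : i ∈ O) (hw : w ∈ O) (Ii : IsI i) (Iw : IsW ε w)
    (hc : ¬ Commute i w) : HasPair ε O := by
  have hs := D.s_ne
  have hz := O.mul_mem hi hw
  have hn : nrd (i * w) = ε := by rw [nrd_mul, Ii.2, Iw.2, one_mul]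
  have hw' : w = -(i * (i * w)) := by rw [← mul_assoc, Ii.mul_self]; simp
  have hneg := re_neg_nrd_neg (i * w)
  have key : ∀ z ∈ O, nrd z = ε → 2 * z.re = s → ¬ Commute i z → HasPair ε O := by
    intro z hz hn ht hcz
    refine hasPair_I_I h hab hO hi (O.sub_mem (O.mul_mem (hO.algebraMap_mem D.two_div_s_mem) hz) O.one_mem) Ii
      (isI_of_trace D hn ht) fun hcc => hcz (commute_of_smul_sub_one (div_ne_zero two_ne_zero hs) hcc)
  have hcz : ¬ Commute i (i * w) := fun hcc => hc (by
    rw [hw']; exact ((Commute.refl i).mul_right hcc).neg_right)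
  rcases trace_of_nrd_eps h D hab hO hz hn with e | e | e
  · exact .inr (.inl ⟨i, hi, w, hw, Ii, .inr Iw, by linear_combination e / 2⟩)
  · exact key _ hz hn e hcz
  · exact key _ (O.neg_mem hz) (hneg.2.trans hn) (by rw [hneg.1]; linear_combination -e)
      fun hcc => hcz (commute_of_neg hcc)

lemma hasPair_Omega_W {ω w : ℍ[F,a,b]} (hω : ω ∈ O) (hw : w ∈ O) (Iω : IsOmega ω) (Iw : IsW ε w)
    (hc : ¬ Commute ω w) : HasPair ε O := by
  have hs := D.s_ne
  have hz := O.mul_mem hω hw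
  have hn : nrd (ω * w) = ε := by rw [nrd_mul, Iω.2, Iw.2, one_mul]
  have hw' : w = (-1 - ω) * (ω * w) := by
    rw [← mul_assoc, sub_mul, Iω.mul_self]; simp
  have hneg := re_neg_nrd_neg (ω * w)
  have key : ∀ z ∈ O, nrd z = ε → 2 * z.re = s → ¬ Commute ω z → HasPair ε O := by
    intro z hz hn ht hcz
    refine hasPair_I_Omega h hab hO
      (O.sub_mem (O.mul_mem (hO.algebraMap_mem D.two_div_s_mem) hz) O.one_mem) hω
      (isI_of_trace D hn ht) Iω fun hcc => hcz (commute_of_smul_sub_one (div_ne_zero two_ne_zero hs) hcc.symm)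
  have hcz : ¬ Commute ω (ω * w) := fun hcc => hc (by
    rw [hw']; exact (((Commute.one_right ω).neg_right).sub_right (Commute.refl ω)).mul_right hcc)
  rcases trace_of_nrd_eps h D hab hO hz hn with e | e | e
  · exact .inr (.inr ⟨ω, hω, w, hw, Iω, .inr Iw, by linear_combination e / 2⟩)
  · exact key _ hz hn e hcz
  · exact key _ (O.neg_mem hz) (hneg.2.trans hn) (by rw [hneg.1]; linear_combination -e)
      fun hcc => hcz (commute_of_neg hcc)

omit D in
lemma hasPair_Omega_Omega {ω ω' : ℍ[F,a,b]} (hω : ω ∈ O) (hω' : ω' ∈ O) (Iω : IsOmega ω)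
    (Iω' : IsOmega ω') (hc : ¬ Commute ω ω') : HasPair ε O := by
  have hst : star ω' ∈ O := hO.star_mem hω'
  have hsn : nrd (star ω') = 1 := by rw [← Iω'.2]; simp [nrd]
  have hsum : 2 * (ω * ω').re + 2 * (ω * star ω').re = 1 := by
    rw [Iω'.star, mul_sub, mul_neg, mul_one]
    simp only [QuaternionAlgebra.re_sub, QuaternionAlgebra.re_neg]
    linear_combination -Iω.1
  have cancel : ∀ x : ℍ[F,a,b], x = (-1 - ω) * (ω * x) := fun x => by
    rw [← mul_assoc, sub_mul, Iω.mul_self]; simp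
  have key : ∀ x ∈ O, nrd x = 1 → ¬ Commute ω x → 2 * (ω * x).re = 0 → HasPair ε O := by
    intro x hx hn hcx h0
    have hcz : ¬ Commute (ω * x) ω := fun hcc => hcx (by
      rw [cancel x]
      exact (((Commute.one_right ω).neg_right).sub_right (Commute.refl ω)).mul_right hcc.symm)
    exact hasPair_I_Omega h hab hO (O.mul_mem hω hx) hω
      ⟨by linear_combination h0 / 2, by rw [nrd_mul, Iω.2, hn, one_mul]⟩ Iω hcz
  have hc' : ¬ Commute ω (star ω') := fun hcc => hc (by
    rw [Iω'.star] at hcc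
    have := (((Commute.one_right ω).neg_right).sub_right hcc)
    simpa using this)
  have ne : ∀ x : ℍ[F,a,b], ¬ Commute ω x → ω * x ≠ 1 ∧ ω * x ≠ -1 := fun x hx =>
    ⟨fun e => hx (by rw [cancel x, e, mul_one]; exact ((Commute.one_right ω).neg_right).sub_right (Commute.refl ω)),
      fun e => hx (by rw [cancel x, e, mul_neg, mul_one]; exact (((Commute.one_right ω).neg_right).sub_right (Commute.refl ω)).neg_right)⟩
  have n1 := ne _ hc
  have n2 := ne _ hc'
  rcases trace_of_nrd_one h hab hO (O.mul_mem hω hω') (by rw [nrd_mul, Iω.2, Iω'.2, one_mul]) with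
    e | e | e | e | e
  · exact absurd e n1.1
  · exact absurd e n1.2
  · exact key _ hω' Iω'.2 hc e
  · exact key _ hst hsn hc' (by linear_combination hsum - e)
  · have e2 : 2 * (ω * star ω').re = 2 := by grind
    rcases trace_of_nrd_one h hab hO (O.mul_mem hω hst) (by rw [nrd_mul, Iω.2, hsn, one_mul]) with
      f | f | f | f | f
    · exact absurd f n2.1
    · exact absurd f n2.2
    · grind
    · grind
    · grind

lemma hasPair_W_W {w w' : ℍ[F,a,b]} (hw : w ∈ O) (hw' : w' ∈ O) (Iw : IsW ε w) (Iw' : IsW ε w')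
    (hc : ¬ Commute w w') : HasPair ε O := by
  have he := D.eps_ne
  set z : ℍ[F,a,b] := algebraMap F _ ε⁻¹ * (w * w') with hzdef
  have hz : z ∈ O := O.mul_mem (hO.algebraMap_mem D.inv_mem) (O.mul_mem hw hw')
  have hn : nrd z = 1 := by
    rw [hzdef, nrd_mul, nrd_algebraMap, nrd_mul, Iw.2, Iw'.2]; field_simp
  have hw'z : w' = -(w * z) := by
    rw [hzdef, ← mul_assoc, ← Algebra.commutes, mul_assoc, ← mul_assoc w w, Iw.mul_self, neg_mul,
      mul_neg, neg_neg, ← mul_assoc, ← map_mul, inv_mul_cancel₀ he, map_one, one_mul]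
  have hcz : ¬ Commute z w := fun hcc => hc (by
    rw [hw'z]; exact ((Commute.refl w).mul_right hcc.symm).neg_right)
  have hneg := re_neg_nrd_neg z
  rcases trace_of_nrd_one h hab hO hz hn with e | e | e | e | e
  · exact absurd (by rw [e]; simp) hcz
  · exact absurd (by rw [e]; simp) hcz
  · exact hasPair_I_W h D hab hO hz hw ⟨by linear_combination e / 2, hn⟩ Iw hcz
  · exact hasPair_Omega_W h D hab hO (O.neg_mem hz) hw ⟨by rw [hneg.1]; linear_combination -e,
      hneg.2.trans hn⟩ Iw fun hcc => hcz (commute_of_neg hcc.symm).symm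
  · exact hasPair_Omega_W h D hab hO hz hw ⟨e, hn⟩ Iw hcz

/-- Two non-commuting units produce one of the noncyclic configurations. -/
lemma hasPair_of_not_commute {x y : ℍ[F,a,b]} (hx : x ∈ O) (hy : y ∈ O)
    (Ix : IsI x ∨ IsOmega x ∨ IsW ε x) (Iy : IsI y ∨ IsOmega y ∨ IsW ε y)
    (hc : ¬ Commute x y) : HasPair ε O := by
  have hc' : ¬ Commute y x := fun hcc => hc hcc.symm
  rcases Ix with Ix | Ix | Ix <;> rcases Iy with Iy | Iy | Iy
  · exact hasPair_I_I h hab hO hx hy Ix Iy hc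
  · exact hasPair_I_Omega h hab hO hx hy Ix Iy hc
  · exact hasPair_I_W h D hab hO hx hy Ix Iy hc
  · exact hasPair_I_Omega h hab hO hy hx Iy Ix hc'
  · exact hasPair_Omega_Omega h hab hO hx hy Ix Iy hc
  · exact hasPair_Omega_W h D hab hO hx hy Ix Iy hc
  · exact hasPair_I_W h D hab hO hy hx Iy Ix hc'
  · exact hasPair_Omega_W h D hab hO hy hx Iy Ix hc'
  · exact hasPair_W_W h D hab hO hx hy Ix Iy hc

end Pairs

end Units

section ReducedUnits

variable {F : Type} [Field F] {H : Type} [Ring H] [Algebra F H] {O : Subring H}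

variable (F O) in
/-- The subgroup of scalar units. -/
def scalarUnits : Subgroup (↥O)ˣ where
  carrier := {u | IsScalarUnit F u}
  one_mem' := ⟨1, by simp⟩
  mul_mem' := by
    rintro u v ⟨r, hr⟩ ⟨r', hr'⟩
    exact ⟨r * r', by simp [hr, hr']⟩
  inv_mem' := by
    rintro u ⟨r, hr⟩
    refine ⟨r⁻¹, ?_⟩
    have h1 : ((u⁻¹ : (↥O)ˣ) : ↥O) * (u : ↥O) = 1 := u.inv_mul
    have h2 : ((((u⁻¹ : (↥O)ˣ) : ↥O)) : H) * ((u : ↥O) : H) = 1 := mod_cast congrArg Subtype.val h1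
    rw [hr] at h2
    have h3 : algebraMap F H (algebraMap (𝓞 F) F r) *
        algebraMap F H (algebraMap (𝓞 F) F (r⁻¹ : (𝓞 F)ˣ)) = 1 := by
      rw [← map_mul, ← map_mul, Units.mul_inv, map_one, map_one]
    grind

instance : (scalarUnits F O).Normal := ⟨by
  rintro u ⟨r, hr⟩ g
  refine ⟨r, ?_⟩
  have h1 : (g : ↥O) * ((g⁻¹ : (↥O)ˣ) : ↥O) = 1 := g.mul_inv
  have h2 : ((g : ↥O) : H) * ((((g⁻¹ : (↥O)ˣ) : ↥O)) : H) = 1 := by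
    exact_mod_cast congrArg Subtype.val h1
  simp only [Units.val_mul, Subring.coe_mul]
  rw [hr, ← Algebra.commutes, mul_assoc, h2, mul_one]⟩

variable (F O) in
/-- The reduced unit group. -/
abbrev RedUnits := (↥O)ˣ ⧸ scalarUnits F O

lemma redUnitIso_redUnits : RedUnitIso F O (RedUnits F O) :=
  ⟨QuotientGroup.mk' _, QuotientGroup.mk'_surjective _, fun u => QuotientGroup.eq_one_iff u⟩

lemma RedUnitIso.mulEquiv {G G' : Type*} [Group G] [Group G'] (h : RedUnitIso F O G)
    (h' : RedUnitIso F O G') : Nonempty (G ≃* G') := by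
  obtain ⟨φ, hφ, hk⟩ := h
  obtain ⟨φ', hφ', hk'⟩ := h'
  have : φ.ker = φ'.ker := by
    ext u; rw [MonoidHom.mem_ker, MonoidHom.mem_ker, hk, hk']
  exact ⟨(QuotientGroup.quotientKerEquivOfSurjective φ hφ).symm.trans
    ((QuotientGroup.quotientMulEquivOfEq this).trans
      (QuotientGroup.quotientKerEquivOfSurjective φ' hφ'))⟩

lemma RedUnitIso.congr {G G' : Type*} [Group G] [Group G'] (h : RedUnitIso F O G) (e : G ≃* G') :
    RedUnitIso F O G' := by
  obtain ⟨φ, hφ, hk⟩ := h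
  exact ⟨e.toMonoidHom.comp φ, e.surjective.comp hφ, fun u => by simp [hk]⟩

variable [NumberField F]

lemma isScalarUnit_iff {u : (↥O)ˣ} : IsScalarUnit F u ↔
    ∃ c ∈ intR F, c⁻¹ ∈ intR F ∧ c ≠ 0 ∧ ((u : ↥O) : H) = algebraMap F H c := by
  constructor
  · rintro ⟨r, hr⟩
    refine ⟨algebraMap (𝓞 F) F r, ⟨r, rfl⟩, ⟨(r⁻¹ : (𝓞 F)ˣ), ?_⟩, ?_, hr⟩
    · refine eq_inv_of_mul_eq_one_left ?_
      rw [← map_mul, Units.inv_mul, map_one]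
    · simp
  · rintro ⟨c, ⟨r, hr⟩, ⟨r', hr'⟩, hc, hu⟩
    have hrr : r * r' = 1 := by
      apply IsFractionRing.injective (𝓞 F) F
      grind
    exact ⟨⟨r, r', hrr, by rw [mul_comm, hrr]⟩, by rw [hu, ← hr]⟩

end ReducedUnits

section NormUnits

variable {F} {p : ℕ} {θ s ε a b : F}

lemma IsSqrtGen.three_ne_sq (h : IsSqrtGen F p θ) (x : F) : x ^ 2 ≠ 3 := by
  have := h.sq_ne (n := 3) (by norm_num) (by
    rintro ⟨k, hk⟩
    have : k < 2 := by nlinarith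
    interval_cases k <;> omega) x
  grind

lemma IsSqrtGen.six_ne_sq (h : IsSqrtGen F p θ) (x : F) : x ^ 2 ≠ 6 := by
  have := h.sq_ne (n := 6) (by norm_num) (by
    rintro ⟨k, hk⟩
    have : k < 3 := by nlinarith
    interval_cases k <;> omega) x
  grind

lemma eq_add_of_commute {σ : F →+* ℝ} (hσ : σ a < 0 ∧ σ b < 0) {g y : ℍ[F,a,b]} (hg : g ≠ 0)
    (hre : g.re = 0) (hc : Commute g y) :
    ∃ β : F, y = algebraMap F _ y.re + algebraMap F _ β * g ∧ nrd y = y.re ^ 2 + β ^ 2 * nrd g := by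
  have ha : a ≠ 0 := by rintro rfl; simp at hσ
  have hb : b ≠ 0 := by rintro rfl; simp at hσ
  have hc' : g * y = y * g := hc
  have e1 := congrArg QuaternionAlgebra.imI hc'
  have e2 := congrArg QuaternionAlgebra.imJ hc'
  have e3 := congrArg QuaternionAlgebra.imK hc'
  simp [hre] at e1 e2 e3
  have f1 : g.imJ * y.imK = g.imK * y.imJ := by grind
  have f2 : g.imI * y.imK = g.imK * y.imI := by grind
  have f3 : g.imI * y.imJ = g.imJ * y.imI := by grind
  suffices ∃ β : F, y = algebraMap F _ y.re + algebraMap F _ β * g by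
    obtain ⟨β, hβ⟩ := this
    refine ⟨β, hβ, ?_⟩
    have : ∀ x c : F, nrd (algebraMap F _ x + algebraMap F _ c * g) = x ^ 2 + c ^ 2 * nrd g := by
      intro x c
      simp [nrd, algebraMap_quat, hre]; ring
    grind
  by_cases h1 : g.imI = 0
  · by_cases h2 : g.imJ = 0
    · by_cases h3 : g.imK = 0
      · exact absurd (by ext <;> simp [hre, h1, h2, h3]) hg
      · refine ⟨y.imK / g.imK, ?_⟩
        rw [algebraMap_quat, algebraMap_quat]
        ext <;> simp [hre, h1, h2]
        · simpa [h1, h3] using f2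
        · simpa [h2, h3] using f1
        · field_simp
    · refine ⟨y.imJ / g.imJ, ?_⟩
      rw [algebraMap_quat, algebraMap_quat]
      ext <;> simp [hre, h1]
      · simpa [h1, h2] using f3
      · field_simp
      · grind
  · refine ⟨y.imI / g.imI, ?_⟩
    rw [algebraMap_quat, algebraMap_quat]
    ext <;> simp [hre]
    · field_simp
    · grind
    · grind

section Cyclic

variable (D : DyadicData θ s ε)
  {O : Subring ℍ[F,a,b]} (hO : IsOrder F O)
include D hO

lemma exists_unit {y : ℍ[F,a,b]} (hy : y ∈ O) (hn : nrd y = 1 ∨ nrd y = ε) :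
    ∃ u : (↥O)ˣ, ((u : ↥O) : ℍ[F,a,b]) = y := by
  have hinv : (nrd y)⁻¹ ∈ intR F ∧ nrd y ≠ 0 := by
    rcases hn with hn | hn <;> rw [hn]
    · simp
    · exact ⟨D.inv_mem, D.eps_ne⟩
  have h1 : star y * y = y * star y := by
    rw [star_eq_sub, mul_sub, sub_mul, (Algebra.commutes _ _)]
  have h2 : y * (algebraMap F _ (nrd y)⁻¹ * star y) = 1 := by
    rw [← mul_assoc, ← Algebra.commutes, mul_assoc, mul_star_eq, ← map_mul, inv_mul_cancel₀ hinv.2, map_one]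
  have h3 : (algebraMap F _ (nrd y)⁻¹ * star y) * y = 1 := by
    rw [mul_assoc, h1, mul_star_eq, ← map_mul, inv_mul_cancel₀ hinv.2, map_one]
  exact ⟨⟨⟨y, hy⟩, ⟨_, O.mul_mem (hO.algebraMap_mem hinv.1) (hO.star_mem hy)⟩, Subtype.ext h2, Subtype.ext h3⟩, rfl⟩

variable (hab : ∀ σ : F →+* ℝ, σ a < 0 ∧ σ b < 0)
include hab

lemma exists_normUnit (u : (↥O)ˣ) : ∃ v ∈ intR F, v⁻¹ ∈ intR F ∧ v ≠ 0 ∧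
    ∃ y ∈ O, (nrd y = 1 ∨ nrd y = ε) ∧ ((u : ↥O) : ℍ[F,a,b]) = algebraMap F _ v * y := by
  have h1 : (u : ↥O) * ((u⁻¹ : (↥O)ˣ) : ↥O) = 1 := u.mul_inv
  exact unit_decomp D hab hO (u : ↥O).2 ((u⁻¹ : (↥O)ˣ) : ↥O).2 (mod_cast congrArg Subtype.val h1)

lemma redUnitIso_cyclic {g : ℍ[F,a,b]} (hg : g ∈ O) (hn : nrd g = 1 ∨ nrd g = ε) {n : ℕ}
    (hn0 : 0 < n) (hn4 : n ≤ 4) {c : F} (hc : c ∈ intR F) (hc' : c⁻¹ ∈ intR F) (hc0 : c ≠ 0)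
    (hgn : g ^ n = algebraMap F _ c)
    (hall : ∀ y ∈ O, (nrd y = 1 ∨ nrd y = ε) → ∃ k : ℕ, ∃ d ∈ intR F, d⁻¹ ∈ intR F ∧ d ≠ 0 ∧
      y = algebraMap F _ d * g ^ k) :
    ∃ m : ℕ, 0 < m ∧ m ≤ 4 ∧ RedUnitIso F O (Multiplicative (ZMod m)) := by
  obtain ⟨u, hu⟩ := exists_unit D hO hg hn
  let q : (↥O)ˣ →* RedUnits F O := QuotientGroup.mk' _
  have hq : ∀ w, q w = 1 ↔ IsScalarUnit F w := fun w => QuotientGroup.eq_one_iff w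
  have hcyc : ∀ x : RedUnits F O, x ∈ Subgroup.zpowers (q u) := by
    intro x
    obtain ⟨w, rfl⟩ := QuotientGroup.mk'_surjective _ x
    obtain ⟨v, hv, hv', hv0, y, hy, hyn, hw⟩ := exists_normUnit D hO hab w
    obtain ⟨k, d, hd, hd', hd0, hyk⟩ := hall y hy hyn
    refine ⟨k, ?_⟩
    change q u ^ (k : ℤ) = q w
    rw [zpow_natCast, ← map_pow, ← mul_inv_eq_one, ← map_inv, ← map_mul, ← inv_eq_one, ← map_inv, hq,
      isScalarUnit_iff]
    refine ⟨v * d, (intR F).mul_mem hv hd, by rw [mul_inv]; exact (intR F).mul_mem hv' hd', mul_ne_zero hv0 hd0, ?_⟩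
    rw [mul_inv_rev, inv_inv]
    have h1 : (w : ↥O) = ⟨_, hO.algebraMap_mem ((intR F).mul_mem hv hd)⟩ * ((u ^ k : (↥O)ˣ) : ↥O) := by
      apply Subtype.ext
      simp only [Subring.coe_mul, Units.val_pow_eq_pow_val, Subring.coe_pow]
      grind
    rw [Units.val_mul, h1, mul_assoc, Units.mul_inv, mul_one]
  have hpow : q u ^ n = 1 := by
    rw [← map_pow, hq, isScalarUnit_iff]
    exact ⟨c, hc, hc', hc0, by rw [Units.val_pow_eq_pow_val, Subring.coe_pow, hu, hgn]⟩
  have hcy : IsCyclic (RedUnits F O) := ⟨q u, hcyc⟩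
  have hfin : IsOfFinOrder (q u) := isOfFinOrder_iff_pow_eq_one.mpr ⟨n, hn0, hpow⟩
  have hcard : Nat.card (RedUnits F O) = orderOf (q u) := by
    rw [← Nat.card_zpowers]
    exact (Nat.card_congr (Equiv.subtypeUnivEquiv hcyc)).symm
  refine ⟨Nat.card (RedUnits F O), by rw [hcard]; exact hfin.orderOf_pos, ?_,
    redUnitIso_redUnits.congr (zmodCyclicMulEquiv hcy).symm⟩
  rw [hcard]
  exact (Nat.le_of_dvd hn0 (orderOf_dvd_of_pow_eq_one hpow)).trans hn4

end Cyclic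

end NormUnits

section CommutingUnits

variable {F} {p : ℕ} {θ s ε a b : F} (h : IsSqrtGen F p θ) (D : DyadicData θ s ε)
  (hab : ∀ σ : F →+* ℝ, σ a < 0 ∧ σ b < 0) {O : Subring ℍ[F,a,b]} (hO : IsOrder F O)

omit [NumberField F] in
lemma eq_or_neg_of_sq {β γ : F} (hβ : β ^ 2 = γ ^ 2) : β = γ ∨ β = -γ := sq_eq_sq_iff_eq_or_eq_neg.mp hβ

omit [NumberField F] in
lemma ne_zero_of_nrd {y : ℍ[F,a,b]} {c : F} (hn : nrd y = c) (hc : c ≠ 0) : y ≠ 0 := by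
  rintro rfl; exact hc (by rw [← hn]; simp [nrd])

include h hab

lemma exists_of_commute {x y : ℍ[F,a,b]} (hx : x ≠ 0) (hr : x.re = 0) (hc : Commute x y) :
    ∃ β : F, y = algebraMap F _ y.re + algebraMap F _ β * x ∧ nrd y = y.re ^ 2 + β ^ 2 * nrd x :=
  let ⟨σ, _⟩ := h.exists_real_pair
  eq_add_of_commute (hab σ) hx hr hc

lemma IsI.eq_or_neg_of_commute {i j : ℍ[F,a,b]} (Ii : IsI i) (Ij : IsI j) (hc : Commute i j) :
    j = i ∨ j = -i := by
  obtain ⟨β, hβ, hn⟩ := exists_of_commute h hab (ne_zero_of_nrd Ii.2 one_ne_zero) Ii.1 hc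
  rw [Ij.2, Ij.1, Ii.2] at hn
  rw [Ij.1, map_zero, zero_add] at hβ
  rcases eq_or_neg_of_sq (β := β) (γ := 1) (by linear_combination -hn) with e | e <;> rw [hβ, e] <;> simp

lemma IsI.not_commute_omega {i ω : ℍ[F,a,b]} (Ii : IsI i) (Iω : IsOmega ω) : ¬ Commute i ω := by
  intro hc
  obtain ⟨β, hβ, hn⟩ := exists_of_commute h hab (ne_zero_of_nrd Ii.2 one_ne_zero) Ii.1 hc
  rw [Iω.2, Ii.2] at hn
  exact h.three_ne_sq (2 * β) (by linear_combination -4 * hn - (2 * ω.re - 1) * Iω.1)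

lemma IsOmega.eq_of_commute {ω y : ℍ[F,a,b]} (Iω : IsOmega ω) (Iy : IsOmega y) (hc : Commute ω y) :
    y = ω ∨ y = ω * ω := by
  have hω : ω.re = -1 / 2 := by linear_combination Iω.1 / 2
  have hy : y.re = -1 / 2 := by linear_combination Iy.1 / 2
  have hnη : nrd (1 + algebraMap F _ 2 * ω) = 3 := by
    have : nrd (1 + algebraMap F _ 2 * ω) = 1 + 2 * (2 * ω.re) + 4 * nrd ω := by
      simp [nrd, algebraMap_quat]; ring
    rw [this, Iω.1, Iω.2]; norm_num
  have hη : (1 + algebraMap F ℍ[F,a,b] 2 * ω).re = 0 := by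
    simp only [algebraMap_quat, QuaternionAlgebra.re_add, QuaternionAlgebra.re_mul, QuaternionAlgebra.re_one]
    linear_combination Iω.1
  have hcη : Commute (1 + algebraMap F ℍ[F,a,b] 2 * ω) y :=
    (Commute.one_left y).add_left ((show Commute (algebraMap F ℍ[F,a,b] 2) y from Algebra.commutes _ _).mul_left hc)
  obtain ⟨β, hβ, hn⟩ := exists_of_commute h hab (ne_zero_of_nrd hnη (by norm_num)) hη hcη
  rw [Iy.2, hnη, hy] at hn
  rw [Iω.mul_self, hβ, hy]
  rcases eq_or_neg_of_sq (β := β) (γ := 1 / 2) (by linear_combination -hn / 3) with e | e <;> rw [e]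
  · left; rw [algebraMap_quat, algebraMap_quat, algebraMap_quat]; ext <;> simp; ring
  · right; rw [algebraMap_quat, algebraMap_quat, algebraMap_quat]; ext <;> simp; ring

include D

lemma IsI.not_commute_w {i w : ℍ[F,a,b]} (Ii : IsI i) (Iw : IsW ε w) : ¬ Commute i w := by
  intro hc
  obtain ⟨β, hβ, hn⟩ := exists_of_commute h hab (ne_zero_of_nrd Ii.2 one_ne_zero) Ii.1 hc
  rw [Iw.2, Iw.1, Ii.2] at hn
  exact D.eps_ne_sq h β (by linear_combination -hn)

lemma IsW.eq_or_neg_of_commute {w y : ℍ[F,a,b]} (Iw : IsW ε w) (Iy : IsW ε y) (hc : Commute w y) :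
    y = w ∨ y = -w := by
  obtain ⟨β, hβ, hn⟩ := exists_of_commute h hab (ne_zero_of_nrd Iw.2 D.eps_ne) Iw.1 hc
  rw [Iy.2, Iy.1, Iw.2] at hn
  rw [Iy.1, map_zero, zero_add] at hβ
  have hb : β ^ 2 = 1 ^ 2 := mul_right_cancel₀ D.eps_ne (by linear_combination -hn)
  rcases eq_or_neg_of_sq hb with e | e <;> rw [hβ, e] <;> simp

lemma IsOmega.not_commute_w {ω w : ℍ[F,a,b]} (Iω : IsOmega ω) (Iw : IsW ε w) : ¬ Commute w ω := by
  intro hc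
  obtain ⟨β, hβ, hn⟩ := exists_of_commute h hab (ne_zero_of_nrd Iw.2 D.eps_ne) Iw.1 hc
  rw [Iω.2, Iw.2] at hn
  exact h.six_ne_sq (2 * β * s) (by
    linear_combination 4 * β ^ 2 * D.sq - 8 * hn - 2 * (2 * ω.re - 1) * Iω.1)

include hO

/-- If all units commute then the reduced unit group is cyclic of order at most four. -/
theorem exists_cyclic_of_commute
    (hcomm : ∀ x ∈ O, ∀ y ∈ O, (IsI x ∨ IsOmega x ∨ IsW ε x) → (IsI y ∨ IsOmega y ∨ IsW ε y) → Commute x y) :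
    ∃ m : ℕ, 0 < m ∧ m ≤ 4 ∧ RedUnitIso F O (Multiplicative (ZMod m)) := by
  have hs := D.s_ne
  have he := D.eps_ne
  have one : (1 : F) ∈ intR F ∧ (1 : F)⁻¹ ∈ intR F ∧ (1 : F) ≠ 0 := by simp [(intR F).one_mem]
  have neg : ∀ {c : F} {k : ℕ} {g y : ℍ[F,a,b]}, c ∈ intR F ∧ c⁻¹ ∈ intR F ∧ c ≠ 0 →
      (y = algebraMap F _ c * g ^ k ∨ y = -(algebraMap F _ c * g ^ k)) →
      ∃ k : ℕ, ∃ d ∈ intR F, d⁻¹ ∈ intR F ∧ d ≠ 0 ∧ y = algebraMap F _ d * g ^ k := by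
    rintro c k g y ⟨h1, h2, h3⟩ (e | e)
    · exact ⟨k, c, h1, h2, h3, e⟩
    · exact ⟨k, -c, (intR F).neg_mem h1, by rw [inv_neg]; exact (intR F).neg_mem h2, neg_ne_zero.mpr h3, by
        rw [e, map_neg, neg_mul]⟩
  by_cases hΩ : ∃ ω ∈ O, IsOmega ω
  · obtain ⟨ω, hω, Iω⟩ := hΩ
    have noI : ∀ i ∈ O, ¬ IsI i := fun i hi Ii =>
      Ii.not_commute_omega h hab Iω (hcomm i hi ω hω (.inl Ii) (.inr (.inl Iω)))
    refine redUnitIso_cyclic D hO hab hω (.inl Iω.2) (n := 3) (by norm_num) (by norm_num) one.1 one.2.1 one.2.2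
      ?_ ?_
    · rw [map_one, pow_succ, pow_two, Iω.mul_self, sub_mul, neg_mul, Iω.mul_self]; simp
    · intro y hy hyn
      rcases normUnit_cases h D hab hO hy hyn with e | ⟨g, hg, Ig | Ig | Ig, e⟩ | ⟨i, hi, Ii, e⟩
      · exact neg (k := 0) one (by simpa using e)
      · exact absurd Ig (noI g hg)
      · rcases Iω.eq_of_commute h hab Ig (hcomm ω hω g hg (.inr (.inl Iω)) (.inr (.inl Ig))) with rfl | rfl
        · exact neg (k := 1) one (by simpa using e)
        · exact neg (k := 2) one (by simpa [pow_two] using e)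
      · exact absurd (hcomm g hg ω hω (.inr (.inr Ig)) (.inr (.inl Iω))) (Iω.not_commute_w h D hab Ig)
      · exact absurd Ii (noI i hi)
  by_cases hI : ∃ i ∈ O, IsI i
  · obtain ⟨i, hi, Ii⟩ := hI
    have noW : ∀ w ∈ O, ¬ IsW ε w := fun w hw Iw =>
      Ii.not_commute_w h D hab Iw (hcomm i hi w hw (.inl Ii) (.inr (.inr Iw)))
    have eqI : ∀ j ∈ O, IsI j → j = i ∨ j = -i := fun j hj Ij =>
      Ii.eq_or_neg_of_commute h hab Ij (hcomm i hi j hj (.inl Ii) (.inl Ij))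
    set u : ℍ[F,a,b] := algebraMap F _ (s / 2) * (1 + i) with hu
    have hu2 : u ^ 2 = algebraMap F _ ε * i := by
      rw [hu, pow_two, mul_assoc, ← mul_assoc (1 + i), ← Algebra.commutes, mul_assoc, ← mul_assoc,
        ← map_mul, show (1 + i) * (1 + i) = algebraMap F _ 2 * i by
          rw [mul_add, add_mul, add_mul, Ii.mul_self]; simp; noncomm_ring, ← mul_assoc, ← map_mul, D.eps_def]
      congr 2; field_simp
    have hi' : i = algebraMap F _ ε⁻¹ * u ^ 2 := by
      rw [hu2, ← mul_assoc, ← map_mul, inv_mul_cancel₀ he, map_one, one_mul]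
    have hu3 : algebraMap F _ (s / 2) * (1 - i) = -(algebraMap F _ ε⁻¹ * u ^ 3) := by
      rw [pow_succ, ← mul_assoc, ← hi', hu, ← mul_assoc, ← Algebra.commutes, mul_assoc, mul_add,
        Ii.mul_self, mul_one, ← mul_neg]
      congr 1; abel
    by_cases hU : u ∈ O
    · have hun : nrd u = ε := by
        have : nrd u = (s / 2) ^ 2 * (1 + 2 * i.re + nrd i) := by
          rw [hu, nrd_mul, nrd_algebraMap]; congr 1; simp [nrd]; ring
        rw [this, Ii.1, Ii.2, D.eps_def]; ring
      have e2 : -(ε ^ 2) ∈ intR F := (intR F).neg_mem ((intR F).pow_mem D.eps_mem 2)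
      have e3 : (-(ε ^ 2))⁻¹ ∈ intR F := by
        rw [inv_neg, ← inv_pow]; exact (intR F).neg_mem ((intR F).pow_mem D.inv_mem 2)
      refine redUnitIso_cyclic D hO hab hU (.inr hun) (n := 4) (by norm_num) (by norm_num) e2 e3
        (by simpa using he) ?_ ?_
      · rw [show u ^ 4 = u ^ 2 * u ^ 2 by rw [← pow_add], hu2, mul_assoc, ← mul_assoc i,
          ← Algebra.commutes, mul_assoc, Ii.mul_self, ← mul_assoc, ← map_mul, map_neg]
        simp [pow_two]
      · intro y hy hyn
        have inv : ε⁻¹ ∈ intR F ∧ (ε⁻¹)⁻¹ ∈ intR F ∧ ε⁻¹ ≠ 0 :=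
          ⟨D.inv_mem, by rw [inv_inv]; exact D.eps_mem, inv_ne_zero he⟩
        rcases normUnit_cases h D hab hO hy hyn with e | ⟨g, hg, Ig | Ig | Ig, e⟩ | ⟨j, hj, Ij, e⟩
        · exact neg (k := 0) one (by simpa using e)
        · refine neg (k := 2) inv ?_
          rw [← hi']
          rcases eqI g hg Ig with rfl | rfl
          · exact e
          · grind
        · exact absurd ⟨g, hg, Ig⟩ hΩ
        · exact absurd Ig (noW g hg)
        · rcases eqI j hj Ij with rfl | rfl
          · exact neg (k := 1) one (by rw [pow_one, map_one, one_mul, hu]; exact e)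
          · refine neg (k := 3) inv ?_
            rw [← sub_eq_add_neg, hu3, neg_neg] at e
            exact e.symm
    · refine redUnitIso_cyclic D hO hab hi (.inl Ii.2) (n := 2) (by norm_num) (by norm_num)
        ((intR F).neg_mem one.1) (by rw [inv_neg]; exact (intR F).neg_mem one.2.1) (neg_ne_zero.mpr one.2.2) ?_ ?_
      · rw [pow_two, Ii.mul_self, map_neg, map_one]
      · intro y hy hyn
        rcases normUnit_cases h D hab hO hy hyn with e | ⟨g, hg, Ig | Ig | Ig, e⟩ | ⟨j, hj, Ij, e⟩
        · exact neg (k := 0) one (by simpa using e)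
        · refine neg (k := 1) one ?_
          rcases eqI g hg Ig with rfl | rfl
          · simpa using e
          · grind
        · exact absurd ⟨g, hg, Ig⟩ hΩ
        · exact absurd Ig (noW g hg)
        · refine absurd ?_ hU
          have hy' : algebraMap F ℍ[F,a,b] (s / 2) * (1 + j) ∈ O := by
            rcases e with e | e
            · rw [← e]; exact hy
            · rw [← neg_neg (algebraMap F ℍ[F,a,b] (s / 2) * (1 + j)), ← e]; exact O.neg_mem hy
          rcases eqI j hj Ij with rfl | rfl
          · exact hy'
          · have : u = i * (algebraMap F ℍ[F,a,b] (s / 2) * (1 + -i)) := by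
              rw [hu, ← mul_assoc, ← Algebra.commutes, mul_assoc]
              congr 1
              rw [mul_add, mul_neg, Ii.mul_self]
              simp [add_comm]
            rw [this]; exact O.mul_mem hi hy'
  · by_cases hW : ∃ w ∈ O, IsW ε w
    · obtain ⟨w, hw, Iw⟩ := hW
      refine redUnitIso_cyclic D hO hab hw (.inr Iw.2) (n := 2) (by norm_num) (by norm_num)
        ((intR F).neg_mem D.eps_mem) (by rw [inv_neg]; exact (intR F).neg_mem D.inv_mem) (neg_ne_zero.mpr he) ?_ ?_
      · rw [pow_two, Iw.mul_self, map_neg]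
      · intro y hy hyn
        rcases normUnit_cases h D hab hO hy hyn with e | ⟨g, hg, Ig | Ig | Ig, e⟩ | ⟨j, hj, Ij, e⟩
        · exact neg (k := 0) one (by simpa using e)
        · exact absurd ⟨g, hg, Ig⟩ hI
        · exact absurd ⟨g, hg, Ig⟩ hΩ
        · refine neg (k := 1) one ?_
          rcases Iw.eq_or_neg_of_commute h D hab Ig (hcomm w hw g hg (.inr (.inr Iw)) (.inr (.inr Ig))) with rfl | rfl
          · simpa using e
          · grind
        · exact absurd ⟨j, hj, Ij⟩ hI
    · refine redUnitIso_cyclic D hO hab O.one_mem (.inl (by simp [nrd])) (n := 1) (by norm_num) (by norm_num)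
        one.1 one.2.1 one.2.2 (by simp) ?_
      intro y hy hyn
      rcases normUnit_cases h D hab hO hy hyn with e | ⟨g, hg, Ig | Ig | Ig, e⟩ | ⟨j, hj, Ij, e⟩
      · exact neg (k := 0) one (by simpa using e)
      · exact absurd ⟨g, hg, Ig⟩ hI
      · exact absurd ⟨g, hg, Ig⟩ hΩ
      · exact absurd ⟨g, hg, Ig⟩ hW
      · exact absurd ⟨j, hj, Ij⟩ hI

end CommutingUnits

section Transport

variable {F : Type} [Field F] {H₁ H₂ H₃ : Type} [Ring H₁] [Algebra F H₁] [Ring H₂] [Algebra F H₂] [Ring H₃] [Algebra F H₃]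

/-- Two subrings correspond under an isomorphism of the ambient algebras. -/
def Corr (F : Type) [Field F] {H₁ H₂ : Type} [Ring H₁] [Algebra F H₁] [Ring H₂] [Algebra F H₂]
    (S : Subring H₁) (O : Subring H₂) : Prop :=
  ∃ e : H₁ ≃ₐ[F] H₂, ∀ y, y ∈ S ↔ e y ∈ O

lemma Corr.symm {S : Subring H₁} {O : Subring H₂} (h : Corr F S O) : Corr F O S := by
  obtain ⟨e, he⟩ := h
  exact ⟨e.symm, fun y => by rw [he, e.apply_symm_apply]⟩

lemma Corr.trans {S : Subring H₁} {O : Subring H₂} {T : Subring H₃} (h : Corr F S O) (h' : Corr F O T) :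
    Corr F S T := by
  obtain ⟨e, he⟩ := h
  obtain ⟨e', he'⟩ := h'
  exact ⟨e.trans e', fun y => by rw [he, he', AlgEquiv.trans_apply]⟩

lemma corr_comap (e : H₁ ≃ₐ[F] H₂) (O : Subring H₂) : Corr F (O.comap (e : H₁ →+* H₂)) O :=
  ⟨e, fun _ => Iff.rfl⟩

lemma corr_map (e : H₁ ≃ₐ[F] H₂) (S : Subring H₁) : Corr F S (S.map (e : H₁ →+* H₂)) :=
  ⟨e, fun y => by
    constructor
    · exact fun hy => ⟨y, hy, rfl⟩
    · rintro ⟨z, hz, hzy⟩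
      rwa [← e.injective hzy]⟩

lemma IsOrder.of_corr {S : Subring H₁} {O : Subring H₂} (h : Corr F S O) (hO : IsOrder F O) : IsOrder F S := by
  obtain ⟨e, he⟩ := h
  obtain ⟨h1, h2, h3⟩ := hO
  refine ⟨?_, ?_, ?_⟩
  · rintro _ ⟨r, rfl⟩
    refine (he _).mpr (h1 ⟨r, ?_⟩)
    simp
  · have : S.toAddSubgroup = O.toAddSubgroup.map (e.symm : H₂ →+ H₁) := by
      ext y
      constructor
      · intro hy
        exact ⟨e y, (he y).mp hy, e.symm_apply_apply y⟩
      · rintro ⟨z, hz, rfl⟩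
        refine (he _).mpr ?_
        change e (e.symm z) ∈ O
        rw [e.apply_symm_apply]; exact hz
    rw [this]
    obtain ⟨T, hT⟩ := h2
    classical
    exact ⟨T.image (e.symm : H₂ →+ H₁), by rw [← hT, AddMonoidHom.map_closure, Finset.coe_image]⟩
  · have : (S : Set H₁) = e.symm.toLinearMap '' (O : Set H₂) := by
      ext y
      constructor
      · intro hy
        exact ⟨e y, (he y).mp hy, e.symm_apply_apply y⟩
      · rintro ⟨z, hz, rfl⟩
        refine (he _).mpr ?_
        change e (e.symm z) ∈ O
        rw [e.apply_symm_apply]; exact hz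
    rw [this, Submodule.span_image, h3, Submodule.map_top, LinearMap.range_eq_top]
    exact e.symm.surjective

lemma IsMaximalOrder.of_corr {S : Subring H₁} {O : Subring H₂} (h : Corr F S O) (hO : IsMaximalOrder F O) :
    IsMaximalOrder F S := by
  refine ⟨hO.1.of_corr h, fun S' hS' hle => le_antisymm ?_ hle⟩
  obtain ⟨e, he⟩ := h
  have hc := corr_map e S'
  have := hO.2 (S'.map (e : H₁ →+* H₂)) (hS'.of_corr hc.symm) (fun y hy => by
    refine ⟨e.symm y, hle ((he _).mpr ?_), e.apply_symm_apply y⟩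
    rw [e.apply_symm_apply]; exact hy)
  intro y hy
  rw [he, ← this]
  exact ⟨y, hy, rfl⟩

lemma RedUnitIso.of_corr {S : Subring H₁} {O : Subring H₂} (h : Corr F S O) {G : Type*} [Group G]
    (hO : RedUnitIso F O G) : RedUnitIso F S G := by
  obtain ⟨e, he⟩ := h
  obtain ⟨φ, hφ, hk⟩ := hO
  let f : S ≃* O :=
    { toFun := fun y => ⟨e y, (he y).mp y.2⟩
      invFun := fun z => ⟨e.symm z, (he _).mpr (by rw [e.apply_symm_apply]; exact z.2)⟩
      left_inv := fun y => Subtype.ext (e.symm_apply_apply _)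
      right_inv := fun z => Subtype.ext (e.apply_symm_apply _)
      map_mul' := fun x y => Subtype.ext (map_mul e _ _) }
  refine ⟨φ.comp (Units.mapEquiv f).toMonoidHom, hφ.comp (Units.mapEquiv f).surjective, fun u => ?_⟩
  refine (hk _).trans ⟨?_, ?_⟩
  · rintro ⟨r, hr⟩
    refine ⟨r, e.injective ?_⟩
    rw [e.commutes]; exact hr
  · rintro ⟨r, hr⟩
    refine ⟨r, ?_⟩
    rw [← e.commutes (algebraMap (𝓞 F) F r), ← hr]; rfl

end Transport

section SkolemNoether

variable {F : Type} [Field F] {a b c d : F}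

lemma exists_intertwiner (h2 : (2 : F) ≠ 0) (ha : a ≠ 0) (hb : b ≠ 0) {H : Type} [Ring H] [Nontrivial H] [Algebra F H]
    {X Y X' Y' : H} (h : Anti a b X Y) (h' : Anti a b X' Y') :
    ∃ z ≠ 0, X * z = z * X' ∧ Y * z = z * Y' := by
  have unit : ∀ {r : F}, r ≠ 0 → ∀ {q : H}, algebraMap F H r * q = 0 → q = 0 := by
    intro r hr q hq
    rw [← one_mul q, ← map_one (algebraMap F H), ← inv_mul_cancel₀ hr, map_mul, mul_assoc, hq, mul_zero]
  have unit' : ∀ {r : F}, r ≠ 0 → ∀ {q x : H}, x * x = algebraMap F H r → q * x = 0 → q = 0 := by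
    intro r hr q x hx hq
    refine unit hr ?_
    rw [Algebra.commutes, ← hx, ← mul_assoc, hq, zero_mul]
  have cX := fun q : H => Algebra.commutes a q
  have cY := fun q : H => Algebra.commutes b q
  obtain ⟨q, hq0, hq⟩ : ∃ q ≠ 0, X * q = q * X' := by
    by_cases hX : X + X' = 0
    · refine ⟨Y', fun hY => hb ?_, ?_⟩
      · have := h'.sqY
        rw [hY, mul_zero] at this
        exact (FaithfulSMul.algebraMap_injective F H) (by rw [← this, map_zero])
      · rw [eq_neg_of_add_eq_zero_left hX, neg_mul, h'.anti, neg_neg]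
    · exact ⟨X + X', hX, by rw [mul_add, add_mul, h.sqX, h'.sqX, add_comm]⟩
  have key : ∀ q : H, X * q = q * X' →
      X * (algebraMap F H b * q + Y * q * Y') = (algebraMap F H b * q + Y * q * Y') * X' ∧
      Y * (algebraMap F H b * q + Y * q * Y') = (algebraMap F H b * q + Y * q * Y') * Y' := by
    intro q hq
    constructor
    · rw [mul_add, add_mul, ← mul_assoc, ← cY, mul_assoc, hq, ← mul_assoc X, ← mul_assoc X, h.anti, neg_mul,
        mul_assoc Y, hq, neg_mul, ← mul_assoc Y, mul_assoc (Y * q), h'.anti, mul_neg, neg_neg, mul_assoc (Y * q),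
        ← mul_assoc]
    · rw [mul_add, add_mul, ← mul_assoc Y, ← cY, mul_assoc, ← mul_assoc Y, ← mul_assoc Y, h.sqY, mul_assoc (Y * q), h'.sqY,
        ← cY, add_comm, mul_assoc]
  by_cases hz : algebraMap F H b * q + Y * q * Y' = 0
  · refine ⟨_, fun hz' => hq0 ?_, key (q * X') (by rw [← mul_assoc, hq])⟩
    have hz1 : Y * q * Y' = -(algebraMap F H b * q) := by grind
    refine unit hb (unit h2 (unit' ha h'.sqX ?_))
    rw [← mul_assoc Y, mul_assoc (Y * q), h'.anti, mul_neg, ← mul_assoc (Y * q), hz1] at hz'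
    rw [map_ofNat, two_mul, add_mul, mul_assoc]
    simpa [mul_assoc] using hz'
  · exact ⟨_, hz, key q hq⟩

end SkolemNoether

section Conj

variable {F} {a b c d : F}

lemma conjRel_of_corr {σ : F →+* ℝ} (hcd : σ c < 0 ∧ σ d < 0) (ha : a ≠ 0) (hb : b ≠ 0)
    {S : Subring ℍ[F,a,b]} {O O' : Subring ℍ[F,c,d]} (h : Corr F S O) (h' : Corr F S O') : ConjRel O O' := by
  obtain ⟨e, he⟩ := h
  obtain ⟨e', he'⟩ := h'
  obtain ⟨z, hz, hX, hY⟩ := exists_intertwiner two_ne_zero ha hb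
    ((anti_basis a b).map (e' : ℍ[F,a,b] →ₐ[F] ℍ[F,c,d])) ((anti_basis a b).map (e : ℍ[F,a,b] →ₐ[F] ℍ[F,c,d]))
  have hn := nrd_ne_zero hcd hz
  have hz1 : z * (algebraMap F _ (nrd z)⁻¹ * star z) = 1 := by
    rw [← mul_assoc, ← Algebra.commutes, mul_assoc, mul_star_eq, ← map_mul, inv_mul_cancel₀ hn, map_one]
  have hz2 : algebraMap F _ (nrd z)⁻¹ * star z * z = 1 := by
    rw [mul_assoc, star_eq_sub, sub_mul, Algebra.commutes (2 * z.re), ← mul_sub, ← star_eq_sub, mul_star_eq,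
      ← map_mul, inv_mul_cancel₀ hn, map_one]
  let x : ℍ[F,c,d]ˣ := ⟨z, algebraMap F _ (nrd z)⁻¹ * star z, hz1, hz2⟩
  have key : ∀ y, e' y * z = z * e y := by
    intro y
    have hy : y = algebraMap F _ y.re + y.imI • ⟨0, 1, 0, 0⟩ + y.imJ • ⟨0, 0, 1, 0⟩ +
        y.imK • (⟨0, 1, 0, 0⟩ * ⟨0, 0, 1, 0⟩) := by
      rw [algebraMap_quat]; ext <;> simp
    have hX' : e' ⟨0, 1, 0, 0⟩ * z = z * e ⟨0, 1, 0, 0⟩ := hX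
    have hY' : e' ⟨0, 0, 1, 0⟩ * z = z * e ⟨0, 0, 1, 0⟩ := hY
    rw [hy]
    simp only [map_add, map_smul, map_mul, AlgEquiv.commutes, add_mul, mul_add, smul_mul_assoc, mul_smul_comm]
    rw [hX', hY', Algebra.commutes, mul_assoc, hY', ← mul_assoc, hX', mul_assoc]
  refine ⟨x, fun y => ?_⟩
  rw [← e.apply_symm_apply y, ← he, he']
  change _ ↔ z * e (e.symm y) * (algebraMap F _ (nrd z)⁻¹ * star z) ∈ O'
  rw [← key, mul_assoc, hz1, mul_one]

end Conj

section LatticeOrders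

variable {F} {a b : F}

/-- The `R`-lattice spanned by four quaternions. -/
def latticeSpan (v : Fin 4 → ℍ[F,a,b]) : AddSubgroup ℍ[F,a,b] where
  carrier := {y | ∃ c : Fin 4 → ↥(intR F), y = ∑ k, (c k : F) • v k}
  zero_mem' := ⟨0, by simp⟩
  add_mem' := by
    rintro _ _ ⟨c, rfl⟩ ⟨d, rfl⟩
    exact ⟨c + d, by simp [add_smul, Finset.sum_add_distrib]⟩
  neg_mem' := by
    rintro _ ⟨c, rfl⟩
    exact ⟨-c, by simp⟩

lemma smul_mem_latticeSpan {v : Fin 4 → ℍ[F,a,b]} {r : F} (hr : r ∈ intR F) {y : ℍ[F,a,b]}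
    (hy : y ∈ latticeSpan v) : r • y ∈ latticeSpan v := by
  obtain ⟨c, rfl⟩ := hy
  exact ⟨fun k => ⟨r, hr⟩ * c k, by simp [Finset.smul_sum, mul_smul]⟩

lemma mem_latticeSpan {v : Fin 4 → ℍ[F,a,b]} (k : Fin 4) : v k ∈ latticeSpan v :=
  ⟨Pi.single k 1, by
    rw [Finset.sum_eq_single k]
    · simp
    · intro j _ hj; simp [Pi.single_eq_of_ne hj]
    · simp⟩

/-- Four quaternions spanning an order. -/
structure IsOrderBasis (v : Fin 4 → ℍ[F,a,b]) : Prop where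
  one_mem : 1 ∈ latticeSpan v
  mul_mem : ∀ i j, v i * v j ∈ latticeSpan v
  span : ∀ y, ∃ c : Fin 4 → F, y = ∑ k, c k • v k

namespace IsOrderBasis

variable {v : Fin 4 → ℍ[F,a,b]}

/-- The order spanned by an order basis. -/
def order (hv : IsOrderBasis v) : Subring ℍ[F,a,b] where
  __ := latticeSpan v
  one_mem' := hv.one_mem
  mul_mem' := by
    rintro _ _ ⟨c, rfl⟩ ⟨d, rfl⟩
    change _ ∈ latticeSpan v
    rw [Finset.sum_mul_sum]
    refine AddSubgroup.sum_mem _ fun i _ => AddSubgroup.sum_mem _ fun j _ => ?_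
    rw [smul_mul_smul_comm]
    exact smul_mem_latticeSpan ((intR F).mul_mem (c i).2 (d j).2) (hv.mul_mem i j)

lemma smul_mem (hv : IsOrderBasis v) {r : F} (hr : r ∈ intR F) {y : ℍ[F,a,b]} (hy : y ∈ hv.order) :
    r • y ∈ hv.order := smul_mem_latticeSpan hr hy

lemma basis_mem (hv : IsOrderBasis v) (k : Fin 4) : v k ∈ hv.order := mem_latticeSpan k

lemma isOrder {p : ℕ} {θ : F} (h : IsSqrtGen F p θ) (hv : IsOrderBasis v) : IsOrder F hv.order := by
  classical
  refine ⟨?_, ?_, ?_⟩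
  · rintro _ ⟨r, rfl⟩
    change algebraMap F _ (algebraMap (𝓞 F) F r) ∈ hv.order
    rw [Algebra.algebraMap_eq_smul_one]
    exact hv.smul_mem (mem_intR_of_isIntegral (NumberField.RingOfIntegers.isIntegral_coe r)) hv.order.one_mem
  · refine ⟨Finset.univ.image v ∪ Finset.univ.image fun k => θ • v k, le_antisymm ?_ ?_⟩
    · rw [AddSubgroup.closure_le]
      intro y hy
      simp only [Finset.coe_union, Finset.coe_image, Finset.coe_univ, Set.image_univ] at hy
      rcases hy with ⟨k, rfl⟩ | ⟨k, rfl⟩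
      · exact hv.basis_mem k
      · exact hv.smul_mem h.theta_mem (hv.basis_mem k)
    · rintro _ ⟨c, rfl⟩
      refine AddSubgroup.sum_mem _ fun k _ => ?_
      obtain ⟨m, n, hmn⟩ := h.mem_intR.mp (c k).2
      rw [hmn, add_smul, mul_smul, Int.cast_smul_eq_zsmul, Int.cast_smul_eq_zsmul]
      refine AddSubgroup.add_mem _ (AddSubgroup.zsmul_mem _ (AddSubgroup.subset_closure ?_) _)
        (AddSubgroup.zsmul_mem _ (AddSubgroup.subset_closure ?_) _)
      · simp
      · simp
  · rw [eq_top_iff]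
    intro y _
    obtain ⟨c, rfl⟩ := hv.span y
    exact Submodule.sum_mem _ fun k _ => Submodule.smul_mem _ _ (Submodule.subset_span (hv.basis_mem k))

end IsOrderBasis

end LatticeOrders

section OctahedralOrder

variable {F} {p : ℕ} {θ s ε : F}

lemma mem_latticeSpan_of {a b : F} {v : Fin 4 → ℍ[F,a,b]} {y : ℍ[F,a,b]} {c₀ c₁ c₂ c₃ : F} (h₀ : c₀ ∈ intR F)
    (h₁ : c₁ ∈ intR F) (h₂ : c₂ ∈ intR F) (h₃ : c₃ ∈ intR F)
    (hy : y = c₀ • v 0 + c₁ • v 1 + c₂ • v 2 + c₃ • v 3) : y ∈ latticeSpan v :=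
  ⟨![⟨c₀, h₀⟩, ⟨c₁, h₁⟩, ⟨c₂, h₂⟩, ⟨c₃, h₃⟩], by simp [Fin.sum_univ_four, hy]⟩

/-- A basis of the maximal order whose reduced unit group is octahedral. -/
def octBasis (s : F) : Fin 4 → ℍ[F,-1,-1] :=
  ![1, ⟨s / 2, s / 2, 0, 0⟩, ⟨s / 2, 0, s / 2, 0⟩, ⟨1 / 2, 1 / 2, 1 / 2, 1 / 2⟩]

lemma DyadicData.isOrderBasis_oct (D : DyadicData θ s ε) : IsOrderBasis (octBasis s) := by
  have hs := D.s_ne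
  have s1 := D.s_mem
  have e1 := D.eps_mem
  have o := (intR F).one_mem
  have z := (intR F).zero_mem
  have n : ∀ {x : F}, x ∈ intR F → -x ∈ intR F := (intR F).neg_mem
  refine ⟨mem_latticeSpan 0, ?_, ?_⟩
  · intro i j
    by_cases hi : i = 0
    · subst hi; simpa [octBasis] using mem_latticeSpan (v := octBasis s) j
    by_cases hj : j = 0
    · subst hj; simpa [octBasis] using mem_latticeSpan (v := octBasis s) i
    fin_cases i <;> fin_cases j <;> first | exact absurd rfl hi | exact absurd rfl hj | skip
    map_tacs [
      refine mem_latticeSpan_of (n e1) s1 z z ?_;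
      refine mem_latticeSpan_of z z z e1 ?_;
      refine mem_latticeSpan_of z z (n o) s1 ?_;
      refine mem_latticeSpan_of (n e1) s1 s1 (n e1) ?_;
      refine mem_latticeSpan_of (n e1) z s1 z ?_;
      refine mem_latticeSpan_of (n s1) o o z ?_;
      refine mem_latticeSpan_of (n s1) o o z ?_;
      refine mem_latticeSpan_of z (n o) z s1 ?_;
      refine mem_latticeSpan_of (n o) z z o ?_]
    all_goals ext <;> simp [octBasis, D.eps_def] <;> ring
  · intro y
    refine ⟨![y.re - y.imI - y.imJ + y.imK, 2 / s * (y.imI - y.imK), 2 / s * (y.imJ - y.imK), 2 * y.imK], ?_⟩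
    rw [Fin.sum_univ_four]
    ext <;> simp [octBasis] <;> field_simp <;> ring

/-- The maximal order whose reduced unit group is octahedral. -/
def octOrder (D : DyadicData θ s ε) : Subring ℍ[F,-1,-1] := D.isOrderBasis_oct.order

lemma mem_octOrder (D : DyadicData θ s ε) {y : ℍ[F,-1,-1]} : y ∈ octOrder D ↔
    y.re - y.imI - y.imJ + y.imK ∈ intR F ∧ 2 / s * (y.imI - y.imK) ∈ intR F ∧
      2 / s * (y.imJ - y.imK) ∈ intR F ∧ 2 * y.imK ∈ intR F := by
  have hs := D.s_ne
  constructor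
  · rintro ⟨c, rfl⟩
    rw [Fin.sum_univ_four]
    refine ⟨?_, ?_, ?_, ?_⟩
    · convert (c 0).2 using 1; simp [octBasis]; ring
    · convert (c 1).2 using 1; simp [octBasis]; field_simp
    · convert (c 2).2 using 1; simp [octBasis]; field_simp
    · convert (c 3).2 using 1; simp [octBasis]; field_simp
  · rintro ⟨h0, h1, h2, h3⟩
    refine mem_latticeSpan_of h0 h1 h2 h3 ?_
    ext <;> simp [octBasis] <;> field_simp <;> ring

end OctahedralOrder

section HamiltonPatterns

variable {F} {p : ℕ} {θ s ε : F} (h : IsSqrtGen F p θ) (D : DyadicData θ s ε)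

/-- The quaternion with coordinates `(a k + b k * s) / 2`. -/
def halfPat (s : F) (a b : Fin 4 → ℤ) : ℍ[F,-1,-1] :=
  ⟨(a 0 + b 0 * s) / 2, (a 1 + b 1 * s) / 2, (a 2 + b 2 * s) / 2, (a 3 + b 3 * s) / 2⟩

/-- All entries are `0` or `1`. -/
def IsBits (a : Fin 4 → ℤ) : Prop := ∀ k, a k = 0 ∨ a k = 1

lemma hab_hamilton : ∀ σ : F →+* ℝ, σ (-1) < 0 ∧ σ (-1) < 0 := fun σ => by simp

include D in
lemma halfPat_mem_octOrder {a b : Fin 4 → ℤ} (ha : a 1 = a 3 ∧ a 2 = a 3) (ha' : 2 ∣ a 0 - a 3)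
    (hb : 2 ∣ b 0 + b 1 + b 2 + b 3) : halfPat s a b ∈ octOrder D := by
  have hs := D.s_ne
  have ic := fun m : ℤ => intCast_mem (intR F) m
  rw [mem_octOrder]
  simp only [halfPat, ha.1, ha.2]
  obtain ⟨m, hm⟩ := ha'
  obtain ⟨n, hn⟩ := hb
  have hm' : (a 0 : F) - a 3 = 2 * m := mod_cast hm
  have hn' : (b 0 : F) + b 1 + b 2 + b 3 = 2 * n := mod_cast hn
  refine ⟨?_, ?_, ?_, ?_⟩
  · convert (intR F).add_mem (ic m) ((intR F).mul_mem (ic (n - b 1 - b 2)) D.s_mem) using 1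
    grind
  · convert ic (b 1 - b 3) using 1
    grind
  · convert ic (b 2 - b 3) using 1
    grind
  · convert (intR F).add_mem (ic (a 3)) ((intR F).mul_mem (ic (b 3)) D.s_mem) using 1
    ring

variable {O : Subring ℍ[F,-1,-1]} (hO : IsOrder F O) (hi : (⟨0, 1, 0, 0⟩ : ℍ[F,-1,-1]) ∈ O)
  (hj : (⟨0, 0, 1, 0⟩ : ℍ[F,-1,-1]) ∈ O)

omit [NumberField F] in
include hi hj in
lemma basisK_mem : (⟨0, 0, 0, 1⟩ : ℍ[F,-1,-1]) ∈ O := by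
  convert O.mul_mem hi hj using 1
  ext <;> simp

include hO hi hj

lemma coords_mem_of {z : Fin 4 → F} (hz : ∀ k, z k ∈ intR F) : (⟨z 0, z 1, z 2, z 3⟩ : ℍ[F,-1,-1]) ∈ O := by
  have hk := basisK_mem hi hj
  have := O.add_mem (O.add_mem (O.add_mem (hO.algebraMap_mem (hz 0)) (O.mul_mem (hO.algebraMap_mem (hz 1)) hi))
    (O.mul_mem (hO.algebraMap_mem (hz 2)) hj)) (O.mul_mem (hO.algebraMap_mem (hz 3)) hk)
  convert this using 1
  simp only [algebraMap_quat]
  ext <;> simp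

lemma two_coords_mem {y : ℍ[F,-1,-1]} (hy : y ∈ O) :
    2 * y.re ∈ intR F ∧ 2 * y.imI ∈ intR F ∧ 2 * y.imJ ∈ intR F ∧ 2 * y.imK ∈ intR F := by
  have hk := basisK_mem hi hj
  have n : ∀ {x : F}, -x ∈ intR F → x ∈ intR F := fun hx => by simpa using (intR F).neg_mem hx
  refine ⟨hO.tr_mem hy, n ?_, n ?_, n ?_⟩
  · simpa using hO.tr_mem (O.mul_mem hy hi)
  · simpa using hO.tr_mem (O.mul_mem hy hj)
  · simpa using hO.tr_mem (O.mul_mem hy hk)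

include h D

lemma exists_halfPat {y : ℍ[F,-1,-1]} (hy : y ∈ O) : ∃ a b, IsBits a ∧ IsBits b ∧ halfPat s a b ∈ O ∧
    ∃ z : Fin 4 → F, (∀ k, z k ∈ intR F) ∧ y = halfPat s a b + ⟨z 0, z 1, z 2, z 3⟩ := by
  have bit : ∀ x : F, 2 * x ∈ intR F → ∃ a b : ℤ, (a = 0 ∨ a = 1) ∧ (b = 0 ∨ b = 1) ∧
      ∃ z ∈ intR F, x = (a + b * s) / 2 + z := by
    intro x hx
    obtain ⟨a, b, z, hz, e⟩ := D.exists_pattern h hx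
    exact ⟨(a : ℕ), (b : ℕ), by omega, by omega, z, hz, by push_cast; linear_combination e / 2⟩
  obtain ⟨h0, h1, h2, h3⟩ := two_coords_mem hO hi hj hy
  obtain ⟨a0, b0, ha0, hb0, z0, hz0, e0⟩ := bit _ h0
  obtain ⟨a1, b1, ha1, hb1, z1, hz1, e1⟩ := bit _ h1
  obtain ⟨a2, b2, ha2, hb2, z2, hz2, e2⟩ := bit _ h2
  obtain ⟨a3, b3, ha3, hb3, z3, hz3, e3⟩ := bit _ h3
  have hz : ∀ k, ![z0, z1, z2, z3] k ∈ intR F := by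
    intro k; fin_cases k <;> assumption
  have e : y = halfPat s ![a0, a1, a2, a3] ![b0, b1, b2, b3] + ⟨z0, z1, z2, z3⟩ := by
    ext <;> simp [halfPat, e0, e1, e2, e3]
  refine ⟨_, _, ?_, ?_, ?_, ![z0, z1, z2, z3], hz, e⟩
  · intro k; fin_cases k <;> assumption
  · intro k; fin_cases k <;> assumption
  · rw [eq_sub_of_add_eq e.symm]
    exact O.sub_mem hy (coords_mem_of hO hi hj hz)

omit hi hj in
lemma halfPat_dvd {a b : Fin 4 → ℤ} (hab : halfPat s a b ∈ O) :
    4 ∣ a 0 ^ 2 + a 1 ^ 2 + a 2 ^ 2 + a 3 ^ 2 + 2 * (b 0 ^ 2 + b 1 ^ 2 + b 2 ^ 2 + b 3 ^ 2) ∧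
    4 ∣ 2 * (a 0 * b 0 + a 1 * b 1 + a 2 * b 2 + a 3 * b 3) + 2 * (b 0 ^ 2 + b 1 ^ 2 + b 2 ^ 2 + b 3 ^ 2) := by
  obtain ⟨z, hz, e⟩ := D.eps_eq
  have hn := hO.nrd_mem hab
  apply D.dvd_four h
  have := (intR F).sub_mem hn ((intR F).mul_mem hz (intCast_mem (intR F) (b 0 ^ 2 + b 1 ^ 2 + b 2 ^ 2 + b 3 ^ 2)))
  convert this using 1
  simp only [nrd, halfPat]
  push_cast
  linear_combination (-(b 0 ^ 2 + b 1 ^ 2 + b 2 ^ 2 + b 3 ^ 2) / 4 : F) * (D.sq + 2 * e)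

lemma le_octOrder (hmix : ∀ a b, IsBits a → IsBits b → halfPat s a b ∈ O → a 0 = a 3 ∧ a 1 = a 3 ∧ a 2 = a 3) :
    O ≤ octOrder D := by
  intro y hy
  obtain ⟨a, b, ha, hb, hm, z, hz, rfl⟩ := exists_halfPat h D hO hi hj hy
  obtain ⟨m0, m1, m2⟩ := hmix a b ha hb hm
  have hd := (halfPat_dvd h D hO hm).1
  have sq : ∀ k, b k ^ 2 = b k := fun k => by rcases hb k with e | e <;> rw [e] <;> norm_num
  rw [sq, sq, sq, sq, m0, m1, m2] at hd
  refine (octOrder D).add_mem (halfPat_mem_octOrder D ⟨m1, m2⟩ (by rw [m0]; simp) ?_) ?_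
  · grind
  · have hs := D.s_mem
    have ht := D.two_div_s_mem
    rw [mem_octOrder]
    exact ⟨(intR F).add_mem ((intR F).sub_mem ((intR F).sub_mem (hz 0) (hz 1)) (hz 2)) (hz 3),
      (intR F).mul_mem ht ((intR F).sub_mem (hz 1) (hz 3)), (intR F).mul_mem ht ((intR F).sub_mem (hz 2) (hz 3)),
      (intR F).mul_mem (ofNat_mem (intR F) 2) (hz 3)⟩

lemma le_octOrder_of_half (hh : (⟨1 / 2, 1 / 2, 1 / 2, 1 / 2⟩ : ℍ[F,-1,-1]) ∈ O) : O ≤ octOrder D := by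
  refine le_octOrder h D hO hi hj fun a b ha hb hm => ?_
  have hd := (halfPat_dvd h D hO hm).1
  have hd' := D.dvd_two h (m := a 0 - a 1 - a 2 - a 3) (n := b 0 - b 1 - b 2 - b 3) (by
    convert hO.tr_mem (O.mul_mem hm hh) using 1
    simp only [halfPat, QuaternionAlgebra.re_mul]
    push_cast; ring)
  have sq : ∀ k, b k ^ 2 = b k := fun k => by rcases hb k with e | e <;> rw [e] <;> norm_num
  have sq' : ∀ k, a k ^ 2 = a k := fun k => by rcases ha k with e | e <;> rw [e] <;> norm_num
  rw [sq, sq, sq, sq, sq', sq', sq', sq'] at hd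
  have := ha 0; have := ha 1; have := ha 2; have := ha 3
  omega

end HamiltonPatterns

section PairReduction

variable {F} {a b : F}

lemma exists_corr_of_anti {c d : F} {σ : F →+* ℝ} (hc : σ c < 0) (hd : σ d < 0) {X Y : ℍ[F,a,b]}
    (hXY : Anti c d X Y) (O : Subring ℍ[F,a,b]) :
    ∃ S : Subring ℍ[F,c,d], Corr F S O ∧ ∀ y, y ∈ S ↔ hXY.hom y ∈ O := by
  obtain ⟨e, he⟩ := hXY.exists_algEquiv σ hc hd
  exact ⟨_, corr_comap e O, fun y => by rw [← he]; rfl⟩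

end PairReduction

section TypeOne

lemma anti_of_relations {H : Type} [Ring H] {i ω : H} (hi : i * i = -1) (hω : ω * ω = -1 - ω)
    (hc : ω * i = -1 - i - i * ω) : (1 + ω + i * ω) * (1 + ω + i * ω) = -1 ∧
      i * (1 + ω + i * ω) = -((1 + ω + i * ω) * i) ∧ i * (1 + ω + i * ω) = i - ω + i * ω := by
  have h1 : i * ω * i = 1 - i + ω := by
    rw [mul_assoc, hc, mul_sub, mul_sub, hi, ← mul_assoc, hi]; noncomm_ring
  have h2 : i * (i * ω) = -ω := by rw [← mul_assoc, hi]; simp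
  have e2 : i * ω * ω = -i - i * ω := by rw [mul_assoc, hω]; noncomm_ring
  have e1 : ω * (i * ω) = i - ω := by rw [← mul_assoc, hc, sub_mul, sub_mul, e2]; noncomm_ring
  have e3 : i * ω * (i * ω) = -1 - i * ω := by rw [mul_assoc, e1, mul_sub, hi]
  refine ⟨?_, ?_, ?_⟩
  · simp only [add_mul, mul_add, mul_one, one_mul, e1, e2, e3, hω]
    noncomm_ring
  · simp only [add_mul, mul_add, mul_one, one_mul, h1, h2, hc]
    noncomm_ring
  · simp only [mul_add, mul_one, h2]
    noncomm_ring

variable {F} {p : ℕ} {θ s ε : F} (h : IsSqrtGen F p θ) (D : DyadicData θ s ε)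

include h in
lemma octOrder_isOrder : IsOrder F (octOrder D) := D.isOrderBasis_oct.isOrder h

lemma i_mem_octOrder : (⟨0, 1, 0, 0⟩ : ℍ[F,-1,-1]) ∈ octOrder D := by
  rw [mem_octOrder]
  simpa using D.two_div_s_mem

lemma j_mem_octOrder : (⟨0, 0, 1, 0⟩ : ℍ[F,-1,-1]) ∈ octOrder D := by
  rw [mem_octOrder]
  simpa using D.two_div_s_mem

lemma half_mem_octOrder : (⟨1 / 2, 1 / 2, 1 / 2, 1 / 2⟩ : ℍ[F,-1,-1]) ∈ octOrder D :=
  D.isOrderBasis_oct.basis_mem 3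

include h in
lemma octOrder_isMaximalOrder : IsMaximalOrder F (octOrder D) :=
  ⟨octOrder_isOrder h D, fun _ hO hle => le_antisymm
    (le_octOrder_of_half h D hO (hle (i_mem_octOrder D)) (hle (j_mem_octOrder D)) (hle (half_mem_octOrder D))) hle⟩

variable {a b : F} {O : Subring ℍ[F,a,b]} (hO : IsMaximalOrder F O)

include h hO in
lemma corr_octOrder_of_isI_isOmega {i ω : ℍ[F,a,b]} (hi : i ∈ O) (hω : ω ∈ O) (Ii : IsI i) (Iω : IsOmega ω)
    (ht : 2 * (i * ω).re = -1) : Corr F (octOrder D) O := by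
  have hc : ω * i = -1 - i - i * ω := by
    have := star_eq_sub (i * ω)
    rw [star_mul, Ii.star, Iω.star, ht, map_neg, map_one] at this
    linear_combination (norm := noncomm_ring) this
  obtain ⟨h1, h2, h3⟩ := anti_of_relations Ii.mul_self (by rw [Iω.mul_self]; noncomm_ring) hc
  have hA : Anti (-1 : F) (-1) i (1 + ω + i * ω) := ⟨by rw [Ii.mul_self]; simp, by rw [h1]; simp, h2⟩
  obtain ⟨σ⟩ := h.exists_real
  obtain ⟨S, hS, hm⟩ := exists_corr_of_anti (σ := σ) (by simp) (by simp) hA O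
  have hi' : (⟨0, 1, 0, 0⟩ : ℍ[F,-1,-1]) ∈ S := by rw [hm, hA.hom_apply]; simpa using hi
  have hY : 1 + ω + i * ω ∈ O := O.add_mem (O.add_mem O.one_mem hω) (O.mul_mem hi hω)
  have hj' : (⟨0, 0, 1, 0⟩ : ℍ[F,-1,-1]) ∈ S := by rw [hm, hA.hom_apply]; simpa using hY
  have hh : (⟨1 / 2, 1 / 2, 1 / 2, 1 / 2⟩ : ℍ[F,-1,-1]) ∈ S := by
    rw [hm, hA.hom_apply]
    convert O.add_mem (O.add_mem hω O.one_mem) (O.mul_mem hi hY) using 1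
    rw [h3]
    ext <;> simp <;> ring
  have hSm := hO.of_corr hS
  rw [hSm.2 _ (octOrder_isOrder h D) (le_octOrder_of_half h D hSm.1 hi' hj' hh)]
  exact hS

end TypeOne

section DihedralOrder

variable {F} {p : ℕ} {θ s ε : F} (h : IsSqrtGen F p θ) (D : DyadicData θ s ε)

/-- A basis of the maximal order whose reduced unit group is dihedral of order eight. -/
def dihBasis (s : F) : Fin 4 → ℍ[F,-1,-1] :=
  ![1, ⟨(1 + s) / 2, 1 / 2, 0, 0⟩, ⟨0, 0, 1, 0⟩, ⟨0, 0, (1 + s) / 2, 1 / 2⟩]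

include D in
lemma DyadicData.norm_mem : (ε + 1 + s) / 2 ∈ intR F := by
  obtain ⟨z, hz, e⟩ := D.eps_eq
  convert (intR F).sub_mem D.eps_mem hz using 1
  grind

include D in
lemma DyadicData.isOrderBasis_dih : IsOrderBasis (dihBasis s) := by
  have s1 := D.s_mem
  have e1 := D.norm_mem
  have o := (intR F).one_mem
  have z := (intR F).zero_mem
  have os := (intR F).add_mem o s1
  have n : ∀ {x : F}, x ∈ intR F → -x ∈ intR F := (intR F).neg_mem
  refine ⟨mem_latticeSpan 0, ?_, ?_⟩
  · intro i j
    by_cases hi : i = 0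
    · subst hi; simpa [dihBasis] using mem_latticeSpan (v := dihBasis s) j
    by_cases hj : j = 0
    · subst hj; simpa [dihBasis] using mem_latticeSpan (v := dihBasis s) i
    fin_cases i <;> fin_cases j <;> first | exact absurd rfl hi | exact absurd rfl hj | skip
    map_tacs [
      refine mem_latticeSpan_of (n e1) os z z ?_;
      refine mem_latticeSpan_of z z z o ?_;
      refine mem_latticeSpan_of z z (n e1) os ?_;
      refine mem_latticeSpan_of z z os (n o) ?_;
      refine mem_latticeSpan_of (n o) z z z ?_;
      refine mem_latticeSpan_of (n os) o z z ?_;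
      refine mem_latticeSpan_of z z e1 z ?_;
      refine mem_latticeSpan_of z (n o) z z ?_;
      refine mem_latticeSpan_of (n e1) z z z ?_]
    all_goals ext <;> simp [dihBasis, D.eps_def] <;> ring
  · intro y
    refine ⟨![y.re - (1 + s) * y.imI, 2 * y.imI, y.imJ - (1 + s) * y.imK, 2 * y.imK], ?_⟩
    rw [Fin.sum_univ_four]
    ext <;> simp [dihBasis] <;> ring

/-- The maximal order whose reduced unit group is dihedral of order eight. -/
def dihOrder : Subring ℍ[F,-1,-1] := D.isOrderBasis_dih.order

lemma mem_dihOrder {y : ℍ[F,-1,-1]} : y ∈ dihOrder D ↔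
    y.re - (1 + s) * y.imI ∈ intR F ∧ 2 * y.imI ∈ intR F ∧
      y.imJ - (1 + s) * y.imK ∈ intR F ∧ 2 * y.imK ∈ intR F := by
  constructor
  · rintro ⟨c, rfl⟩
    rw [Fin.sum_univ_four]
    refine ⟨?_, ?_, ?_, ?_⟩
    · convert (c 0).2 using 1; simp [dihBasis]; ring
    · convert (c 1).2 using 1; simp [dihBasis]; ring
    · convert (c 2).2 using 1; simp [dihBasis]; ring
    · convert (c 3).2 using 1; simp [dihBasis]; ring
  · rintro ⟨h0, h1, h2, h3⟩
    refine mem_latticeSpan_of h0 h1 h2 h3 ?_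
    ext <;> simp [dihBasis] <;> ring

lemma halfPat_mem_dihOrder {a b : Fin 4 → ℤ} (h0 : 2 ∣ a 0 - a 1) (h1 : 2 ∣ b 0 - b 1 - a 1) (h2 : 2 ∣ a 2 - a 3)
    (h3 : 2 ∣ b 2 - b 3 - a 3) : halfPat s a b ∈ dihOrder D := by
  have ic := fun m : ℤ => intCast_mem (intR F) m
  have key : ∀ m n k l : ℤ, 2 ∣ m - n → 2 ∣ k - l - n →
      ((m + k * s) / 2 - (1 + s) * ((n + l * s) / 2) : F) ∈ intR F := by
    rintro m n k l ⟨x, hx⟩ ⟨y, hy⟩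
    convert (intR F).sub_mem ((intR F).add_mem (ic x) ((intR F).mul_mem (ic y) D.s_mem))
      ((intR F).mul_mem (ic l) D.eps_mem) using 1
    have hx' : (m : F) - n = 2 * x := mod_cast hx
    have hy' : (k : F) - l - n = 2 * y := mod_cast hy
    linear_combination hx' / 2 + hy' / 2 * s - l / 2 * D.sq
  have key' : ∀ n l : ℤ, (2 * ((n + l * s) / 2) : F) ∈ intR F := fun n l => by
    rw [mul_div_cancel₀ _ two_ne_zero]
    exact (intR F).add_mem (ic n) ((intR F).mul_mem (ic l) D.s_mem)
  rw [mem_dihOrder]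
  exact ⟨key _ _ _ _ h0 h1, key' _ _, key _ _ _ _ h2 h3, key' _ _⟩

lemma j_mem_dihOrder : (⟨0, 0, 1, 0⟩ : ℍ[F,-1,-1]) ∈ dihOrder D := D.isOrderBasis_dih.basis_mem 2

lemma i_mem_dihOrder : (⟨0, 1, 0, 0⟩ : ℍ[F,-1,-1]) ∈ dihOrder D := by
  rw [mem_dihOrder]
  refine ⟨?_, ?_, ?_, ?_⟩ <;> simp only [mul_one, mul_zero, zero_sub, sub_zero, (intR F).zero_mem]
  · exact (intR F).neg_mem ((intR F).add_mem (intR F).one_mem D.s_mem)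
  · exact ofNat_mem (intR F) 2

lemma u_mem_dihOrder : (⟨s / 2, s / 2, 0, 0⟩ : ℍ[F,-1,-1]) ∈ dihOrder D := by
  rw [mem_dihOrder]
  refine ⟨?_, ?_, ?_, ?_⟩
  · convert (intR F).neg_mem D.eps_mem using 1
    rw [D.eps_def]; simp; ring
  · convert D.s_mem using 1; ring
  · simp
  · simp

section Containing

variable {O : Subring ℍ[F,-1,-1]} (hO : IsOrder F O) (hi : (⟨0, 1, 0, 0⟩ : ℍ[F,-1,-1]) ∈ O)
  (hj : (⟨0, 0, 1, 0⟩ : ℍ[F,-1,-1]) ∈ O)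

include hO hi hj in
lemma half_mem_of_odd {a : Fin 4 → ℤ} (ha : ∀ k, 2 ∣ a k - 1) (hm : halfPat s a 0 ∈ O) :
    (⟨1 / 2, 1 / 2, 1 / 2, 1 / 2⟩ : ℍ[F,-1,-1]) ∈ O := by
  choose z hz using ha
  have e : ∀ k, (a k : F) = 1 + 2 * z k := fun k => by
    have := hz k
    exact_mod_cast (by linarith : a k = 1 + 2 * z k)
  convert O.sub_mem hm (coords_mem_of hO hi hj (z := fun k => z k) fun k => intCast_mem _ _) using 1
  ext <;> simp [halfPat, e] <;> ring

variable (hu : (⟨s / 2, s / 2, 0, 0⟩ : ℍ[F,-1,-1]) ∈ O)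

include h hO hi hj hu

lemma half_mem_or_le_dihOrder : (⟨1 / 2, 1 / 2, 1 / 2, 1 / 2⟩ : ℍ[F,-1,-1]) ∈ O ∨ O ≤ dihOrder D := by
  rw [or_iff_not_imp_left]
  intro hh y hy
  obtain ⟨a, b, ha, hb, hm, z, hz, rfl⟩ := exists_halfPat h D hO hi hj hy
  have hs := D.s_ne
  have he := D.eps_ne
  have tr : ∀ c d : Fin 4 → ℤ, halfPat s c d ∈ O → 2 ∣ c 0 - c 1 := by
    intro c d hc
    apply D.dvd_s h (n := d 0 - d 1)
    convert (intR F).mul_mem D.inv_mem (hO.tr_mem (O.mul_mem hc hu)) using 1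
    simp only [halfPat, QuaternionAlgebra.re_mul, D.eps_def]
    grind
  have h01 := tr a b hm
  have h23 := tr ![-a 2, -a 3, a 0, a 1] ![-b 2, -b 3, b 0, b 1] (by
    convert O.mul_mem hm hj using 1
    ext <;> simp [halfPat] <;> ring)
  have hd := halfPat_dvd h D hO hm
  have sq : ∀ k, b k ^ 2 = b k := fun k => by rcases hb k with e | e <;> rw [e] <;> norm_num
  have sq' : ∀ k, a k ^ 2 = a k := fun k => by rcases ha k with e | e <;> rw [e] <;> norm_num
  rw [sq, sq, sq, sq, sq', sq', sq', sq'] at hd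
  refine (dihOrder D).add_mem ?_ (coords_mem_of (D.isOrderBasis_dih.isOrder h) (i_mem_dihOrder D) (j_mem_dihOrder D) hz)
  simp only [Matrix.cons_val] at h23
  have b0 := hb 0; have b1 := hb 1; have b2 := hb 2; have b3 := hb 3
  have e01 : a 0 = a 1 := by have := ha 0; have := ha 1; omega
  have e23 : a 2 = a 3 := by have := ha 2; have := ha 3; omega
  rw [e01, e23] at hd
  by_cases hgood : (2 ∣ b 0 - b 1 - a 1) ∧ 2 ∣ b 2 - b 3 - a 3
  · exact halfPat_mem_dihOrder D (by rw [e01]; simp) hgood.1 (by rw [e23]; simp) hgood.2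
  refine absurd ?_ hh
  rcases ha 1 with e1 | e1 <;> rcases ha 3 with e3 | e3 <;> rw [e1] at hd hgood e01 <;> rw [e3] at hd hgood e23
  · refine half_mem_of_odd (s := s) (a := ![b 0 - b 1, b 0 + b 1, b 2 - b 3, b 2 + b 3]) hO hi hj ?_ ?_
    · intro k; fin_cases k <;> simp <;> omega
    · convert O.mul_mem (hO.algebraMap_mem D.inv_mem) (O.mul_mem hu hm) using 1
      rw [algebraMap_quat]
      ext <;> simp [halfPat, e01, e23, e1, e3, D.eps_def] <;> field_simp <;> ring
  · omega
  · omega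
  · convert O.sub_mem (O.sub_mem hm (O.mul_mem (intCast_mem O (b 1)) hu))
      (O.mul_mem (intCast_mem O (b 3)) (O.mul_mem hu hj)) using 1
    have e0 : b 0 = b 1 := by omega
    have e2 : b 2 = b 3 := by omega
    ext <;> simp [halfPat, e01, e23, e1, e3, e0, e2] <;> ring

end Containing

include h in
lemma dihOrder_isOrder : IsOrder F (dihOrder D) := D.isOrderBasis_dih.isOrder h

include h in
lemma dihOrder_isMaximalOrder : IsMaximalOrder F (dihOrder D) := by
  refine ⟨dihOrder_isOrder h D, fun O hO hle => le_antisymm ?_ hle⟩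
  have hi := hle (i_mem_dihOrder D)
  have hj := hle (j_mem_dihOrder D)
  refine (half_mem_or_le_dihOrder h D hO hi hj (hle (u_mem_dihOrder D))).resolve_left fun hh => ?_
  have he := (mem_octOrder D).mp (le_octOrder_of_half h D hO hi hj hh (hle (D.isOrderBasis_dih.basis_mem 1)))
  have := D.dvd_s h (m := 1) (n := 0) (by convert he.2.1 using 1; simp [dihBasis]; ring)
  omega

/-- The order corresponds to one of the two standard maximal orders with even reduced units. -/
def IsEvenType {a b : F} (D : DyadicData θ s ε) (O : Subring ℍ[F,a,b]) : Prop :=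
  Corr F (octOrder D) O ∨ Corr F (dihOrder D) O

include h in
lemma isEvenType_of_u_mem {O : Subring ℍ[F,-1,-1]} (hO : IsMaximalOrder F O) (hi : (⟨0, 1, 0, 0⟩ : ℍ[F,-1,-1]) ∈ O)
    (hj : (⟨0, 0, 1, 0⟩ : ℍ[F,-1,-1]) ∈ O) (hu : (⟨s / 2, s / 2, 0, 0⟩ : ℍ[F,-1,-1]) ∈ O) : IsEvenType D O := by
  have refl : Corr F O O := ⟨AlgEquiv.refl, fun _ => Iff.rfl⟩
  rcases half_mem_or_le_dihOrder h D hO.1 hi hj hu with hh | hh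
  · exact .inl (by rwa [hO.2 _ (octOrder_isOrder h D) (le_octOrder_of_half h D hO.1 hi hj hh)])
  · exact .inr (by rwa [hO.2 _ (dihOrder_isOrder h D) hh])

end DihedralOrder

section TypeTwo

variable {F} {p : ℕ} {θ s ε : F} (h : IsSqrtGen F p θ) (D : DyadicData θ s ε)

lemma IsEvenType.of_corr {a b c d : F} {S : Subring ℍ[F,a,b]} {O : Subring ℍ[F,c,d]} (hS : IsEvenType D S)
    (hc : Corr F S O) : IsEvenType D O :=
  hS.imp (fun e => e.trans hc) (fun e => e.trans hc)

include h in
lemma isEvenType_of_le {O : Subring ℍ[F,-1,-1]} (hO : IsMaximalOrder F O) (hle : O ≤ octOrder D) : IsEvenType D O := by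
  refine .inl ?_
  rw [hO.2 _ (octOrder_isOrder h D) hle]
  exact ⟨AlgEquiv.refl, fun _ => Iff.rfl⟩

section Hamilton

variable {O : Subring ℍ[F,-1,-1]} (hO : IsOrder F O) (hi : (⟨0, 1, 0, 0⟩ : ℍ[F,-1,-1]) ∈ O)
  (hj : (⟨0, 0, 1, 0⟩ : ℍ[F,-1,-1]) ∈ O)

include h D hO hi hj

lemma u_mem_of_mixed {a b : Fin 4 → ℤ} (ha : IsBits a) (hb : IsBits b) (hm : halfPat s a b ∈ O)
    (hmix : ¬ (a 0 = a 3 ∧ a 1 = a 3 ∧ a 2 = a 3)) :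
    (⟨s / 2, s / 2, 0, 0⟩ : ℍ[F,-1,-1]) ∈ O ∨ (⟨s / 2, 0, s / 2, 0⟩ : ℍ[F,-1,-1]) ∈ O ∨
      (⟨s / 2, 0, 0, s / 2⟩ : ℍ[F,-1,-1]) ∈ O := by
  have hk := basisK_mem hi hj
  have hx : (⟨a 0 * s / 2, a 1 * s / 2, a 2 * s / 2, a 3 * s / 2⟩ : ℍ[F,-1,-1]) ∈ O := by
    convert O.sub_mem (O.mul_mem (hO.algebraMap_mem D.s_mem) hm) (coords_mem_of hO hi hj (z := fun k => ε * b k)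
      fun k => (intR F).mul_mem D.eps_mem (intCast_mem _ _)) using 1
    rw [algebraMap_quat]
    ext <;> simp [halfPat, D.eps_def] <;> ring
  have hd := (halfPat_dvd h D hO hm).1
  have sq : ∀ k, b k ^ 2 = b k := fun k => by rcases hb k with e | e <;> rw [e] <;> norm_num
  have sq' : ∀ k, a k ^ 2 = a k := fun k => by rcases ha k with e | e <;> rw [e] <;> norm_num
  rw [sq, sq, sq, sq, sq', sq', sq', sq'] at hd
  rcases ha 0 with e0 | e0 <;> rcases ha 1 with e1 | e1 <;> rcases ha 2 with e2 | e2 <;> rcases ha 3 with e3 | e3 <;>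
    rw [e0, e1, e2, e3] at hd hmix hx <;> first | omega | skip
  · left
    convert O.neg_mem (O.mul_mem hx hj) using 1
    ext <;> simp
  · right; left
    convert O.neg_mem (O.mul_mem hi hx) using 1
    ext <;> simp
  · right; right
    convert O.add_mem (O.mul_mem hi hx) (O.mul_mem (hO.algebraMap_mem D.s_mem) O.one_mem) using 1
    rw [algebraMap_quat]
    ext <;> simp
    ring
  · grind
  · grind
  · grind

end Hamilton

variable {a b : F} {O : Subring ℍ[F,a,b]} (hO : IsMaximalOrder F O) {X Y : ℍ[F,a,b]}
  (hA : Anti (-1 : F) (-1) X Y) (hX : X ∈ O)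

include h hO hA hX

lemma isEvenType_of_anti_of_mem (hY : Y ∈ O) (hu : algebraMap F _ (s / 2) * (1 + X) ∈ O) : IsEvenType D O := by
  obtain ⟨σ⟩ := h.exists_real
  obtain ⟨S, hS, hm⟩ := exists_corr_of_anti (σ := σ) (by simp) (by simp) hA O
  refine (isEvenType_of_u_mem h D (hO.of_corr hS) ?_ ?_ ?_).of_corr D hS
  · rw [hm, hA.hom_apply]; simpa using hX
  · rw [hm, hA.hom_apply]; simpa using hY
  · rw [hm, hA.hom_apply]
    convert hu using 1
    simp [mul_add, Algebra.smul_def]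

lemma isEvenType_of_anti (hY : Y ∈ O) : IsEvenType D O := by
  obtain ⟨σ⟩ := h.exists_real
  obtain ⟨S, hS, hm⟩ := exists_corr_of_anti (σ := σ) (by simp) (by simp) hA O
  have hSm := hO.of_corr hS
  refine IsEvenType.of_corr D ?_ hS
  have hi : (⟨0, 1, 0, 0⟩ : ℍ[F,-1,-1]) ∈ S := by rw [hm, hA.hom_apply]; simpa using hX
  have hj : (⟨0, 0, 1, 0⟩ : ℍ[F,-1,-1]) ∈ S := by rw [hm, hA.hom_apply]; simpa using hY
  have hk := basisK_mem hi hj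
  by_cases hmix : ∀ a b, IsBits a → IsBits b → halfPat s a b ∈ S → a 0 = a 3 ∧ a 1 = a 3 ∧ a 2 = a 3
  · exact isEvenType_of_le h D hSm (le_octOrder h D hSm.1 hi hj hmix)
  push Not at hmix
  obtain ⟨a, b, ha, hb, hab, hmix⟩ := hmix
  rcases u_mem_of_mixed h D hSm.1 hi hj ha hb hab (by tauto) with hu | hu | hu
  · exact isEvenType_of_u_mem h D hSm hi hj hu
  · refine isEvenType_of_anti_of_mem h D hSm (X := ⟨0, 0, 1, 0⟩) (Y := ⟨0, 0, 0, 1⟩) ⟨?_, ?_, ?_⟩ hj hk ?_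
    · rw [algebraMap_quat]; ext <;> simp
    · rw [algebraMap_quat]; ext <;> simp
    · ext <;> simp
    · convert hu using 1
      rw [algebraMap_quat]; ext <;> simp
  · refine isEvenType_of_anti_of_mem h D hSm (X := ⟨0, 0, 0, 1⟩) (Y := ⟨0, 1, 0, 0⟩) ⟨?_, ?_, ?_⟩ hk hi ?_
    · rw [algebraMap_quat]; ext <;> simp
    · rw [algebraMap_quat]; ext <;> simp
    · ext <;> simp
    · convert hu using 1
      rw [algebraMap_quat]; ext <;> simp

end TypeTwo

section TypeTwoRamified

variable {F} {p : ℕ} {θ s ε : F} (h : IsSqrtGen F p θ) (D : DyadicData θ s ε)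

/-- The quaternion `x₀ + x₁ i + x₂ w + x₃ i w` where `w = s (j - k) / 2`. -/
def wCoord (s : F) (x : Fin 4 → F) : ℍ[F,-1,-1] :=
  ⟨x 0, x 1, s / 2 * (x 2 + x 3), s / 2 * (x 3 - x 2)⟩

/-- The coefficients `(a k + b k * s) / 2`. -/
def halfCoeff (s : F) (a b : Fin 4 → ℤ) (k : Fin 4) : F := (a k + b k * s) / 2

variable {O : Subring ℍ[F,-1,-1]} (hO : IsOrder F O) (hi : (⟨0, 1, 0, 0⟩ : ℍ[F,-1,-1]) ∈ O)
  (hw : (⟨0, 0, s / 2, -(s / 2)⟩ : ℍ[F,-1,-1]) ∈ O)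

include hO hi hw

lemma wCoord_mem {z : Fin 4 → F} (hz : ∀ k, z k ∈ intR F) : wCoord s z ∈ O := by
  convert O.add_mem (O.add_mem (O.add_mem (hO.algebraMap_mem (hz 0)) (O.mul_mem (hO.algebraMap_mem (hz 1)) hi))
    (O.mul_mem (hO.algebraMap_mem (hz 2)) hw)) (O.mul_mem (hO.algebraMap_mem (hz 3)) (O.mul_mem hi hw)) using 1
  simp only [algebraMap_quat]
  ext <;> simp [wCoord] <;> ring

include h D

lemma exists_wCoord {y : ℍ[F,-1,-1]} (hy : y ∈ O) : ∃ a b, IsBits a ∧ IsBits b ∧ wCoord s (halfCoeff s a b) ∈ O ∧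
    ∃ z : Fin 4 → F, (∀ k, z k ∈ intR F) ∧ y = wCoord s (halfCoeff s a b) + wCoord s z := by
  have hs := D.s_ne
  have he := D.eps_ne
  have bit : ∀ x : F, 2 * x ∈ intR F → ∃ a b : ℤ, (a = 0 ∨ a = 1) ∧ (b = 0 ∨ b = 1) ∧
      ∃ z ∈ intR F, x = (a + b * s) / 2 + z := by
    intro x hx
    obtain ⟨a, b, z, hz, e⟩ := D.exists_pattern h hx
    exact ⟨(a : ℕ), (b : ℕ), by omega, by omega, z, hz, by push_cast; linear_combination e / 2⟩
  have hiw := O.mul_mem hi hw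
  obtain ⟨a0, b0, ha0, hb0, z0, hz0, e0⟩ := bit _ (hO.tr_mem hy)
  obtain ⟨a1, b1, ha1, hb1, z1, hz1, e1⟩ := bit y.imI (by
    convert (intR F).neg_mem (hO.tr_mem (O.mul_mem hy hi)) using 1; simp)
  obtain ⟨a2, b2, ha2, hb2, z2, hz2, e2⟩ := bit ((y.imJ - y.imK) / s) (by
    convert (intR F).neg_mem ((intR F).mul_mem D.inv_mem (hO.tr_mem (O.mul_mem hy hw))) using 1
    simp [D.eps_def]; field_simp; ring)
  obtain ⟨a3, b3, ha3, hb3, z3, hz3, e3⟩ := bit ((y.imJ + y.imK) / s) (by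
    convert (intR F).neg_mem ((intR F).mul_mem D.inv_mem (hO.tr_mem (O.mul_mem hy hiw))) using 1
    simp [D.eps_def]; field_simp; ring)
  have hz : ∀ k, ![z0, z1, z2, z3] k ∈ intR F := by
    intro k; fin_cases k <;> assumption
  have e : y = wCoord s (halfCoeff s ![a0, a1, a2, a3] ![b0, b1, b2, b3]) + wCoord s ![z0, z1, z2, z3] := by
    have h2 : y.imJ - y.imK = s * ((a2 + b2 * s) / 2 + z2) := by rw [← e2]; field_simp
    have h3 : y.imJ + y.imK = s * ((a3 + b3 * s) / 2 + z3) := by rw [← e3]; field_simp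
    ext
    · simp [wCoord, halfCoeff, e0]
    · simp [wCoord, halfCoeff, e1]
    · simp [wCoord, halfCoeff]
      linear_combination h2 / 2 + h3 / 2
    · simp [wCoord, halfCoeff]
      linear_combination -h2 / 2 + h3 / 2
  refine ⟨_, _, ?_, ?_, ?_, ![z0, z1, z2, z3], hz, e⟩
  · intro k; fin_cases k <;> assumption
  · intro k; fin_cases k <;> assumption
  · rw [eq_sub_of_add_eq e.symm]
    exact O.sub_mem hy (wCoord_mem hO hi hw hz)

omit hi hw in
lemma wCoord_parity {a b : Fin 4 → ℤ} (ha : IsBits a) (hb : IsBits b) (hab : wCoord s (halfCoeff s a b) ∈ O) :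
    a 0 = a 1 ∧ a 2 = a 3 ∧ 2 ∣ a 0 + (b 0 + b 1) + a 2 + (b 2 + b 3) ∧
      2 ∣ b 0 + b 1 + a 0 * (b 0 + b 1) + a 2 + a 2 * (b 2 + b 3) := by
  obtain ⟨z, hz, e⟩ := D.eps_eq
  have ic := fun m : ℤ => intCast_mem (intR F) m
  have hn := hO.nrd_mem hab
  have sq : ∀ k, b k ^ 2 = b k := fun k => by rcases hb k with e | e <;> rw [e] <;> norm_num
  have sq' : ∀ k, a k ^ 2 = a k := fun k => by rcases ha k with e | e <;> rw [e] <;> norm_num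
  set A := a 0 ^ 2 + a 1 ^ 2
  set A' := a 2 ^ 2 + a 3 ^ 2
  set B := b 0 ^ 2 + b 1 ^ 2
  set B' := b 2 ^ 2 + b 3 ^ 2
  set C := a 0 * b 0 + a 1 * b 1
  set C' := a 2 * b 2 + a 3 * b 3
  have hn' : nrd (wCoord s (halfCoeff s a b)) =
      (A + 2 * ε * B + 2 * C * s + ε * (A' + 2 * ε * B' + 2 * C' * s)) / 4 := by
    simp only [nrd, wCoord, halfCoeff, D.eps_def, A, A', B, B', C, C']
    push_cast; ring
  rw [hn'] at hn
  have hp := D.dvd_two h (m := A + A') (n := A') (by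
    have := (intR F).sub_mem ((intR F).mul_mem (ofNat_mem (intR F) 2) hn)
      ((intR F).add_mem ((intR F).add_mem ((intR F).add_mem ((intR F).mul_mem D.eps_mem (ic B))
        ((intR F).mul_mem (ic C) D.s_mem)) ((intR F).mul_mem hz (ic A')))
        ((intR F).mul_mem D.eps_mem ((intR F).add_mem ((intR F).mul_mem D.eps_mem (ic B')) ((intR F).mul_mem (ic C') D.s_mem))))
    convert this using 1
    push_cast
    linear_combination (-A' / 2 : F) * e)
  have hA : a 0 = a 1 ∧ a 2 = a 3 := by
    simp only [A, A', sq'] at hp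
    have := ha 0; have := ha 1; have := ha 2; have := ha 3
    omega
  obtain ⟨A₂, hA₂⟩ := hp.2
  have hq := D.dvd_four h (m := A + 2 * B + A' + 2 * B') (n := 2 * B + 2 * C + A' + 2 * C') (by
    have t1 := (intR F).mul_mem hz (ic (B + A₂))
    have t2 := (intR F).mul_mem ((intR F).add_mem ((intR F).add_mem D.s_mem D.eps_mem) ((intR F).mul_mem
      ((intR F).mul_mem (ofNat_mem (intR F) 2) hz) ((intR F).add_mem ((intR F).add_mem (intR F).one_mem D.s_mem) hz))) (ic B')
    have t3 := (intR F).mul_mem ((intR F).add_mem D.eps_mem ((intR F).mul_mem D.s_mem hz)) (ic C')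
    convert (intR F).sub_mem hn ((intR F).add_mem ((intR F).add_mem t1 t2) t3) using 1
    have hA₂' : (A' : F) = 2 * A₂ := mod_cast hA₂
    push_cast
    rw [hA₂']
    linear_combination (-(B + A₂) / 2 - C' * s / 2 - B' / 2 * (ε + 1 + s + 2 * z) : F) * e + (-C' / 2 - B' / 2 : F) * D.sq)
  refine ⟨hA.1, hA.2, ?_⟩
  grind

end TypeTwoRamified

section TypeTwoRamified

variable {F} {p : ℕ} {θ s ε : F} (h : IsSqrtGen F p θ) (D : DyadicData θ s ε)

section Hamilton

variable {O : Subring ℍ[F,-1,-1]} (hO : IsOrder F O) (hi : (⟨0, 1, 0, 0⟩ : ℍ[F,-1,-1]) ∈ O)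
  (hw : (⟨0, 0, s / 2, -(s / 2)⟩ : ℍ[F,-1,-1]) ∈ O)

include D

lemma u_mem_octOrder : (⟨s / 2, s / 2, 0, 0⟩ : ℍ[F,-1,-1]) ∈ octOrder D := D.isOrderBasis_oct.basis_mem 1

lemma w_mem_octOrder : (⟨0, 0, s / 2, -(s / 2)⟩ : ℍ[F,-1,-1]) ∈ octOrder D := by
  have hs := D.s_ne
  rw [mem_octOrder]
  refine ⟨?_, ?_, ?_, ?_⟩
  · convert (intR F).neg_mem D.s_mem using 1; simp; ring
  · convert (intR F).one_mem using 1; simp [hs]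
  · convert ofNat_mem (intR F) 2 using 1; simp; field_simp
  · convert (intR F).neg_mem D.s_mem using 1; simp; ring

include hO hw

lemma j_mem_of_u_mem (hu : (⟨s / 2, s / 2, 0, 0⟩ : ℍ[F,-1,-1]) ∈ O) : (⟨0, 0, 1, 0⟩ : ℍ[F,-1,-1]) ∈ O := by
  have he := D.eps_ne
  have hs := D.s_ne
  convert O.mul_mem (hO.algebraMap_mem D.inv_mem) (O.mul_mem hu hw) using 1
  rw [algebraMap_quat, D.eps_def]
  ext <;> simp
  field_simp; ring

lemma u_mem_of_uw_mem (hu : wCoord s ![0, 0, s / 2, s / 2] ∈ O) : (⟨s / 2, s / 2, 0, 0⟩ : ℍ[F,-1,-1]) ∈ O := by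
  have he := D.eps_ne
  have hs := D.s_ne
  convert O.mul_mem (hO.algebraMap_mem ((intR F).neg_mem D.inv_mem)) (O.mul_mem hu hw) using 1
  rw [algebraMap_quat, D.eps_def]
  ext <;> simp [wCoord] <;> field_simp

include h hi

lemma u_mem_or_le_octOrder : (⟨s / 2, s / 2, 0, 0⟩ : ℍ[F,-1,-1]) ∈ O ∨ O ≤ octOrder D := by
  rw [or_iff_not_imp_left]
  intro hu y hy
  have huw := mt (u_mem_of_uw_mem D hO hw) hu
  obtain ⟨z₀, hz₀, hε⟩ := D.eps_eq
  have ic := fun m : ℤ => intCast_mem (intR F) m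
  obtain ⟨a, b, ha, hb, hm, z, hz, rfl⟩ := exists_wCoord h D hO hi hw hy
  refine (octOrder D).add_mem ?_ (wCoord_mem (octOrder_isOrder h D) (i_mem_octOrder D) (w_mem_octOrder D) hz)
  obtain ⟨h01, h23, hd, hd'⟩ := wCoord_parity h D hO ha hb hm
  have lat : ∀ x : Fin 4 → F, (∀ k, x k ∈ intR F) → wCoord s x ∈ O := fun x hx => wCoord_mem hO hi hw hx
  have hsm : wCoord s (fun k => a k * s / 2) ∈ O := by
    convert O.sub_mem (O.mul_mem (hO.algebraMap_mem D.s_mem) hm) (lat (fun k => ε * b k)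
      fun k => (intR F).mul_mem D.eps_mem (ic _)) using 1
    rw [algebraMap_quat]
    ext <;> simp [wCoord, halfCoeff, D.eps_def] <;> ring
  rcases ha 1 with e1 | e1 <;> rcases ha 3 with e3 | e3 <;> rw [e1] at h01 <;> rw [e3] at h23 <;>
    rw [h01, h23] at hd hd'
  · have b01 : b 0 = b 1 := by have := hb 0; have := hb 1; omega
    have b23 : b 2 = b 3 := by have := hb 2; have := hb 3; omega
    rcases hb 1 with f1 | f1 <;> rcases hb 3 with f3 | f3
    · convert (octOrder D).zero_mem using 1
      ext <;> simp [wCoord, halfCoeff, e1, e3, h01, h23, b01, b23, f1, f3]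
    · refine absurd ?_ huw
      convert hm using 1
      ext <;> simp [wCoord, halfCoeff, e1, e3, h01, h23, b01, b23, f1, f3]
    · refine absurd ?_ hu
      convert hm using 1
      ext <;> simp [wCoord, halfCoeff, e1, e3, h01, h23, b01, b23, f1, f3]
    · convert (octOrder D).mul_mem (u_mem_octOrder D) ((octOrder D).add_mem (octOrder D).one_mem (w_mem_octOrder D)) using 1
      ext <;> simp [wCoord, halfCoeff, e1, e3, h01, h23, b01, b23, f1, f3]
      ring
  · refine absurd ?_ huw
    convert hsm using 1
    ext <;> simp [wCoord, e1, e3, h01, h23]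
  · refine absurd ?_ hu
    convert hsm using 1
    ext <;> simp [wCoord, e1, e3, h01, h23]
  · have hyw := O.add_mem hm (O.mul_mem hm hw)
    have hz' : z₀ = (s ^ 2 / 2 - 1 - s) / 2 := by rw [← D.eps_def, hε]; ring
    have c0 := (intR F).neg_mem hz₀
    have c1 := (intR F).add_mem D.eps_mem ((intR F).mul_mem D.s_mem hz₀)
    have s1 := D.s_mem
    have o := (intR F).one_mem
    have b1 : b 1 = 1 - b 0 := by have := hb 0; have := hb 1; omega
    have b3 : b 3 = 1 - b 2 := by have := hb 2; have := hb 3; omega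
    rcases (by have := hb 0; have := hb 2; omega : b 2 = b 0 ∨ b 2 = 1 - b 0) with f | f
    · refine absurd ?_ hu
      convert O.sub_mem (lat ![-z₀ - (ε + s * z₀) * b 0, -z₀ - (ε + s * z₀) * b 1, 1 + s * b 0, 1 + s * b 1] ?_) hyw using 1
      · ext <;> simp [wCoord, halfCoeff, e1, e3, h01, h23, b1, b3, f, hz', D.eps_def] <;> ring
        
      · intro k
        fin_cases k
        · exact (intR F).sub_mem c0 ((intR F).mul_mem c1 (ic _))
        · exact (intR F).sub_mem c0 ((intR F).mul_mem c1 (ic _))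
        · exact (intR F).add_mem o ((intR F).mul_mem s1 (ic _))
        · exact (intR F).add_mem o ((intR F).mul_mem s1 (ic _))
    · refine absurd ?_ huw
      convert O.sub_mem hyw (lat ![-z₀ - s + s * b 0 - (ε + s * z₀) * b 1, -z₀ - s + s * b 1 - (ε + s * z₀) * b 0, 1, 1] ?_) using 1
      · ext <;> simp [wCoord, halfCoeff, e1, e3, h01, h23, b1, b3, f, hz', D.eps_def] <;> ring
        
      · intro k
        fin_cases k
        · exact (intR F).sub_mem ((intR F).add_mem ((intR F).sub_mem c0 s1) ((intR F).mul_mem s1 (ic _))) ((intR F).mul_mem c1 (ic _))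
        · exact (intR F).sub_mem ((intR F).add_mem ((intR F).sub_mem c0 s1) ((intR F).mul_mem s1 (ic _))) ((intR F).mul_mem c1 (ic _))
        · exact o
        · exact o

end Hamilton

variable {a b : F} {O : Subring ℍ[F,a,b]} (hO : IsMaximalOrder F O)

include h hO

lemma isEvenType_of_isI_isW {i w : ℍ[F,a,b]} (hi : i ∈ O) (hw : w ∈ O) (Ii : IsI i) (Iw : IsW ε w)
    (ht : (i * w).re = 0) : IsEvenType D O := by
  have hs := D.s_ne
  have hc : w * i = -(i * w) := by
    have := star_eq_sub (i * w)
    rw [star_mul, Ii.star, star_eq_sub, Iw.1, ht] at this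
    simpa using this
  have hww : w * w = -algebraMap F _ ε := by rw [mul_self_eq, Iw.1, Iw.2]; simp
  have hwi : w * (1 + i) = (1 - i) * w := by rw [mul_add, hc]; noncomm_ring
  have hii : (1 + i) * (1 - i) = 2 := by
    rw [mul_sub, add_mul, add_mul, Ii.mul_self, ← one_add_one_eq_two]; noncomm_ring
  have hA : Anti (-1 : F) (-1) i (s⁻¹ • ((1 + i) * w)) := by
    refine ⟨by rw [Ii.mul_self]; simp, ?_, ?_⟩
    · have : (1 + i) * w * ((1 + i) * w) = algebraMap F _ (-(2 * ε)) := by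
        rw [mul_assoc, ← mul_assoc w, hwi, ← mul_assoc, ← mul_assoc, hii, mul_assoc, hww]; simp
      rw [smul_mul_smul_comm, this, Algebra.smul_def, ← map_mul, D.eps_def]
      grind
    · rw [mul_smul_comm, smul_mul_assoc, ← smul_neg, mul_assoc (1 + i), hc]
      congr 1; noncomm_ring
  obtain ⟨σ⟩ := h.exists_real
  obtain ⟨S, hS, hm⟩ := exists_corr_of_anti (σ := σ) (by simp) (by simp) hA O
  have hSm := hO.of_corr hS
  refine IsEvenType.of_corr D ?_ hS
  have hi' : (⟨0, 1, 0, 0⟩ : ℍ[F,-1,-1]) ∈ S := by rw [hm, hA.hom_apply]; simpa using hi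
  have hw' : (⟨0, 0, s / 2, -(s / 2)⟩ : ℍ[F,-1,-1]) ∈ S := by
    rw [hm, hA.hom_apply]
    convert hw using 1
    have : i * ((1 + i) * w) = (1 + i) * w - 2 * w := by
      rw [← hii, ← mul_assoc]; noncomm_ring
    rw [mul_smul_comm, this, smul_smul, smul_smul]
    simp only [map_zero, zero_smul, zero_add, add_zero]
    rw [neg_mul, neg_smul, smul_sub, div_mul_eq_mul_div, mul_inv_cancel₀ hs]
    rw [two_mul, smul_add, ← add_smul]; norm_num
  rcases u_mem_or_le_octOrder h D hSm.1 hi' hw' with hu | hle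
  · exact isEvenType_of_u_mem h D hSm hi' (j_mem_of_u_mem D hSm.1 hw' hu) hu
  · exact isEvenType_of_le h D hSm hle

end TypeTwoRamified

section TriangularOrder

variable {F} {p : ℕ} {θ δ l : F} (h : IsSqrtGen F p θ)

/-- Parameters of a maximal order of `ℍ[F,-3,-δ]` containing a cube root of unity and `j`. -/
structure TriData (δ l : F) : Prop where
  unit_mem : δ ∈ intR F
  inv_mem : δ⁻¹ ∈ intR F
  ne_zero : δ ≠ 0
  pos : ∀ σ : F →+* ℝ, 0 < σ δ
  param_mem : l ∈ intR F
  div_mem : (l ^ 2 + δ) / 3 ∈ intR F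

variable (T : TriData δ l)

/-- A basis of a maximal order of `ℍ[F,-3,-δ]`. -/
def triBasis (δ l : F) : Fin 4 → ℍ[F,-3,-δ] :=
  ![⟨1 / 2, 1 / 2, 0, 0⟩, ⟨0, 0, 1 / 2, 1 / 2⟩, ⟨0, 1, 0, 0⟩, ⟨0, l / 3, 0, 1 / 3⟩]

include T in
lemma TriData.isOrderBasis : IsOrderBasis (triBasis δ l) := by
  have l1 := T.param_mem
  obtain ⟨m, hm, e⟩ : ∃ m ∈ intR F, δ = 3 * m - l ^ 2 := ⟨_, T.div_mem, by ring⟩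
  have t : ∀ {x y : F}, x ∈ intR F → y ∈ intR F → x * y ∈ intR F := (intR F).mul_mem
  have n : ∀ {x : F}, x ∈ intR F → -x ∈ intR F := (intR F).neg_mem
  have c := fun k : ℤ => intCast_mem (intR F) k
  have s2 : ∀ {x : F}, x ∈ intR F → 2 * x ∈ intR F := t (ofNat_mem _ 2)
  have ll := t l1 l1
  have l2 := s2 l1
  have m3 : 3 * m ∈ intR F := t (ofNat_mem _ 3) hm
  refine ⟨?_, ?_, ?_⟩
  · refine mem_latticeSpan_of (c 2) (c 0) (c (-1)) (c 0) ?_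
    ext <;> simp [triBasis]
  · intro i j
    fin_cases i <;> fin_cases j
    map_tacs [
      refine mem_latticeSpan_of (c (-1)) (c 0) (c 1) (c 0) ?_;
      refine mem_latticeSpan_of (c 0) (c (-1)) (n l1) (c 3) ?_;
      refine mem_latticeSpan_of (c (-3)) (c 0) (c 2) (c 0) ?_;
      refine mem_latticeSpan_of (n l1) (c (-1)) (c 0) (c 2) ?_;
      refine mem_latticeSpan_of (c 0) (c 2) l1 (c (-3)) ?_;
      refine mem_latticeSpan_of (sub_mem (s2 ll) (t (ofNat_mem _ 6) hm)) (c 0) (sub_mem m3 ll) (c 0) ?_;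
      refine mem_latticeSpan_of (c 0) (c 3) l2 (c (-6)) ?_;
      refine mem_latticeSpan_of (sub_mem ll m3) l1 (s2 hm) (n l2) ?_;
      refine mem_latticeSpan_of (c (-3)) (c 0) (c 2) (c 0) ?_;
      refine mem_latticeSpan_of (c 0) (c (-3)) (n l2) (c 6) ?_;
      refine mem_latticeSpan_of (c (-6)) (c 0) (c 3) (c 0) ?_;
      refine mem_latticeSpan_of (n l2) (c (-2)) (c 0) (c 3) ?_;
      refine mem_latticeSpan_of (n l1) (c 1) l1 (c (-1)) ?_;
      refine mem_latticeSpan_of (sub_mem ll m3) (n l1) (sub_mem hm ll) l2 ?_;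
      refine mem_latticeSpan_of (n l2) (c 2) l2 (c (-3)) ?_;
      refine mem_latticeSpan_of (n (s2 hm)) (c 0) hm (c 0) ?_]
    all_goals ext <;> simp [triBasis, e] <;> ring
  · intro y
    refine ⟨![2 * y.re, 2 * y.imJ, (y.imI - y.re) - l * (y.imK - y.imJ), 3 * (y.imK - y.imJ)], ?_⟩
    rw [Fin.sum_univ_four]
    ext <;> simp [triBasis] <;> ring

/-- A maximal order of `ℍ[F,-3,-δ]` containing a cube root of unity and `j`. -/
def triOrder : Subring ℍ[F,-3,-δ] := T.isOrderBasis.order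

lemma mem_triOrder {y : ℍ[F,-3,-δ]} : y ∈ triOrder T ↔ 2 * y.re ∈ intR F ∧ 2 * y.imJ ∈ intR F ∧
    (y.imI - y.re) - l * (y.imK - y.imJ) ∈ intR F ∧ 3 * (y.imK - y.imJ) ∈ intR F := by
  constructor
  · rintro ⟨c, rfl⟩
    rw [Fin.sum_univ_four]
    refine ⟨?_, ?_, ?_, ?_⟩
    · convert (c 0).2 using 1; simp [triBasis]; ring
    · convert (c 1).2 using 1; simp [triBasis]; ring
    · convert (c 2).2 using 1; simp [triBasis]; ring
    · convert (c 3).2 using 1; simp [triBasis]; ring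
  · rintro ⟨h0, h1, h2, h3⟩
    refine mem_latticeSpan_of h0 h1 h2 h3 ?_
    ext <;> simp [triBasis] <;> ring

include h in
lemma triOrder_isOrder : IsOrder F (triOrder T) := T.isOrderBasis.isOrder h

lemma omega_mem_triOrder : (⟨-1 / 2, 1 / 2, 0, 0⟩ : ℍ[F,-3,-δ]) ∈ triOrder T := by
  rw [mem_triOrder]
  refine ⟨?_, ?_, ?_, ?_⟩ <;> norm_num

lemma j_mem_triOrder : (⟨0, 0, 1, 0⟩ : ℍ[F,-3,-δ]) ∈ triOrder T := by
  rw [mem_triOrder]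
  have := T.param_mem
  refine ⟨?_, ?_, ?_, ?_⟩ <;> simp [this, ofNat_mem]

lemma z_mem_triOrder : (⟨0, l / 3, 0, 1 / 3⟩ : ℍ[F,-3,-δ]) ∈ triOrder T := T.isOrderBasis.basis_mem 3

section Containing

variable {S : Subring ℍ[F,-3,-δ]} (hS : IsOrder F S) (hω : (⟨-1 / 2, 1 / 2, 0, 0⟩ : ℍ[F,-3,-δ]) ∈ S)
  (hj : (⟨0, 0, 1, 0⟩ : ℍ[F,-3,-δ]) ∈ S)

include hS hω hj

lemma tri_coords_mem (hd : δ⁻¹ ∈ intR F) (hd0 : δ ≠ 0) {y : ℍ[F,-3,-δ]} (hy : y ∈ S) :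
    2 * y.re ∈ intR F ∧ 2 * y.imJ ∈ intR F ∧ 3 * (y.imI - y.re) ∈ intR F ∧ 3 * (y.imK - y.imJ) ∈ intR F := by
  have h0 := hS.tr_mem hy
  have h1 := hS.tr_mem (S.mul_mem hy hω)
  have h2 := hS.tr_mem (S.mul_mem hy hj)
  have h3 := hS.tr_mem (S.mul_mem (S.mul_mem hy hj) hω)
  have h2' := mul_mem hd h2
  have h3' := mul_mem hd h3
  simp only [QuaternionAlgebra.re_mul, QuaternionAlgebra.imI_mul, QuaternionAlgebra.imJ_mul,
    QuaternionAlgebra.imK_mul] at h0 h1 h2 h3 h2' h3'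
  refine ⟨h0, ?_, ?_, ?_⟩
  · convert neg_mem h2' using 1
    field_simp; ring
  · convert neg_mem (add_mem h1 (add_mem h0 h0)) using 1
    ring
  · convert add_mem h3' (add_mem h2' h2') using 1
    field_simp; ring

lemma tri_norm_mem (hd : δ ∈ intR F) (hd' : δ⁻¹ ∈ intR F) (hd0 : δ ≠ 0) {y : ℍ[F,-3,-δ]} (hy : y ∈ S) :
    ((3 * (y.imI - y.re)) ^ 2 + δ * (3 * (y.imK - y.imJ)) ^ 2) / 3 ∈ intR F := by
  obtain ⟨h0, h1, h2, h3⟩ := tri_coords_mem hS hω hj hd' hd0 hy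
  have hn := hS.nrd_mem hy
  convert sub_mem (sub_mem hn (add_mem (mul_mem h0 h0) (mul_mem hd (mul_mem h1 h1))))
    (add_mem (mul_mem h0 h2) (mul_mem hd (mul_mem h1 h3))) using 1
  simp only [nrd]; ring

lemma le_triOrder (T : TriData δ l) (hz : (⟨0, l / 3, 0, 1 / 3⟩ : ℍ[F,-3,-δ]) ∈ S) : S ≤ triOrder T := by
  intro y hy
  obtain ⟨h0, h1, h2, h3⟩ := tri_coords_mem hS hω hj T.inv_mem T.ne_zero hy
  have ht := hS.tr_mem (S.mul_mem hy hz)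
  have hl := T.param_mem
  have hd := T.div_mem
  have hd0 := T.ne_zero
  rw [mem_triOrder]
  refine ⟨h0, h1, ?_, h3⟩
  have h4 : -(2 * ((y.imI - y.re) * l + δ * (y.imK - y.imJ))) ∈ intR F := by
    convert add_mem ht (add_mem (mul_mem hl h0) (mul_mem T.unit_mem h1)) using 1
    simp only [QuaternionAlgebra.re_mul]; field_simp; ring
  have h5 : 2 * ((y.imI - y.re) - l * (y.imK - y.imJ)) ∈ intR F := by
    convert mul_mem T.inv_mem (add_mem (mul_mem hl h4) (mul_mem (mul_mem (ofNat_mem _ 2) hd) h2)) using 1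
    field_simp; ring
  convert sub_mem (sub_mem h2 (mul_mem hl h3)) h5 using 1
  ring

end Containing

include h in
lemma triOrder_isMaximalOrder : IsMaximalOrder F (triOrder T) :=
  ⟨triOrder_isOrder h T, fun _ hO hle => le_antisymm
    (le_triOrder hO (hle (omega_mem_triOrder T)) (hle (j_mem_triOrder T)) T (hle (z_mem_triOrder T))) hle⟩

end TriangularOrder

section TypeTwo

variable {F} {p : ℕ} {θ s ε : F} (h : IsSqrtGen F p θ) (D : DyadicData θ s ε) {a b : F} {O : Subring ℍ[F,a,b]}
  (hO : IsMaximalOrder F O)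

include h hO in
lemma isEvenType_of_isI_isI {i g : ℍ[F,a,b]} (hi : i ∈ O) (hg : g ∈ O) (Ii : IsI i) (Ig : IsI g)
    (ht : (i * g).re = 0) : IsEvenType D O := by
  have hc : i * g = -(g * i) := by
    have := star_eq_sub (i * g)
    rw [star_mul, Ii.star, Ig.star, ht] at this
    simp at this
    grind
  exact isEvenType_of_anti h D hO ⟨by rw [Ii.mul_self]; simp, by rw [Ig.mul_self]; simp, hc⟩ hi hg

end TypeTwo

section TriangularClassification

variable {F} {p : ℕ} {θ s ε δ l c : F} (h : IsSqrtGen F p θ) (D : DyadicData θ s ε)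

lemma TriData.neg (T : TriData δ l) : TriData δ (-l) where
  unit_mem := T.unit_mem
  inv_mem := T.inv_mem
  ne_zero := T.ne_zero
  pos := T.pos
  param_mem := neg_mem T.param_mem
  div_mem := by rw [neg_sq]; exact T.div_mem

include D in
lemma DyadicData.triData : TriData ε s where
  unit_mem := D.eps_mem
  inv_mem := D.inv_mem
  ne_zero := D.eps_ne
  pos := D.pos
  param_mem := D.s_mem
  div_mem := by
    rw [D.sq]
    convert D.eps_mem using 1
    ring

include h in
lemma IsSqrtGen.triData (hp : p % 3 = 2) : TriData 1 θ where
  unit_mem := one_mem _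
  inv_mem := by simp
  ne_zero := one_ne_zero
  pos := by simp
  param_mem := h.theta_mem
  div_mem := by
    rw [h.sq]
    have : p + 1 = 3 * ((p + 1) / 3) := by omega
    have := congrArg (Nat.cast : ℕ → F) this
    push_cast at this
    rw [this]
    convert natCast_mem (intR F) ((p + 1) / 3) using 1
    grind

include h D in
lemma DyadicData.triData_theta (hp : p % 3 = 1) : TriData ε (θ * s) where
  unit_mem := D.eps_mem
  inv_mem := D.inv_mem
  ne_zero := D.eps_ne
  pos := D.pos
  param_mem := mul_mem h.theta_mem D.s_mem
  div_mem := by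
    have : 2 * p + 1 = 3 * ((2 * p + 1) / 3) := by omega
    have := congrArg (Nat.cast : ℕ → F) this
    push_cast at this
    convert mul_mem D.eps_mem (natCast_mem (intR F) ((2 * p + 1) / 3)) using 1
    rw [mul_pow, h.sq, D.sq]
    grind

/-- The annihilator of `c` modulo three is a prime ideal. -/
def IsThreePrime (c : F) : Prop :=
  c ∈ intR F ∧ ∀ x ∈ intR F, ∀ y ∈ intR F, x * y * c / 3 ∈ intR F → x * c / 3 ∈ intR F ∨ y * c / 3 ∈ intR F

lemma three_dvd_iff (m : ℤ) : 3 ∣ m ↔ (m : ZMod 3) = 0 := (ZMod.intCast_zmod_eq_zero_iff_dvd m 3).symm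

include h in
lemma isThreePrime_one (hp : p % 3 = 2) : IsThreePrime (1 : F) := by
  refine ⟨one_mem _, fun x hx y hy hxy => ?_⟩
  obtain ⟨m, n, rfl⟩ := h.mem_intR.mp hx
  obtain ⟨k, l, rfl⟩ := h.mem_intR.mp hy
  have key := fun m n => h.int_div_mem (N := 3) (by norm_num) (m := m) (n := n)
  simp only [mul_one, Int.cast_ofNat] at key hxy ⊢
  rw [key, key]
  have := (key (m * k + n * l * p) (m * l + n * k)).mp (by
    convert hxy using 2; push_cast; linear_combination (-n * l : F) * h.sq)
  have hp' : (p : ZMod 3) = 2 := by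
    rw [← ZMod.natCast_mod, hp]; rfl
  simp only [three_dvd_iff, Int.cast_add, Int.cast_mul, Int.cast_natCast, hp'] at this ⊢
  generalize (m : ZMod 3) = m, (n : ZMod 3) = n, (k : ZMod 3) = k, (l : ZMod 3) = l at this ⊢
  revert m n k l
  decide

include h in
lemma isThreePrime_theta (hp : p % 3 = 1) {e : ℤ} (he : e = 1 ∨ e = -1) : IsThreePrime (θ + e : F) := by
  refine ⟨add_mem h.theta_mem (intCast_mem _ _), fun x hx y hy hxy => ?_⟩
  obtain ⟨m, n, rfl⟩ := h.mem_intR.mp hx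
  obtain ⟨k, l, rfl⟩ := h.mem_intR.mp hy
  have key := fun m n => h.int_div_mem (N := 3) (by norm_num) (m := m) (n := n)
  have key' : ∀ m n : ℤ, ((m + n * θ) * (θ + e) / 3 : F) ∈ intR F ↔ 3 ∣ m * e + n * p ∧ 3 ∣ m + n * e := by
    intro m n
    rw [← key]
    have : ((m + n * θ) * (θ + e) : F) = ((m * e + n * p : ℤ) : F) + ((m + n * e : ℤ) : F) * θ := by
      push_cast; linear_combination (n : F) * h.sq
    grind
  have e1 : ((m + n * θ) * (k + l * θ) : F) = ((m * k + n * l * p : ℤ) : F) + ((m * l + n * k : ℤ) : F) * θ := by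
    push_cast; linear_combination (n * l : F) * h.sq
  rw [e1, key'] at hxy
  rw [key', key']
  have hp' : (p : ZMod 3) = 1 := by
    rw [← ZMod.natCast_mod, hp]; rfl
  have he' : (e : ZMod 3) = 1 ∨ (e : ZMod 3) = -1 := by
    rcases he with rfl | rfl <;> simp
  simp only [three_dvd_iff, Int.cast_add, Int.cast_mul, Int.cast_natCast, hp'] at hxy ⊢
  generalize (m : ZMod 3) = m, (n : ZMod 3) = n, (k : ZMod 3) = k, (l : ZMod 3) = l, (e : ZMod 3) = e at hxy he' ⊢
  grind

section

variable {S : Subring ℍ[F,-3,-δ]} (hS : IsOrder F S) (hω : (⟨-1 / 2, 1 / 2, 0, 0⟩ : ℍ[F,-3,-δ]) ∈ S)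
  (hj : (⟨0, 0, 1, 0⟩ : ℍ[F,-3,-δ]) ∈ S)

include hS hω hj

lemma tri_dichotomy (T : TriData δ l) (hc : IsThreePrime c) :
    (∀ y ∈ S, c * ((y.imI - y.re) - l * (y.imK - y.imJ)) ∈ intR F) ∨
      ∀ y ∈ S, c * ((y.imI - y.re) - -l * (y.imK - y.imJ)) ∈ intR F := by
  have key : ∀ y ∈ S, c * ((y.imI - y.re) - l * (y.imK - y.imJ)) ∈ intR F ∨
      c * ((y.imI - y.re) - -l * (y.imK - y.imJ)) ∈ intR F := by
    intro y hy
    obtain ⟨-, -, h2, h3⟩ := tri_coords_mem hS hω hj T.inv_mem T.ne_zero hy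
    have hn := tri_norm_mem hS hω hj T.unit_mem T.inv_mem T.ne_zero hy
    have hl := mul_mem T.param_mem h3
    convert hc.2 _ (sub_mem h2 hl) _ (add_mem h2 hl) ?_ using 2
    · ring
    · ring
    · convert mul_mem hc.1 (sub_mem hn (mul_mem T.div_mem (mul_mem h3 h3))) using 1
      ring
  by_contra! hcon
  obtain ⟨⟨x, hx, hx'⟩, y, hy, hy'⟩ := hcon
  have h1 := (key x hx).resolve_left hx'
  have h2 := (key y hy).resolve_right hy'
  rcases key _ (S.add_mem hx hy) with h3 | h3
  · refine hx' ?_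
    convert sub_mem h3 h2 using 1
    simp; ring
  · refine hy' ?_
    convert sub_mem h3 h1 using 1
    simp; ring

lemma le_triOrder_of_forall (T : TriData δ l) (hc : ∀ y ∈ S, 2 * ((y.imI - y.re) - l * (y.imK - y.imJ)) ∈ intR F) :
    S ≤ triOrder T := by
  intro y hy
  obtain ⟨h0, h1, h2, h3⟩ := tri_coords_mem hS hω hj T.inv_mem T.ne_zero hy
  refine (mem_triOrder T).mpr ⟨h0, h1, ?_, h3⟩
  convert sub_mem (sub_mem h2 (mul_mem T.param_mem h3)) (hc y hy) using 1
  ring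

include h in
lemma tri_le_of_two (hp : p % 3 = 2) (T : TriData δ l) : S ≤ triOrder T ∨ S ≤ triOrder T.neg := by
  rcases tri_dichotomy hS hω hj T (isThreePrime_one h hp) with hc | hc
  · exact .inl (le_triOrder_of_forall hS hω hj T fun y hy => mul_mem (ofNat_mem _ 2) (by simpa using hc y hy))
  · exact .inr (le_triOrder_of_forall hS hω hj T.neg fun y hy =>
      mul_mem (ofNat_mem _ 2) (by rw [← one_mul (_ - _)]; exact hc y hy))

end

include h in
lemma tri_le_of_one (hp : p % 3 = 1) {S : Subring ℍ[F,-3,-ε]} (hS : IsOrder F S)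
    (hω : (⟨-1 / 2, 1 / 2, 0, 0⟩ : ℍ[F,-3,-ε]) ∈ S) (hj : (⟨0, 0, 1, 0⟩ : ℍ[F,-3,-ε]) ∈ S) :
    (S ≤ triOrder D.triData ∨ S ≤ triOrder D.triData.neg) ∨
      S ≤ triOrder (D.triData_theta h hp) ∨ S ≤ triOrder (D.triData_theta h hp).neg := by
  have key := tri_dichotomy hS hω hj D.triData (isThreePrime_theta h hp (.inl rfl))
  have key' := tri_dichotomy hS hω hj D.triData (isThreePrime_theta h hp (.inr rfl))
  rcases key with k1 | k1 <;> rcases key' with k2 | k2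
  · refine .inl (.inl (le_triOrder_of_forall hS hω hj _ fun y hy => ?_))
    convert sub_mem (k1 y hy) (k2 y hy) using 1
    push_cast; ring
  · refine .inr (.inl (le_triOrder_of_forall hS hω hj _ fun y hy => ?_))
    convert sub_mem (k1 y hy) (k2 y hy) using 1
    push_cast; ring
  · refine .inr (.inr (le_triOrder_of_forall hS hω hj _ fun y hy => ?_))
    convert sub_mem (k1 y hy) (k2 y hy) using 1
    push_cast; ring
  · refine .inl (.inr (le_triOrder_of_forall hS hω hj _ fun y hy => ?_))
    convert sub_mem (k1 y hy) (k2 y hy) using 1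
    push_cast; ring

end TriangularClassification

section TypeThree

variable {F} {p : ℕ} {θ s ε δ l : F} (h : IsSqrtGen F p θ) (D : DyadicData θ s ε)

include h in
lemma corr_triOrder_neg (T : TriData δ l) : Corr F (triOrder T.neg) (triOrder T) := by
  obtain ⟨σ⟩ := h.exists_real
  have hA : Anti (-3 : F) (-δ) (⟨0, 1, 0, 0⟩ : ℍ[F,-3,-δ]) ⟨0, 0, -1, 0⟩ := by
    refine ⟨?_, ?_, ?_⟩ <;> (try rw [algebraMap_quat]) <;> ext <;> simp
  obtain ⟨S, hS, hm⟩ := exists_corr_of_anti (σ := σ) (by rw [map_neg, map_ofNat]; norm_num) (by simp [T.pos σ]) hA (triOrder T)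
  convert hS
  ext y
  rw [hm, mem_triOrder, mem_triOrder, hA.hom_apply, algebraMap_quat]
  simp only [QuaternionAlgebra.re_add, QuaternionAlgebra.imI_add, QuaternionAlgebra.imJ_add,
    QuaternionAlgebra.imK_add, QuaternionAlgebra.re_smul, QuaternionAlgebra.imI_smul, QuaternionAlgebra.imJ_smul,
    QuaternionAlgebra.imK_smul, QuaternionAlgebra.re_mul, QuaternionAlgebra.imI_mul, QuaternionAlgebra.imJ_mul,
    QuaternionAlgebra.imK_mul, smul_eq_mul]
  have n : ∀ x : F, -x ∈ intR F ↔ x ∈ intR F := fun x => neg_mem_iff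
  rw [← n (2 * y.imJ), ← n (3 * (y.imK - y.imJ))]
  ring_nf

include h in
lemma corr_octOrder_triOrder : Corr F (octOrder D) (triOrder D.triData) := by
  have hs := D.s_ne
  have t := D.two_div_s_mem
  refine corr_octOrder_of_isI_isOmega h D (triOrder_isMaximalOrder h _) (i := ⟨0, 1 / 3, 1 / s, 1 / (3 * s)⟩)
    ?_ (omega_mem_triOrder _) ?_ ?_ ?_
  · rw [mem_triOrder]
    refine ⟨by simp, by simpa [div_eq_mul_inv] using t, ?_, ?_⟩
    · convert one_mem (intR F) using 1
      field_simp; ring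
    · convert neg_mem t using 1
      field_simp; ring
  · refine ⟨rfl, ?_⟩
    simp only [nrd]
    field_simp
    linear_combination (-2 : F) * D.sq
  · refine ⟨?_, ?_⟩ <;> simp [nrd] <;> norm_num
  · simp

/-- Parameters of the maximal order whose reduced unit group is dihedral of order six. -/
def SixParam (p : ℕ) (θ s ε δ l : F) : Prop := (p % 3 = 2 ∧ δ = 1 ∧ l = θ) ∨ (p % 3 = 1 ∧ δ = ε ∧ l = θ * s)

include h D in
lemma SixParam.triData (hP : SixParam p θ s ε δ l) : TriData δ l := by
  rcases hP with ⟨hp, rfl, rfl⟩ | ⟨hp, rfl, rfl⟩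
  · exact h.triData hp
  · exact D.triData_theta h hp

omit [NumberField F] in
lemma SixParam.unique (hP : SixParam p θ s ε δ l) {δ' l' : F} (hP' : SixParam p θ s ε δ' l') : δ = δ' ∧ l = l' := by
  rcases hP with ⟨hp, rfl, rfl⟩ | ⟨hp, rfl, rfl⟩ <;> rcases hP' with ⟨hp', rfl, rfl⟩ | ⟨hp', rfl, rfl⟩
  · simp
  · omega
  · omega
  · simp

include h in
lemma IsSqrtGen.mod_three : p % 3 = 2 ∨ p % 3 = 1 := by
  have : ¬ 3 ∣ p := fun hd => by
    have := (Nat.prime_dvd_prime_iff_eq Nat.prime_three h.prime).mp hd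
    have := h.gt
    omega
  omega

/-- The order corresponds to the standard maximal order with dihedral reduced unit group of order six. -/
def IsSixType {a b : F} (p : ℕ) (θ s ε : F) (O : Subring ℍ[F,a,b]) : Prop :=
  ∃ δ l, SixParam p θ s ε δ l ∧ ∃ T : TriData δ l, Corr F (triOrder T) O

variable {a b : F} {O : Subring ℍ[F,a,b]} (hO : IsMaximalOrder F O) {ω g : ℍ[F,a,b]}

omit [NumberField F] in
lemma anti_of_isOmega (Iω : IsOmega ω) (hg : g.re = 0) (hn : nrd g = δ) (ht : (ω * g).re = 0) :
    Anti (-3) (-δ) (ω + ω + 1) g := by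
  have hgs : star g = -g := by rw [star_eq_sub, hg]; simp
  have hc : g * ω = -g - ω * g := by
    have := star_eq_sub (ω * g)
    rw [star_mul, hgs, Iω.star, ht, mul_zero, map_zero] at this
    linear_combination (norm := noncomm_ring) this
  refine ⟨?_, ?_, ?_⟩
  · have : (ω + ω + 1) * (ω + ω + 1) = 4 * (ω * ω) + 4 * ω + 1 := by noncomm_ring
    rw [this, Iω.mul_self, map_neg, map_ofNat, show (3 : ℍ[F,a,b]) = 1 + 1 + 1 by norm_num,
      show (4 : ℍ[F,a,b]) = 1 + 1 + 1 + 1 by norm_num]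
    noncomm_ring
  · rw [mul_self_eq, hg, hn]; simp
  · have : g * (ω + ω + 1) = g * ω + g * ω + g := by noncomm_ring
    rw [this, hc]; noncomm_ring

include h hO in
lemma exists_tri_corr (hω : ω ∈ O) (hg : g ∈ O) (Iω : IsOmega ω) (hgr : g.re = 0) (hn : nrd g = δ)
    (ht : (ω * g).re = 0) (hδ : ∀ σ : F →+* ℝ, 0 < σ δ) : ∃ S : Subring ℍ[F,-3,-δ], Corr F S O ∧ IsMaximalOrder F S ∧
      ⟨-1 / 2, 1 / 2, 0, 0⟩ ∈ S ∧ ⟨0, 0, 1, 0⟩ ∈ S := by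
  obtain ⟨σ⟩ := h.exists_real
  have hA := anti_of_isOmega Iω hgr hn ht
  obtain ⟨S, hS, hm⟩ := exists_corr_of_anti (σ := σ) (by rw [map_neg, map_ofNat]; norm_num) (by simp [hδ σ]) hA O
  refine ⟨S, hS, hO.of_corr hS, ?_, ?_⟩
  · rw [hm, hA.hom_apply]
    convert hω using 1
    ext <;> simp <;> ring
  · rw [hm, hA.hom_apply]
    simpa using hg

include h in
lemma corr_triOrder_of_le {S : Subring ℍ[F,-3,-δ]} (hS : IsMaximalOrder F S) (hSO : Corr F S O) (T : TriData δ l)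
    (hle : S ≤ triOrder T ∨ S ≤ triOrder T.neg) : Corr F (triOrder T) O := by
  rcases hle with hle | hle
  · rwa [hS.2 _ (triOrder_isOrder h _) hle]
  · refine (corr_triOrder_neg h T).symm.trans ?_
    rwa [hS.2 _ (triOrder_isOrder h _) hle]

include h hO in
lemma corr_of_isOmega (hA : p % 3 = 1 → ∀ X Y : ℍ[F,a,b], ¬ Anti (-3 : F) (-1) X Y)
    (hω : ω ∈ O) (hg : g ∈ O) (Iω : IsOmega ω) (Ig : IsI g ∨ IsW ε g)
    (ht : (ω * g).re = 0) : Corr F (octOrder D) O ∨ IsSixType p θ s ε O := by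
  rcases Ig with Ig | Ig
  · rcases h.mod_three with hp | hp
    · obtain ⟨S, hS, hSm, hω', hj'⟩ := exists_tri_corr h hO hω hg Iω Ig.1 Ig.2 ht (by simp)
      exact .inr ⟨1, θ, .inl ⟨hp, rfl, rfl⟩, h.triData hp,
        corr_triOrder_of_le h hSm hS _ (tri_le_of_two h hSm.1 hω' hj' hp (h.triData hp))⟩
    · exact absurd (anti_of_isOmega Iω Ig.1 Ig.2 ht) (hA hp _ _)
  · obtain ⟨S, hS, hSm, hω', hj'⟩ := exists_tri_corr h hO hω hg Iω Ig.1 Ig.2 ht D.pos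
    have oct := fun hle => (corr_octOrder_triOrder h D).trans (corr_triOrder_of_le h hSm hS D.triData hle)
    rcases h.mod_three with hp | hp
    · exact .inl (oct (tri_le_of_two h hSm.1 hω' hj' hp D.triData))
    · rcases tri_le_of_one h D hp hSm.1 hω' hj' with hle | hle
      · exact .inl (oct hle)
      · exact .inr ⟨ε, θ * s, .inr ⟨hp, rfl, rfl⟩, D.triData_theta h hp, corr_triOrder_of_le h hSm hS _ hle⟩

end TypeThree

section SumOfTwoSquares

lemma padic_three_sq_add_sq_ne (x y : ℚ_[3]) : x ^ 2 + y ^ 2 ≠ 3 := by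
  suffices H : ∀ x y : ℚ_[3], ‖y‖ ≤ ‖x‖ → x ^ 2 + y ^ 2 ≠ 3 by
    rcases le_total ‖y‖ ‖x‖ with hxy | hxy
    · exact H x y hxy
    · grind
  intro x y hxy e
  have hx : x ≠ 0 := by
    rintro rfl
    rw [norm_zero, norm_le_zero_iff] at hxy
    grind
  have ht : ‖y / x‖ ≤ 1 := by
    rw [norm_div]
    exact div_le_one_of_le₀ hxy (norm_nonneg _)
  obtain ⟨t, rfl⟩ : ∃ t : ℤ_[3], y = t * x := ⟨⟨_, ht⟩, by field_simp⟩
  have hu : IsUnit (1 + t ^ 2) := by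
    by_contra hn
    have : (1 + t ^ 2) ∈ IsLocalRing.maximalIdeal ℤ_[3] := (IsLocalRing.mem_maximalIdeal _).mpr hn
    rw [← PadicInt.ker_toZMod, RingHom.mem_ker, map_add, map_pow, map_one] at this
    revert this
    generalize PadicInt.toZMod t = a
    revert a
    decide
  have hn := PadicInt.isUnit_iff.mp hu
  have e' : x ^ 2 * ((1 + t ^ 2 : ℤ_[3]) : ℚ_[3]) = 3 := by
    push_cast
    grind
  have h3 : ‖(3 : ℚ_[3])‖ = (3 : ℝ)⁻¹ := by simpa using Padic.norm_p (p := 3)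
  have := congrArg norm e'
  rw [norm_mul, norm_pow, ← PadicInt.norm_def, hn, h3, mul_one, Padic.norm_eq_zpow_neg_valuation hx,
    ← zpow_natCast, ← zpow_mul, ← zpow_neg_one] at this
  have := zpow_right_injective₀ (by norm_num) (by norm_num) this
  omega

variable {F} {p : ℕ} {θ s ε δ l : F} (h : IsSqrtGen F p θ) (D : DyadicData θ s ε)

include h

lemma sq_add_sq_ne_three (hp : p % 3 = 1) (x y : F) : x ^ 2 + y ^ 2 ≠ 3 := by
  have hp' : (p : ZMod 3) = 1 := by
    rw [← ZMod.natCast_mod, hp]; rfl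
  obtain ⟨r, hr⟩ := exists_padic_sqrt (l := 3) (n := p) (by norm_num) (by rw [hp']; decide)
    (by rw [hp']; exact IsSquare.one)
  intro e
  apply padic_three_sq_add_sq_ne (h.lift r hr x) (h.lift r hr y)
  rw [← map_pow, ← map_pow, ← map_add, e, map_ofNat]

lemma not_anti_three (hp : p % 3 = 1) (X Y : ℍ[F,-1,-1]) : ¬ Anti (-3 : F) (-1) X Y := by
  rintro ⟨hX, hY, hXY⟩
  obtain ⟨σ⟩ := h.exists_real
  have pure : ∀ {Z : ℍ[F,-1,-1]} {n : F}, 0 < σ n → Z * Z = algebraMap F _ (-n) →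
      Z.re = 0 ∧ Z.imI ^ 2 + Z.imJ ^ 2 + Z.imK ^ 2 = n := by
    intro Z n hn hZ
    rw [algebraMap_quat] at hZ
    have h0 := congrArg QuaternionAlgebra.re hZ
    have h1 := congrArg QuaternionAlgebra.imI hZ
    have h2 := congrArg QuaternionAlgebra.imJ hZ
    have h3 := congrArg QuaternionAlgebra.imK hZ
    simp at h0 h1 h2 h3
    have hr : Z.re = 0 := by
      by_contra hr
      have e1 : Z.imI = 0 := by grind
      have e2 : Z.imJ = 0 := by grind
      have e3 : Z.imK = 0 := by grind
      rw [e1, e2, e3] at h0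
      have := congrArg σ h0
      simp at this
      nlinarith [mul_self_nonneg (σ Z.re)]
    refine ⟨hr, ?_⟩
    grind
  obtain ⟨hX0, hXn⟩ := pure (by rw [map_ofNat]; norm_num) hX
  obtain ⟨hY0, hYn⟩ := pure (by rw [map_one]; norm_num) hY
  have hd := congrArg QuaternionAlgebra.re hXY
  simp [hX0, hY0] at hd
  have hd' : X.imI * Y.imI + X.imJ * Y.imJ + X.imK * Y.imK = 0 := by grind
  by_cases hg : 1 + Y.imI = 0
  · have e0 : Y.imI = -1 := by linear_combination hg
    have e := congrArg σ hYn
    rw [e0] at e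
    simp at e
    have e1 : Y.imJ = 0 := (map_eq_zero σ).mp (by nlinarith [sq_nonneg (σ Y.imJ), sq_nonneg (σ Y.imK)])
    have e2 : Y.imK = 0 := (map_eq_zero σ).mp (by nlinarith [sq_nonneg (σ Y.imJ), sq_nonneg (σ Y.imK)])
    rw [e0, e1, e2] at hd'
    have e3 : X.imI = 0 := by linear_combination -hd'
    rw [e3] at hXn
    exact sq_add_sq_ne_three h hp X.imJ X.imK (by linear_combination hXn)
  · apply sq_add_sq_ne_three h hp (X.imJ - X.imI * Y.imJ / (1 + Y.imI)) (X.imK - X.imI * Y.imK / (1 + Y.imI))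
    grind

lemma exists_sq_add_sq_eq_three (hp : p % 3 = 2) : ∃ x y : F, x ^ 2 + y ^ 2 = 3 := by
  have : Fact p.Prime := ⟨h.prime⟩
  have h5 := h.gt
  have hsq : IsSquare ((3 : ℕ) : ZMod p) := by
    rw [ZMod.exists_sq_eq_prime_iff_of_mod_four_eq_three h.mod (by norm_num) (by omega)]
    have hp' : (p : ZMod 3) = 2 := by
      rw [← ZMod.natCast_mod, hp]; rfl
    rw [hp']
    decide
  obtain ⟨r, hr⟩ := hsq
  obtain ⟨r, rfl⟩ := ZMod.intCast_surjective r
  have hp0 : (0 : ℝ) < p := mod_cast h.prime.pos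
  obtain ⟨j, k, hk, hkn, hjk⟩ := Real.exists_int_int_abs_mul_sub_le ((r : ℝ) / p) (n := Nat.sqrt p)
    (Nat.sqrt_pos.mpr h.prime.pos)
  have hx : (k * r - j * p) ^ 2 < (p : ℤ) := by
    have h1 : |(k * r - j * p : ℝ)| * (Nat.sqrt p + 1) ≤ p := by
      have : (k * r - j * p : ℝ) = (k * (r / p) - j) * p := by field_simp
      rw [this, abs_mul, abs_of_pos hp0]
      rw [le_div_iff₀ (by positivity)] at hjk
      nlinarith
    have h2 : (p : ℝ) < (Nat.sqrt p + 1) ^ 2 := by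
      have := Nat.lt_succ_sqrt p
      rw [← sq] at this
      exact_mod_cast this
    have h3 : (k * r - j * p : ℝ) ^ 2 < p := by
      by_contra! hcon
      have h4 : (|(k * r - j * p : ℝ)| * (Nat.sqrt p + 1)) ^ 2 ≤ p ^ 2 := pow_le_pow_left₀ (by positivity) h1 2
      rw [mul_pow, sq_abs] at h4
      nlinarith
    exact_mod_cast h3
  have hz : k ^ 2 ≤ (p : ℤ) := by
    have := Nat.sqrt_le' p
    have : ((Nat.sqrt p : ℕ) : ℤ) ^ 2 ≤ p := mod_cast this
    nlinarith
  obtain ⟨q, hq⟩ : (p : ℤ) ∣ (k * r - j * p) ^ 2 - 3 * k ^ 2 := by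
    rw [← ZMod.intCast_zmod_eq_zero_iff_dvd]
    push_cast at hr ⊢
    simp only [CharP.cast_eq_zero]
    grind
  generalize k * r - j * p = x at hx hq
  have hp1 : (0 : ℤ) < p := by grind
  have hk0 : 0 < k ^ 2 := by positivity
  have hq1 : q < 1 := by nlinarith
  have hq3 : -3 ≤ q := by nlinarith [sq_nonneg x]
  have hp4 : (p : ℤ) % 4 = 3 := mod_cast h.mod
  have m8 : x ^ 2 % 8 = 0 ∨ x ^ 2 % 8 = 1 ∨ x ^ 2 % 8 = 4 := by
    have : x % 8 = 0 ∨ x % 8 = 1 ∨ x % 8 = 2 ∨ x % 8 = 3 ∨ x % 8 = 4 ∨ x % 8 = 5 ∨ x % 8 = 6 ∨ x % 8 = 7 := by omega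
    rcases this with e | e | e | e | e | e | e | e <;> simp [pow_two, Int.mul_emod, e]
  have k8 : k ^ 2 % 8 = 0 ∨ k ^ 2 % 8 = 1 ∨ k ^ 2 % 8 = 4 := by
    have : k % 8 = 0 ∨ k % 8 = 1 ∨ k % 8 = 2 ∨ k % 8 = 3 ∨ k % 8 = 4 ∨ k % 8 = 5 ∨ k % 8 = 6 ∨ k % 8 = 7 := by omega
    rcases this with e | e | e | e | e | e | e | e <;> simp [pow_two, Int.mul_emod, e]
  have hk' : (k : F) ≠ 0 := mod_cast hk.ne'
  interval_cases q
  · grind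
  · omega
  · refine ⟨θ / k, x / k, ?_⟩
    have := congrArg (Int.cast : ℤ → F) hq
    push_cast at this
    field_simp
    rw [h.sq]
    grind
  · refine absurd ?_ (h.three_ne_sq (x / k))
    have := congrArg (Int.cast : ℤ → F) hq
    push_cast at this
    grind

end SumOfTwoSquares

section Types

variable {F} {p : ℕ} {θ s ε : F} (h : IsSqrtGen F p θ) (D : DyadicData θ s ε)

include h in
lemma order_cases {O : Subring ℍ[F,-1,-1]} (hO : IsMaximalOrder F O) :
    (∃ m : ℕ, 0 < m ∧ m ≤ 4 ∧ RedUnitIso F O (Multiplicative (ZMod m))) ∨ IsEvenType D O ∨ IsSixType p θ s ε O := by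
  by_cases hcomm : ∀ x ∈ O, ∀ y ∈ O, (IsI x ∨ IsOmega x ∨ IsW ε x) → (IsI y ∨ IsOmega y ∨ IsW ε y) → Commute x y
  · exact .inl (exists_cyclic_of_commute h D hab_hamilton hO.1 hcomm)
  refine .inr ?_
  push Not at hcomm
  obtain ⟨x, hx, y, hy, Ix, Iy, hc⟩ := hcomm
  rcases hasPair_of_not_commute h D hab_hamilton hO.1 hx hy Ix Iy hc with
    ⟨i, hi, ω, hω, Ii, Iω, ht⟩ | ⟨i, hi, g, hg, Ii, Ig | Ig, ht⟩ | ⟨ω, hω, g, hg, Iω, Ig, ht⟩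
  · exact .inl (.inl (corr_octOrder_of_isI_isOmega h D hO hi hω Ii Iω ht))
  · exact .inl (isEvenType_of_isI_isI h D hO hi hg Ii Ig ht)
  · exact .inl (isEvenType_of_isI_isW h D hO hi hg Ii Ig ht)
  · rcases corr_of_isOmega h D hO (not_anti_three h) hω hg Iω Ig ht with ho | ho
    · exact .inl (.inl ho)
    · exact .inr ho

include h D in
lemma exists_isSixType : ∃ O : Subring ℍ[F,-1,-1], IsMaximalOrder F O ∧ IsSixType p θ s ε O := by
  obtain ⟨σ⟩ := h.exists_real
  have key : ∀ {δ l : F} (X Y : ℍ[F,-1,-1]), Anti (-3) (-δ) X Y → SixParam p θ s ε δ l →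
      ∃ O : Subring ℍ[F,-1,-1], IsMaximalOrder F O ∧ IsSixType p θ s ε O := by
    intro δ l X Y hA hP
    have T := hP.triData h D
    obtain ⟨e, -⟩ := hA.exists_algEquiv σ (by rw [map_neg, map_ofNat]; norm_num) (by simp [T.pos σ])
    have hc := corr_map e (triOrder T)
    exact ⟨_, (triOrder_isMaximalOrder h T).of_corr hc.symm, δ, l, hP, T, hc⟩
  rcases h.mod_three with hp | hp
  · obtain ⟨x, y, hxy⟩ := exists_sq_add_sq_eq_three h hp
    refine key ⟨0, x, 0, y⟩ ⟨0, 0, 1, 0⟩ ⟨?_, ?_, ?_⟩ (.inl ⟨hp, rfl, rfl⟩)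
    · rw [algebraMap_quat]
      ext <;> simp
      · linear_combination -hxy
      · ring
    · rw [algebraMap_quat]
      ext <;> simp
    · ext <;> simp
  · refine key ⟨0, 1, 1, 1⟩ ⟨0, s / 2, -(s / 2), 0⟩ ⟨?_, ?_, ?_⟩ (.inr ⟨hp, rfl, rfl⟩)
    · rw [algebraMap_quat]
      ext <;> simp; norm_num
    · rw [algebraMap_quat, D.eps_def]
      ext <;> simp; ring
    · ext <;> simp; ring

end Types

section Dihedral

variable {F} {a b : F} {O : Subring ℍ[F,a,b]} (hO : IsOrder F O)

include hO in
lemma isScalarUnit_of_eq {u : (↥O)ˣ} {c : F} (hu : ((u : ↥O) : ℍ[F,a,b]) = algebraMap F _ c) : IsScalarUnit F u := by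
  have h1 : ((u : ↥O) : ℍ[F,a,b]) * (((u⁻¹ : (↥O)ˣ) : ↥O) : ℍ[F,a,b]) = 1 := by
    exact_mod_cast congrArg Subtype.val u.mul_inv
  have hc : c ≠ 0 := by
    rintro rfl
    rw [hu, map_zero, zero_mul] at h1
    exact zero_ne_one h1
  refine isScalarUnit_iff.mpr ⟨c, ?_, ?_, hc, hu⟩
  · exact isIntegral_algebraMap_quat (hu ▸ hO.isIntegral (u : ↥O).2)
  · have h2 : (((u⁻¹ : (↥O)ˣ) : ↥O) : ℍ[F,a,b]) = algebraMap F _ c⁻¹ := by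
      calc _ = algebraMap F ℍ[F,a,b] c⁻¹ * (((u : ↥O) : ℍ[F,a,b]) * (((u⁻¹ : (↥O)ˣ) : ↥O) : ℍ[F,a,b])) := by
            rw [← mul_assoc, hu, ← map_mul, inv_mul_cancel₀ hc, map_one, one_mul]
        _ = _ := by rw [h1, mul_one]
    exact isIntegral_algebraMap_quat (h2 ▸ hO.isIntegral ((u⁻¹ : (↥O)ˣ) : ↥O).2)

omit [NumberField F] in
lemma IsScalarUnit.exists_eq {u : (↥O)ˣ} (h : IsScalarUnit F u) :
    ∃ c : F, ((u : ↥O) : ℍ[F,a,b]) = algebraMap F _ c := by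
  obtain ⟨r, hr⟩ := h
  grind

include hO in
lemma mk_eq_mk {u v : (↥O)ˣ} {c : F} (h : ((u : ↥O) : ℍ[F,a,b]) = algebraMap F _ c * ((v : ↥O) : ℍ[F,a,b])) :
    (u : RedUnits F O) = v := by
  have hv : ((v : ↥O) : ℍ[F,a,b]) * (((v⁻¹ : (↥O)ˣ) : ↥O) : ℍ[F,a,b]) = 1 := by
    exact_mod_cast congrArg Subtype.val v.mul_inv
  have : ((u * v⁻¹ : (↥O)ˣ) : RedUnits F O) = 1 := by
    refine (QuotientGroup.eq_one_iff _).mpr (isScalarUnit_of_eq hO (c := c) ?_)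
    rw [Units.val_mul, Subring.coe_mul, h, mul_assoc, hv, mul_one]
  rwa [QuotientGroup.mk_mul, QuotientGroup.mk_inv, mul_inv_eq_one] at this

lemma nonempty_dihedral_mulEquiv {G : Type*} [Group G] {n : ℕ} [NeZero n] {x y : G} (hx : x ^ n = 1) (hy : y * y = 1)
    (hyx : y * x * y * x = 1) (hall : ∀ g : G, ∃ k : ℕ, g = x ^ k ∨ g = y * x ^ k)
    (hk : ∀ k < n, x ^ k = 1 → k = 0) (hk' : ∀ k < n, y * x ^ k ≠ 1) : Nonempty (DihedralGroup n ≃* G) := by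
  have hmod : ∀ k : ℕ, x ^ (k % n) = x ^ k := fun k => by
    conv_rhs => rw [← Nat.div_add_mod k n, pow_add, pow_mul, hx, one_pow, one_mul]
  let ψ : ZMod n → G := fun i => x ^ i.val
  have hadd : ∀ i j, ψ (i + j) = ψ i * ψ j := fun i j => by
    simp only [ψ, ZMod.val_add, hmod, pow_add]
  have hdiff : ∀ i j, (ψ i)⁻¹ * ψ j = ψ (j - i) := fun i j => by
    rw [inv_mul_eq_iff_eq_mul, ← hadd, add_sub_cancel]
  have hy' : y⁻¹ = y := inv_eq_of_mul_eq_one_left hy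
  have hyx' : y * x * y⁻¹ = x⁻¹ := by rw [hy']; exact eq_inv_of_mul_eq_one_left hyx
  have hconj : ∀ i, y * ψ i * y = (ψ i)⁻¹ := fun i => by
    have := conj_pow (a := y) (b := x) (i := i.val)
    rw [hyx', hy', inv_pow] at this
    exact this.symm
  have hswap : ∀ i, ψ i * y = y * (ψ i)⁻¹ := fun i => by
    grind
  let f : DihedralGroup n → G := fun g => match g with
    | .r i => ψ i
    | .sr i => y * ψ i
  have hf : ∀ g g', f (g * g') = f g * f g' := by
    rintro (i | i) (j | j)
    · exact hadd i j
    · change y * ψ (j - i) = ψ i * (y * ψ j)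
      grind
    · change y * ψ (i + j) = y * ψ i * ψ j
      grind
    · change ψ (j - i) = y * ψ i * (y * ψ j)
      grind
  let φ : DihedralGroup n →* G := MonoidHom.mk' f hf
  refine ⟨MulEquiv.ofBijective φ ⟨(injective_iff_map_eq_one φ).mpr ?_, fun g => ?_⟩⟩
  · rintro (i | i) hi
    · have : i.val = 0 := hk _ i.val_lt hi
      rw [(ZMod.val_eq_zero i).mp this]; rfl
    · exact absurd hi (hk' _ i.val_lt)
  · obtain ⟨k, rfl | rfl⟩ := hall g
    · refine ⟨.r k, ?_⟩
      change x ^ (k : ZMod n).val = _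
      rw [ZMod.val_natCast, hmod]
    · refine ⟨.sr k, ?_⟩
      change y * x ^ (k : ZMod n).val = _
      rw [ZMod.val_natCast, hmod]

include hO in
lemma redUnitIso_dihedral {n : ℕ} [NeZero n] {x y : (↥O)ˣ} {c₁ c₂ c₃ : F} (hx : ((x : ↥O) : ℍ[F,a,b]) ^ n = algebraMap F _ c₁)
    (hy : ((y : ↥O) : ℍ[F,a,b]) * y = algebraMap F _ c₂)
    (hyx : ((y : ↥O) : ℍ[F,a,b]) * x * y * x = algebraMap F _ c₃)
    (hall : ∀ g : (↥O)ˣ, ∃ (k : ℕ) (c : F), ((g : ↥O) : ℍ[F,a,b]) = algebraMap F _ c * (x : ↥O) ^ k ∨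
      ((g : ↥O) : ℍ[F,a,b]) = algebraMap F _ c * ((y : ↥O) * (x : ↥O) ^ k))
    (hk : ∀ k < n, ∀ c, ((x : ↥O) : ℍ[F,a,b]) ^ k = algebraMap F _ c → k = 0)
    (hk' : ∀ k < n, ∀ c, ((y : ↥O) : ℍ[F,a,b]) * (x : ↥O) ^ k ≠ algebraMap F _ c) :
    RedUnitIso F O (DihedralGroup n) := by
  have one : ∀ {u : (↥O)ˣ} {c : F}, ((u : ↥O) : ℍ[F,a,b]) = algebraMap F _ c → (u : RedUnits F O) = 1 :=
    fun h => (QuotientGroup.eq_one_iff _).mpr (isScalarUnit_of_eq hO h)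
  have one' : ∀ {u : (↥O)ˣ}, (u : RedUnits F O) = 1 → ∃ c : F, ((u : ↥O) : ℍ[F,a,b]) = algebraMap F _ c :=
    fun h => ((QuotientGroup.eq_one_iff _).mp h).exists_eq
  obtain ⟨e⟩ := nonempty_dihedral_mulEquiv (n := n) (x := (x : RedUnits F O)) (y := (y : RedUnits F O))
    (one (u := x ^ n) (c := c₁) (by simpa using hx)) (one (u := y * y) (c := c₂) (by simpa using hy))
    (one (u := y * x * y * x) (c := c₃) (by simpa using hyx)) (fun g => by
      induction g using QuotientGroup.induction_on with
      | H g =>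
        obtain ⟨k, c, hg | hg⟩ := hall g
        · exact ⟨k, .inl (mk_eq_mk hO (v := x ^ k) (c := c) (by simpa using hg))⟩
        · exact ⟨k, .inr (mk_eq_mk hO (v := y * x ^ k) (c := c) (by simpa using hg))⟩)
    (fun k hkn h1 => by
      obtain ⟨c, hc⟩ := one' (u := x ^ k) h1
      exact hk k hkn c (by simpa using hc))
    (fun k hkn h1 => by
      obtain ⟨c, hc⟩ := one' (u := y * x ^ k) h1
      exact hk' k hkn c (by simpa using hc))
  exact redUnitIso_redUnits.congr e.symm

end Dihedral

section DihedralEight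

variable {F} {p : ℕ} {θ s ε : F} (h : IsSqrtGen F p θ) (D : DyadicData θ s ε)

include h D in
lemma half_s_notMem : s / 2 ∉ intR F := fun hm => by
  have := (D.dvd_two h (m := 0) (n := 1) (by simpa using hm)).2
  omega

include h in
lemma sq_eq_of_sum_eq {n : F} {x y z : F} (hx : x ∈ intR F) (hy : y ∈ intR F) (hz : z ∈ intR F)
    (hn : ∀ σ : F →+* ℝ, σ n ≤ 4) (he : x ^ 2 + y ^ 2 + z ^ 2 = n) :
    (x = 0 ∨ x = 1 ∨ x = -1 ∨ x = 2 ∨ x = -2) ∧ (y = 0 ∨ y = 1 ∨ y = -1 ∨ y = 2 ∨ y = -2) ∧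
      (z = 0 ∨ z = 1 ∨ z = -1 ∨ z = 2 ∨ z = -2) := by
  have e : ∀ σ : F →+* ℝ, σ x ^ 2 + σ y ^ 2 + σ z ^ 2 ≤ 4 := fun σ => by
    rw [← map_pow, ← map_pow, ← map_pow, ← map_add, ← map_add, he]; exact hn σ
  refine ⟨h.eq_of_bounded_two hx fun σ => ?_, h.eq_of_bounded_two hy fun σ => ?_, h.eq_of_bounded_two hz fun σ => ?_⟩ <;>
    nlinarith [e σ, sq_nonneg (σ x), sq_nonneg (σ y), sq_nonneg (σ z)]

include h in
/-- A sum of three integral squares equal to `3`. -/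
lemma eq_one_of_sum_eq_three {x y z : F} (hx : x ∈ intR F) (hy : y ∈ intR F) (hz : z ∈ intR F)
    (he : x ^ 2 + y ^ 2 + z ^ 2 = 3) : (x = 1 ∨ x = -1) ∧ (y = 1 ∨ y = -1) ∧ (z = 1 ∨ z = -1) := by
  obtain ⟨h1, h2, h3⟩ := sq_eq_of_sum_eq h hx hy hz (fun σ => by rw [map_ofNat]; norm_num) he
  have q : ∀ {t : F}, (t = 0 ∨ t = 1 ∨ t = -1 ∨ t = 2 ∨ t = -2) → t ^ 2 = 0 ∨ (t = 1 ∨ t = -1) ∧ t ^ 2 = 1 ∨ t ^ 2 = 4 := by grind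
  rcases q h1 with a | ⟨a', a⟩ | a <;> rcases q h2 with b | ⟨b', b⟩ | b <;> rcases q h3 with c | ⟨c', c⟩ | c <;>
    first
    | exact ⟨a', b', c'⟩
    | (rw [a, b, c] at he; norm_num at he)

include h in
lemma eq_two_of_sum_eq_four {x y z : F} (hx : x ∈ intR F) (hy : y ∈ intR F) (hz : z ∈ intR F)
    (he : x ^ 2 + y ^ 2 + z ^ 2 = 4) : ((x = 2 ∨ x = -2) ∧ y = 0 ∧ z = 0) ∨ (x = 0 ∧ (y = 2 ∨ y = -2) ∧ z = 0) ∨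
      (x = 0 ∧ y = 0 ∧ (z = 2 ∨ z = -2)) := by
  obtain ⟨h1, h2, h3⟩ := sq_eq_of_sum_eq h hx hy hz (fun σ => by rw [map_ofNat]) he
  have q : ∀ {t : F}, (t = 0 ∨ t = 1 ∨ t = -1 ∨ t = 2 ∨ t = -2) →
      t = 0 ∧ t ^ 2 = 0 ∨ t ^ 2 = 1 ∨ (t = 2 ∨ t = -2) ∧ t ^ 2 = 4 := by
    grind
  rcases q h1 with ⟨a', a⟩ | a | ⟨a', a⟩ <;> rcases q h2 with ⟨b', b⟩ | b | ⟨b', b⟩ <;>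
    rcases q h3 with ⟨c', c⟩ | c | ⟨c', c⟩ <;>
    first
    | exact .inl ⟨a', b', c'⟩
    | exact .inr (.inl ⟨a', b', c'⟩)
    | exact .inr (.inr ⟨a', b', c'⟩)
    | (rw [a, b, c] at he; norm_num at he)

lemma dihOrder_coords {y : ℍ[F,-1,-1]} (hy : y ∈ dihOrder D) : 2 * y.imI ∈ intR F ∧ 2 * y.imJ ∈ intR F ∧ 2 * y.imK ∈ intR F := by
  obtain ⟨-, h2, h3, h4⟩ := (mem_dihOrder D).mp hy
  refine ⟨h2, ?_, h4⟩
  have := (intR F).add_mem ((intR F).mul_mem (ofNat_mem (intR F) 2) h3)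
    ((intR F).mul_mem ((intR F).add_mem (intR F).one_mem D.s_mem) h4)
  convert this using 1; ring

include h

lemma dihOrder_isI {y : ℍ[F,-1,-1]} (hy : y ∈ dihOrder D) (hI : IsI y) :
    ∃ c : F, y = ⟨0, c, 0, 0⟩ ∨ y = ⟨0, 0, c, 0⟩ ∨ y = ⟨0, 0, 0, c⟩ := by
  obtain ⟨hB, hC, hE⟩ := dihOrder_coords D hy
  obtain ⟨h0, hn⟩ := hI
  simp only [nrd, h0] at hn
  rcases eq_two_of_sum_eq_four h hB hC hE (by linear_combination 4 * hn) with ⟨-, h2, h3⟩ | ⟨h1, -, h3⟩ | ⟨h1, h2, -⟩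
  · refine ⟨y.imI, .inl ?_⟩
    ext <;> simp_all
  · refine ⟨y.imJ, .inr (.inl ?_)⟩
    ext <;> simp_all
  · refine ⟨y.imK, .inr (.inr ?_)⟩
    ext <;> simp_all

lemma dihOrder_not_isOmega {y : ℍ[F,-1,-1]} (hy : y ∈ dihOrder D) : ¬ IsOmega y := fun hω => by
  obtain ⟨hB, hC, hE⟩ := dihOrder_coords D hy
  obtain ⟨h0, hn⟩ := hω
  simp only [nrd] at hn
  have h1 := ((mem_dihOrder D).mp hy).1
  refine half_s_notMem h D ?_
  rcases (eq_one_of_sum_eq_three h hB hC hE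
    (by linear_combination 4 * hn - (2 * y.re - 1) * h0)).1 with h2 | h2
  · convert (intR F).neg_mem ((intR F).add_mem h1 (intR F).one_mem) using 1
    grind
  · grind

lemma dihOrder_isW {y : ℍ[F,-1,-1]} (hy : y ∈ dihOrder D) (hW : IsW ε y) :
    ∃ c : F, y = ⟨0, 0, c, c⟩ ∨ y = ⟨0, 0, c, -c⟩ := by
  obtain ⟨hB, hC, hE⟩ := dihOrder_coords D hy
  obtain ⟨h0, hn⟩ := hW
  simp only [nrd, h0] at hn
  have hs := D.s_ne
  have he : (2 * y.imI) ^ 2 + (2 * y.imJ) ^ 2 + (2 * y.imK) ^ 2 = 2 * s ^ 2 := by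
    rw [D.eps_def] at hn; linear_combination 4 * hn
  have e : ∀ σ : F →+* ℝ, σ (2 * y.imI) ^ 2 + σ (2 * y.imJ) ^ 2 + σ (2 * y.imK) ^ 2 = 4 * σ ε := fun σ => by
    have h1 := congrArg σ he
    have h2 := congrArg σ D.sq
    rw [map_mul, map_pow, map_ofNat] at h2
    rw [map_add, map_add, map_pow, map_pow, map_pow, map_mul σ 2 (s ^ 2), map_pow σ s, map_ofNat, h2] at h1
    linarith
  have b1 := D.eq_of_bounded_eps h hB fun σ => by nlinarith [e σ, sq_nonneg (σ (2 * y.imJ)), sq_nonneg (σ (2 * y.imK))]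
  have b2 := D.eq_of_bounded_eps h hC fun σ => by nlinarith [e σ, sq_nonneg (σ (2 * y.imI)), sq_nonneg (σ (2 * y.imK))]
  have b3 := D.eq_of_bounded_eps h hE fun σ => by nlinarith [e σ, sq_nonneg (σ (2 * y.imI)), sq_nonneg (σ (2 * y.imJ))]
  have h1 := ((mem_dihOrder D).mp hy).1
  have hI : y.imI = 0 := by
    have key : ∀ t : F, 2 * y.imI = t → (t = s ∨ t = -s) → False := by
      intro t ht hts
      refine half_s_notMem h D ?_
      have hm : (1 + s) * t / 2 ∈ intR F := by
        convert (intR F).neg_mem h1 using 1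
        grind
      rcases hts with rfl | rfl
      · convert (intR F).sub_mem hm D.eps_mem using 1
        grind
      · convert (intR F).neg_mem ((intR F).add_mem hm D.eps_mem) using 1
        grind
    rcases b1 with b | b | b
    · simpa using b
    · exact (key _ b (.inl rfl)).elim
    · exact (key _ b (.inr rfl)).elim
  have q : ∀ {t : F}, (t = 0 ∨ t = s ∨ t = -s) → t ^ 2 = 0 ∨ t ^ 2 = s ^ 2 := by grind
  have hs2 : s ^ 2 ≠ 0 := pow_ne_zero 2 hs
  have hsq : y.imJ ^ 2 = y.imK ^ 2 := by
    rw [hI] at he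
    rcases q b2 with c2 | c2 <;> rcases q b3 with c3 | c3 <;> rw [c2, c3] at he
    · exact absurd (by linear_combination he / (-2) : s ^ 2 = 0) hs2
    · exact absurd (by linear_combination -he : s ^ 2 = 0) hs2
    · exact absurd (by linear_combination -he : s ^ 2 = 0) hs2
    · grind
  refine ⟨y.imJ, ?_⟩
  rcases sq_eq_sq_iff_eq_or_eq_neg.mp hsq with e | e
  · left; ext <;> simp [h0, hI, e]
  · right; ext <;> simp [h0, hI, e]

lemma dihOrder_cases {y : ℍ[F,-1,-1]} (hy : y ∈ dihOrder D) (hn : nrd y = 1 ∨ nrd y = ε) :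
    ∃ c : F, y = ⟨c, 0, 0, 0⟩ ∨ y = ⟨0, c, 0, 0⟩ ∨ y = ⟨0, 0, c, 0⟩ ∨ y = ⟨0, 0, 0, c⟩ ∨ y = ⟨0, 0, c, c⟩ ∨
      y = ⟨0, 0, c, -c⟩ ∨ y = ⟨c, c, 0, 0⟩ ∨ y = ⟨c, -c, 0, 0⟩ := by
  have hO := dihOrder_isOrder h D
  rcases normUnit_cases h D hab_hamilton hO hy hn with (rfl | rfl) | ⟨g, hg, hG, hyg⟩ | ⟨i, hi, hI, hyi⟩
  · exact ⟨1, .inl (by ext <;> simp)⟩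
  · exact ⟨-1, .inl (by ext <;> simp)⟩
  · have : y ∈ dihOrder D ∧ (IsI y ∨ IsOmega (-y) ∨ IsOmega y ∨ IsW ε y) := by
      refine ⟨hy, ?_⟩
      rcases hyg with rfl | rfl
      · exact hG.imp_right .inr
      · have := re_neg_nrd_neg g
        rcases hG with hG | hG | hG
        · exact .inl ⟨by rw [this.1, hG.1, neg_zero], by rw [this.2, hG.2]⟩
        · right; left; rwa [neg_neg]
        · exact .inr (.inr (.inr ⟨by rw [this.1, hG.1, neg_zero], by rw [this.2, hG.2]⟩))
    rcases this.2 with hG | hG | hG | hG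
    · obtain ⟨c, hc | hc | hc⟩ := dihOrder_isI h D hy hG
      · exact ⟨c, .inr (.inl hc)⟩
      · exact ⟨c, .inr (.inr (.inl hc))⟩
      · exact ⟨c, .inr (.inr (.inr (.inl hc)))⟩
    · exact absurd hG (dihOrder_not_isOmega h D ((dihOrder D).neg_mem hy))
    · exact absurd hG (dihOrder_not_isOmega h D hy)
    · obtain ⟨c, hc | hc⟩ := dihOrder_isW h D hy hG
      · exact ⟨c, .inr (.inr (.inr (.inr (.inl hc))))⟩
      · exact ⟨c, .inr (.inr (.inr (.inr (.inr (.inl hc)))))⟩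
  · obtain ⟨c, hc⟩ := dihOrder_isI h D hi hI
    have hu : algebraMap F _ (s / 2) * (1 + i) ∈ dihOrder D := by
      rcases hyi with rfl | rfl
      · exact hy
      · simpa using (dihOrder D).neg_mem hy
    have h1 := ((mem_dihOrder D).mp hu).1
    rcases hc with rfl | rfl | rfl
    · have hc2 : c = 1 ∨ c = -1 := by
        have := hI.2
        simp [nrd] at this
        exact this
      rcases hc2 with rfl | rfl <;> rcases hyi with rfl | rfl
      · exact ⟨s / 2, by rw [algebraMap_quat]; simp [QuaternionAlgebra.ext_iff]⟩
      · exact ⟨-(s / 2), by rw [algebraMap_quat]; simp [QuaternionAlgebra.ext_iff]⟩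
      · exact ⟨s / 2, by rw [algebraMap_quat]; simp [QuaternionAlgebra.ext_iff]⟩
      · exact ⟨-(s / 2), by rw [algebraMap_quat]; simp [QuaternionAlgebra.ext_iff]⟩
    all_goals
      rw [algebraMap_quat] at h1
      simp at h1
      exact absurd h1 (half_s_notMem h D)

theorem redUnitIso_dihOrder : RedUnitIso F (dihOrder D) (DihedralGroup 4) := by
  have hO := dihOrder_isOrder h D
  have hs := D.s_ne
  have hs2 : s / 2 ≠ 0 := by simpa using hs
  obtain ⟨x, hx⟩ := exists_unit D hO (u_mem_dihOrder D) (.inr (by simp [nrd, D.eps_def]; ring))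
  obtain ⟨y, hy⟩ := exists_unit D hO (j_mem_dihOrder D) (.inl (by simp [nrd]))
  have p2 : (⟨s / 2, s / 2, 0, 0⟩ : ℍ[F,-1,-1]) ^ 2 = ⟨0, s ^ 2 / 2, 0, 0⟩ := by
    rw [pow_two]; ext <;> simp; ring
  have p3 : (⟨s / 2, s / 2, 0, 0⟩ : ℍ[F,-1,-1]) ^ 3 = ⟨-(s ^ 3 / 4), s ^ 3 / 4, 0, 0⟩ := by
    rw [pow_succ, p2]; ext <;> simp <;> ring
  refine redUnitIso_dihedral hO (x := x) (y := y) (c₁ := -(s ^ 4 / 4)) (c₂ := -1) (c₃ := -(s ^ 2 / 2)) ?_ ?_ ?_ ?_ ?_ ?_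
  · rw [hx, pow_succ, p3, algebraMap_quat]
    ext <;> simp; ring
  · rw [hy, algebraMap_quat]
    ext <;> simp
  · rw [hx, hy, algebraMap_quat]
    ext <;> simp; ring
  · intro g
    obtain ⟨v, -, -, -, z, hz, hn, hg⟩ := exists_normUnit D hO hab_hamilton g
    rw [hg, hx, hy]
    obtain ⟨c, hc⟩ := dihOrder_cases h D hz hn
    have nx : ∀ (k : ℕ) (d : F), (z = algebraMap F _ d * ⟨s / 2, s / 2, 0, 0⟩ ^ k ∨
        z = algebraMap F _ d * (⟨0, 0, 1, 0⟩ * ⟨s / 2, s / 2, 0, 0⟩ ^ k)) →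
        ∃ (k : ℕ) (c : F), algebraMap F ℍ[F,-1,-1] v * z = algebraMap F _ c * ⟨s / 2, s / 2, 0, 0⟩ ^ k ∨
        algebraMap F ℍ[F,-1,-1] v * z = algebraMap F _ c * (⟨0, 0, 1, 0⟩ * ⟨s / 2, s / 2, 0, 0⟩ ^ k) := by
      rintro k d (e | e)
      · exact ⟨k, v * d, .inl (by rw [e, map_mul, mul_assoc])⟩
      · exact ⟨k, v * d, .inr (by rw [e, map_mul, mul_assoc])⟩
    rcases hc with rfl | rfl | rfl | rfl | rfl | rfl | rfl | rfl
    · refine nx 0 c (.inl ?_)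
      rw [algebraMap_quat, pow_zero, mul_one]
    · refine nx 2 (c / (s ^ 2 / 2)) (.inl ?_)
      rw [algebraMap_quat, p2]; ext <;> simp; field_simp
    · refine nx 0 c (.inr ?_)
      rw [algebraMap_quat, pow_zero, mul_one]; ext <;> simp
    · refine nx 2 (-c / (s ^ 2 / 2)) (.inr ?_)
      rw [algebraMap_quat, p2]; ext <;> simp; field_simp
    · refine nx 3 (-c / (s ^ 3 / 4)) (.inr ?_)
      rw [algebraMap_quat, p3]; ext <;> simp <;> field_simp
    · refine nx 1 (c / (s / 2)) (.inr ?_)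
      rw [algebraMap_quat, pow_one]; ext <;> simp <;> field_simp
    · refine nx 1 (c / (s / 2)) (.inl ?_)
      rw [algebraMap_quat, pow_one]; ext <;> simp <;> field_simp
    · refine nx 3 (-c / (s ^ 3 / 4)) (.inl ?_)
      rw [algebraMap_quat, p3]; ext <;> simp <;> field_simp
  · intro k hk c hc
    rw [hx] at hc
    have hc' := congrArg QuaternionAlgebra.imI hc
    rw [algebraMap_quat] at hc'
    interval_cases k
    · rfl
    · simp [hs] at hc'
    · grind
    · grind
  · intro k hk c hc
    rw [hx, hy] at hc
    have hc' := congrArg QuaternionAlgebra.imJ hc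
    have hc'' := congrArg QuaternionAlgebra.imK hc
    rw [algebraMap_quat] at hc' hc''
    interval_cases k
    · simp at hc'
    · simp [hs] at hc'
    · rw [p2] at hc''; simp [hs] at hc''
    · rw [p3] at hc'; simp [hs] at hc'

end DihedralEight

section DihedralSix

variable {F} {p : ℕ} {θ s ε δ l : F} (h : IsSqrtGen F p θ) (D : DyadicData θ s ε)

include h D in
lemma SixParam.form_ne_two (hP : SixParam p θ s ε δ l) {C E : F} (hC : C ∈ intR F) {m : ℤ}
    (hm : ¬ 3 ∣ m) (hl : (m - l * E) / 3 ∈ intR F) : δ * (3 * C ^ 2 + 3 * C * E + E ^ 2) ≠ 2 := fun he => by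
  rcases hP with ⟨-, rfl, rfl⟩ | ⟨-, rfl, rfl⟩
  · have e1 : (2 * E + 3 * C) ^ 2 + 3 * C ^ 2 = 8 := by grind
    obtain ⟨c, hc, hc2⟩ := h.eq_int_of_bounded hC (c := 8 / 3) (by norm_num) fun σ => by
      have := congrArg σ e1
      rw [map_add, map_pow, map_mul σ 3, map_pow, map_ofNat, map_ofNat] at this
      nlinarith [sq_nonneg (σ (2 * E + 3 * C))]
    have hc3 : (c : ℝ) ^ 2 < 4 := by linarith
    have hc4 : c ^ 2 < 4 := mod_cast hc3
    have l1 : c < 2 := by nlinarith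
    have l2 : -2 < c := by nlinarith
    have h5 : ∀ x : F, x ^ 2 ≠ 5 := fun x => by
      have := h.sq_ne (n := 5) (by norm_num) (by
        rintro ⟨k, hk⟩
        have : k < 3 := by nlinarith
        interval_cases k <;> omega) x
      grind
    interval_cases c <;> subst hc
    · exact h5 (2 * E - 3) (by push_cast at e1; linear_combination e1)
    · exact h.two_ne_sq E (by push_cast at e1; linear_combination e1 / 4)
    · exact h5 (2 * E + 3) (by push_cast at e1; linear_combination e1)
  · have hs := D.s_ne
    have e1 : (2 * (s * E) + 3 * (s * C)) ^ 2 + 3 * (s * C) ^ 2 = 16 := by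
      rw [D.eps_def] at he; linear_combination 8 * he
    obtain ⟨c, hc, hc2⟩ := h.eq_int_of_bounded ((intR F).mul_mem D.s_mem hC) (c := 16 / 3) (by norm_num) fun σ => by
      have := congrArg σ e1
      rw [map_add, map_pow, map_mul σ 3, map_pow, map_ofNat, map_ofNat] at this
      nlinarith [sq_nonneg (σ (2 * (s * E) + 3 * (s * C)))]
    have hc3 : (c : ℝ) ^ 2 < 9 := by linarith
    have hc4 : c ^ 2 < 9 := mod_cast hc3
    have l1 : c < 3 := by nlinarith
    have l2 : -3 < c := by nlinarith
    have hdvd : 2 ∣ c := D.dvd_s h (m := c) (n := 0) (by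
      rw [Int.cast_zero, zero_mul, add_zero, ← hc, mul_div_cancel_left₀ _ hs]; exact hC)
    have key : ∀ n : ℤ, s * E = n → False := fun n hn => by
      refine hm (((h.int_div_mem (N := 3) (by norm_num) (m := m) (n := -n)).mp ?_).1)
      convert hl using 1
      grind
    have sq4 : ∀ x : F, x ^ 2 = 4 → x = 2 ∨ x = -2 := fun x hx =>
      sq_eq_sq_iff_eq_or_eq_neg.mp (by rw [hx]; norm_num)
    rw [hc] at e1
    interval_cases c
    · push_cast at e1
      rcases sq4 (2 * (s * E) - 6) (by linear_combination e1) with e | e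
      · exact key 4 (by push_cast; linear_combination e / 2)
      · exact key 2 (by push_cast; linear_combination e / 2)
    · omega
    · push_cast at e1
      rcases sq4 (s * E) (by linear_combination e1 / 4) with e | e
      · exact key 2 (by push_cast; exact e)
      · exact key (-2) (by push_cast; exact e)
    · omega
    · push_cast at e1
      rcases sq4 (2 * (s * E) + 6) (by linear_combination e1) with e | e
      · exact key (-2) (by push_cast; linear_combination e / 2)
      · exact key (-4) (by push_cast; linear_combination e / 2)

variable (T : TriData δ l)

omit [NumberField F] in
lemma nrd_triOrder (y : ℍ[F,-3,-δ]) : 3 * nrd y = 3 * y.re ^ 2 + (3 * y.imI) ^ 2 +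
    δ * (3 * (2 * y.imJ) ^ 2 + 3 * (2 * y.imJ) * (3 * (y.imK - y.imJ)) + (3 * (y.imK - y.imJ)) ^ 2) := by
  simp only [nrd]; ring

lemma map_nrd_triOrder_ge (y : ℍ[F,-3,-δ]) (T : TriData δ l) (σ : F →+* ℝ) :
    3 * σ y.re ^ 2 + σ (3 * y.imI) ^ 2 ≤ 3 * σ (nrd y) := by
  have h1 := T.pos σ
  have h2 := congrArg σ (nrd_triOrder y)
  simp only [nrd, map_mul, map_add, map_sub, map_pow, map_neg, map_ofNat] at h2 ⊢
  have h3 : 0 ≤ σ δ * (σ y.imJ ^ 2 + 3 * σ y.imK ^ 2) := by positivity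
  nlinarith

lemma hab_tri (T : TriData δ l) (σ : F →+* ℝ) : σ (-3) < 0 ∧ σ (-δ) < 0 := by
  rw [map_neg, map_neg, map_ofNat]
  have := T.pos σ
  grind

include h D

lemma triOrder_isI (hP : SixParam p θ s ε δ l) {y : ℍ[F,-3,-δ]} (hy : y ∈ triOrder T) (hI : IsI y) : y.imI = 0 := by
  obtain ⟨h0, hn⟩ := hI
  obtain ⟨-, h2, h3, h4⟩ := (mem_triOrder T).mp hy
  have hm : 3 * y.imI ∈ intR F := by
    convert (intR F).add_mem ((intR F).mul_mem (ofNat_mem (intR F) 3) h3) ((intR F).mul_mem T.param_mem h4) using 1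
    rw [h0]; ring
  obtain ⟨m, hm, hm2⟩ := h.eq_int_of_bounded hm (c := 3) (by norm_num) fun σ => by
    have := map_nrd_triOrder_ge y T σ
    rw [hn, map_one] at this
    nlinarith [sq_nonneg (σ y.re)]
  have hm3 : m ^ 2 ≤ 3 := mod_cast hm2
  have l1 : m < 2 := by nlinarith
  have l2 : -2 < m := by nlinarith
  have hN := nrd_triOrder y
  rw [hn, h0, hm] at hN
  have hl : ((m : F) - l * (3 * (y.imK - y.imJ))) / 3 ∈ intR F := by grind
  have key := fun h3m => hP.form_ne_two h D h2 (m := m) h3m hl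
  interval_cases m
  · exact absurd (by push_cast at hN; linear_combination -hN) (key (by omega))
  · simpa using hm
  · exact absurd (by push_cast at hN; linear_combination -hN) (key (by omega))

lemma triOrder_isW (hP : SixParam p θ s ε δ l) {y : ℍ[F,-3,-δ]} (hy : y ∈ triOrder T) (hW : IsW ε y) : y.imI = 0 := by
  obtain ⟨h0, hn⟩ := hW
  obtain ⟨-, h2, h3, h4⟩ := (mem_triOrder T).mp hy
  have hs := D.s_ne
  have hm : 3 * y.imI ∈ intR F := by
    convert (intR F).add_mem ((intR F).mul_mem (ofNat_mem (intR F) 3) h3) ((intR F).mul_mem T.param_mem h4) using 1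
    rw [h0]; ring
  have hN := nrd_triOrder y
  have key : ∀ n : ℤ, ¬ 3 ∣ n → n ^ 2 = 4 → 3 * y.imI = n * s / 2 → False := by
    intro n hn3 hn4 hns
    have hn4' : (n : F) ^ 2 = 4 := mod_cast hn4
    refine hP.form_ne_two h D (C := 2 / s * (2 * y.imJ)) (E := 2 / s * (3 * (y.imK - y.imJ)))
      ((intR F).mul_mem D.two_div_s_mem h2) hn3 ?_ ?_
    · convert (intR F).mul_mem D.two_div_s_mem h3 using 1
      grind
    · rw [hn, h0, hns, D.eps_def] at hN
      grind
  rcases D.eq_of_bounded_eps h hm fun σ => by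
    have := map_nrd_triOrder_ge y T σ
    rw [hn] at this
    nlinarith [sq_nonneg (σ y.re), D.pos σ] with e | e | e
  · simpa using e
  · exact (key 2 (by omega) (by norm_num) (by rw [e]; push_cast; ring)).elim
  · exact (key (-2) (by omega) (by norm_num) (by rw [e]; push_cast; ring)).elim

lemma triOrder_isOmega (hP : SixParam p θ s ε δ l) {y : ℍ[F,-3,-δ]} (hy : y ∈ triOrder T) (hω : IsOmega y) :
    y = ⟨-1 / 2, 1 / 2, 0, 0⟩ ∨ y = ⟨-1 / 2, -1 / 2, 0, 0⟩ := by
  have hO := triOrder_isOrder h T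
  obtain ⟨h0, hn⟩ := hω
  obtain ⟨-, h2, h3, h4⟩ := (mem_triOrder T).mp hy
  have h0' : y.re = -1 / 2 := by grind
  have ht : 1 / 2 - 3 * y.imI ∈ intR F := by
    convert hO.tr_mem ((triOrder T).mul_mem hy (omega_mem_triOrder T)) using 1
    simp [h0']; ring
  have hN := nrd_triOrder y
  have hbd : ∀ σ : F →+* ℝ, σ (3 * y.imI) ^ 2 ≤ 9 / 4 := fun σ => by
    have := map_nrd_triOrder_ge y T σ
    rw [hn, h0', map_one, map_div₀, map_neg, map_one, map_ofNat] at this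
    linarith
  have hab := hab_tri T
  have hz : 3 * (3 * y.imI) ^ 2 = 27 / 4 → y.imJ = 0 ∧ y.imK = 0 := fun e => by
    have e1 : nrd (⟨0, 0, y.imJ, y.imK⟩ : ℍ[F,-3,-δ]) = 0 := by
      simp only [nrd, h0'] at hn ⊢
      linear_combination hn - e / 9
    obtain ⟨σ⟩ := h.exists_real
    by_contra hne
    refine nrd_ne_zero (hab σ) (fun e0 => hne ?_) e1
    exact ⟨congrArg QuaternionAlgebra.imJ e0, congrArg QuaternionAlgebra.imK e0⟩
  rcases h.eq_of_bounded_two ht fun σ => by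
    have := hbd σ
    rw [map_sub, map_div₀, map_one, map_ofNat]
    have l1 : σ (3 * y.imI) ≤ 3 / 2 := by nlinarith
    have l2 : -(3 / 2) ≤ σ (3 * y.imI) := by nlinarith
    nlinarith with e | e | e | e | e
  · have e' : y.imI = 1 / 6 := by grind
    refine absurd ?_ (hP.form_ne_two h D (E := 3 * (y.imK - y.imJ)) h2 (m := 2) (by omega) ?_)
    · grind
    · convert h3 using 1
      rw [h0', e']; push_cast; ring
  · have e' : y.imI = -1 / 6 := by grind
    refine absurd ?_ (hP.form_ne_two h D (E := 3 * (y.imK - y.imJ)) h2 (m := 1) (by omega) ?_)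
    · grind
    · convert h3 using 1
      rw [h0', e']; push_cast; ring
  · left
    have e' : y.imI = 1 / 2 := by grind
    obtain ⟨z1, z2⟩ := hz (by rw [e']; norm_num)
    ext <;> simp [h0', e', z1, z2]
  · right
    have e' : y.imI = -1 / 2 := by grind
    obtain ⟨z1, z2⟩ := hz (by rw [e']; norm_num)
    ext <;> simp [h0', e', z1, z2]
  · exfalso
    obtain ⟨σ⟩ := h.exists_real
    have := hbd σ
    rw [show 3 * y.imI = 5 / 2 by linear_combination -e, map_div₀, map_ofNat, map_ofNat] at this
    norm_num at this

lemma triOrder_cases (hP : SixParam p θ s ε δ l) {y : ℍ[F,-3,-δ]} (hy : y ∈ triOrder T) (hn : nrd y = 1 ∨ nrd y = ε) :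
    ∃ c : F, y = ⟨c, 0, 0, 0⟩ ∨ y = ⟨-c, c, 0, 0⟩ ∨ y = ⟨c, c, 0, 0⟩ ∨ (y.re = 0 ∧ y.imI = 0) := by
  have hO := triOrder_isOrder h T
  rcases normUnit_cases h D (hab_tri T) hO hy hn with (rfl | rfl) | ⟨g, hg, hG, hyg⟩ | ⟨i, hi, hI, hyi⟩
  · exact ⟨1, .inl (by ext <;> simp)⟩
  · exact ⟨-1, .inl (by ext <;> simp)⟩
  · have hg' : (g = ⟨-1 / 2, 1 / 2, 0, 0⟩ ∨ g = ⟨-1 / 2, -1 / 2, 0, 0⟩) ∨ g.re = 0 ∧ g.imI = 0 := by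
      rcases hG with hG | hG | hG
      · exact .inr ⟨hG.1, triOrder_isI h D T hP hg hG⟩
      · exact .inl (triOrder_isOmega h D T hP hg hG)
      · exact .inr ⟨hG.1, triOrder_isW h D T hP hg hG⟩
    rcases hg' with (rfl | rfl) | ⟨h1, h2⟩ <;> rcases hyg with rfl | rfl
    · exact ⟨1 / 2, .inr (.inl (by ext <;> simp; norm_num))⟩
    · exact ⟨-1 / 2, .inr (.inl (by ext <;> simp; norm_num))⟩
    · exact ⟨-1 / 2, .inr (.inr (.inl rfl))⟩
    · exact ⟨1 / 2, .inr (.inr (.inl (by ext <;> simp <;> norm_num)))⟩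
    · exact ⟨0, .inr (.inr (.inr ⟨h1, h2⟩))⟩
    · exact ⟨0, .inr (.inr (.inr ⟨by simp [h1], by simp [h2]⟩))⟩
  · have hu : algebraMap F _ (s / 2) * (1 + i) ∈ triOrder T := by
      rcases hyi with rfl | rfl
      · exact hy
      · simpa using (triOrder T).neg_mem hy
    have h1 := hO.tr_mem ((triOrder T).mul_mem hu (omega_mem_triOrder T))
    have h2 := triOrder_isI h D T hP hi hI
    refine absurd ?_ (half_s_notMem h D)
    convert (intR F).neg_mem h1 using 1
    rw [algebraMap_quat]
    simp [h2, hI.1]; ring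

lemma triOrder_cases_of_inverts (hP : SixParam p θ s ε δ l) {y : ℍ[F,-3,-δ]} (hy : y ∈ triOrder T)
    (hn : nrd y = 1 ∨ nrd y = ε) (h0 : y.re = 0) (h1 : y.imI = 0) :
    ∃ c : F, y = ⟨0, 0, c, 0⟩ ∨ y = ⟨0, 0, c, -c⟩ ∨ y = ⟨0, 0, c, c⟩ := by
  have hO := triOrder_isOrder h T
  have he := D.eps_ne
  have hr : ∃ r ∈ intR F, r ≠ 0 ∧ (r ^ 2 * (nrd y * δ) = 1 ∨ r ^ 2 * (nrd y * δ) = ε) := by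
    rcases hP with ⟨-, rfl, -⟩ | ⟨-, rfl, -⟩
    · exact ⟨1, (intR F).one_mem, one_ne_zero, by simpa using hn⟩
    · rcases hn with hn | hn <;> rw [hn]
      · exact ⟨1, (intR F).one_mem, one_ne_zero, by simp⟩
      · exact ⟨δ⁻¹, D.inv_mem, inv_ne_zero he, .inl (by field_simp)⟩
  obtain ⟨r, hr, hr0, hrn⟩ := hr
  have hw : algebraMap F _ r * (y * ⟨0, 0, 1, 0⟩) = ⟨-(r * δ * y.imJ), -(r * δ * y.imK), 0, 0⟩ := by
    rw [algebraMap_quat]; ext <;> simp [h0, h1] <;> ring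
  have hm := (triOrder T).mul_mem (hO.algebraMap_mem hr) ((triOrder T).mul_mem hy (j_mem_triOrder T))
  have hnw : nrd (algebraMap F _ r * (y * ⟨0, 0, 1, 0⟩) : ℍ[F,-3,-δ]) = r ^ 2 * (nrd y * δ) := by
    rw [nrd_mul, nrd_mul, nrd_algebraMap]; simp [nrd]
  have hrd : r * δ ≠ 0 := mul_ne_zero hr0 T.ne_zero
  obtain ⟨c, hc⟩ := triOrder_cases h D T hP hm (by rwa [hnw])
  rw [hw] at hc
  simp only [QuaternionAlgebra.mk.injEq] at hc
  refine ⟨y.imJ, ?_⟩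
  rcases hc with ⟨-, e, -⟩ | ⟨e, e', -⟩ | ⟨e, e', -⟩ | ⟨-, e⟩
  · left
    have : y.imK = 0 := by grind
    ext <;> simp [h0, h1, this]
  · right; left
    have : y.imK = -y.imJ := mul_left_cancel₀ hrd (by linear_combination -e - e')
    ext <;> simp [h0, h1, this]
  · right; right
    have : y.imK = y.imJ := mul_left_cancel₀ hrd (by linear_combination e - e')
    ext <;> simp [h0, h1, this]
  · left
    have : y.imK = 0 := by grind
    ext <;> simp [h0, h1, this]

theorem redUnitIso_triOrder (hP : SixParam p θ s ε δ l) : RedUnitIso F (triOrder T) (DihedralGroup 3) := by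
  have hO := triOrder_isOrder h T
  obtain ⟨x, hx⟩ := exists_unit D hO (omega_mem_triOrder T) (.inl (by simp [nrd]; norm_num))
  obtain ⟨y, hy⟩ := exists_unit D hO (j_mem_triOrder T) (by
    rcases hP with ⟨-, rfl, -⟩ | ⟨-, rfl, -⟩ <;> simp [nrd])
  have p2 : (⟨-1 / 2, 1 / 2, 0, 0⟩ : ℍ[F,-3,-δ]) ^ 2 = ⟨-1 / 2, -1 / 2, 0, 0⟩ := by
    rw [pow_two]; ext <;> simp <;> norm_num
  refine redUnitIso_dihedral hO (x := x) (y := y) (c₁ := 1) (c₂ := -δ) (c₃ := -δ) ?_ ?_ ?_ ?_ ?_ ?_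
  · rw [hx, pow_succ, p2, algebraMap_quat]
    ext <;> simp <;> norm_num
  · rw [hy, algebraMap_quat]
    ext <;> simp
  · rw [hx, hy, algebraMap_quat]
    ext <;> simp <;> ring
  · intro g
    obtain ⟨v, -, -, -, z, hz, hn, hg⟩ := exists_normUnit D hO (hab_tri T) g
    rw [hg, hx, hy]
    have nx : ∀ (k : ℕ) (d : F), (z = algebraMap F _ d * ⟨-1 / 2, 1 / 2, 0, 0⟩ ^ k ∨
        z = algebraMap F _ d * (⟨0, 0, 1, 0⟩ * ⟨-1 / 2, 1 / 2, 0, 0⟩ ^ k)) →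
        ∃ (k : ℕ) (c : F), algebraMap F ℍ[F,-3,-δ] v * z = algebraMap F _ c * ⟨-1 / 2, 1 / 2, 0, 0⟩ ^ k ∨
        algebraMap F ℍ[F,-3,-δ] v * z = algebraMap F _ c * (⟨0, 0, 1, 0⟩ * ⟨-1 / 2, 1 / 2, 0, 0⟩ ^ k) := by
      rintro k d (e | e)
      · exact ⟨k, v * d, .inl (by rw [e, map_mul, mul_assoc])⟩
      · exact ⟨k, v * d, .inr (by rw [e, map_mul, mul_assoc])⟩
    obtain ⟨c, rfl | rfl | rfl | ⟨e0, e1⟩⟩ := triOrder_cases h D T hP hz hn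
    · refine nx 0 c (.inl ?_)
      rw [algebraMap_quat, pow_zero, mul_one]
    · refine nx 1 (2 * c) (.inl ?_)
      rw [algebraMap_quat, pow_one]; ext <;> simp <;> ring
    · refine nx 2 (-(2 * c)) (.inl ?_)
      rw [algebraMap_quat, p2]; ext <;> simp <;> ring
    · obtain ⟨c, rfl | rfl | rfl⟩ := triOrder_cases_of_inverts h D T hP hz hn e0 e1
      · refine nx 0 c (.inr ?_)
        rw [algebraMap_quat, pow_zero, mul_one]; ext <;> simp
      · refine nx 2 (-(2 * c)) (.inr ?_)
        rw [algebraMap_quat, p2]; ext <;> simp <;> ring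
      · refine nx 1 (-(2 * c)) (.inr ?_)
        rw [algebraMap_quat, pow_one]; ext <;> simp <;> ring
  · intro k hk c hc
    rw [hx] at hc
    have hc' := congrArg QuaternionAlgebra.imI hc
    rw [algebraMap_quat] at hc'
    interval_cases k
    · rfl
    · simp at hc'
    · grind
  · intro k hk c hc
    rw [hx, hy] at hc
    have hc' := congrArg QuaternionAlgebra.imJ hc
    rw [algebraMap_quat] at hc'
    interval_cases k
    · simp at hc'
    · simp at hc'
    · rw [p2] at hc'; simp at hc'

end DihedralSix

section Octahedral

variable {F} {p : ℕ} {θ s ε : F} (h : IsSqrtGen F p θ) (D : DyadicData θ s ε)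

/-- The four diagonals of the cube. -/
def diag (F : Type) [Field F] : Fin 4 → ℍ[F,-1,-1] :=
  ![⟨0, 1, 1, 1⟩, ⟨0, 1, -1, -1⟩, ⟨0, -1, 1, -1⟩, ⟨0, -1, -1, 1⟩]

lemma diag_injective : ∀ a b, (diag F a = diag F b ∨ diag F a = -diag F b) → a = b := by
  have h2 : (1 : F) ≠ -1 := fun e => by
    grind
  intro a b
  fin_cases a <;> fin_cases b <;> simp [diag, QuaternionAlgebra.ext_iff, h2, h2.symm]

include h in
lemma exists_diag {y : ℍ[F,-1,-1]} (hy : y ∈ octOrder D) (hω : IsOmega y) :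
    ∃ b, 2 * y + 1 = diag F b ∨ 2 * y + 1 = -diag F b := by
  obtain ⟨h1, h2, h3, h4⟩ := (mem_octOrder D).mp hy
  obtain ⟨h0, hn⟩ := hω
  have hs := D.s_ne
  simp only [nrd] at hn
  have hB : 2 * y.imI ∈ intR F := by
    convert (intR F).add_mem ((intR F).mul_mem D.s_mem h2) h4 using 1
    field_simp; ring
  have hC : 2 * y.imJ ∈ intR F := by
    convert (intR F).add_mem ((intR F).mul_mem D.s_mem h3) h4 using 1
    field_simp; ring
  obtain ⟨x1, x2, x3⟩ := eq_one_of_sum_eq_three h hB hC h4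
    (by linear_combination 4 * hn - (2 * y.re - 1) * h0)
  have e : 2 * y + 1 = ⟨0, 2 * y.imI, 2 * y.imJ, 2 * y.imK⟩ := by
    rw [two_mul]
    ext <;> simp
    · linear_combination h0
    all_goals ring
  rw [e]
  rcases x1 with x1 | x1 <;> rcases x2 with x2 | x2 <;> rcases x3 with x3 | x3 <;> rw [x1, x2, x3]
  · exact ⟨0, .inl (by simp [diag])⟩
  · exact ⟨3, .inr (by simp [diag])⟩
  · exact ⟨2, .inr (by simp [diag])⟩
  · exact ⟨1, .inl (by simp [diag])⟩
  · exact ⟨1, .inr (by simp [diag])⟩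
  · exact ⟨2, .inl (by simp [diag])⟩
  · exact ⟨3, .inl (by simp [diag])⟩
  · exact ⟨0, .inr (by simp [diag])⟩

lemma omega_mem_octOrder (a : Fin 4) : ∃ ω ∈ octOrder D, IsOmega ω ∧ 2 * ω + 1 = diag F a := by
  refine ⟨algebraMap F _ (1 / 2) * (diag F a - 1), ?_, ?_, ?_⟩
  · rw [mem_octOrder, algebraMap_quat]
    have := D.two_div_s_mem
    have e1 : (2⁻¹ + 2⁻¹ : F) = 1 := by norm_num
    have e2 : (-2⁻¹ - 2⁻¹ : F) = -1 := by norm_num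
    have e3 : (-2⁻¹ + -2⁻¹ : F) = -1 := by norm_num
    have h1 := (intR F).one_mem
    have h2 := (intR F).neg_mem h1
    have h3 := (intR F).neg_mem this
    fin_cases a <;> simp [diag, e1, e2, e3, h1, h2, h3, this]
  · rw [algebraMap_quat]
    constructor <;> fin_cases a <;> simp [diag, nrd] <;> norm_num
  · rw [two_mul, algebraMap_quat]
    fin_cases a <;> ext <;> simp [diag] <;> norm_num

include h in
lemma exists_perm (u : (↥(octOrder D))ˣ) : ∃ π : Equiv.Perm (Fin 4), ∀ a,
    ((u : ↥(octOrder D)) : ℍ[F,-1,-1]) * diag F a = diag F (π a) * (u : ↥(octOrder D)) ∨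
    ((u : ↥(octOrder D)) : ℍ[F,-1,-1]) * diag F a = -(diag F (π a) * (u : ↥(octOrder D))) := by
  set x : ℍ[F,-1,-1] := ((u : ↥(octOrder D)) : ℍ[F,-1,-1]) with hx
  set x' : ℍ[F,-1,-1] := (((u⁻¹ : (↥(octOrder D))ˣ) : ↥(octOrder D)) : ℍ[F,-1,-1]) with hx'
  have h1 : x * x' = 1 := congrArg Subtype.val u.mul_inv
  have h2 : x' * x = 1 := congrArg Subtype.val u.inv_mul
  have key : ∀ a, ∃ b, x * diag F a = diag F b * x ∨ x * diag F a = -(diag F b * x) := by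
    intro a
    obtain ⟨ω, hω, Iω, e⟩ := omega_mem_octOrder D a
    have hc : 2 * (x * ω * x') + 1 = x * diag F a * x' := by
      rw [← e, mul_add, add_mul, mul_one, h1, two_mul, two_mul]; noncomm_ring
    obtain ⟨b, hb⟩ := exists_diag h D (y := x * ω * x')
      ((octOrder D).mul_mem ((octOrder D).mul_mem (u : ↥(octOrder D)).2 hω) ((u⁻¹ : (↥(octOrder D))ˣ) : ↥(octOrder D)).2)
      ⟨by rw [re_mul_comm, ← mul_assoc, h2, one_mul]; exact Iω.1,
        by rw [nrd_mul, nrd_mul, mul_right_comm, ← nrd_mul, h1, Iω.2]; simp [nrd]⟩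
    rw [hc] at hb
    refine ⟨b, hb.imp (fun e => ?_) fun e => ?_⟩
    · rw [← e, mul_assoc, h2, mul_one]
    · rw [← neg_mul, ← e, mul_assoc, h2, mul_one]
  choose f hf using key
  have hinj : Function.Injective f := by
    intro a b hab
    refine diag_injective (F := F) a b ?_
    have hl : ∀ {y z : ℍ[F,-1,-1]}, x * y = x * z → y = z := fun {y z} e => by
      rw [← one_mul y, ← h2, mul_assoc, e, ← mul_assoc, h2, one_mul]
    rcases hf a with e1 | e1 <;> rcases hf b with e2 | e2 <;> rw [hab] at e1
    · exact .inl (hl (e1.trans e2.symm))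
    · exact .inr (hl (by rw [mul_neg, e1, e2, neg_neg]))
    · exact .inr (hl (by rw [mul_neg, e1, e2]))
    · exact .inl (hl (e1.trans e2.symm))
  exact ⟨Equiv.ofBijective f (Finite.injective_iff_bijective.mp hinj), hf⟩

lemma diag_perm_unique {x x' : ℍ[F,-1,-1]} (hx : x * x' = 1) {a b c : Fin 4}
    (hb : x * diag F a = diag F b * x ∨ x * diag F a = -(diag F b * x))
    (hc : x * diag F a = diag F c * x ∨ x * diag F a = -(diag F c * x)) : b = c := by
  have hl : ∀ {y z : ℍ[F,-1,-1]}, y * x = z * x → y = z := fun {y z} e => by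
    rw [← mul_one y, ← hx, ← mul_assoc, e, mul_assoc, hx, mul_one]
  refine diag_injective (F := F) b c ?_
  rcases hb with e1 | e1 <;> rcases hc with e2 | e2
  · exact .inl (hl (e1.symm.trans e2))
  · exact .inr (hl (by rw [neg_mul, ← e1, ← e2]))
  · exact .inr (hl (by rw [neg_mul, ← e2, e1, neg_neg]))
  · exact .inl (hl (neg_injective (e1.symm.trans e2)))

lemma eq_algebraMap_of_diag {x : ℍ[F,-1,-1]}
    (hx : ∀ a, x * diag F a = diag F a * x ∨ x * diag F a = -(diag F a * x)) :
    x.imI = 0 ∧ x.imJ = 0 ∧ x.imK = 0 := by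
  have e0 := hx 0
  have e1 := hx 1
  have e2 := hx 2
  have e3 := hx 3
  simp [diag, QuaternionAlgebra.ext_iff] at e0 e1 e2 e3
  grind

include h in
theorem redUnitIso_octOrder : RedUnitIso F (octOrder D) (Equiv.Perm (Fin 4)) := by
  have hO := octOrder_isOrder h D
  choose π hπ using exists_perm h D
  have hu : ∀ u : (↥(octOrder D))ˣ, ((u : ↥(octOrder D)) : ℍ[F,-1,-1]) * (((u⁻¹ : (↥(octOrder D))ˣ) : ↥(octOrder D)) : ℍ[F,-1,-1]) = 1 :=
    fun u => congrArg Subtype.val u.mul_inv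
  have hmul : ∀ u v, π (u * v) = π u * π v := by
    intro u v
    ext a : 1
    refine diag_perm_unique (hu (u * v)) (hπ (u * v) a) ?_
    rw [Units.val_mul, Subring.coe_mul, Equiv.Perm.mul_apply, mul_assoc]
    rcases hπ v a with e | e <;> rcases hπ u (π v a) with e' | e' <;> rw [e]
    · exact .inl (by rw [← mul_assoc, e', mul_assoc])
    · exact .inr (by rw [← mul_assoc, e', neg_mul, mul_assoc])
    · exact .inr (by rw [mul_neg, ← mul_assoc, e', mul_assoc])
    · exact .inl (by rw [mul_neg, ← mul_assoc, e', neg_mul, neg_neg, mul_assoc])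
  refine ⟨MonoidHom.mk' π hmul, ?_, fun u => ⟨fun hu1 => ?_, fun hu1 => ?_⟩⟩
  · rw [← MonoidHom.mrange_eq_top, ← top_le_iff, ← Equiv.Perm.mclosure_swap_castSucc_succ 3, Submonoid.closure_le]
    rintro _ ⟨i, rfl⟩
    have hs := D.s_ne
    have key : ∀ w ∈ octOrder D, nrd w = ε → ∀ τ : Equiv.Perm (Fin 4),
        (∀ a, w * diag F a = diag F (τ a) * w ∨ w * diag F a = -(diag F (τ a) * w)) →
        τ ∈ MonoidHom.mrange (MonoidHom.mk' π hmul) := by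
      intro w hw hn τ hτ
      obtain ⟨u, hu'⟩ := exists_unit D hO hw (.inr hn)
      refine ⟨u, ?_⟩
      ext a : 1
      refine diag_perm_unique (hu u) (hπ u a) ?_
      grind
    have hsm := D.s_mem
    have hsn := (intR F).neg_mem hsm
    fin_cases i
    · refine key ⟨0, 0, s / 2, s / 2⟩ ?_ ?_ _ ?_
      · rw [mem_octOrder]; simpa [hs, mul_div_cancel₀] using hsm
      · simp [nrd, D.eps_def]; ring
      · intro a; fin_cases a <;> simp [diag, QuaternionAlgebra.ext_iff, Equiv.swap_apply_def]
        all_goals grind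
    · refine key ⟨0, s / 2, -(s / 2), 0⟩ ?_ ?_ _ ?_
      · rw [mem_octOrder]; simp [hs]
      · simp [nrd, D.eps_def]; ring
      · intro a; fin_cases a <;> simp [diag, QuaternionAlgebra.ext_iff, Equiv.swap_apply_def]
        all_goals grind
    · refine key ⟨0, 0, s / 2, -(s / 2)⟩ ?_ ?_ _ ?_
      · rw [mem_octOrder]; simpa [hs, mul_div_cancel₀, ← neg_add] using hsm
      · simp [nrd, D.eps_def]; ring
      · intro a; fin_cases a <;> simp [diag, QuaternionAlgebra.ext_iff, Equiv.swap_apply_def]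
        all_goals grind
  · have hu1 : π u = 1 := hu1
    obtain ⟨x1, x2, x3⟩ := eq_algebraMap_of_diag fun a => by
      have := hπ u a
      rwa [hu1] at this
    exact isScalarUnit_of_eq hO (c := ((u : ↥(octOrder D)) : ℍ[F,-1,-1]).re) (by
      rw [algebraMap_quat]; ext <;> simp [x1, x2, x3])
  · obtain ⟨c, hc⟩ := hu1.exists_eq
    ext a : 1
    refine diag_perm_unique (hu u) (hπ u a) (.inl ?_)
    rw [hc]; exact Algebra.commutes _ _

end Octahedral

section TypeNumbers

variable {F} {p : ℕ} {θ s ε : F} (h : IsSqrtGen F p θ) (D : DyadicData θ s ε)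

lemma typeNum_eq_one {σ : F →+* ℝ} {a b c d : F} (hcd : σ c < 0 ∧ σ d < 0) (ha : a ≠ 0) (hb : b ≠ 0)
    {S : Subring ℍ[F,a,b]} {G : Type*} [Group G] (hS : IsMaximalOrder F S) (hG : RedUnitIso F S G)
    (hex : ∃ O : Subring ℍ[F,c,d], Corr F S O)
    (huniq : ∀ O : Subring ℍ[F,c,d], IsMaximalOrder F O → RedUnitIso F O G → Corr F S O) :
    typeNum F ℍ[F,c,d] G = 1 := by
  obtain ⟨O, hO⟩ := hex
  refine Nat.card_eq_one_iff_unique.mpr ⟨⟨?_⟩, ⟨Quot.mk _ ⟨O, hS.of_corr hO.symm, hG.of_corr hO.symm⟩⟩⟩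
  rintro ⟨O₁⟩ ⟨O₂⟩
  exact Quot.sound (conjRel_of_corr hcd ha hb (huniq _ O₁.2.1 O₁.2.2) (huniq _ O₂.2.1 O₂.2.2))

include h in
lemma order_cases_of_algEquiv {A B : F} (e : ℍ[F,A,B] ≃ₐ[F] ℍ[F,-1,-1]) {O : Subring ℍ[F,A,B]}
    (hO : IsMaximalOrder F O) :
    (∃ m, 0 < m ∧ m ≤ 4 ∧ RedUnitIso F O (Multiplicative (ZMod m))) ∨
      Corr F (octOrder D) O ∨ Corr F (dihOrder D) O ∨
      ∃ δ l, SixParam p θ s ε δ l ∧ ∃ T : TriData δ l, Corr F (triOrder T) O := by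
  have hc := corr_map e O
  rcases order_cases h D (hO.of_corr hc.symm) with ⟨m, h0, h4, hm⟩ | (ho | hd) | ⟨δ, l, hP, T, hT⟩
  · exact .inl ⟨m, h0, h4, hm.of_corr hc⟩
  · exact .inr (.inl (ho.trans hc.symm))
  · exact .inr (.inr (.inl (hd.trans hc.symm)))
  · exact .inr (.inr (.inr ⟨δ, l, hP, T, hT.trans hc.symm⟩))

lemma card_perm_four : Nat.card (Equiv.Perm (Fin 4)) = 24 := by
  rw [Nat.card_perm, Nat.card_eq_fintype_card, Fintype.card_fin]; rfl

include h in
lemma group_cases {A B : F} (e : ℍ[F,A,B] ≃ₐ[F] ℍ[F,-1,-1]) {O : Subring ℍ[F,A,B]} (hO : IsMaximalOrder F O)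
    {G : Type*} [Group G] (hG : RedUnitIso F O G) :
    (∃ m, 0 < m ∧ m ≤ 4 ∧ Nonempty (G ≃* Multiplicative (ZMod m))) ∨
      (Corr F (octOrder D) O ∧ Nonempty (G ≃* Equiv.Perm (Fin 4))) ∨
      (Corr F (dihOrder D) O ∧ Nonempty (G ≃* DihedralGroup 4)) ∨
      ((∃ δ l, SixParam p θ s ε δ l ∧ ∃ T : TriData δ l, Corr F (triOrder T) O) ∧
        Nonempty (G ≃* DihedralGroup 3)) := by
  rcases order_cases_of_algEquiv h D e hO with ⟨m, h0, h4, hm⟩ | ho | hd | ⟨δ, l, hP, T, hT⟩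
  · exact .inl ⟨m, h0, h4, hG.mulEquiv hm⟩
  · exact .inr (.inl ⟨ho, hG.mulEquiv ((redUnitIso_octOrder h D).of_corr ho.symm)⟩)
  · exact .inr (.inr (.inl ⟨hd, hG.mulEquiv ((redUnitIso_dihOrder h D).of_corr hd.symm)⟩))
  · exact .inr (.inr (.inr ⟨⟨δ, l, hP, T, hT⟩,
      hG.mulEquiv ((redUnitIso_triOrder h D T hP).of_corr hT.symm)⟩))

/-- The sizes of the possible reduced unit groups. -/
lemma card_cases {G : Type*} [Group G] {P Q R : Prop}
    (hc : (∃ m, 0 < m ∧ m ≤ 4 ∧ Nonempty (G ≃* Multiplicative (ZMod m))) ∨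
      (P ∧ Nonempty (G ≃* Equiv.Perm (Fin 4))) ∨ (Q ∧ Nonempty (G ≃* DihedralGroup 4)) ∨
      (R ∧ Nonempty (G ≃* DihedralGroup 3))) :
    (0 < Nat.card G ∧ Nat.card G ≤ 4) ∨ (P ∧ Nat.card G = 24) ∨ (Q ∧ Nat.card G = 8) ∨ (R ∧ Nat.card G = 6) := by
  rcases hc with ⟨m, h0, h4, ⟨f⟩⟩ | ⟨hP, ⟨f⟩⟩ | ⟨hQ, ⟨f⟩⟩ | ⟨hR, ⟨f⟩⟩
  · rw [Nat.card_congr f.toEquiv]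
    exact .inl (by simp [Nat.card_congr Multiplicative.toAdd, h0, h4])
  · exact .inr (.inl ⟨hP, by rw [Nat.card_congr f.toEquiv, card_perm_four]⟩)
  · exact .inr (.inr (.inl ⟨hQ, by rw [Nat.card_congr f.toEquiv, DihedralGroup.nat_card]⟩))
  · exact .inr (.inr (.inr ⟨hR, by rw [Nat.card_congr f.toEquiv, DihedralGroup.nat_card]⟩))

end TypeNumbers

/-- **Type numbers for `F = ℚ(√p)`, `p ≡ 3 (mod 4)`, `p > 5`, `H = H_{∞₁,∞₂}`:
noncyclic part.** -/
theorem typeNum_p3mod4_noncyclic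
    (p : ℕ) (hp : p.Prime) (hp5 : 5 < p) (hp4 : p % 4 = 3)
    (sqrtp : F) (hsqrtp : sqrtp ^ 2 = (p : F))
    (hgen : Algebra.adjoin ℚ {sqrtp} = ⊤)
    -- `H = ℍ[F, A, B]` is a totally definite quaternion `F`-algebra (every totally
    -- definite quaternion algebra admits such a presentation) ...
    (A B : F) (hdef : ∀ σ : F →+* ℝ, σ A < 0 ∧ σ B < 0)
    -- ... unramified at every finite place of `F`
    (hunram : ∀ v : IsDedekindDomain.HeightOneSpectrum (𝓞 F),
      Nonempty
        (ℍ[v.adicCompletion F, algebraMap F (v.adicCompletion F) A,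
            algebraMap F (v.adicCompletion F) B] ≃ₐ[v.adicCompletion F]
          Matrix (Fin 2) (Fin 2) (v.adicCompletion F))) :
    typeNum F ℍ[F, A, B] (DihedralGroup 3) = 1 ∧
    typeNum F ℍ[F, A, B] (DihedralGroup 4) = 1 ∧
    typeNum F ℍ[F, A, B] (Equiv.Perm (Fin 4)) = 1 ∧
    ∀ (G : Type) [Group G] [Finite G],
      ¬(Nonempty (G ≃* Equiv.Perm (Fin 4)) ∨ Nonempty (G ≃* DihedralGroup 4) ∨
          Nonempty (G ≃* DihedralGroup 3) ∨ Nonempty (G ≃* Multiplicative (ZMod 4)) ∨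
          Nonempty (G ≃* Multiplicative (ZMod 3)) ∨
          Nonempty (G ≃* Multiplicative (ZMod 2)) ∨
          Nonempty (G ≃* Multiplicative (ZMod 1))) →
        typeNum F ℍ[F, A, B] G = 0 := by
  have h : IsSqrtGen F p sqrtp := ⟨hp, hp5, hp4, hsqrtp, hgen⟩
  obtain ⟨σ⟩ := h.exists_real
  obtain ⟨s, ε, D⟩ := h.exists_dyadicData
  obtain ⟨e⟩ := h.nonempty_algEquiv_hamilton hdef fun v => splitAt_of_adic (hunram v)
  have h1 : (-1 : F) ≠ 0 := neg_ne_zero.mpr one_ne_zero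
  refine ⟨?_, ?_, ?_, fun G _ _ hG => ?_⟩
  · obtain ⟨O, -, δ, l, hP, T, hT⟩ := exists_isSixType h D
    refine typeNum_eq_one (hdef σ) (by norm_num) (neg_ne_zero.mpr T.ne_zero) (triOrder_isMaximalOrder h T)
      (redUnitIso_triOrder h D T hP) ⟨_, hT.trans (corr_comap e O).symm⟩ fun O' hO' hG => ?_
    have hc := card_cases (group_cases h D e hO' hG)
    rw [DihedralGroup.nat_card] at hc
    rcases hc with hc | hc | hc | ⟨⟨δ', l', hP', T', hT'⟩, -⟩
    · omega
    · omega
    · omega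
    · obtain ⟨rfl, rfl⟩ := hP.unique hP'
      exact hT'
  · refine typeNum_eq_one (hdef σ) h1 h1 (dihOrder_isMaximalOrder h D) (redUnitIso_dihOrder h D)
      ⟨_, (corr_comap e (dihOrder D)).symm⟩ fun O' hO' hG => ?_
    have hc := card_cases (group_cases h D e hO' hG)
    rw [DihedralGroup.nat_card] at hc
    rcases hc with hc | hc | hc | hc
    · omega
    · omega
    · exact hc.1
    · omega
  · refine typeNum_eq_one (hdef σ) h1 h1 (octOrder_isMaximalOrder h D) (redUnitIso_octOrder h D)
      ⟨_, (corr_comap e (octOrder D)).symm⟩ fun O' hO' hG => ?_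
    have hc := card_cases (group_cases h D e hO' hG)
    rw [card_perm_four] at hc
    rcases hc with hc | hc | hc | hc
    · omega
    · exact hc.1
    · omega
    · omega
  · refine Nat.card_eq_zero.mpr (.inl ⟨?_⟩)
    rintro ⟨O, hO, hO'⟩
    apply hG
    rcases group_cases h D e hO hO' with ⟨m, h0, h4, hm⟩ | ⟨-, hm⟩ | ⟨-, hm⟩ | ⟨-, hm⟩
    · interval_cases m <;> tauto
    · exact .inl hm
    · exact .inr (.inl hm)
    · exact .inr (.inr (.inl hm))

end QuatPaper
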